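/- Local Tb theorem with weak-type maximal truncation testing: Let μ be a Radon measure on ℝ^d of degree n ∈ (0,d] and let T be an n-dimensional singular integral operator with Calderón–Zygmund kernel K satisfying K(x,y) = −K(y,x). Suppose q ∈ (1,∞), and let b and t be large enough constants (depending only on d). Assume that to every μ-(5,b)-doubling cube Q ⊂ ℝ^d with t-small boundary with respect to μ there is associated an L^q(μ)-admissible test function b_Q on Q with constant B₁ such that sup_{λ>0} λ^s μ({x ∈ Q : T_{μ,*} b_Q(x) > λ}) ≤ B₂ μ(Q) for some fixed B₂ < ∞ and s > 0 (uniform over Q). Then T_μ is bounded on L²(μ), i.e., the truncations T_{μ,ε} are bounded on L²(μ) uniformly in ε > 0, with a bound depending on d, n, the degree constant of μ, the kernel constants, q, B₁, B₂ and s. -/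

import Mathlib

open MeasureTheory Metric Set ENNReal

noncomputable section

abbrev Pt (d : ℕ) := EuclideanSpace ℝ (Fin d)

structure Cube (d : ℕ) where
  center : Pt d
  side : ℝ

def Cube.toSet {d : ℕ} (Q : Cube d) : Set (Pt d) :=
  {x | ∀ i, |x i - Q.center i| ≤ Q.side / 2}

def Cube.scale {d : ℕ} (a : ℝ) (Q : Cube d) : Cube d := ⟨Q.center, a * Q.side⟩

def HasDegree {d : ℕ} (μ : Measure (Pt d)) (n C₀ : ℝ) : Prop :=
  ∀ (x : Pt d) (r : ℝ), 0 < r → μ (ball x r) ≤ ENNReal.ofReal (C₀ * r ^ n)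

structure IsCZKernel {d : ℕ} (K : Pt d → Pt d → ℂ) (n C α : ℝ) : Prop where
  size : ∀ x y : Pt d, x ≠ y → ‖K x y‖ ≤ C / dist x y ^ n
  smooth_fst : ∀ x x' y : Pt d, x ≠ y → 2 * dist x x' ≤ dist x y →
    ‖K x y - K x' y‖ ≤ C * dist x x' ^ α / dist x y ^ (n + α)
  smooth_snd : ∀ x y y' : Pt d, x ≠ y → 2 * dist y y' ≤ dist x y →
    ‖K x y - K x y'‖ ≤ C * dist y y' ^ α / dist x y ^ (n + α)

def truncT {d : ℕ} (μ : Measure (Pt d)) (K : Pt d → Pt d → ℂ) (ε : ℝ) (f : Pt d → ℂ)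
    (x : Pt d) : ℂ :=
  ∫ y in {y | ε < dist x y}, K x y * f y ∂μ

def maxT {d : ℕ} (μ : Measure (Pt d)) (K : Pt d → Pt d → ℂ) (δ : ℝ) (f : Pt d → ℂ)
    (x : Pt d) : ℝ≥0∞ :=
  ⨆ (ε : ℝ) (_ : δ < ε), (‖truncT μ K ε f x‖₊ : ℝ≥0∞)

def ballMax {d : ℕ} (μ : Measure (Pt d)) (f : Pt d → ℂ) (x : Pt d) : ℝ≥0∞ :=
  ⨆ (r : ℝ) (_ : 0 < r), (∫⁻ y in ball x r, ‖f y‖₊ ∂μ) / μ (ball x r)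

def cubeMax {d : ℕ} (μ : Measure (Pt d)) (p : ℝ) (f : Pt d → ℂ) (x : Pt d) : ℝ≥0∞ :=
  ⨆ (r : ℝ) (_ : 0 < r),
    ((∫⁻ y in (Cube.toSet ⟨x, 2 * r⟩), (‖f y‖₊ : ℝ≥0∞) ^ p ∂μ) / μ (Cube.toSet ⟨x, 2 * r⟩)) ^ (1 / p)

def IsAdmissible {d : ℕ} (μ : Measure (Pt d)) (Q : Cube d) (p B₁ : ℝ) (b : Pt d → ℂ) : Prop :=
  (∀ x ∉ Q.toSet, b x = 0) ∧
  (∫ x in Q.toSet, b x ∂μ = ((μ Q.toSet).toReal : ℂ)) ∧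
  (∫⁻ x in Q.toSet, (‖b x‖₊ : ℝ≥0∞) ^ p ∂μ ≤ ENNReal.ofReal B₁ * μ Q.toSet)

def IsDoubling {d : ℕ} (μ : Measure (Pt d)) (a b : ℝ) (Q : Cube d) : Prop :=
  μ (Cube.scale a Q).toSet ≤ ENNReal.ofReal b * μ Q.toSet

def SmallBoundary {d : ℕ} (μ : Measure (Pt d)) (t : ℝ) (Q : Cube d) : Prop :=
  ∀ lam : ℝ, 0 < lam →
    μ {x ∈ (Cube.scale 5 Q).toSet | infDist x (frontier Q.toSet) ≤ lam * Q.side}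
      ≤ ENNReal.ofReal (t * lam) * μ (Cube.scale 5 Q).toSet

def Cube.dyadicPiece {d : ℕ} (R : Cube d) (j : ℕ) (m : Fin d → Fin (2 ^ j)) : Cube d :=
  ⟨(WithLp.equiv 2 (Fin d → ℝ)).symm
      (fun i => R.center i - R.side / 2 + R.side / 2 ^ j * ((m i : ℝ) + 1 / 2)),
    R.side / 2 ^ j⟩

set_option linter.unusedSectionVars false
set_option linter.unusedVariables false
open scoped Classical
open Finset (sum_pos sum_congr sum_add_distrib sum_sub_distrib smul_sum mul_sum sum_filter sum_comm sum_mul sum_le_sum sum_nonneg sum_range_sub single_le_sum sum_range_sub' sum_le_sum_of_subset_of_nonneg induction_on sum_insert sum_eq_zero mem_filter sum_neg_distrib sum_eq_single sum_const card_range sum_subtype)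
open Real (norm_of_nonneg norm_eq_abs div_rpow mul_rpow dist_eq sq_sqrt)
open Complex (normSq_eq_norm_sq norm_real ofReal_sum)
open Nat (succ_le_of_lt mod_eq_of_lt mul_succ div_add_mod mod_lt find find_spec find_min)
open Filter (Tendsto atTop eventually_ge_atTop Eventually)
open MeasureTheory.Measure (restrict_univ restrict_apply_univ)
notation "oR" => ENNReal.ofReal
notation "rg" => Finset.range
notation:max "pz" => by positivity
notation:max "nz" => by norm_num
notation:max "lz" => by linarith
notation:max "oz" => by omega
notation:max "zs" => by simp
notation "mll" => mul_le_mul_of_nonneg_left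
notation:max "Eu" d:max => Fin d → ℝ
notation:max "KT" d:max => Eu d → Eu d → ℂ
section Mart
variable {X I : Type} [Fintype X] {E : Type} [NormedAddCommGroup E] [NormedSpace ℝ E]
def cw (w : X → ℝ) (c : X → I) (x : X) : ℝ := ∑ y with c y = c x, w y
def av (w : X → ℝ) (c : X → I) (F : X → E) (x : X) : E :=
  (cw w c x)⁻¹ • ∑ y with c y = c x, w y • F y
variable {w : X → ℝ} {c c' : X → I}
lemma cw_pos (hw : ∀ x, 0 < w x) (x : X) : 0 < cw w c x :=
  sum_pos (fun y _ => hw y) ⟨x, by simp⟩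
lemma cw_congr {x x' : X} (h : c x = c x') : cw w c x = cw w c x' := by
  simp only [cw, h]
lemma av_congr (F : X → E) {x x' : X} (h : c x = c x') : av w c F x = av w c F x' := by
  simp only [av, cw, h]
lemma av_local {F G : X → E} {x : X} (h : ∀ y, c y = c x → F y = G y) :
    av w c F x = av w c G x := by
  simp only [av]
  congr 1
  refine sum_congr rfl fun y hy => ?_
  rw [h y (by simpa using hy)]
lemma av_const (hw : ∀ x, 0 < w x) {F : X → E} {x : X} (h : ∀ y, c y = c x → F y = F x) :
    av w c F x = F x := by
  rw [av_local h]
  simp only [av, ← Finset.sum_smul, smul_smul]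
  rw [show ∑ y with c y = c x, w y = cw w c x from rfl, inv_mul_cancel₀ (cw_pos hw x).ne', one_smul]
lemma av_add (F G : X → E) (x : X) : av w c (fun y => F y + G y) x = av w c F x + av w c G x := by
  simp [av, sum_add_distrib]
lemma av_sub (F G : X → E) (x : X) : av w c (fun y => F y - G y) x = av w c F x - av w c G x := by
  simp [av, smul_sub]
lemma av_smul (r : ℝ) (F : X → E) (x : X) : av w c (fun y => r • F y) x = r • av w c F x := by
  simp only [av, smul_sum]
  refine sum_congr rfl fun y _ => ?_
  simp only [smul_smul]; ring
lemma av_mulC {a : X → ℂ} (F : X → ℂ) {x : X} (h : ∀ y, c y = c x → a y = a x) :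
    av w c (fun y => a y * F y) x = a x * av w c F x := by
  rw [av_local (fun y hy => by rw [h y hy])]
  simp only [av, mul_sum, mul_smul_comm]
lemma av_mulR {a : X → ℝ} (F : X → ℝ) {x : X} (h : ∀ y, c y = c x → a y = a x) :
    av w c (fun y => a y * F y) x = a x * av w c F x := by
  rw [av_local (fun y hy => by rw [h y hy])]
  simp only [av, mul_sum, mul_smul_comm]
lemma sum_av (hw : ∀ x, 0 < w x) (F : X → E) :
    ∑ x, w x • av w c F x = ∑ x, w x • F x := by
  have h1 : ∀ x, w x • av w c F x
      = ∑ y, if c y = c x then (w x * (cw w c y)⁻¹ * w y) • F y else 0 := by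
    intro x
    rw [av, smul_sum, smul_sum, sum_filter]
    refine sum_congr rfl fun y _ => ?_
    split_ifs with h
    · rw [cw_congr h, smul_smul, smul_smul]
    · rfl
  simp_rw [h1]
  rw [sum_comm]
  refine sum_congr rfl fun y _ => ?_
  rw [← sum_filter, ← Finset.sum_smul, ← sum_mul, ← sum_mul]
  congr 1
  have : ∑ x with c y = c x, w x = cw w c y := by
    simp only [cw]; simp [eq_comm]
  rw [this, mul_inv_cancel₀ (cw_pos hw y).ne', one_mul]
lemma sum_mul_avC (hw : ∀ x, 0 < w x) {a : X → ℂ} (ha : ∀ x y, c x = c y → a x = a y)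
    (F : X → ℂ) : ∑ x, (w x : ℂ) * (a x * av w c F x) = ∑ x, (w x : ℂ) * (a x * F x) := by
  have := sum_av (c := c) hw (fun x => a x * F x)
  simp only [Complex.real_smul] at this
  rw [← this]
  refine sum_congr rfl fun x _ => ?_
  rw [av_mulC]
  intro y hy; exact ha y x hy
lemma sum_mul_avR (hw : ∀ x, 0 < w x) {a : X → ℝ} (ha : ∀ x y, c x = c y → a x = a y)
    (F : X → ℝ) : ∑ x, w x * (a x * av w c F x) = ∑ x, w x * (a x * F x) := by
  have := sum_av (c := c) hw (fun x => a x * F x)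
  simp only [smul_eq_mul] at this
  rw [← this]
  refine sum_congr rfl fun x _ => ?_
  rw [av_mulR]
  intro y hy; exact ha y x hy
lemma av_tower (hw : ∀ x, 0 < w x) (hr : ∀ x y, c' x = c' y → c x = c y) (F : X → E) (x : X) :
    av w c (av w c' F) x = av w c F x := by
  have key := sum_av (c := c') hw (fun y => (if c y = c x then (1:ℝ) else 0) • F y)
  have h2 : ∀ y, av w c' (fun y => (if c y = c x then (1:ℝ) else 0) • F y) y
      = (if c y = c x then (1:ℝ) else 0) • av w c' F y := by
    intro y
    rw [av_local (G := fun z => (if c y = c x then (1:ℝ) else 0) • F z), av_smul]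
    intro z hz; simp only [hr z y hz]
  simp_rw [h2] at key
  simp only [av]
  congr 1
  rw [sum_filter, sum_filter]
  convert key using 2 with y _ y _
  · split_ifs <;> simp [av]
  · split_ifs <;> simp
lemma norm_av_le (hw : ∀ x, 0 < w x) (F : X → E) (x : X) :
    ‖av w c F x‖ ≤ av w c (fun y => ‖F y‖) x := by
  rw [av, av, norm_smul, norm_of_nonneg (inv_nonneg.2 (cw_pos hw x).le), smul_eq_mul]
  have := cw_pos (c := c) hw x
  gcongr
  refine (norm_sum_le _ _).trans (sum_le_sum fun y _ => ?_)
  rw [norm_smul, norm_of_nonneg (hw y).le, smul_eq_mul]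
lemma av_mono (hw : ∀ x, 0 < w x) {F G : X → ℝ} {x : X} (h : ∀ y, c y = c x → F y ≤ G y) :
    av w c F x ≤ av w c G x := by
  simp only [av]
  have := cw_pos (c := c) hw x
  gcongr with y hy
  · exact (hw y).le
  · exact h y (by simpa using hy)
lemma av_nonneg (hw : ∀ x, 0 < w x) {F : X → ℝ} (h : ∀ y, 0 ≤ F y) (x : X) :
    0 ≤ av w c F x := by
  exact mul_nonneg (inv_nonneg.2 (cw_pos hw x).le)
    (sum_nonneg fun y _ => mul_nonneg (hw y).le (h y))
lemma norm_av_le_of_le (hw : ∀ x, 0 < w x) {F : X → E} {B : ℝ} {x : X}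
    (h : ∀ y, c y = c x → ‖F y‖ ≤ B) : ‖av w c F x‖ ≤ B := by
  refine (norm_av_le hw F x).trans ((av_mono hw h).trans ?_)
  rw [av_const hw zs]
lemma av_jensen (hw : ∀ x, 0 < w x) {F V : X → ℝ} (hV : ∀ y, 0 < V y) (x : X) :
    av w c F x ^ 2 / av w c V x ≤ av w c (fun y => F y ^ 2 / V y) x := by
  have hVp : 0 < av w c V x := by
    exact mul_pos (inv_pos.2 (cw_pos hw x))
      (sum_pos (fun y _ => mul_pos (hw y) (hV y)) ⟨x, by simp⟩)
  rw [div_le_iff₀ hVp]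
  simp only [av, smul_eq_mul]
  have h := Finset.sum_sq_le_sum_mul_sum_of_sq_le_mul (Finset.univ.filter fun y => c y = c x)
    (r := fun y => w y * F y) (f := fun y => w y * (F y ^ 2 / V y))
    (fun y _ => mul_nonneg (hw y).le (div_nonneg (sq_nonneg _) (hV y).le))
    (fun y _ => mul_nonneg (hw y).le (hV y).le)
    (fun y _ => le_of_eq (by have := (hV y).ne'; field_simp))
  calc _ = (cw w c x)⁻¹ ^ 2 * (∑ y with c y = c x, w y * F y) ^ 2 := by ring
    _ ≤ (cw w c x)⁻¹ ^ 2 * ((∑ i with c i = c x, w i * (F i ^ 2 / V i)) * ∑ i with c i = c x, w i * V i) := by gcongr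
    _ = _ := by ring
lemma av_sq_le (hw : ∀ x, 0 < w x) (F : X → E) (x : X) :
    ‖av w c F x‖ ^ 2 ≤ av w c (fun y => ‖F y‖ ^ 2) x := by
  have h1 := av_jensen (c := c) hw (F := fun y => ‖F y‖) (V := fun _ => 1) zs x
  rw [av_const hw (F := fun _ => (1:ℝ)) zs] at h1
  simp only [div_one] at h1
  exact (pow_le_pow_left₀ (norm_nonneg _) (norm_av_le hw F x) 2).trans h1
lemma sum_av_sq_le (hw : ∀ x, 0 < w x) (F : X → E) :
    ∑ x, w x * ‖av w c F x‖ ^ 2 ≤ ∑ x, w x * ‖F x‖ ^ 2 := by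
  have := sum_av (c := c) hw (fun y => ‖F y‖ ^ 2)
  simp only [smul_eq_mul] at this
  rw [← this]
  exact sum_le_sum fun x _ => mll (av_sq_le hw F x) (hw x).le
variable {lab : ℕ → X → I}
def Df (w : X → ℝ) (lab : ℕ → X → I) (k : ℕ) (F : X → ℂ) (x : X) : ℂ :=
  av w (lab (k+1)) F x - av w (lab k) F x
lemma mart_sq (hw : ∀ x, 0 < w x) (hr : ∀ k x y, lab (k+1) x = lab (k+1) y → lab k x = lab k y)
    (F : X → ℂ) (M : ℕ) :
    ∑ k ∈ rg M, ∑ x, w x * ‖Df w lab k F x‖ ^ 2 ≤ ∑ x, w x * ‖F x‖ ^ 2 := by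
  have step : ∀ k, ∑ x, w x * ‖Df w lab k F x‖ ^ 2
      = ∑ x, w x * ‖av w (lab (k+1)) F x‖ ^ 2 - ∑ x, w x * ‖av w (lab k) F x‖ ^ 2 := by
    intro k
    have orth : ∑ x, (w x : ℂ) * (starRingEnd ℂ (av w (lab k) F x) * Df w lab k F x) = 0 := by
      have h1 := sum_mul_avC hw (a := fun x => starRingEnd ℂ (av w (lab k) F x))
        (fun x y h => by rw [av_congr F h]) (av w (lab (k+1)) F)
      simp_rw [av_tower hw (hr k)] at h1
      simp only [Df, mul_sub, sum_sub_distrib]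
      rw [h1, sub_self]
    have orth' : ∑ x, w x * (starRingEnd ℂ (av w (lab k) F x) * Df w lab k F x).re = 0 := by
      have := congrArg Complex.re orth
      simpa only [Complex.re_sum, Complex.re_ofReal_mul, Complex.zero_re] using this
    have e : ∀ x, w x * ‖av w (lab (k+1)) F x‖ ^ 2 = w x * ‖Df w lab k F x‖ ^ 2
        + w x * ‖av w (lab k) F x‖ ^ 2
        + 2 * (w x * (starRingEnd ℂ (av w (lab k) F x) * Df w lab k F x).re) := by
      intro x
      have : av w (lab (k+1)) F x = av w (lab k) F x + Df w lab k F x := by simp [Df]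
      rw [this]
      simp only [← normSq_eq_norm_sq, Complex.normSq_add]
      simp only [Complex.mul_re, Complex.conj_re, Complex.conj_im]
      ring
    simp_rw [e, sum_add_distrib, ← mul_sum, orth']
    simp
  simp_rw [step]
  rw [sum_range_sub (fun k => ∑ x, w x * ‖av w (lab k) F x‖ ^ 2)]
  have := sum_av_sq_le (c := lab M) hw F
  have h0 : 0 ≤ ∑ x, w x * ‖av w (lab 0) F x‖ ^ 2 :=
    sum_nonneg fun x _ => mul_nonneg (hw x).le (sq_nonneg _)
  linarith
lemma mart_sq_loc (hw : ∀ x, 0 < w x)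
    (hr : ∀ k x y, lab (k+1) x = lab (k+1) y → lab k x = lab k y)
    (F : X → ℂ) (M : ℕ) (R : X → Prop) :
    ∑ k ∈ rg M, ∑ x, (if ∀ y, lab k y = lab k x → R y then w x * ‖Df w lab k F x‖ ^ 2 else 0)
      ≤ ∑ x, if R x then w x * ‖F x‖ ^ 2 else 0 := by
  have h := mart_sq hw hr (fun x => if R x then F x else 0) M
  have e : ∀ x, w x * ‖if R x then F x else 0‖ ^ 2 = if R x then w x * ‖F x‖ ^ 2 else 0 := by bound
  simp_rw [e] at h
  refine le_trans (sum_le_sum fun k _ => sum_le_sum fun x _ => ?_) h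
  split_ifs with hx
  · refine le_of_eq ?_
    congr 3
    simp only [Df]
    congr 1
    · exact av_local fun y hy => by rw [if_pos (hx y (hr k y x hy))]
    · exact av_local fun y hy => by rw [if_pos (hx y hy)]
  · exact mul_nonneg (hw x).le (sq_nonneg _)
lemma carleson_real (hw : ∀ x, 0 < w x)
    (hr : ∀ k x y, lab (k+1) x = lab (k+1) y → lab k x = lab k y) {M : ℕ} {B : ℝ} (hB : 0 < B)
    {a : ℕ → X → ℝ} (ha : ∀ k x, 0 ≤ a k x)
    (hC : ∀ j x, j < M → ∑ k ∈ Finset.Ico j M, ∑ y with lab j y = lab j x, w y * a k y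
      ≤ B * cw w (lab j) x) (F : X → ℝ) :
    ∑ k ∈ rg M, ∑ x, w x * (a k x * av w (lab k) F x ^ 2)
      ≤ 4 * B * ∑ x, w x * F x ^ 2 := by
  set S : ℕ → X → ℝ := fun j x => ∑ k ∈ Finset.Ico j M, a k x with hS
  set A : ℕ → X → ℝ := fun j => av w (lab j) (S j) with hA
  have hS0 : ∀ j x, 0 ≤ S j x := fun j x => sum_nonneg fun k _ => ha k x
  have hA0 : ∀ j x, 0 ≤ A j x := fun j x => av_nonneg hw (hS0 j) x
  have hAB : ∀ j x, j < M → A j x ≤ B := by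
    intro j x hj
    have := hC j x hj
    rw [sum_comm] at this
    simp_rw [← mul_sum] at this
    simp only [hA, av, smul_eq_mul]
    rw [inv_mul_le_iff₀ (cw_pos hw x), mul_comm (cw w (lab j) x)]
    exact this
  set Φ : ℕ → ℝ := fun j => ∑ x, w x * (av w (lab j) F x ^ 2 / (B + A j x)) with hΦ
  have step : ∀ j, j < M → ∑ x, w x * (a j x * av w (lab j) F x ^ 2)
      ≤ 4 * B ^ 2 * (Φ (j+1) - Φ j) := by
    intro j hj
    have h1 : ∀ x, av w (lab j) F x ^ 2 / (B + A j x - av w (lab j) (a j) x)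
        ≤ av w (lab j) (fun y => av w (lab (j+1)) F y ^ 2 / (B + A (j+1) y)) x := by
      intro x
      have := av_jensen (c := lab j) hw (F := av w (lab (j+1)) F) (V := fun y => B + A (j+1) y)
        (fun y => by have := hA0 (j+1) y; linarith) x
      rw [av_tower hw (hr j), av_add, av_const hw (F := fun _ => B) zs] at this
      refine le_trans (le_of_eq ?_) this
      congr 1
      simp only [hA]
      rw [av_tower hw (hr j)]
      have e : S j = fun y => a j y + S (j+1) y := by
        funext y; simp only [hS]; rw [Finset.sum_eq_sum_Ico_succ_bot hj]
      rw [e, av_add]; ring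
    have h2 : ∀ x, av w (lab j) (a j) x * av w (lab j) F x ^ 2 / (4 * B ^ 2)
        ≤ av w (lab j) (fun y => av w (lab (j+1)) F y ^ 2 / (B + A (j+1) y)) x
          - av w (lab j) F x ^ 2 / (B + A j x) := by
      intro x
      refine le_trans ?_ (sub_le_sub_right (h1 x) _)
      have ha0 : 0 ≤ av w (lab j) (a j) x := av_nonneg hw (ha j) x
      have haA : av w (lab j) (a j) x ≤ A j x := by
        refine av_mono hw fun y _ => ?_
        exact single_le_sum (fun k _ => ha k y) (by simp [hj])
      have hAx := hAB j x hj
      set p := av w (lab j) (a j) x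
      set q := A j x
      set f := av w (lab j) F x
      have e1 : f ^ 2 / (B + q - p) - f ^ 2 / (B + q) = f ^ 2 * p / ((B + q - p) * (B + q)) := by grind
      rw [e1, mul_comm p]
      apply div_le_div_of_nonneg_left pz
      · exact mul_pos lz lz
      · nlinarith
    have h3 : Φ (j+1) = ∑ x, w x * av w (lab j) (fun y => av w (lab (j+1)) F y ^ 2 / (B + A (j+1) y)) x := by
      have := sum_av (c := lab j) hw (fun y => av w (lab (j+1)) F y ^ 2 / (B + A (j+1) y))
      simp only [smul_eq_mul] at this
      rw [this]
    have h4 : ∑ x, w x * (a j x * av w (lab j) F x ^ 2)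
        = ∑ x, w x * (av w (lab j) (a j) x * av w (lab j) F x ^ 2) := by
      have := sum_mul_avR (c := lab j) hw (a := fun x => av w (lab j) F x ^ 2)
        (fun x y h => by rw [av_congr F h]) (a j)
      simp_rw [mul_comm (a j _), mul_comm (av w (lab j) (a j) _)]
      exact this.symm
    rw [h4, h3, hΦ, ← sum_sub_distrib, mul_sum]
    refine sum_le_sum fun x _ => ?_
    have := h2 x
    rw [div_le_iff₀ pz] at this
    nlinarith [hw x, mll this (hw x).le]
  calc _ ≤ ∑ k ∈ rg M, 4 * B ^ 2 * (Φ (k+1) - Φ k) :=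
        sum_le_sum fun k hk => step k (by simpa using hk)
    _ = 4 * B ^ 2 * (Φ M - Φ 0) := by rw [← mul_sum, sum_range_sub]
    _ ≤ 4 * B ^ 2 * Φ M := by
        have : 0 ≤ Φ 0 := sum_nonneg fun x _ => mul_nonneg (hw x).le
          (div_nonneg (sq_nonneg _) (by have := hA0 0 x; linarith))
        have : 0 < B ^ 2 := pz
        nlinarith
    _ ≤ 4 * B ^ 2 * ∑ x, w x * (F x ^ 2 / B) := by
        gcongr
        refine le_trans (sum_le_sum fun x _ => _root_.mul_le_mul_of_nonneg_left
          (c := 1 / B * ‖av w (lab M) F x‖ ^ 2 ) ?_ (hw x).le) ?_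
        · rw [norm_eq_abs, sq_abs, one_div, ← div_eq_inv_mul]
          have := hA0 M x
          gcongr; linarith
        · have := sum_av_sq_le (c := lab M) hw F
          simp only [norm_eq_abs, sq_abs] at this ⊢
          calc _ = 1 / B * ∑ x, w x * av w (lab M) F x ^ 2 := by
                rw [mul_sum]; exact sum_congr rfl fun x _ => by ring
            _ ≤ 1 / B * ∑ x, w x * F x ^ 2 := by gcongr
            _ = _ := by rw [mul_sum]; exact sum_congr rfl fun x _ => by ring
    _ = _ := by
        rw [mul_sum, mul_sum]
        refine sum_congr rfl fun x _ => ?_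
        field_simp
lemma carleson (hw : ∀ x, 0 < w x)
    (hr : ∀ k x y, lab (k+1) x = lab (k+1) y → lab k x = lab k y) {M : ℕ} {B : ℝ} (hB : 0 < B)
    {a : ℕ → X → ℝ} (ha : ∀ k x, 0 ≤ a k x)
    (hC : ∀ j x, j < M → ∑ k ∈ Finset.Ico j M, ∑ y with lab j y = lab j x, w y * a k y
      ≤ B * cw w (lab j) x) (F : X → E) :
    ∑ k ∈ rg M, ∑ x, w x * (a k x * ‖av w (lab k) F x‖ ^ 2)
      ≤ 4 * B * ∑ x, w x * ‖F x‖ ^ 2 := by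
  refine le_trans ?_ (carleson_real hw hr hB ha hC fun x => ‖F x‖)
  refine sum_le_sum fun k _ => sum_le_sum fun x _ => ?_
  have := hw x
  have := ha k x
  have := norm_av_le (c := lab k) hw F x
  gcongr
end Mart
def nq {X : Type} [Fintype X] (w : X → ℝ) (f : X → ℂ) : ℝ := ∑ x, w x * ‖f x‖ ^ 2
structure TM {X : Type} [Fintype X] (w : X → ℝ) (b : X → ℂ) (M : ℕ) (δ : ℝ) (I : Type) where
  lab : ℕ → X → I
  tr : ℕ → X → Prop
  hw : ∀ x, 0 < w x
  hr : ∀ k x y, lab (k+1) x = lab (k+1) y → lab k x = lab k y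
  hb : ∀ x, ‖b x‖ ≤ 1
  hδ : 0 < δ
  hδ1 : δ ≤ 1
  trc : ∀ k x y, lab k x = lab k y → tr k x → tr k y
  trm : ∀ k x, tr (k+1) x → tr k x
  tr0 : ∀ x, tr 0 x
  trM : ∀ x, ¬ tr M x
  acc : ∀ k x, tr k x → δ ≤ ‖av w (lab k) b x‖
namespace TM
variable {X I : Type} [Fintype X] {w : X → ℝ} {b : X → ℂ} {M : ℕ} {δ : ℝ} (S : TM w b M δ I)
def ga (f : X → ℂ) (k : ℕ) (x : X) : ℂ :=
  if S.tr k x then av w (S.lab k) f x / av w (S.lab k) b x else 0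
def u (f : X → ℂ) (k : ℕ) (x : X) : ℂ := S.ga f (k+1) x - S.ga f k x
def e (f : X → ℂ) (k : ℕ) (x : X) : ℂ := if S.tr k x ∧ ¬ S.tr (k+1) x then f x else 0
def De (f : X → ℂ) (k : ℕ) (x : X) : ℂ := b x * S.u f k x + S.e f k x
def ue (f : X → ℂ) (k : ℕ) (x : X) : ℝ := ‖S.u f k x‖ ^ 2 + ‖S.e f k x‖ ^ 2
lemma nsq_nonneg (S : TM w b M δ I) (f : X → ℂ) : 0 ≤ nq w f :=
  sum_nonneg fun x _ => mul_nonneg (S.hw x).le (sq_nonneg _)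
lemma ue_nonneg (f : X → ℂ) (k x) : 0 ≤ S.ue f k x := by unfold ue; positivity
lemma tr_iff {k x y} (h : S.lab k x = S.lab k y) : S.tr k x ↔ S.tr k y :=
  ⟨S.trc k x y h, S.trc k y x h.symm⟩
lemma tr_mono {i k x} (h : i ≤ k) (ht : S.tr k x) : S.tr i x := by
  induction h with
  | refl => exact ht
  | step _ ih => exact ih (S.trm _ _ ht)
lemma lab_mono {i k x y} (h : i ≤ k) (ht : S.lab k x = S.lab k y) : S.lab i x = S.lab i y := by
  induction h with
  | refl => exact ht
  | step _ ih => exact ih (S.hr _ _ _ ht)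
lemma ga_congr (f) {k x y} (h : S.lab k x = S.lab k y) : S.ga f k x = S.ga f k y := by
  simp only [ga, S.tr_iff h, av_congr _ h]
lemma u_congr (f) {k x y} (h : S.lab (k+1) x = S.lab (k+1) y) : S.u f k x = S.u f k y := by
  simp only [u, S.ga_congr f h, S.ga_congr f (S.hr _ _ _ h)]
lemma u_zero (f) {k x} (h : ¬ S.tr k x) : S.u f k x = 0 := by
  have h' : ¬ S.tr (k+1) x := fun h2 => h (S.trm _ _ h2)
  simp [u, ga, h, h']
lemma e_zero (f) {k x} (h : ¬ S.tr k x) : S.e f k x = 0 := by simp [e, h]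
lemma De_zero (f) {k x} (h : ¬ S.tr k x) : S.De f k x = 0 := by
  simp [De, S.u_zero f h, S.e_zero f h]
lemma avb_ne {k x} (h : S.tr k x) : av w (S.lab k) b x ≠ 0 := by
  intro h0; have := S.acc k x h; rw [h0, norm_zero] at this; linarith [S.hδ]
lemma ga_mul (f) {k x} (h : S.tr k x) :
    S.ga f k x * av w (S.lab k) b x = av w (S.lab k) f x := by
  rw [ga, if_pos h, div_mul_cancel₀ _ (S.avb_ne h)]
lemma ga_le (f) (k x) : ‖S.ga f k x‖ ≤ δ⁻¹ * ‖av w (S.lab k) f x‖ := by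
  have := S.hδ
  unfold ga
  split_ifs with h
  · rw [norm_div, div_eq_inv_mul]
    gcongr
    exact S.acc k x h
  · rw [norm_zero]; positivity
lemma De_mean (f) (k x) : av w (S.lab k) (S.De f k) x = 0 := by
  by_cases h : S.tr k x
  · have e1 : av w (S.lab k) (S.De f k) x
        = av w (S.lab k) (fun y => S.ga f (k+1) y * b y + S.e f k y) x
          - av w (S.lab k) (fun y => S.ga f k y * b y) x := by
      rw [← av_sub]; congr 1; funext y; simp only [De, u]; ring
    rw [e1, av_mulC _ (fun y hy => S.ga_congr f hy), S.ga_mul f h, ← av_tower S.hw (S.hr k), sub_eq_zero,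
      ← av_tower S.hw (S.hr k) f]
    refine av_local fun y hy => ?_
    have hty := (S.tr_iff hy).2 h
    rw [av_add, av_mulC _ (fun z hz => S.ga_congr f hz)]
    by_cases h1 : S.tr (k+1) y
    · rw [S.ga_mul f h1, av_local (F := S.e f k), av_const S.hw (F := fun _ => (0:ℂ)) zs, add_zero]
      intro z hz
      simp [e, (S.tr_iff hz).2 h1]
    · rw [show S.ga f (k+1) y = 0 by simp [ga, h1], zero_mul, zero_add]
      refine av_local fun z hz => ?_
      have : ¬ S.tr (k+1) z := fun h2 => h1 ((S.tr_iff hz).1 h2)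
      have h3 := (S.tr_iff (S.hr _ _ _ hz)).2 hty
      simp [e, this, h3]
  · rw [av_local (G := fun _ => (0:ℂ)), av_const S.hw zs]
    intro y hy
    exact S.De_zero f fun h2 => h ((S.tr_iff hy).1 h2)
lemma e_sum (f) (x) : ∑ k ∈ rg M, S.e f k x = f x := by
  have : ∀ k, S.e f k x = (if S.tr k x then f x else 0) - (if S.tr (k+1) x then f x else 0) := by
    intro k
    have := S.trm k x
    unfold e
    split_ifs <;> simp_all
  simp_rw [this]
  rw [sum_range_sub' (fun k => if S.tr k x then f x else 0)]
  simp [S.tr0 x, S.trM x]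
lemma esq_sum (f) (x) : ∑ k ∈ rg M, ‖S.e f k x‖ ^ 2 = ‖f x‖ ^ 2 := by
  have : ∀ k, ‖S.e f k x‖ ^ 2
      = (if S.tr k x then ‖f x‖ ^ 2 else 0) - (if S.tr (k+1) x then ‖f x‖ ^ 2 else 0) := by
    intro k
    have := S.trm k x
    unfold e
    split_ifs <;> simp_all
  simp_rw [this]
  rw [sum_range_sub' (fun k => if S.tr k x then ‖f x‖ ^ 2 else 0)]
  simp [S.tr0 x, S.trM x]
lemma expand (f) (x) : f x = b x * S.ga f 0 x + ∑ k ∈ rg M, S.De f k x := by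
  simp only [De, sum_add_distrib, S.e_sum f x, ← mul_sum, u]
  rw [sum_range_sub (fun k => S.ga f k x)]
  simp [ga, S.trM x]
def st (k : ℕ) (x : X) : ℝ := if S.tr k x ∧ ¬ S.tr (k+1) x then 1 else 0
lemma st_sum_le (s : Finset ℕ) (x) : ∑ k ∈ s, S.st k x ≤ 1 := by
  have h1 : ∀ N, ∑ k ∈ rg N, S.st k x ≤ 1 := by
    intro N
    have : ∀ k, S.st k x = (if S.tr k x then 1 else 0) - (if S.tr (k+1) x then 1 else 0) := by
      intro k
      have := S.trm k x
      unfold st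
      split_ifs <;> simp_all
    simp_rw [this]
    rw [sum_range_sub' (fun k => if S.tr k x then (1:ℝ) else 0)]
    split_ifs <;> norm_num
  refine le_trans (sum_le_sum_of_subset_of_nonneg (t := rg (s.sup id + 1)) ?_ ?_) (h1 _)
  · intro k hk
    have := Finset.le_sup (f := id) hk
    simp only [id] at this
    simp; omega
  · intro k _ _; unfold st; split_ifs <;> norm_num
lemma car (F : X → ℂ) : ∑ k ∈ rg M, ∑ x, w x *
    ((‖Df w S.lab k b x‖ ^ 2 + S.st k x) * ‖av w (S.lab k) F x‖ ^ 2) ≤ 8 * nq w F := by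
  have h := carleson (M := M) (B := 2) S.hw S.hr nz
    (a := fun k x => ‖Df w S.lab k b x‖ ^ 2 + S.st k x)
    (fun k x => by unfold st; positivity) ?_ F
  · simp only [nq]; linarith
  intro j x _
  have e1 : ∀ k, ∑ y with S.lab j y = S.lab j x, w y * (‖Df w S.lab k b y‖ ^ 2 + S.st k y)
      = (∑ y with S.lab j y = S.lab j x, w y * ‖Df w S.lab k b y‖ ^ 2)
        + ∑ y with S.lab j y = S.lab j x, w y * S.st k y := by
    intro k; rw [← sum_add_distrib]; simp only [mul_add]
  simp_rw [e1]
  rw [sum_add_distrib]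
  have h1 : ∑ k ∈ Finset.Ico j M, ∑ y with S.lab j y = S.lab j x, w y * ‖Df w S.lab k b y‖ ^ 2
      ≤ cw w (S.lab j) x := by
    have h2 := mart_sq_loc S.hw S.hr b M (fun y => S.lab j y = S.lab j x)
    refine le_trans ?_ (h2.trans ?_)
    · refine le_trans ?_ (sum_le_sum_of_subset_of_nonneg (s := Finset.Ico j M) ?_ ?_)
      · refine sum_le_sum fun k hk => ?_
        rw [sum_filter]
        refine sum_le_sum fun y _ => ?_
        split_ifs with ha hb hb
        · exact le_rfl
        · exact absurd (fun z hz => (S.lab_mono (Finset.mem_Ico.1 hk).1 hz).trans ha) hb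
        · exact mul_nonneg (S.hw y).le (sq_nonneg _)
        · exact le_rfl
      · intro k; simp
      · intro k _ _
        refine sum_nonneg fun y _ => ?_
        split_ifs
        · exact mul_nonneg (S.hw y).le (sq_nonneg _)
        · exact le_rfl
    · rw [← sum_filter]
      refine sum_le_sum fun y _ => ?_
      have := S.hb y
      have := S.hw y
      have : ‖b y‖ ^ 2 ≤ 1 := by
        rw [show (1:ℝ) = 1 ^ 2 by norm_num]; gcongr
      nlinarith
  have h3 : ∑ k ∈ Finset.Ico j M, ∑ y with S.lab j y = S.lab j x, w y * S.st k y
      ≤ cw w (S.lab j) x := by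
    rw [sum_comm]
    refine sum_le_sum fun y _ => ?_
    rw [← mul_sum]
    have := S.st_sum_le (Finset.Ico j M) y
    nlinarith [S.hw y]
  linarith
lemma Df_sq (F : X → ℂ) : ∑ k ∈ rg M, ∑ x, w x * ‖Df w S.lab k F x‖ ^ 2 ≤ nq w F :=
  mart_sq S.hw S.hr F M
lemma u_le (f) (k x) : ‖S.u f k x‖ ^ 2 ≤ 2 * (δ⁻¹ ^ 2 * ‖Df w S.lab k f x‖ ^ 2) + 2 * (δ⁻¹ ^ 4 *
    ((‖Df w S.lab k b x‖ ^ 2 + S.st k x) * ‖av w (S.lab k) f x‖ ^ 2)) := by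
  have hδ := S.hδ
  have hst : 0 ≤ S.st k x := by unfold st; positivity
  by_cases h : S.tr k x
  swap
  · rw [S.u_zero f h, norm_zero, zero_pow two_ne_zero]; positivity
  by_cases h1 : S.tr (k+1) x
  · have hs : S.st k x = 0 := by simp [st, h1]
    have key : S.u f k x = (Df w S.lab k f x - S.ga f k x * Df w S.lab k b x)
        / av w (S.lab (k+1)) b x := by
      rw [eq_div_iff (S.avb_ne h1)]
      simp only [u, Df, sub_mul, mul_sub, S.ga_mul f h1, S.ga_mul f h]
      ring
    have h2 : ‖S.u f k x‖ ≤ δ⁻¹ * ‖Df w S.lab k f x‖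
        + δ⁻¹ ^ 2 * (‖av w (S.lab k) f x‖ * ‖Df w S.lab k b x‖) := by
      rw [key, norm_div, div_eq_inv_mul]
      have := S.acc _ _ h1
      calc _ ≤ δ⁻¹ * (‖Df w S.lab k f x‖ + δ⁻¹ * ‖av w (S.lab k) f x‖ * ‖Df w S.lab k b x‖) := by
            gcongr
            refine (norm_sub_le _ _).trans ?_
            rw [norm_mul]
            have := S.ga_le f k x
            gcongr
        _ = _ := by ring
    rw [hs, add_zero]
    set p := δ⁻¹ * ‖Df w S.lab k f x‖
    set q := δ⁻¹ ^ 2 * (‖av w (S.lab k) f x‖ * ‖Df w S.lab k b x‖)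
    calc _ ≤ (p + q) ^ 2 := by gcongr
      _ ≤ 2 * p ^ 2 + 2 * q ^ 2 := by nlinarith [sq_nonneg (p - q)]
      _ = _ := by simp only [p, q]; ring
  · have hs : S.st k x = 1 := by simp [st, h1, h]
    have h2 : ‖S.u f k x‖ ≤ δ⁻¹ * ‖av w (S.lab k) f x‖ := by
      rw [u, show S.ga f (k+1) x = 0 by simp [ga, h1], zero_sub, norm_neg]
      exact S.ga_le f k x
    have h3 := (one_le_inv₀ hδ).2 S.hδ1
    rw [hs]
    calc _ ≤ (δ⁻¹ * ‖av w (S.lab k) f x‖) ^ 2 := by gcongr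
      _ = δ⁻¹ ^ 2 * (1 * ‖av w (S.lab k) f x‖ ^ 2) := by ring
      _ ≤ δ⁻¹ ^ 4 * ((‖Df w S.lab k b x‖ ^ 2 + 1) * ‖av w (S.lab k) f x‖ ^ 2) := by
          gcongr
          · norm_num
          · nlinarith
      _ ≤ _ := by
          have : 0 ≤ δ⁻¹ ^ 2 * ‖Df w S.lab k f x‖ ^ 2 := pz
          have : 0 ≤ δ⁻¹ ^ 4 * ((‖Df w S.lab k b x‖ ^ 2 + 1) * ‖av w (S.lab k) f x‖ ^ 2) := pz
          linarith
lemma SQ (f) : ∑ k ∈ rg M, ∑ x, w x * S.ue f k x ≤ 19 * δ⁻¹ ^ 4 * nq w f := by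
  have hδ := S.hδ
  have h3 := (one_le_inv₀ hδ).2 S.hδ1
  have h1 : ∑ k ∈ rg M, ∑ x, w x * ‖S.e f k x‖ ^ 2 = nq w f := by
    rw [sum_comm]
    simp_rw [← mul_sum, S.esq_sum]; rfl
  have h2 : ∑ k ∈ rg M, ∑ x, w x * ‖S.u f k x‖ ^ 2
      ≤ 2 * δ⁻¹ ^ 2 * nq w f + 2 * δ⁻¹ ^ 4 * (8 * nq w f) := by
    calc _ ≤ ∑ k ∈ rg M, ∑ x, (2 * δ⁻¹ ^ 2 * (w x * ‖Df w S.lab k f x‖ ^ 2)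
          + 2 * δ⁻¹ ^ 4 * (w x * ((‖Df w S.lab k b x‖ ^ 2 + S.st k x)
            * ‖av w (S.lab k) f x‖ ^ 2))) := by
          refine sum_le_sum fun k _ => sum_le_sum fun x _ => ?_
          refine (mll (S.u_le f k x) (S.hw x).le).trans (le_of_eq ?_)
          ring
      _ ≤ _ := by
          simp_rw [sum_add_distrib, ← mul_sum]
          have := S.car f
          have := S.Df_sq f
          gcongr
  simp only [ue, mul_add, sum_add_distrib]
  rw [h1]
  have hn := S.nsq_nonneg f
  have h5 : δ⁻¹ ^ 2 ≤ δ⁻¹ ^ 4 := pow_le_pow_right₀ h3 nz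
  have h6 : 1 ≤ δ⁻¹ ^ 4 := one_le_pow₀ h3
  nlinarith
def G (h : X → ℂ) (k : ℕ) (x : X) : ℝ :=
  if S.tr k x then ‖Df w S.lab k (fun y => b y * h y) x‖
    + ‖S.ga (fun y => b y * h y) k x‖ * ‖Df w S.lab k b x‖
    + S.st k x * (‖h x‖ + ‖S.ga (fun y => b y * h y) k x‖) else 0
lemma dual (f h : X → ℂ) (k : ℕ) {s : X → ℂ} (hs : ∀ x y, S.lab k x = S.lab k y → s x = s y) :
    ‖∑ x, (w x : ℂ) * (s x * (S.De f k x * h x))‖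
      ≤ ∑ x, w x * (‖s x‖ * ((‖S.u f k x‖ + ‖S.e f k x‖) * S.G h k x)) := by
  set bh : X → ℂ := fun y => b y * h y
  have h1 : ∑ x, (w x : ℂ) * ((s x * S.ga bh k x) * S.De f k x) = 0 := by
    rw [← sum_mul_avC S.hw (fun x y hxy => by rw [hs x y hxy, S.ga_congr bh hxy])]
    simp [S.De_mean]
  have h2 : ∑ x, (w x : ℂ) * ((s x * S.u f k x) * bh x)
      = ∑ x, (w x : ℂ) * ((s x * S.u f k x) * av w (S.lab (k+1)) bh x) :=
    (sum_mul_avC S.hw (fun x y hxy => by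
      rw [hs x y (S.hr _ _ _ hxy), S.u_congr f hxy]) bh).symm
  have h3 : ∑ x, (w x : ℂ) * ((s x * S.ga bh k x * S.u f k x) * b x)
      = ∑ x, (w x : ℂ) * ((s x * S.ga bh k x * S.u f k x) * av w (S.lab (k+1)) b x) :=
    (sum_mul_avC S.hw (fun x y hxy => by
      rw [hs x y (S.hr _ _ _ hxy), S.u_congr f hxy, S.ga_congr bh (S.hr _ _ _ hxy)]) b).symm
  have h4 : ∑ x, (w x : ℂ) * (s x * (S.De f k x * h x))
      = ∑ x, (w x : ℂ) * (s x * (S.u f k x * (av w (S.lab (k+1)) bh x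
          - S.ga bh k x * av w (S.lab (k+1)) b x) + S.e f k x * (h x - S.ga bh k x))) := by
    have e1 : ∑ x, (w x : ℂ) * (s x * (S.De f k x * h x))
       = ∑ x, (w x : ℂ) * ((s x * S.u f k x) * bh x) + ∑ x, (w x : ℂ) * (s x * (S.e f k x * h x)) := by
      rw [← sum_add_distrib]
      refine sum_congr rfl fun x _ => ?_
      simp only [De, bh]; ring
    have e2 : ∑ x, (w x : ℂ) * ((s x * S.ga bh k x) * S.De f k x)
       = ∑ x, (w x : ℂ) * ((s x * S.ga bh k x * S.u f k x) * b x)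
         + ∑ x, (w x : ℂ) * (s x * (S.ga bh k x * S.e f k x)) := by
      rw [← sum_add_distrib]
      refine sum_congr rfl fun x _ => ?_
      simp only [De]; ring
    rw [e1, ← sub_zero (_ + _), ← h1, e2, h2, h3, ← sum_add_distrib, ← sum_add_distrib,
      ← sum_sub_distrib]
    refine sum_congr rfl fun x _ => ?_
    ring
  rw [h4]
  refine (norm_sum_le _ _).trans (sum_le_sum fun x _ => ?_)
  rw [norm_mul, norm_mul, norm_real, norm_of_nonneg (S.hw x).le]
  have := S.hw x
  gcongr
  by_cases ht : S.tr k x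
  swap
  · simp [S.u_zero f ht, S.e_zero f ht]
  have e3 : av w (S.lab (k+1)) bh x - S.ga bh k x * av w (S.lab (k+1)) b x
      = Df w S.lab k bh x - S.ga bh k x * Df w S.lab k b x := by
    simp only [Df, mul_sub, S.ga_mul bh ht]; ring
  rw [e3, G, if_pos ht]
  have hst : 0 ≤ S.st k x := by unfold st; positivity
  have n1 : ‖Df w S.lab k bh x - S.ga bh k x * Df w S.lab k b x‖
      ≤ ‖Df w S.lab k bh x‖ + ‖S.ga bh k x‖ * ‖Df w S.lab k b x‖ :=
    (norm_sub_le _ _).trans (by rw [norm_mul])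
  have n2 : ‖S.e f k x * (h x - S.ga bh k x)‖ ≤ ‖S.e f k x‖ * (S.st k x * (‖h x‖ + ‖S.ga bh k x‖)) := by
    rw [norm_mul]
    by_cases h5 : S.tr (k+1) x
    · simp [e, h5]
    · rw [show S.st k x = 1 by simp [st, h5, ht], one_mul]
      gcongr; exact norm_sub_le _ _
  refine (norm_add_le _ _).trans ?_
  rw [norm_mul]
  have n3 := mll n1 (norm_nonneg (S.u f k x))
  have : 0 ≤ ‖S.u f k x‖ * (S.st k x * (‖h x‖ + ‖S.ga bh k x‖)) := pz
  have : 0 ≤ ‖S.e f k x‖ * (‖Df w S.lab k bh x‖ + ‖S.ga bh k x‖ * ‖Df w S.lab k b x‖) := pz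
  nlinarith
lemma bh_nsq (S : TM w b M δ I) (h : X → ℂ) : nq w (fun y => b y * h y) ≤ nq w h := by
  refine sum_le_sum fun x _ => mll ?_ (S.hw x).le
  rw [norm_mul]
  have := S.hb x
  gcongr
  nlinarith [norm_nonneg (h x)]
lemma G_sq_le (h) (k x) : S.G h k x ^ 2 ≤ 4 * ‖Df w S.lab k (fun y => b y * h y) x‖ ^ 2
    + 4 * δ⁻¹ ^ 2 * ((‖Df w S.lab k b x‖ ^ 2 + S.st k x)
      * ‖av w (S.lab k) (fun y => b y * h y) x‖ ^ 2) + 4 * (S.st k x * ‖h x‖ ^ 2) := by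
  set bh : X → ℂ := fun y => b y * h y
  have hδ := S.hδ
  have hst : 0 ≤ S.st k x := by unfold st; positivity
  have hst2 : S.st k x ^ 2 = S.st k x := by unfold st; split_ifs <;> norm_num
  unfold G
  split_ifs with ht
  swap
  · rw [zero_pow two_ne_zero]; positivity
  have hg : ‖S.ga bh k x‖ ^ 2 ≤ δ⁻¹ ^ 2 * ‖av w (S.lab k) bh x‖ ^ 2 := by
    rw [← mul_pow]; gcongr; exact S.ga_le bh k x
  set D := ‖Df w S.lab k bh x‖
  set g := ‖S.ga bh k x‖
  set q := ‖Df w S.lab k b x‖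
  set s := S.st k x
  have e1 : (D + g * q + s * (‖h x‖ + g)) ^ 2
      ≤ 4 * D ^ 2 + 4 * (g * q) ^ 2 + 4 * (s * ‖h x‖) ^ 2 + 4 * (s * g) ^ 2 := by
    nlinarith [sq_nonneg (D - g * q), sq_nonneg (D - s * g), sq_nonneg (g * q - s * g), sq_nonneg (s * ‖h x‖ - s * g)]
  refine e1.trans ?_
  simp only [mul_pow, hst2]
  nlinarith
lemma G_sum (h) : ∑ k ∈ rg M, ∑ x, w x * S.G h k x ^ 2 ≤ 40 * δ⁻¹ ^ 2 * nq w h := by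
  have hδ := S.hδ
  have h3 := (one_le_inv₀ hδ).2 S.hδ1
  have h1 : ∑ k ∈ rg M, ∑ x, w x * (S.st k x * ‖h x‖ ^ 2) ≤ nq w h := by
    rw [sum_comm]
    simp_rw [← mul_sum, ← sum_mul]
    refine sum_le_sum fun x _ => mll ?_ (S.hw x).le
    have := S.st_sum_le (rg M) x
    nlinarith
  calc _ ≤ ∑ k ∈ rg M, ∑ x, (4 * (w x * ‖Df w S.lab k (fun y => b y * h y) x‖ ^ 2)
        + 4 * δ⁻¹ ^ 2 * (w x * ((‖Df w S.lab k b x‖ ^ 2 + S.st k x)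
      * ‖av w (S.lab k) (fun y => b y * h y) x‖ ^ 2)) + 4 * (w x * (S.st k x * ‖h x‖ ^ 2))) := by
        refine sum_le_sum fun k _ => sum_le_sum fun x _ => ?_
        refine (mll (S.G_sq_le h k x) (S.hw x).le).trans (le_of_eq ?_)
        ring
    _ ≤ 4 * nq w h + 4 * δ⁻¹ ^ 2 * (8 * nq w h) + 4 * nq w h := by
        simp_rw [sum_add_distrib, ← mul_sum]
        have a1 := (S.Df_sq (fun y => b y * h y)).trans (S.bh_nsq h)
        have a2 := (S.car (fun y => b y * h y)).trans (mll (S.bh_nsq h) nz)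
        gcongr
    _ ≤ _ := by
        have hn := S.nsq_nonneg h
        have h6 : 1 ≤ δ⁻¹ ^ 2 := one_le_pow₀ h3
        nlinarith
lemma dualSQ (f) (P : ℕ → X → Prop) (hP : ∀ k x y, S.lab k x = S.lab k y → (P k x ↔ P k y)) :
    nq w (fun x => ∑ k ∈ rg M, if P k x then S.De f k x else 0)
      ≤ 80 * δ⁻¹ ^ 2 * ∑ k ∈ rg M, ∑ x, w x * (if P k x then S.ue f k x else 0) := by
  set Φ : X → ℂ := fun x => ∑ k ∈ rg M, if P k x then S.De f k x else 0 with hΦ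
  set h : X → ℂ := fun x => starRingEnd ℂ (Φ x) with hh
  have hδ := S.hδ
  have hn : nq w h = nq w Φ := by simp [nq, hh]
  have h1 : (nq w Φ : ℂ) = ∑ k ∈ rg M, ∑ x, (w x : ℂ) *
      ((if P k x then 1 else 0) * (S.De f k x * h x)) := by
    rw [sum_comm]
    simp only [nq, ofReal_sum, Complex.ofReal_mul, ← mul_sum]
    refine sum_congr rfl fun x _ => ?_
    congr 1
    rw [← normSq_eq_norm_sq, ← Complex.mul_conj]
    simp_rw [← mul_assoc]
    rw [← sum_mul]
    congr 1
    simp [hΦ]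
  have hR : nq w Φ = ‖(nq w Φ : ℂ)‖ := by
    rw [norm_real, norm_of_nonneg (S.nsq_nonneg _)]
  have c0 : 0 < 40 * δ⁻¹ ^ 2 := pz
  have h2 : nq w Φ ≤ ∑ k ∈ rg M, ∑ x, ((40 * δ⁻¹ ^ 2) *
      (w x * (if P k x then S.ue f k x else 0)) + 1 / (2 * (40 * δ⁻¹ ^ 2)) * (w x * S.G h k x ^ 2)) := by
    rw [hR, h1]
    refine (norm_sum_le _ _).trans (sum_le_sum fun k _ => ?_)
    refine (S.dual f h k (fun x y hxy => by simp only [hP k x y hxy])).trans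
      (sum_le_sum fun x _ => ?_)
    have hwx := S.hw x
    set c := 40 * δ⁻¹ ^ 2
    set g := S.G h k x
    split_ifs with hp
    · have : (‖S.u f k x‖ + ‖S.e f k x‖) * g ≤ c * S.ue f k x + 1 / (2 * c) * g ^ 2 := by
        set p := ‖S.u f k x‖ + ‖S.e f k x‖ with hp
        have a1 : p ^ 2 ≤ 2 * S.ue f k x := by
          simp only [ue, hp]; nlinarith [sq_nonneg (‖S.u f k x‖ - ‖S.e f k x‖)]
        have a2 : 0 ≤ (c * p - g) ^ 2 / (2 * c) := pz
        have a3 : (c * p - g) ^ 2 / (2 * c) = c * p ^ 2 / 2 - p * g + 1 / (2 * c) * g ^ 2 := by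
          field_simp; ring
        nlinarith
      rw [norm_one, one_mul]
      nlinarith [mll this hwx.le]
    · rw [norm_zero]; simp only [zero_mul, mul_zero, zero_add]; positivity
  simp_rw [sum_add_distrib, ← mul_sum] at h2
  have h3 := S.G_sum h
  rw [hn] at h3
  have h4 : 1 / (2 * (40 * δ⁻¹ ^ 2)) * ∑ k ∈ rg M, ∑ x, w x * S.G h k x ^ 2
      ≤ 1 / 2 * nq w Φ := by
    calc _ ≤ 1 / (2 * (40 * δ⁻¹ ^ 2)) * (40 * δ⁻¹ ^ 2 * nq w Φ) := by gcongr
      _ = _ := by field_simp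
  linarith
end TM
section
variable {X I : Type} [Fintype X] {w : X → ℝ} {b : X → ℂ} {M : ℕ} {δ : ℝ}
namespace TM
variable (S : TM w b M δ I)
def fg (f : X → ℂ) (P : ℕ → X → Prop) (x : X) : ℂ :=
  b x * S.ga f 0 x + ∑ k ∈ rg M, if P k x then S.De f k x else 0
def H (f : X → ℂ) (P : ℕ → X → Prop) (i : ℕ) (x : X) : ℂ :=
  S.ga f 0 x + ∑ j ∈ rg i, if P j x then S.u f j x else 0
lemma av_zero (c : X → I) (x : X) : av w c (fun _ => (0:ℂ)) x = 0 := by simp [av]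
lemma av_fg (f) {P : ℕ → X → Prop} (hP : ∀ k x y, S.lab k x = S.lab k y → (P k x ↔ P k y))
    {i : ℕ} (hi : i ≤ M) {x : X} (ht : S.tr i x) :
    av w (S.lab i) (S.fg f P) x = S.H f P i x * av w (S.lab i) b x := by
  have hsum : ∀ (s : Finset ℕ) (F : ℕ → X → ℂ), av w (S.lab i) (fun y => ∑ k ∈ s, F k y) x
      = ∑ k ∈ s, av w (S.lab i) (F k) x := by
    intro s F
    induction s using induction_on with
    | empty => simp [av_zero]
    | insert a s ha ih =>
      simp only [sum_insert ha]; rw [av_add, ih]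
  have e0 : S.fg f P = fun y => S.ga f 0 y * b y + ∑ k ∈ rg M, if P k y then S.De f k y else 0 := by
    funext y; simp [fg, mul_comm]
  rw [e0, av_add, hsum, av_mulC _ (fun y hy => S.ga_congr f (S.lab_mono (Nat.zero_le _) hy)), H, add_mul,
    sum_mul]
  congr 1
  rw [← Finset.sum_range_add_sum_Ico _ hi]
  have z : ∀ k ∈ Finset.Ico i M, av w (S.lab i) (fun y => if P k y then S.De f k y else 0) x = 0 := by
    intro k hk
    have hik := (Finset.mem_Ico.1 hk).1
    rw [← av_tower S.hw (fun x y h => S.lab_mono hik h),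
      av_local (fun y _ => ?_), av_zero]
    have : (fun y => if P k y then S.De f k y else 0)
        = fun y => (if P k y then (1:ℂ) else 0) * S.De f k y := by simp
    rw [this, av_mulC _ (fun z hz => by simp only [hP k z y hz]), S.De_mean, mul_zero]
  rw [sum_eq_zero z, add_zero]
  refine sum_congr rfl fun j hj => ?_
  have hj := Finset.mem_range.1 hj
  have : (if P j x then S.u f j x else 0) * av w (S.lab i) b x
      = av w (S.lab i) (fun y => (if P j y then S.u f j y else 0) * b y) x := by
    rw [av_mulC _ (fun y hy => ?_)]
    rw [S.u_congr f (S.lab_mono (succ_le_of_lt hj) hy)]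
    simp only [hP j y x (S.lab_mono hj.le hy)]
  rw [this]
  refine av_local fun y hy => ?_
  have ty := (S.tr_iff hy).2 ht
  have := S.tr_mono (succ_le_of_lt hj) ty
  have e : S.e f j y = 0 := by simp [e, this]
  split_ifs <;> simp [De, e, mul_comm]
def lt (k : ℕ) (x : X) : ℕ := Nat.findGreatest (fun i => S.tr i x) k
lemma lt_tr (k x) : S.tr (S.lt k x) x :=
  Nat.findGreatest_spec (P := fun i => S.tr i x) (Nat.zero_le k) (S.tr0 x)
lemma lt_le (k x) : S.lt k x ≤ k := Nat.findGreatest_le k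
lemma lt_M (k x) : S.lt k x < M := by
  by_contra h
  exact S.trM x (S.tr_mono (not_lt.1 h) (S.lt_tr k x))
lemma H_le (f) {P : ℕ → X → Prop} (hP : ∀ k x y, S.lab k x = S.lab k y → (P k x ↔ P k y)) (k x) :
    ‖S.H f P k x‖ ^ 2 ≤ 2 * δ⁻¹ ^ 2 * ‖av w (S.lab (S.lt k x)) (S.fg f P) x‖ ^ 2
      + 2 * δ⁻¹ ^ 2 * ‖av w (S.lab (S.lt k x)) f x‖ ^ 2 := by
  have hδ := S.hδ
  set i := S.lt k x with hi
  have ht := S.lt_tr k x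
  have h1 : ‖S.H f P i x‖ ≤ δ⁻¹ * ‖av w (S.lab i) (S.fg f P) x‖ := by
    rw [S.av_fg f hP (S.lt_M k x).le ht, norm_mul, ← hi]
    have := S.acc i x ht
    rw [inv_mul_eq_div, le_div_iff₀ hδ]
    gcongr
  have h2 : ‖S.H f P k x‖ ≤ ‖S.H f P i x‖ + δ⁻¹ * ‖av w (S.lab i) f x‖ := by
    have hik := S.lt_le k x
    rcases hik.eq_or_lt with h | h
    · rw [hi, h]
      have : 0 ≤ δ⁻¹ * ‖av w (S.lab k) f x‖ := pz
      linarith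
    · have hn : ¬ S.tr (i+1) x := Nat.findGreatest_is_greatest
        (Nat.lt_succ_self _) (succ_le_of_lt h)
      have e1 : S.H f P k x = S.H f P i x + (if P i x then S.u f i x else 0) := by
        simp only [H]
        rw [← Finset.sum_range_add_sum_Ico _ (succ_le_of_lt h), Finset.sum_range_succ,
          sum_eq_zero (s := Finset.Ico _ _)]
        · ring
        · intro j hj
          have := (Finset.mem_Ico.1 hj).1
          rw [S.u_zero f (fun h' => hn (S.tr_mono this h'))]; simp
      rw [e1]
      refine (norm_add_le _ _).trans (add_le_add le_rfl ?_)
      have hu : ‖S.u f i x‖ ≤ δ⁻¹ * ‖av w (S.lab i) f x‖ := by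
        rw [u, show S.ga f (i+1) x = 0 by simp [ga, hn], zero_sub, norm_neg]
        exact S.ga_le f i x
      split_ifs
      · exact hu
      · rw [norm_zero]; positivity
  set p := δ⁻¹ * ‖av w (S.lab i) (S.fg f P) x‖
  set q := δ⁻¹ * ‖av w (S.lab i) f x‖
  calc _ ≤ (p + q) ^ 2 := by gcongr; linarith
    _ ≤ 2 * p ^ 2 + 2 * q ^ 2 := by nlinarith [sq_nonneg (p - q)]
    _ = _ := by simp only [p, q]; ring
lemma ue_e (f k x) : ‖S.De f k x‖ ^ 2 ≤ 2 * S.ue f k x := by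
  have h1 : ‖S.De f k x‖ ≤ ‖S.u f k x‖ + ‖S.e f k x‖ := by
    refine (norm_add_le _ _).trans ?_
    rw [norm_mul]
    have := S.hb x
    nlinarith [norm_nonneg (S.u f k x)]
  calc _ ≤ (‖S.u f k x‖ + ‖S.e f k x‖) ^ 2 := by gcongr
    _ ≤ _ := by unfold ue; nlinarith [sq_nonneg (‖S.u f k x‖ - ‖S.e f k x‖)]
lemma fg_nq (f) {P : ℕ → X → Prop} (hP : ∀ k x y, S.lab k x = S.lab k y → (P k x ↔ P k y)) :
    nq w (S.fg f P) ≤ 3042 * δ⁻¹ ^ 6 * nq w f := by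
  have hδ := S.hδ
  have h1 := S.dualSQ f P hP
  have h2 : ∑ k ∈ rg M, ∑ x, w x * (if P k x then S.ue f k x else 0) ≤ 19 * δ⁻¹ ^ 4 * nq w f := by
    refine le_trans ?_ (S.SQ f)
    refine sum_le_sum fun k _ => sum_le_sum fun x _ => mll ?_ (S.hw x).le
    split_ifs
    · exact le_rfl
    · exact S.ue_nonneg f k x
  have h3 : nq w (S.fg f P) ≤ 2 * nq w (fun x => b x * S.ga f 0 x)
      + 2 * nq w (fun x => ∑ k ∈ rg M, if P k x then S.De f k x else 0) := by
    simp only [nq, mul_sum]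
    rw [← sum_add_distrib]
    refine sum_le_sum fun x _ => ?_
    have hwx := S.hw x
    simp only [fg]
    set p := b x * S.ga f 0 x
    set q := ∑ k ∈ rg M, if P k x then S.De f k x else 0
    have : ‖p + q‖ ^ 2 ≤ (‖p‖ + ‖q‖) ^ 2 := by gcongr; exact norm_add_le _ _
    have : ‖p + q‖ ^ 2 ≤ 2 * ‖p‖ ^ 2 + 2 * ‖q‖ ^ 2 := by nlinarith [sq_nonneg (‖p‖ - ‖q‖)]
    nlinarith [mll this hwx.le]
  have h4 : nq w (fun x => b x * S.ga f 0 x) ≤ δ⁻¹ ^ 2 * nq w f := by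
    refine (S.bh_nsq _).trans ?_
    have := sum_av_sq_le (c := S.lab 0) S.hw f
    calc _ ≤ δ⁻¹ ^ 2 * ∑ x, w x * ‖av w (S.lab 0) f x‖ ^ 2 := by
          rw [nq, mul_sum]
          refine sum_le_sum fun x _ => ?_
          have h5 := S.ga_le f 0 x
          have : ‖S.ga f 0 x‖ ^ 2 ≤ (δ⁻¹ * ‖av w (S.lab 0) f x‖) ^ 2 := by gcongr
          rw [mul_pow] at this
          nlinarith [S.hw x]
      _ ≤ _ := by gcongr; exact this
  have hn := S.nsq_nonneg f
  have h3' := (one_le_inv₀ hδ).2 S.hδ1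
  have h6 : δ⁻¹ ^ 2 ≤ δ⁻¹ ^ 6 := pow_le_pow_right₀ h3' nz
  nlinarith [mul_le_mul_of_nonneg_right h6 hn]
end TM
structure KD (w : X → ℝ) (b : X → ℂ) where
  ds : X → X → ℝ
  Ψ : X → ℝ
  k : X → X → ℂ
  (n α C Ct Λ L ρ u A : ℝ)
  ds_nonneg : ∀ x y, 0 ≤ ds x y
  ds_comm : ∀ x y, ds x y = ds y x
  ds_tri : ∀ x y z, ds x z ≤ ds x y + ds y z
  Ψpos : ∀ x, 0 < Ψ x
  anti : ∀ x y, k x y = - k y x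
  hn : 0 < n
  hα : 0 < α
  hC : 0 < C
  hCt : 0 < Ct
  hΛ : 0 < Λ
  hL : 0 < L
  hρ : 0 < ρ
  hρ1 : ρ < 1
  hu : 0 < u
  hu1 : u ≤ 1
  hA : 1 ≤ A
  hρu : 4 * A * ρ ≤ u
  hκ : ρ ^ α ≤ 1 / 2 * u ^ (n + α)
  K1 : ∀ x y, ‖k x y‖ ≤ C / (ds x y + Ψ x + Ψ y) ^ n
  K2 : ∀ x y y' r, 0 < r → ds y y' ≤ r → 4 * r ≤ ds x y + Ψ x + Ψ y →
    ‖k x y - k x y'‖ ≤ C * r ^ α / (ds x y + Ψ x + Ψ y) ^ (n + α)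
  tail : ∀ ℓ z, 0 < ℓ → Ψ z ≤ 2 * ℓ → ∑ x, w x * (ℓ ^ α / (ℓ + ds x z) ^ (n + α)) ≤ Ct
  Tb : ∀ x, ‖∑ y, (w y : ℂ) * (k x y * b y)‖ ≤ Λ
namespace KD
notation:max "nα" K:max => KD.n K + KD.α K
variable (K : KD w b)
def ℓ (i : ℕ) : ℝ := K.L * K.ρ ^ i
def t (i : ℕ) (x y : X) : ℝ := K.ℓ i ^ K.α / (K.ℓ i + K.ds x y) ^ nα K
def _root_.Bw (w : X → ℝ) (k : X → X → ℂ) (φ ψ : X → ℂ) : ℂ := ∑ x, ∑ y, (w x : ℂ) * w y * (k x y * φ y * ψ x)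
def s (x y : X) : ℝ := K.ds x y + K.Ψ x + K.Ψ y
lemma ℓ_pos (i) : 0 < K.ℓ i := by have := K.hL; have := K.hρ; unfold ℓ; positivity
lemma ℓ_succ (i) : K.ℓ (i+1) = K.ρ * K.ℓ i := by unfold ℓ; ring
lemma ℓ_add (i m) : K.ℓ (i+m) = K.ρ ^ m * K.ℓ i := by unfold ℓ; ring
lemma ℓ_anti {i j} (h : i ≤ j) : K.ℓ j ≤ K.ℓ i := by
  unfold ℓ
  have := K.hL
  gcongr 1
  exact pow_le_pow_of_le_one K.hρ.le K.hρ1.le h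
lemma t_nonneg (i x y) : 0 ≤ K.t i x y := by
  have := K.ℓ_pos i; have := K.ds_nonneg x y; unfold t; positivity
lemma t_comm (i x y) : K.t i x y = K.t i y x := by unfold t; rw [K.ds_comm]
lemma smooth {i : ℕ} {a r : ℝ} (ha : 0 < a) (hr : 0 < r) {x y y' : X} (h1 : K.ds y y' ≤ r)
    (h4 : 4 * r ≤ K.s x y) (hs : a * (K.ℓ i + K.ds x y) ≤ K.s x y) :
    ‖K.k x y - K.k x y'‖ ≤ K.C * ((r / K.ℓ i) ^ K.α * (a⁻¹) ^ nα K) * K.t i x y := by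
  have hl := K.ℓ_pos i
  have hd := K.ds_nonneg x y
  have hn := K.hn
  have hα := K.hα
  have hC := K.hC
  refine (K.K2 x y y' r hr h1 h4).trans ?_
  have e : K.C * ((r / K.ℓ i) ^ K.α * (a⁻¹) ^ nα K) * K.t i x y
      = K.C * r ^ K.α / (a * (K.ℓ i + K.ds x y)) ^ nα K := by
    unfold t
    rw [div_rpow hr.le hl.le, Real.inv_rpow ha.le, mul_rpow ha.le pz]
    field_simp
  rw [e]
  apply div_le_div_of_nonneg_left pz pz
  exact Real.rpow_le_rpow pz hs pz
lemma schur (hw : ∀ x, 0 < w x) {i : ℕ} {p q : X → ℝ} (hp : ∀ y, 0 ≤ p y) (hq : ∀ y, 0 ≤ q y)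
    (h1 : ∀ y, p y ≠ 0 → K.Ψ y ≤ 2 * K.ℓ i) (h2 : ∀ y, q y ≠ 0 → K.Ψ y ≤ 2 * K.ℓ i) :
    ∑ x, ∑ y, w x * w y * (K.t i x y * (p y + q x))
      ≤ K.Ct * (∑ y, w y * p y + ∑ x, w x * q x) := by
  have a : ∀ (p : X → ℝ), (∀ y, 0 ≤ p y) → (∀ y, p y ≠ 0 → K.Ψ y ≤ 2 * K.ℓ i) →
      ∑ y, ∑ x, w x * w y * (K.t i x y * p y) ≤ K.Ct * ∑ y, w y * p y := by
    intro p hp h1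
    rw [mul_sum]
    refine sum_le_sum fun y _ => ?_
    by_cases h : p y = 0
    · simp [h]
    · have := K.tail (K.ℓ i) y (K.ℓ_pos i) (h1 y h)
      calc _ = (∑ x, w x * K.t i x y) * (w y * p y) := by
            rw [sum_mul]; exact sum_congr rfl fun x _ => by ring
        _ ≤ K.Ct * (w y * p y) := by
            have := hw y; have := hp y
            gcongr; exact ‹∑ x, _ ≤ _›
  simp_rw [mul_add, sum_add_distrib]
  have h3 := a p hp h1
  have h4 := a q hq h2
  rw [sum_comm] at h3
  have : ∑ x, ∑ y, w x * w y * (K.t i x y * q x) = ∑ y, ∑ x, w x * w y * (K.t i x y * q y) :=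
    sum_congr rfl fun x _ => sum_congr rfl fun y _ => by rw [K.t_comm]; ring
  linarith
end KD
structure GP (K : KD w b) (S S' : TM w b M δ I) (P P' : ℕ → X → Prop) : Prop where
  Pc : ∀ k x y, S.lab k x = S.lab k y → (P k x ↔ P k y)
  Pc' : ∀ k x y, S'.lab k x = S'.lab k y → (P' k x ↔ P' k y)
  good : ∀ k x, P k x → ∀ i, 1 ≤ i → i < k → ∀ y, S'.lab i y ≠ S'.lab i x →
    K.ℓ i * K.u ^ (k - i) ≤ K.ds x y
  good' : ∀ k x, P' k x → ∀ i, 1 ≤ i → i < k → ∀ y, S.lab i y ≠ S.lab i x →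
    K.ℓ i * K.u ^ (k - i) ≤ K.ds x y
  trΨ : ∀ k x, S.tr k x → K.Ψ x ≤ 2 * K.ℓ k
  trΨ' : ∀ k x, S'.tr k x → K.Ψ x ≤ 2 * K.ℓ k
  diam : ∀ k x y, S.lab k x = S.lab k y → K.ds x y ≤ K.ℓ k
  diam' : ∀ k x y, S'.lab k x = S'.lab k y → K.ds x y ≤ K.ℓ k
  top : ∀ x y, S.lab 0 x = S.lab 0 y
  top' : ∀ x y, S'.lab 0 x = S'.lab 0 y
lemma GP.swap {K : KD w b} {S S' : TM w b M δ I} {P P' : ℕ → X → Prop} (h : GP K S S' P P') :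
    GP K S' S P' P :=
  ⟨h.Pc', h.Pc, h.good', h.good, h.trΨ', h.trΨ, h.diam', h.diam, h.top', h.top⟩
namespace GP
variable {K : KD w b} {S S' : TM w b M δ I} {P P' : ℕ → X → Prop} (h : GP K S S' P P')
lemma pow_le (K : KD w b) {m : ℕ} (hm : 1 ≤ m) : 4 * K.A * K.ρ ^ m ≤ K.u ^ m := by
  have hρ := K.hρ
  have hA := K.hA
  have h1 := pow_le_pow_left₀ pz K.hρu m
  have h2 : 4 * K.A ≤ (4 * K.A) ^ m := le_self_pow₀ lz oz
  rw [mul_pow] at h1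
  have : 0 < K.ρ ^ m := pz
  nlinarith
include h in
lemma cellin {k i : ℕ} {x y : X} (hp : P k x) (hi : i < k) (hxy : S.lab k y = S.lab k x) :
    S'.lab i y = S'.lab i x := by
  rcases Nat.eq_zero_or_pos i with rfl | h0
  · exact h.top' _ _
  by_contra hne
  have h1 := h.good k x hp i h0 hi y hne
  have h2 := h.diam k x y hxy.symm
  obtain ⟨m, rfl⟩ := Nat.exists_eq_add_of_lt hi
  have h3 := pow_le K (m := m + 1) oz
  rw [show i + m + 1 - i = m + 1 by omega] at h1
  rw [show i + m + 1 = i + (m + 1) by omega, K.ℓ_add] at h2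
  have hl := K.ℓ_pos i
  have hA := K.hA
  have : 0 < K.ρ ^ (m+1) := by have := K.hρ; positivity
  nlinarith [mul_pos this hl]
end GP
end
section
variable {X I : Type} [Fintype X] {w : X → ℝ} {b : X → ℂ} {M : ℕ} {δ : ℝ}
namespace TM
variable (S : TM w b M δ I)
lemma mz (f) (k : ℕ) {a κ : X → ℂ} {D : X → ℝ} (ha : ∀ x y, S.lab k x = S.lab k y → a x = a y)
    (hD : ∀ y, a y ≠ 0 → S.De f k y ≠ 0 → ∀ y', S.lab k y' = S.lab k y → ‖κ y - κ y'‖ ≤ D y) :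
    ‖∑ y, (w y : ℂ) * (κ y * (a y * S.De f k y))‖ ≤ ∑ y, w y * (D y * (‖a y‖ * ‖S.De f k y‖)) := by
  have h0 : ∑ y, (w y : ℂ) * ((av w (S.lab k) κ y * a y) * S.De f k y) = 0 := by
    rw [← sum_mul_avC S.hw (fun x y h => by rw [ha x y h, av_congr κ h])]
    simp [S.De_mean]
  have h1 : ∑ y, (w y : ℂ) * (κ y * (a y * S.De f k y))
      = ∑ y, (w y : ℂ) * ((κ y - av w (S.lab k) κ y) * (a y * S.De f k y)) := by
    rw [← sub_zero (∑ y, (w y : ℂ) * (κ y * (a y * S.De f k y))), ← h0, ← sum_sub_distrib]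
    exact sum_congr rfl fun y _ => by ring
  rw [h1]
  refine (norm_sum_le _ _).trans (sum_le_sum fun y _ => ?_)
  rw [norm_mul, norm_mul, norm_mul, norm_real, norm_of_nonneg (S.hw y).le]
  by_cases h2 : a y = 0
  · simp [h2]
  by_cases h3 : S.De f k y = 0
  · simp [h3]
  have h4 : ‖κ y - av w (S.lab k) κ y‖ ≤ D y := by
    have : κ y - av w (S.lab k) κ y = av w (S.lab k) (fun z => κ y - κ z) y := by
      rw [av_sub, av_const S.hw (F := fun _ => κ y) zs]
    rw [this]
    exact norm_av_le_of_le S.hw (fun z hz => hD y h2 h3 z hz)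
  have := S.hw y
  gcongr
end TM
lemma geo_half (M : ℕ) (a c : ℕ → ℝ) (ha : ∀ k, 0 ≤ a k) (hc : ∀ k, 0 ≤ c k) :
    ∑ k ∈ rg M, ∑ j ∈ rg (k-1), (1/2:ℝ) ^ (k-j-1) * (a k + c j)
      ≤ ∑ k ∈ rg M, a k + ∑ k ∈ rg M, c k := by
  have g : ∀ N : ℕ, ∑ i ∈ rg N, (1/2:ℝ) ^ (i+1) ≤ 1 := by
    intro N
    have : ∑ i ∈ rg N, (1/2:ℝ) ^ (i+1) = 1 - (1/2)^N := by
      induction N with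
      | zero => simp
      | succ N ih => rw [Finset.sum_range_succ, ih]; ring
    rw [this]; have : (0:ℝ) ≤ (1/2)^N := pz
    linarith
  simp_rw [mul_add, sum_add_distrib]
  refine add_le_add (sum_le_sum fun k hk => ?_) ?_
  · rw [← sum_mul]
    have : ∑ j ∈ rg (k-1), (1/2:ℝ) ^ (k-j-1) ≤ 1 := by
      rw [← Finset.sum_range_reflect]
      refine le_trans (sum_le_sum fun i hi => le_of_eq ?_) (g (k-1))
      have := Finset.mem_range.1 hi
      rw [show k - (k-1-1-i) - 1 = i+1 by omega]
    nlinarith [ha k]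
  · calc _ ≤ ∑ k ∈ rg M, ∑ j ∈ rg M, (if j + 1 < k then (1/2:ℝ) ^ (k-j-1) * c j else 0) := by
          refine sum_le_sum fun k hk => ?_
          have hk := Finset.mem_range.1 hk
          rw [← sum_filter]
          refine sum_le_sum_of_subset_of_nonneg ?_ (fun i _ _ => by have := hc i; positivity)
          intro j hj
          have := Finset.mem_range.1 hj
          simp only [mem_filter, Finset.mem_range]; omega
      _ = ∑ j ∈ rg M, (∑ k ∈ rg M, if j + 1 < k then (1/2:ℝ) ^ (k-j-1) else 0) * c j := by
          rw [sum_comm]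
          refine sum_congr rfl fun j _ => ?_
          rw [sum_mul]
          exact sum_congr rfl fun k _ => by split_ifs <;> simp
      _ ≤ _ := by
          refine sum_le_sum fun j _ => ?_
          have : (∑ k ∈ rg M, if j + 1 < k then (1/2:ℝ) ^ (k-j-1) else 0) ≤ 1 := by
            rw [← sum_filter]
            refine le_trans ?_ (g M)
            have hinj : Set.InjOn (fun k => k - j - 2) (Finset.filter (fun k => j + 1 < k) (rg M)) := by
              intro x hx y hy hxy
              simp only [Finset.coe_filter, Set.mem_setOf_eq] at hx hy hxy
              omega
            have e : ∑ k ∈ rg M with j + 1 < k, (1/2:ℝ) ^ (k-j-1)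
              = ∑ i ∈ (Finset.filter (fun k => j + 1 < k) (rg M)).image (fun k => k - j - 2), (1/2:ℝ)^(i+1) := by
              rw [Finset.sum_image hinj]
              refine sum_congr rfl fun k hk => ?_
              have := (mem_filter.1 hk).2
              rw [show k - j - 2 + 1 = k - j - 1 by omega]
            rw [e]
            refine sum_le_sum_of_subset_of_nonneg ?_ (fun _ _ _ => by positivity)
            intro i hi
            simp only [Finset.mem_image, mem_filter, Finset.mem_range] at hi ⊢
            omega
          nlinarith [hc j]
namespace GP
variable {K : KD w b} {S S' : TM w b M δ I} {P P' : ℕ → X → Prop}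
lemma deepR (h : GP K S S' P P') (f g : X → ℂ) (he : ∀ j x, S'.e g j x ≠ 0 → K.ℓ (j+1) ≤ K.A * K.Ψ x)
    {k j : ℕ} (hjk : j + 1 < k) :
    ‖∑ x, ∑ y, (w x : ℂ) * w y * (K.k x y * (if P k y then S.De f k y else 0) *
      ((if P' j x then S'.De g j x else 0) - (if P' j y then S'.u g j y else 0) * b x))‖
    ≤ 2 * K.C * (2 * K.A / K.ρ) ^ nα K * K.Ct * ((1/2) ^ (k-j-1) *
      (∑ y, w y * S.ue f k y + ∑ x, w x * S'.ue g j x)) := by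
  obtain ⟨m, rfl⟩ : ∃ m, k = j + (m + 1) := ⟨k - j - 1, by omega⟩
  have hm : 1 ≤ m := oz
  rw [show j + (m+1) - j - 1 = m by omega]
  set k := j + (m+1) with hk
  have hρ := K.hρ; have hρ1 := K.hρ1; have hA := K.hA; have hu := K.hu; have hu1 := K.hu1
  have hn := K.hn; have hα := K.hα; have hC := K.hC; have hCt := K.hCt
  have hlj := K.ℓ_pos j
  set c : X → ℂ := fun y => if P' j y then S'.u g j y else 0 with hc
  set ψ : X → ℂ := fun x => if P' j x then S'.De g j x else 0 with hψ
  set CR := K.C * (2 * K.A / K.ρ) ^ nα K with hCR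
  have hCR0 : 0 < CR := pz
  have cc : ∀ x y, S'.lab (j+1) x = S'.lab (j+1) y → c x = c y := by
    intro x y hxy
    simp only [hc, h.Pc' j x y (S'.hr _ _ _ hxy), S'.u_congr g hxy]
  have cb : ∀ y, ‖c y‖ ≤ ‖S'.u g j y‖ := by intro y; simp only [hc]; split_ifs <;> simp
  have ψb : ∀ y, ‖ψ y‖ ≤ ‖S'.De g j y‖ := by intro y; simp only [hψ]; split_ifs <;> simp
  have inner : ∀ x, ‖∑ y, (w y : ℂ) * (K.k x y * ((if P k y then ψ x - c y * b x else 0) * S.De f k y))‖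
      ≤ ∑ y, w y * ((CR * (1/2)^m * K.t j x y) * (‖(if P k y then ψ x - c y * b x else 0)‖ * ‖S.De f k y‖)) := by
    intro x
    refine S.mz f k ?_ ?_
    · intro y z hyz
      simp only [h.Pc k y z hyz]
      split_ifs with hp
      · rw [cc y z (h.cellin hp hjk hyz)]
      · rfl
    · intro y hay hDy y' hy'
      have hp : P k y := by by_contra hp; simp [hp] at hay
      simp only [hp, if_true] at hay
      have hs : K.A⁻¹ * K.ρ * K.u ^ m * K.ℓ j ≤ K.s x y := by
        have hΨx := K.Ψpos x; have hΨy := K.Ψpos y; have hd := K.ds_nonneg x y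
        have hum : K.u ^ m ≤ 1 := pow_le_one₀ hu.le hu1
        have hAi : K.A⁻¹ ≤ 1 := inv_le_one_of_one_le₀ hA
        by_cases hl : S'.lab (j+1) x = S'.lab (j+1) y
        · have e1 : S'.e g j x ≠ 0 := by
            intro h0
            apply hay
            rw [← cc x y hl]
            simp only [hψ, hc, TM.De, h0]
            split_ifs <;> ring
          have := he j x e1
          rw [K.ℓ_succ] at this
          have h2 : K.A⁻¹ * (K.ρ * K.ℓ j) ≤ K.Ψ x := by
            rw [inv_mul_le_iff₀ lz]; exact this
          have h3 : K.A⁻¹ * K.ρ * K.u ^ m * K.ℓ j ≤ K.A⁻¹ * K.ρ * 1 * K.ℓ j := by gcongr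
          unfold KD.s; nlinarith
        · have h1 := h.good k y hp (j+1) oz hjk x hl
          rw [show k - (j+1) = m by omega, K.ℓ_succ, K.ds_comm] at h1
          have h3 : K.A⁻¹ * K.ρ * K.u ^ m * K.ℓ j ≤ 1 * K.ρ * K.u ^ m * K.ℓ j := by gcongr
          unfold KD.s; nlinarith
      have hlk : K.ℓ k = K.ρ ^ (m+1) * K.ℓ j := K.ℓ_add _ _
      have hpl := pow_le K hm
      have hum : K.u ^ m ≤ 1 := pow_le_one₀ hu.le hu1
      have hA0 : 0 < K.A := lz
      refine (K.smooth (i := j) (a := 1/2 * (K.A⁻¹ * K.ρ * K.u ^ m)) (r := K.ℓ k) pz (K.ℓ_pos k)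
        (h.diam k y y' hy'.symm) ?_ ?_).trans ?_
      · refine le_trans ?_ hs
        rw [hlk]
        have : 4 * K.ρ ^ m ≤ K.A⁻¹ * K.u ^ m := by
          rw [← div_eq_inv_mul, le_div_iff₀ hA0]; linarith
        calc 4 * (K.ρ ^ (m+1) * K.ℓ j) = (4 * K.ρ ^ m) * (K.ρ * K.ℓ j) := by ring
          _ ≤ (K.A⁻¹ * K.u ^ m) * (K.ρ * K.ℓ j) := by gcongr
          _ = _ := by ring
      · have hd := K.ds_nonneg x y
        have hds : K.ds x y ≤ K.s x y := by unfold KD.s; linarith [K.Ψpos x, K.Ψpos y]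
        have h5 : K.A⁻¹ * K.ρ * K.u ^ m ≤ 1 * 1 * 1 := by
          have := inv_le_one_of_one_le₀ hA
          gcongr
        nlinarith [mul_le_mul_of_nonneg_right h5 hd]
      · have ht := K.t_nonneg j x y
        refine mul_le_mul_of_nonneg_right ?_ ht
        rw [hCR, mul_assoc K.C]
        refine mll ?_ hC.le
        rw [hlk, mul_div_assoc, div_self hlj.ne', mul_one]
        have e1 : (1/2 * (K.A⁻¹ * K.ρ * K.u ^ m))⁻¹ = (2 * K.A / K.ρ) * (K.u ^ m)⁻¹ := by
          field_simp
        rw [e1, mul_rpow pz pz]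
        have e2 : (K.ρ ^ (m+1)) ^ K.α = K.ρ ^ K.α * (K.ρ ^ K.α) ^ m := by
          rw [← Real.rpow_natCast, ← Real.rpow_mul hρ.le, ← Real.rpow_natCast, ← Real.rpow_mul hρ.le,
            ← Real.rpow_add hρ]
          push_cast; ring_nf
        have e3 : ((K.u ^ m)⁻¹) ^ nα K = ((K.u ^ nα K) ^ m)⁻¹ := by
          rw [Real.inv_rpow pz, ← Real.rpow_natCast, ← Real.rpow_mul hu.le,
            ← Real.rpow_natCast, ← Real.rpow_mul hu.le, mul_comm]
        rw [e2, e3]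
        have e4 : (K.ρ ^ K.α) ^ m ≤ (1/2)^m * (K.u ^ nα K) ^ m := by
          rw [← mul_pow]; exact pow_le_pow_left₀ pz K.hκ m
        have e5 : K.ρ ^ K.α ≤ 1 := Real.rpow_le_one hρ.le hρ1.le hα.le
        calc _ ≤ 1 * ((1/2)^m * (K.u ^ nα K) ^ m) * ((2 * K.A / K.ρ) ^ nα K * ((K.u ^ nα K) ^ m)⁻¹) := by
              gcongr
          _ = _ := by
              have : (K.u ^ nα K) ^ m ≠ 0 := pz
              field_simp
  have e1 : ∑ x, ∑ y, (w x : ℂ) * w y * (K.k x y * (if P k y then S.De f k y else 0) * (ψ x - c y * b x))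
      = ∑ x, (w x : ℂ) * ∑ y, (w y : ℂ) * (K.k x y * ((if P k y then ψ x - c y * b x else 0) * S.De f k y)) := by
    refine sum_congr rfl fun x _ => ?_
    rw [mul_sum]
    refine sum_congr rfl fun y _ => ?_
    split_ifs <;> ring
  rw [e1]
  have sch := K.schur S.hw (i := j) (p := fun y => 2 * S.ue f k y + S'.ue g j y) (q := fun x => S'.ue g j x)
    (fun y => by have := S.ue_nonneg f k y; have := S'.ue_nonneg g j y; positivity)
    (fun y => S'.ue_nonneg g j y)
    (fun y hy => by
      by_cases ht : S'.tr j y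
      · exact h.trΨ' j y ht
      by_cases ht2 : S.tr k y
      · have := h.trΨ k y ht2; have := K.ℓ_anti (i := j) (j := k) oz; linarith
      · simp [TM.ue, S.u_zero f ht2, S.e_zero f ht2, S'.u_zero g ht, S'.e_zero g ht] at hy)
    (fun y hy => by
      by_contra ht
      have ht : ¬ S'.tr j y := fun h2 => ht (h.trΨ' j y h2)
      simp [TM.ue, S'.u_zero g ht, S'.e_zero g ht] at hy)
  calc _ ≤ ∑ x, w x * ∑ y, w y * ((CR * (1/2)^m * K.t j x y) * (‖(if P k y then ψ x - c y * b x else 0)‖ * ‖S.De f k y‖)) := by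
        refine (norm_sum_le _ _).trans (sum_le_sum fun x _ => ?_)
        rw [norm_mul, norm_real, norm_of_nonneg (S.hw x).le]
        exact mll (inner x) (S.hw x).le
    _ ≤ ∑ x, ∑ y, CR * (1/2)^m * (w x * w y * (K.t j x y * ((2 * S.ue f k y + S'.ue g j y) + S'.ue g j x))) := by
        refine sum_le_sum fun x _ => ?_
        rw [mul_sum]
        refine sum_le_sum fun y _ => ?_
        have hwx := S.hw x; have hwy := S.hw y; have ht := K.t_nonneg j x y
        have key : ‖(if P k y then ψ x - c y * b x else 0)‖ * ‖S.De f k y‖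
            ≤ 2 * S.ue f k y + S'.ue g j y + S'.ue g j x := by
          have h1 : ‖(if P k y then ψ x - c y * b x else 0)‖ ≤ ‖S'.De g j x‖ + ‖S'.u g j y‖ := by
            split_ifs
            · refine (norm_sub_le _ _).trans (add_le_add (ψb x) ?_)
              rw [norm_mul]
              have := cb y; have := S.hb x
              nlinarith [norm_nonneg (c y)]
            · rw [norm_zero]; positivity
          have h2 := S'.ue_e g j x
          have h3 := S.ue_e f k y
          have h4 : ‖S'.u g j y‖ ^ 2 ≤ S'.ue g j y := by unfold TM.ue; nlinarith [sq_nonneg ‖S'.e g j y‖]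
          have h5 := mul_le_mul_of_nonneg_right h1 (norm_nonneg (S.De f k y))
          nlinarith [sq_nonneg (‖S'.De g j x‖ - ‖S.De f k y‖), sq_nonneg (‖S'.u g j y‖ - ‖S.De f k y‖), sq_nonneg ‖S'.u g j y‖]
        calc _ = CR * (1/2)^m * (w x * w y * (K.t j x y * (‖(if P k y then ψ x - c y * b x else 0)‖ * ‖S.De f k y‖))) := by ring
          _ ≤ _ := by gcongr
    _ ≤ CR * (1/2)^m * (K.Ct * (∑ y, w y * (2 * S.ue f k y + S'.ue g j y) + ∑ x, w x * S'.ue g j x)) := by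
        simp_rw [← mul_sum]; gcongr
    _ = _ := by
        simp_rw [mul_add, sum_add_distrib, ← mul_assoc, mul_comm _ (2:ℝ), mul_assoc, ← mul_sum]
        rw [hCR]; ring
end GP
end
section
variable {X I : Type} [Fintype X] {w : X → ℝ} {b : X → ℂ} {M : ℕ} {δ : ℝ}
namespace TM
variable (S : TM w b M δ I)
lemma G_loc (h : X → ℂ) {Λ : ℝ} (hh : ∀ x, ‖h x‖ ≤ Λ) (R : X → Prop) :
    ∑ k ∈ rg M, ∑ x, (if ∀ y, S.lab k y = S.lab k x → R y then w x * S.G h k x ^ 2 else 0)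
      ≤ 16 * δ⁻¹ ^ 2 * Λ ^ 2 * ∑ x with R x, w x := by
  have hδ := S.hδ
  have h3 := (one_le_inv₀ hδ).2 S.hδ1
  have hbh : ∀ y, ‖b y * h y‖ ≤ Λ := fun y => by
    rw [norm_mul]; have := S.hb y; have := hh y; nlinarith [norm_nonneg (h y)]
  have hW : 0 ≤ ∑ x with R x, w x := sum_nonneg fun x _ => (S.hw x).le
  have a1 : ∑ k ∈ rg M, ∑ x, (if ∀ y, S.lab k y = S.lab k x → R y then
      w x * ‖Df w S.lab k (fun y => b y * h y) x‖ ^ 2 else 0) ≤ Λ ^ 2 * ∑ x with R x, w x := by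
    refine (mart_sq_loc S.hw S.hr _ M R).trans ?_
    rw [← sum_filter, mul_sum]
    refine sum_le_sum fun x _ => ?_
    have : ‖b x * h x‖ ^ 2 ≤ Λ ^ 2 := by have := hbh x; gcongr
    rw [mul_comm (Λ ^ 2)]
    exact mll this (S.hw x).le
  have a2 : ∑ k ∈ rg M, ∑ x, (if ∀ y, S.lab k y = S.lab k x → R y then
      w x * ‖Df w S.lab k b x‖ ^ 2 else 0) ≤ ∑ x with R x, w x := by
    refine (mart_sq_loc S.hw S.hr _ M R).trans ?_
    rw [← sum_filter]
    refine sum_le_sum fun x _ => ?_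
    have : ‖b x‖ ^ 2 ≤ 1 := pow_le_one₀ (norm_nonneg _) (S.hb x)
    nlinarith [S.hw x]
  have a3 : ∑ k ∈ rg M, ∑ x, (if ∀ y, S.lab k y = S.lab k x → R y then
      w x * S.st k x else 0) ≤ ∑ x with R x, w x := by
    rw [sum_comm, sum_filter]
    refine sum_le_sum fun x _ => ?_
    have hst : ∀ k, 0 ≤ S.st k x := fun k => by unfold st; positivity
    split_ifs with hR
    · calc _ ≤ ∑ k ∈ rg M, w x * S.st k x := by
            refine sum_le_sum fun k _ => ?_
            split_ifs
            · exact le_rfl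
            · exact mul_nonneg (S.hw x).le (hst k)
        _ ≤ _ := by
            rw [← mul_sum]
            have := S.st_sum_le (rg M) x
            nlinarith [S.hw x]
    · refine le_of_eq (sum_eq_zero fun k _ => if_neg fun h => hR (h x rfl))
  calc _ ≤ ∑ k ∈ rg M, ∑ x, (4 * (if ∀ y, S.lab k y = S.lab k x → R y then
        w x * ‖Df w S.lab k (fun y => b y * h y) x‖ ^ 2 else 0)
      + 4 * δ⁻¹ ^ 2 * Λ ^ 2 * (if ∀ y, S.lab k y = S.lab k x → R y then w x * ‖Df w S.lab k b x‖ ^ 2 else 0)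
      + (4 * δ⁻¹ ^ 2 * Λ ^ 2 + 4 * Λ ^ 2) * (if ∀ y, S.lab k y = S.lab k x → R y then w x * S.st k x else 0)) := by
        refine sum_le_sum fun k _ => sum_le_sum fun x _ => ?_
        split_ifs with hR
        · have h1 := S.G_sq_le h k x
          have h4 : ‖av w (S.lab k) (fun y => b y * h y) x‖ ^ 2 ≤ Λ ^ 2 := by
            have := norm_av_le_of_le (c := S.lab k) (x := x) S.hw (fun y _ => hbh y)
            gcongr
          have h5 : ‖h x‖ ^ 2 ≤ Λ ^ 2 := by have := hh x; gcongr
          have hst : 0 ≤ S.st k x := by unfold st; positivity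
          have hwx := S.hw x
          calc _ ≤ w x * (4 * ‖Df w S.lab k (fun y => b y * h y) x‖ ^ 2
    + 4 * δ⁻¹ ^ 2 * ((‖Df w S.lab k b x‖ ^ 2 + S.st k x) * Λ ^ 2) + 4 * (S.st k x * Λ ^ 2)) := by
                refine mll (h1.trans ?_) hwx.le
                gcongr
            _ = _ := by ring
        · simp
    _ ≤ 4 * (Λ ^ 2 * ∑ x with R x, w x) + 4 * δ⁻¹ ^ 2 * Λ ^ 2 * (∑ x with R x, w x)
        + (4 * δ⁻¹ ^ 2 * Λ ^ 2 + 4 * Λ ^ 2) * ∑ x with R x, w x := by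
        simp_rw [sum_add_distrib, ← mul_sum]
        gcongr
    _ ≤ _ := by
        have h6 : 1 ≤ δ⁻¹ ^ 2 := one_le_pow₀ h3
        have : 0 ≤ Λ ^ 2 * ∑ x with R x, w x := pz
        nlinarith
end TM
namespace GP
variable {K : KD w b} {S S' : TM w b M δ I} {P P' : ℕ → X → Prop}
lemma cellin' (h : GP K S S' P P') {k i : ℕ} {x y : X} (hp : P k x) (hi : i ≤ k - 1) (hxy : S.lab k y = S.lab k x) :
    S'.lab i y = S'.lab i x := by
  rcases Nat.eq_zero_or_pos i with rfl | h0
  · exact h.top' _ _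
  · exact h.cellin hp oz hxy
lemma H_congr (h : GP K S S' P P') (g) {i : ℕ} {x y : X} (hxy : S'.lab i x = S'.lab i y) :
    S'.H g P' i x = S'.H g P' i y := by
  unfold TM.H
  rw [S'.ga_congr g (h.top' x y)]
  congr 1
  refine sum_congr rfl fun j hj => ?_
  have hj := Finset.mem_range.1 hj
  rw [S'.u_congr g (S'.lab_mono (succ_le_of_lt hj) hxy)]
  simp only [h.Pc' j x y (S'.lab_mono hj.le hxy)]
lemma para_car (h : GP K S S' P P') (hh : X → ℂ) (hΛ : ∀ x, ‖hh x‖ ≤ K.Λ) (F : X → ℂ) :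
    ∑ k ∈ rg M, ∑ y, w y * ((if P k y then S.G hh k y ^ 2 else 0) *
      ‖av w (S'.lab (S'.lt (k-1) y)) F y‖ ^ 2) ≤ 64 * δ⁻¹ ^ 2 * K.Λ ^ 2 * nq w F := by
  have hδ := S.hδ
  have hL := K.hΛ
  have hc := carleson (M := M) (B := 16 * δ⁻¹ ^ 2 * K.Λ ^ 2) S'.hw S'.hr pz
    (a := fun i y => ∑ k ∈ rg M, if S'.lt (k-1) y = i then (if P k y then S.G hh k y ^ 2 else 0) else 0)
    (fun i y => sum_nonneg fun k _ => by positivity) ?_ F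
  · refine le_trans (le_of_eq ?_) (hc.trans (le_of_eq ?_))
    · rw [sum_comm]
      rw [sum_comm (s := rg M)]
      refine sum_congr rfl fun y _ => ?_
      simp_rw [sum_mul, mul_sum]
      rw [sum_comm]
      refine sum_congr rfl fun k _ => ?_
      simp_rw [ite_mul, zero_mul, mul_ite, mul_zero]
      rw [Finset.sum_ite_eq, if_pos (Finset.mem_range.2 (S'.lt_M _ _))]
    · unfold nq; ring
  · intro j x _
    refine le_trans ?_ (S.G_loc hh hΛ (fun y => S'.lab j y = S'.lab j x))
    rw [sum_comm]
    rw [sum_comm (s := rg M)]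
    rw [sum_filter]
    refine sum_le_sum fun y _ => ?_
    split_ifs with hy
    · simp_rw [mul_sum]
      rw [sum_comm]
      refine sum_le_sum fun k _ => ?_
      simp_rw [mul_ite, mul_zero]
      rw [Finset.sum_ite_eq]
      have hw := S.hw y
      by_cases h1 : S'.lt (k-1) y ∈ Finset.Ico j M
      · rw [if_pos h1]
        have h2 := (Finset.mem_Ico.1 h1).1
        have h3 := S'.lt_le (k-1) y
        by_cases hp : P k y
        · rw [if_pos hp, if_pos]
          intro z hz
          rw [h.cellin' hp (h2.trans h3) hz, hy]
        · rw [if_neg hp]; positivity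
      · rw [if_neg h1]; positivity
    · exact sum_nonneg fun k _ => by have := S.hw y; positivity
lemma para (h : GP K S S' P P') (f g hh : X → ℂ) (hΛ : ∀ x, ‖hh x‖ ≤ K.Λ) :
    ‖∑ k ∈ rg M, ∑ y, (w y : ℂ) * ((if P k y then S'.H g P' (k-1) y else 0) * (S.De f k y * hh y))‖
      ≤ 19 * δ⁻¹ ^ 4 * nq w f + 200000 * δ⁻¹ ^ 10 * K.Λ ^ 2 * nq w g := by
  have hδ := S.hδ
  have h3 := (one_le_inv₀ hδ).2 S.hδ1
  have hL := K.hΛ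
  have hng := S.nsq_nonneg g
  calc _ ≤ ∑ k ∈ rg M, ∑ y, w y * (‖(if P k y then S'.H g P' (k-1) y else 0)‖ *
        ((‖S.u f k y‖ + ‖S.e f k y‖) * S.G hh k y)) := by
        refine (norm_sum_le _ _).trans (sum_le_sum fun k _ => S.dual f hh k ?_)
        intro x y hxy
        simp only [h.Pc k x y hxy]
        split_ifs with hp
        · exact h.H_congr g (h.cellin' hp le_rfl hxy)
        · rfl
    _ ≤ ∑ k ∈ rg M, ∑ y, (w y * S.ue f k y + δ⁻¹ ^ 2 * (w y * ((if P k y then S.G hh k y ^ 2 else 0) *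
      ‖av w (S'.lab (S'.lt (k-1) y)) (S'.fg g P') y‖ ^ 2)) + δ⁻¹ ^ 2 * (w y * ((if P k y then S.G hh k y ^ 2 else 0) *
      ‖av w (S'.lab (S'.lt (k-1) y)) g y‖ ^ 2))) := by
        refine sum_le_sum fun k _ => sum_le_sum fun y _ => ?_
        have hw := S.hw y
        split_ifs with hp
        · have h1 := S'.H_le g h.Pc' (k-1) y
          set p := ‖S'.H g P' (k-1) y‖
          set q := S.G hh k y
          set a := ‖av w (S'.lab (S'.lt (k-1) y)) (S'.fg g P') y‖
          set c := ‖av w (S'.lab (S'.lt (k-1) y)) g y‖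
          have h2 : p * ((‖S.u f k y‖ + ‖S.e f k y‖) * q) ≤ S.ue f k y + 1/2 * (p^2 * q^2) := by
            unfold TM.ue
            nlinarith [sq_nonneg (‖S.u f k y‖ - ‖S.e f k y‖), sq_nonneg (‖S.u f k y‖ + ‖S.e f k y‖ - p * q)]
          have h4 := mul_le_mul_of_nonneg_right h1 (sq_nonneg q)
          calc _ ≤ w y * (S.ue f k y + 1/2 * ((2 * δ⁻¹ ^ 2 * a ^ 2 + 2 * δ⁻¹ ^ 2 * c ^ 2) * q ^ 2)) := by
                refine mll (h2.trans ?_) hw.le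
                linarith
            _ = _ := by ring
        · have := S.ue_nonneg f k y
          simp; positivity
    _ ≤ 19 * δ⁻¹ ^ 4 * nq w f + δ⁻¹ ^ 2 * (64 * δ⁻¹ ^ 2 * K.Λ ^ 2 * (3042 * δ⁻¹ ^ 6 * nq w g))
          + δ⁻¹ ^ 2 * (64 * δ⁻¹ ^ 2 * K.Λ ^ 2 * nq w g) := by
        simp_rw [sum_add_distrib, ← mul_sum]
        have b1 := S.SQ f
        have b2 := (h.para_car hh hΛ (S'.fg g P')).trans
          (mll (S'.fg_nq g h.Pc') pz)
        have b3 := h.para_car hh hΛ g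
        gcongr
    _ ≤ _ := by
        have h6 : δ⁻¹ ^ 4 ≤ δ⁻¹ ^ 10 := pow_le_pow_right₀ h3 nz
        have : 0 ≤ K.Λ ^ 2 * nq w g := pz
        have h7 := mul_le_mul_of_nonneg_right h6 this
        have h8 : 0 ≤ δ⁻¹ ^ 10 * (K.Λ ^ 2 * nq w g) := pz
        have e1 : δ⁻¹ ^ 2 * (64 * δ⁻¹ ^ 2 * K.Λ ^ 2 * (3042 * δ⁻¹ ^ 6 * nq w g))
          = 64 * 3042 * (δ⁻¹ ^ 10 * (K.Λ ^ 2 * nq w g)) := by ring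
        have e2 : δ⁻¹ ^ 2 * (64 * δ⁻¹ ^ 2 * K.Λ ^ 2 * nq w g)
          = 64 * (δ⁻¹ ^ 4 * (K.Λ ^ 2 * nq w g)) := by ring
        rw [e1, e2]
        linarith
lemma deep (h : GP K S S' P P') (f g : X → ℂ) (he : ∀ j x, S'.e g j x ≠ 0 → K.ℓ (j+1) ≤ K.A * K.Ψ x) :
    ‖∑ k ∈ rg M, Bw w K.k (fun y => if P k y then S.De f k y else 0)
      (fun x => b x * S'.ga g 0 x + ∑ j ∈ rg (k-1), if P' j x then S'.De g j x else 0)‖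
      ≤ (19 * δ⁻¹ ^ 4 + 200000 * δ⁻¹ ^ 10 * K.Λ ^ 2 +
         2 * K.C * (2 * K.A / K.ρ) ^ nα K * K.Ct * (19 * δ⁻¹ ^ 4)) * (nq w f + nq w g) := by
  have hδ := S.hδ
  have hρ := K.hρ; have hA := K.hA; have hC := K.hC; have hCt := K.hCt; have hL := K.hΛ
  set hh : X → ℂ := fun y => ∑ x, (w x : ℂ) * (K.k x y * b x) with hhh
  have hΛ : ∀ y, ‖hh y‖ ≤ K.Λ := by
    intro y
    have := K.Tb y
    rw [show hh y = - ∑ x, (w x : ℂ) * (K.k y x * b x) from ?_, norm_neg]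
    · exact this
    · simp only [hhh, ← sum_neg_distrib]
      exact sum_congr rfl fun x _ => by rw [K.anti x y]; ring
  have split : ∀ k, Bw w K.k (fun y => if P k y then S.De f k y else 0)
      (fun x => b x * S'.ga g 0 x + ∑ j ∈ rg (k-1), if P' j x then S'.De g j x else 0)
      = ∑ y, (w y : ℂ) * ((if P k y then S'.H g P' (k-1) y else 0) * (S.De f k y * hh y))
       + ∑ j ∈ rg (k-1), ∑ x, ∑ y, (w x : ℂ) * w y * (K.k x y * (if P k y then S.De f k y else 0) *
      ((if P' j x then S'.De g j x else 0) - (if P' j y then S'.u g j y else 0) * b x)) := by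
    intro k
    have e1 : ∑ y, (w y : ℂ) * ((if P k y then S'.H g P' (k-1) y else 0) * (S.De f k y * hh y))
      = ∑ x, ∑ y, (w x : ℂ) * w y * (K.k x y * (if P k y then S.De f k y else 0) * (S'.H g P' (k-1) y * b x)) := by
      rw [sum_comm]
      refine sum_congr rfl fun y _ => ?_
      simp only [hhh, mul_sum]
      refine sum_congr rfl fun x _ => ?_
      split_ifs <;> ring
    rw [e1, sum_comm (s := rg (k-1)), ← sum_add_distrib]
    unfold Bw
    refine sum_congr rfl fun x _ => ?_
    rw [sum_comm, ← sum_add_distrib]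
    refine sum_congr rfl fun y _ => ?_
    rw [← mul_sum, ← mul_sum, ← mul_add, ← mul_add, sum_sub_distrib, ← sum_mul]
    congr 2
    unfold TM.H
    beta_reduce
    rw [S'.ga_congr g (h.top' x y)]
    ring
  simp_rw [split]
  rw [sum_add_distrib]
  have p1 := h.para f g hh hΛ
  set CR := 2 * K.C * (2 * K.A / K.ρ) ^ nα K * K.Ct with hCR
  have hCR0 : 0 < CR := pz
  have p2 : ‖∑ k ∈ rg M, ∑ j ∈ rg (k-1), ∑ x, ∑ y, (w x : ℂ) * w y * (K.k x y * (if P k y then S.De f k y else 0) *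
      ((if P' j x then S'.De g j x else 0) - (if P' j y then S'.u g j y else 0) * b x))‖
      ≤ CR * (19 * δ⁻¹ ^ 4 * nq w f + 19 * δ⁻¹ ^ 4 * nq w g) := by
    calc _ ≤ ∑ k ∈ rg M, ∑ j ∈ rg (k-1), CR * ((1/2) ^ (k-j-1) *
      (∑ y, w y * S.ue f k y + ∑ x, w x * S'.ue g j x)) := by
          refine (norm_sum_le _ _).trans (sum_le_sum fun k _ => (norm_sum_le _ _).trans
            (sum_le_sum fun j hj => h.deepR f g he ?_))
          have := Finset.mem_range.1 hj; omega
      _ = CR * ∑ k ∈ rg M, ∑ j ∈ rg (k-1), ((1/2) ^ (k-j-1) *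
      (∑ y, w y * S.ue f k y + ∑ x, w x * S'.ue g j x)) := by simp_rw [mul_sum]
      _ ≤ _ := by
          refine mll ?_ hCR0.le
          refine (geo_half M (fun k => ∑ y, w y * S.ue f k y) (fun j => ∑ x, w x * S'.ue g j x) ?_ ?_).trans
            (add_le_add (S.SQ f) (S'.SQ g))
          · exact fun k => sum_nonneg fun x _ => mul_nonneg (S.hw x).le (S.ue_nonneg f k x)
          · exact fun k => sum_nonneg fun x _ => mul_nonneg (S.hw x).le (S'.ue_nonneg g k x)
  refine (norm_add_le _ _).trans ((add_le_add p1 p2).trans ?_)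
  have n1 := S.nsq_nonneg f
  have n2 := S.nsq_nonneg g
  have : 0 ≤ 19 * δ⁻¹ ^ 4 * nq w g := pz
  have : 0 ≤ 200000 * δ⁻¹ ^ 10 * K.Λ ^ 2 * nq w f := pz
  nlinarith
end GP
end
section
variable {X I : Type} [Fintype X] {w : X → ℝ} {b : X → ℂ} {M : ℕ} {δ : ℝ}
namespace KD
def msk (k : X → X → ℂ) (r : X → X → Prop) (x y : X) : ℂ := if r x y then k x y else 0
lemma grp {J : Type} (c : X → J) {r : X → X → Prop} (hr : ∀ x y y', c y = c y' → r x y → r x y') {κ : ℕ}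
    (hκ : ∀ x, ((Finset.univ.image c).filter (fun l => ∃ y, c y = l ∧ r x y)).card ≤ κ)
    (hw : ∀ x, 0 < w x) {N lam : ℝ} (hN0 : 0 ≤ N) (hl : 0 < lam) {k : X → X → ℂ}
    (hN : ∀ φ ψ, ‖Bw w k φ ψ‖ ≤ N * (lam⁻¹ * nq w φ + lam * nq w ψ)) (φ ψ : X → ℂ) :
    ‖Bw w (msk k r) φ ψ‖ ≤ N * (lam⁻¹ * nq w φ + lam * (κ * nq w ψ)) := by
  have e : Bw w (msk k r) φ ψ = ∑ l ∈ Finset.univ.image c, Bw w k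
      (fun y => if c y = l then φ y else 0) (fun x => if ∃ y, c y = l ∧ r x y then ψ x else 0) := by
    unfold Bw
    rw [sum_comm (s := Finset.univ.image c)]
    refine sum_congr rfl fun x _ => ?_
    rw [sum_comm]
    refine sum_congr rfl fun y _ => ?_
    rw [sum_eq_single (c y)]
    · have : (∃ y', c y' = c y ∧ r x y') ↔ r x y :=
        ⟨fun ⟨y', h1, h2⟩ => hr x y' y h1 h2, fun h => ⟨y, rfl, h⟩⟩
      simp only [this, msk]
      split_ifs <;> simp
    · intro l _ hl
      simp [Ne.symm hl]
    · intro h; simp at h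
  rw [e]
  refine (norm_sum_le _ _).trans ((sum_le_sum fun l _ => hN _ _).trans ?_)
  rw [← mul_sum, sum_add_distrib, ← mul_sum, ← mul_sum]
  have h1 : ∑ l ∈ Finset.univ.image c, nq w (fun y => if c y = l then φ y else 0) = nq w φ := by
    unfold nq
    rw [sum_comm]
    refine sum_congr rfl fun y _ => ?_
    rw [sum_eq_single (c y)]
    · simp
    · intro l _ hl
      simp [Ne.symm hl]
    · intro h; simp at h
  have h2 : ∑ l ∈ Finset.univ.image c, nq w (fun x => if ∃ y, c y = l ∧ r x y then ψ x else 0) ≤ κ * nq w ψ := by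
    unfold nq
    rw [sum_comm, mul_sum]
    refine sum_le_sum fun x _ => ?_
    have : ∀ l, w x * ‖(if ∃ y, c y = l ∧ r x y then ψ x else 0)‖ ^ 2
        = if ∃ y, c y = l ∧ r x y then w x * ‖ψ x‖ ^ 2 else 0 := by
      intro l; split_ifs <;> simp
    simp_rw [this]
    rw [← sum_filter, sum_const, nsmul_eq_mul]
    have h3 : ((((Finset.univ.image c).filter (fun l => ∃ y, c y = l ∧ r x y)).card : ℕ) : ℝ) ≤ κ := by
      exact_mod_cast hκ x
    have := hw x
    gcongr
  rw [h1]
  gcongr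
lemma nearS (K : KD w b) (hw : ∀ x, 0 < w x) {i : ℕ} {a : ℝ} (ha : 0 < a) {r : X → X → Prop} {φ ψ : X → ℂ}
    (h : ∀ x y, r x y → φ y ≠ 0 → ψ x ≠ 0 → a * K.ℓ i ≤ K.s x y ∧ K.ds x y ≤ 5 * K.ℓ i)
    (h1 : ∀ y, φ y ≠ 0 → K.Ψ y ≤ 2 * K.ℓ i) (h2 : ∀ y, ψ y ≠ 0 → K.Ψ y ≤ 2 * K.ℓ i) :
    ‖Bw w (msk K.k r) φ ψ‖ ≤ K.C * (a⁻¹) ^ K.n * 6 ^ nα K * K.Ct * (nq w φ + nq w ψ) := by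
  have hn := K.hn; have hα := K.hα; have hC := K.hC; have hCt := K.hCt
  have hl := K.ℓ_pos i
  set c := K.C * (a⁻¹) ^ K.n * 6 ^ nα K with hc
  have hc0 : 0 < c := pz
  have sch := K.schur hw (i := i) (p := fun y => ‖φ y‖ ^ 2) (q := fun y => ‖ψ y‖ ^ 2) (fun y => by positivity)
    (fun y => by positivity) (fun y hy => h1 y (by intro h0; simp [h0] at hy))
    (fun y hy => h2 y (by intro h0; simp [h0] at hy))
  calc _ ≤ ∑ x, ∑ y, c * (w x * w y * (K.t i x y * (‖φ y‖ ^ 2 + ‖ψ y‖ ^ 2 * 0 + ‖ψ x‖ ^ 2))) := by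
        unfold Bw
        refine (norm_sum_le _ _).trans (sum_le_sum fun x _ => (norm_sum_le _ _).trans
          (sum_le_sum fun y _ => ?_))
        have hwx := hw x; have hwy := hw y; have ht := K.t_nonneg i x y
        rw [norm_mul, norm_mul, norm_mul, norm_mul, norm_real, norm_real,
          norm_of_nonneg hwx.le, norm_of_nonneg hwy.le]
        by_cases h3 : r x y; swap
        · simp only [msk, h3, if_false, norm_zero]; simp; positivity
        by_cases h4 : φ y = 0
        · simp only [h4, norm_zero]; simp; positivity
        by_cases h5 : ψ x = 0
        · simp only [h5, norm_zero]; simp; positivity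
        obtain ⟨h6, h7⟩ := h x y h3 h4 h5
        have hd := K.ds_nonneg x y
        have hk : ‖K.k x y‖ ≤ c * K.t i x y := by
          have e : c * K.t i x y = K.C * (a⁻¹) ^ K.n * (6 ^ nα K * (K.ℓ i ^ K.α / (K.ℓ i + K.ds x y) ^ nα K)) := by
            rw [hc]; unfold t; ring
          have e2 : (K.ℓ i ^ K.n)⁻¹ ≤ 6 ^ nα K * (K.ℓ i ^ K.α / (K.ℓ i + K.ds x y) ^ nα K) := by
            have : (K.ℓ i + K.ds x y) ^ nα K ≤ (6 * K.ℓ i) ^ nα K :=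
              Real.rpow_le_rpow pz lz pz
            calc (K.ℓ i ^ K.n)⁻¹ = 6 ^ nα K * (K.ℓ i ^ K.α / (6 * K.ℓ i) ^ nα K) := by
                  rw [mul_rpow nz hl.le, Real.rpow_add hl]
                  have : K.ℓ i ^ K.n ≠ 0 := pz
                  have : K.ℓ i ^ K.α ≠ 0 := pz
                  have : (6:ℝ) ^ nα K ≠ 0 := pz
                  field_simp
              _ ≤ _ := by gcongr
          rw [e]
          refine (K.K1 x y).trans ?_
          have h8 : (a * K.ℓ i) ^ K.n ≤ (K.ds x y + K.Ψ x + K.Ψ y) ^ K.n :=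
            Real.rpow_le_rpow pz h6 hn.le
          calc _ ≤ K.C / (a * K.ℓ i) ^ K.n := by gcongr
            _ = K.C * (a⁻¹) ^ K.n * (K.ℓ i ^ K.n)⁻¹ := by
                rw [mul_rpow ha.le hl.le, Real.inv_rpow ha.le]; field_simp
            _ ≤ _ := by gcongr
        simp only [msk, h3, if_true]
        have h9 : ‖φ y‖ * ‖ψ x‖ ≤ ‖φ y‖ ^ 2 + ‖ψ y‖ ^ 2 * 0 + ‖ψ x‖ ^ 2 := by
          nlinarith [ sq_nonneg ‖φ y‖, sq_nonneg ‖ψ x‖]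
        calc _ = w x * w y * (‖K.k x y‖ * (‖φ y‖ * ‖ψ x‖)) := by ring
          _ ≤ w x * w y * ((c * K.t i x y) * (‖φ y‖ ^ 2 + ‖ψ y‖ ^ 2 * 0 + ‖ψ x‖ ^ 2)) := by gcongr
          _ = _ := by ring
    _ ≤ _ := by
        simp_rw [← mul_sum, mul_zero, add_zero]
        rw [mul_assoc c]
        exact mll sch hc0.le
end KD
lemma nq_mono (hw : ∀ x, 0 < w x) {φ : X → ℂ} {p : X → ℝ} (h : ∀ x, ‖φ x‖ ^ 2 ≤ p x) :
    nq w φ ≤ ∑ x, w x * p x :=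
  sum_le_sum fun x _ => mll (h x) (hw x).le
namespace GP
variable {K : KD w b} {S S' : TM w b M δ I} {P P' : ℕ → X → Prop}
def strip (K : KD w b) (S : TM w b M δ I) (τ : ℝ) (i : ℕ) (y : X) : Prop :=
  ∃ x, K.ds x y < τ * K.ℓ i ∧ S.lab i x ≠ S.lab i y
def near (K : KD w b) (S : TM w b M δ I) (k : ℕ) (x y : X) : Prop :=
  ∃ y', S.lab k y' = S.lab k y ∧ K.ds x y' < 4 * K.ℓ k
lemma comp_far (h : GP K S S' P P') (f : X → ℂ) (ψ : X → ℂ) {k i : ℕ} (hik : i ≤ k) (hki : k ≤ i + 1)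
    (h2 : ∀ y, ψ y ≠ 0 → K.Ψ y ≤ 2 * K.ℓ i) :
    ‖Bw w (KD.msk K.k (fun x y => ¬ near K S k x y)) (fun y => if P k y then S.De f k y else 0) ψ‖
      ≤ K.C * (2 / K.ρ) ^ nα K * K.Ct * (∑ y, w y * (2 * S.ue f k y) + nq w ψ) := by
  have hn := K.hn; have hα := K.hα; have hC := K.hC; have hCt := K.hCt
  have hρ := K.hρ; have hρ1 := K.hρ1
  have hl := K.ℓ_pos i
  have hlk := K.ℓ_pos k
  have hle := K.ℓ_anti hik
  have hle2 : K.ρ * K.ℓ i ≤ K.ℓ k := by rw [← K.ℓ_succ]; exact K.ℓ_anti hki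
  set c := K.C * (2 / K.ρ) ^ nα K with hc
  have hc0 : 0 < c := pz
  have sch := K.schur S.hw (i := i) (p := fun y => 2 * S.ue f k y) (q := fun y => ‖ψ y‖ ^ 2)
    (fun y => by have := S.ue_nonneg f k y; positivity)
    (fun y => by positivity)
    (fun y hy => by
      by_contra ht
      have ht : ¬ S.tr k y := fun h2 => ht ((h.trΨ k y h2).trans lz)
      simp [TM.ue, S.u_zero f ht, S.e_zero f ht] at hy)
    (fun y hy => h2 y (by intro h0; simp [h0] at hy))
  have e1 : Bw w (KD.msk K.k (fun x y => ¬ near K S k x y)) (fun y => if P k y then S.De f k y else 0) ψ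
      = ∑ x, (w x : ℂ) * (ψ x * ∑ y, (w y : ℂ) * (K.k x y *
        ((if P k y ∧ ¬ near K S k x y then 1 else 0) * S.De f k y))) := by
    unfold Bw
    refine sum_congr rfl fun x _ => ?_
    rw [mul_sum, mul_sum]
    refine sum_congr rfl fun y _ => ?_
    simp only [KD.msk]
    by_cases h1 : P k y <;> by_cases h2 : near K S k x y <;> simp [h1, h2]; ring
  rw [e1]
  have inner : ∀ x, ‖∑ y, (w y : ℂ) * (K.k x y * ((if P k y ∧ ¬ near K S k x y then 1 else 0) * S.De f k y))‖
      ≤ ∑ y, w y * (c * K.t i x y * (‖(if P k y ∧ ¬ near K S k x y then (1:ℂ) else 0)‖ * ‖S.De f k y‖)) := by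
    intro x
    refine S.mz f k (fun y z hyz => ?_) (fun y hay _ y' hy' => ?_)
    · have : near K S k x y ↔ near K S k x z := by simp only [near, hyz]
      simp only [this, h.Pc k y z hyz]
    · have hna : ¬ near K S k x y := by
        intro h3; simp [h3] at hay
      have hd : 4 * K.ℓ k ≤ K.ds x y := by
        by_contra h3; exact hna ⟨y, rfl, not_le.1 h3⟩
      have hs : K.ds x y ≤ K.s x y := by unfold KD.s; linarith [K.Ψpos x, K.Ψpos y]
      refine (K.smooth (i := i) (a := K.ρ / 2) pz hlk
        (h.diam k y y' hy'.symm) (hd.trans hs) ?_).trans ?_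
      · nlinarith [K.ds_nonneg x y]
      · have ht := K.t_nonneg i x y
        refine mul_le_mul_of_nonneg_right ?_ ht
        rw [hc, inv_div]
        have := Real.rpow_le_one pz ((div_le_one hl).2 hle) hα.le
        calc _ ≤ K.C * (1 * (2 / K.ρ) ^ nα K) := by gcongr
          _ = _ := by ring
  calc _ ≤ ∑ x, ∑ y, c * (w x * w y * (K.t i x y * (2 * S.ue f k y + ‖ψ x‖ ^ 2))) := by
        refine (norm_sum_le _ _).trans (sum_le_sum fun x _ => ?_)
        have hwx := S.hw x
        rw [norm_mul, norm_mul, norm_real, norm_of_nonneg hwx.le]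
        refine (mll (mll (inner x) (norm_nonneg _)) hwx.le).trans ?_
        rw [mul_sum, mul_sum]
        refine sum_le_sum fun y _ => ?_
        have hwy := S.hw y; have ht := K.t_nonneg i x y
        have h3 := S.ue_e f k y
        have h4 : ‖(if P k y ∧ ¬ near K S k x y then (1:ℂ) else 0)‖ ≤ 1 := by split_ifs <;> simp
        have h5 : ‖ψ x‖ * (‖(if P k y ∧ ¬ near K S k x y then (1:ℂ) else 0)‖ * ‖S.De f k y‖) ≤ 2 * S.ue f k y + ‖ψ x‖ ^ 2 := by
          calc _ ≤ ‖ψ x‖ * (1 * ‖S.De f k y‖) := by gcongr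
            _ ≤ _ := by nlinarith [ sq_nonneg ‖ψ x‖, sq_nonneg ‖S.De f k y‖]
        calc _ = c * (w x * w y * (K.t i x y * (‖ψ x‖ * (‖(if P k y ∧ ¬ near K S k x y then (1:ℂ) else 0)‖ * ‖S.De f k y‖)))) := by ring
          _ ≤ _ := by gcongr
    _ ≤ _ := by
        simp_rw [← mul_sum]
        rw [mul_assoc c]
        exact mll sch hc0.le
end GP
end
section
variable {X I : Type} [Fintype X] {w : X → ℝ} {b : X → ℂ} {M : ℕ} {δ : ℝ}
namespace GP
variable {K : KD w b} {S S' : TM w b M δ I} {P P' : ℕ → X → Prop}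
def C4 (K : KD w b) (τ : ℝ) : ℝ := 2 * (K.C * (2 / K.ρ) ^ nα K * K.Ct) +
  6 * (K.C * ((τ * K.ρ ^ 2 / K.A)⁻¹) ^ K.n * 6 ^ nα K * K.Ct)
lemma comp_ar {A B D E F G H J : ℂ} {c1 c2 a a' N κ lam σ1 σ2 : ℝ} (p1 : 0 ≤ c2 * a) (p2 : 0 ≤ c2 * a')
    (hA : ‖A‖ ≤ c1 * (2 * a + 2 * a')) (hB : ‖B‖ ≤ c2 * (a + 2 * a')) (hD : ‖D‖ ≤ c2 * (a + a')) (hE : ‖E‖ ≤ c2 * (a + a'))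
    (hF : ‖F‖ ≤ N * (κ * (lam⁻¹ * σ2 + lam * a'))) (hG : ‖G‖ ≤ N * (κ * (lam * a + lam⁻¹ * σ1)))
    (hH : ‖H‖ ≤ N * (κ * (lam⁻¹ * σ2 + lam * a'))) (hJ : ‖J‖ ≤ N * (κ * (lam * a + lam⁻¹ * σ1))) :
    ‖A + B + D + E + F + G + 0 - H - J‖ ≤ (2 * c1 + 6 * c2 + 2 * N * κ * lam) * (a + a') + 2 * N * κ * lam⁻¹ * (σ2 + σ1) := by
  have : ‖A + B + D + E + F + G + 0 - H - J‖ ≤ ‖A‖ + ‖B‖ + ‖D‖ + ‖E‖ + ‖F‖ + ‖G‖ + ‖H‖ + ‖J‖ := by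
    rw [add_zero]
    refine (norm_sub_le _ _).trans (add_le_add_left ((norm_sub_le _ _).trans (add_le_add_left ((norm_add_le _ _).trans
      (add_le_add_left ((norm_add_le _ _).trans (add_le_add_left norm_add₄_le _)) _)) _)) _)
  nlinarith
set_option maxHeartbeats 1600000 in
lemma comp_one (h : GP K S S' P P') (f g : X → ℂ) (he : ∀ j x, S.e f j x ≠ 0 → K.ℓ (j+1) ≤ K.A * K.Ψ x)
    (he' : ∀ j x, S'.e g j x ≠ 0 → K.ℓ (j+1) ≤ K.A * K.Ψ x) {k j : ℕ} (hkj : k ≤ j + 1) (hjk : j ≤ k + 1)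
    {τ : ℝ} (hτ : 0 < τ) (hτ1 : τ ≤ 1) {κ : ℕ} (hκ1 : 1 ≤ κ)
    (hκ : ∀ x, ((Finset.univ.image (S.lab k)).filter (fun l => ∃ y, S.lab k y = l ∧ near K S k x y)).card ≤ κ)
    {N lam : ℝ} (hN0 : 0 ≤ N) (hl : 0 < lam)
    (hN : ∀ φ ψ, ∀ lam > 0, ‖Bw w K.k φ ψ‖ ≤ N * (lam⁻¹ * nq w φ + lam * nq w ψ)) :
    ‖Bw w K.k (fun y => if P k y then S.De f k y else 0) (fun x => if P' j x then S'.De g j x else 0)‖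
      ≤ (C4 K τ + 2 * N * κ * lam) * (∑ y, w y * S.ue f k y + ∑ y, w y * S'.ue g j y)
        + 2 * N * κ * lam⁻¹ * (∑ y, w y * (if strip K S' τ (j+1) y then S.ue f k y else 0) +
          ∑ x, w x * (if strip K S τ (k+1) x then S'.ue g j x else 0)) := by
  have hn := K.hn; have hα := K.hα; have hC := K.hC; have hCt := K.hCt
  have hρ := K.hρ; have hρ1 := K.hρ1; have hA := K.hA
  have hw := S.hw
  obtain ⟨i, hik, hij, hki, hji⟩ : ∃ i, i ≤ k ∧ i ≤ j ∧ k ≤ i + 1 ∧ j ≤ i + 1 := ⟨min k j, by omega⟩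
  have hli := K.ℓ_pos i
  have l2 : ∀ m, m ≤ i + 1 → K.ρ ^ 2 * K.ℓ i ≤ K.ℓ (m+1) := fun m hm => by
    rw [← K.ℓ_add]; exact K.ℓ_anti oz
  set s2 := strip K S' τ (j+1)
  set s1 := strip K S τ (k+1)
  set nr := near K S k with hnr
  set J : X → X → Prop := fun x y => S.lab (k+1) x = S.lab (k+1) y ∧ S'.lab (j+1) x = S'.lab (j+1) y with hJ
  have hJn : ∀ x y, J x y → nr x y := fun x y hxy => by
    refine ⟨x, S.hr _ _ _ hxy.1, ?_⟩
    have := h.diam k x x rfl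
    have := K.ℓ_pos k
    linarith
  have near5 : ∀ x y, nr x y → K.ds x y ≤ 5 * K.ℓ i := by
    rintro x y ⟨y', h1, h2⟩
    have := h.diam k y' y h1
    have := K.ds_tri x y' y
    have := K.ℓ_anti hik
    linarith
  set v : X → ℂ := fun y => if P k y then S.u f k y else 0 with hv
  set v' : X → ℂ := fun y => if P' j y then S'.u g j y else 0 with hv'
  set ε : X → ℂ := fun y => if P k y then S.e f k y else 0 with hε
  set ε' : X → ℂ := fun y => if P' j y then S'.e g j y else 0 with hε'
  set φ : X → ℂ := fun y => if P k y then S.De f k y else 0 with hφ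
  set ψ : X → ℂ := fun y => if P' j y then S'.De g j y else 0 with hψ
  set bv : X → ℂ := fun y => b y * v y with hbv
  set bv' : X → ℂ := fun y => b y * v' y with hbv'
  have eφ : ∀ y, φ y = bv y + ε y := fun y => by
    simp only [hφ, hbv, hv, hε]; split_ifs <;> simp [TM.De]
  have eψ : ∀ y, ψ y = bv' y + ε' y := fun y => by
    simp only [hψ, hbv', hv', hε']; split_ifs <;> simp [TM.De]
  set q2 : X → ℂ := fun y => if s2 y then bv y else 0 with hq2
  set q2' : X → ℂ := fun y => if s2 y then 0 else bv y with hq2'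
  set q1 : X → ℂ := fun y => if s1 y then bv' y else 0 with hq1
  set q1' : X → ℂ := fun y => if s1 y then 0 else bv' y with hq1'
  have tφ : ∀ y, S.ue f k y ≠ 0 → K.Ψ y ≤ 2 * K.ℓ i := fun y hy => by
    by_contra ht
    have ht : ¬ S.tr k y := fun h2 => ht ((h.trΨ k y h2).trans (by linarith [K.ℓ_anti hik]))
    simp [TM.ue, S.u_zero f ht, S.e_zero f ht] at hy
  have tψ : ∀ y, S'.ue g j y ≠ 0 → K.Ψ y ≤ 2 * K.ℓ i := fun y hy => by
    by_contra ht
    have ht : ¬ S'.tr j y := fun h2 => ht ((h.trΨ' j y h2).trans (by linarith [K.ℓ_anti hij]))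
    simp [TM.ue, S'.u_zero g ht, S'.e_zero g ht] at hy
  have uv : ∀ (T : TM w b M δ I) (g : X → ℂ) (Q : ℕ → X → Prop) j y,
      ‖b y * (if Q j y then T.u g j y else 0)‖ ^ 2 ≤ T.ue g j y := by
    intro T g Q j y
    have h1 : ‖b y * (if Q j y then T.u g j y else 0)‖ ≤ ‖T.u g j y‖ := by
      rw [norm_mul]
      have := T.hb y
      split_ifs
      · nlinarith [norm_nonneg (T.u g j y)]
      · simp
    have : ‖b y * (if Q j y then T.u g j y else 0)‖ ^ 2 ≤ ‖T.u g j y‖ ^ 2 := by gcongr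
    unfold TM.ue; nlinarith [sq_nonneg ‖T.e g j y‖]
  have ev : ∀ (T : TM w b M δ I) (g : X → ℂ) (Q : ℕ → X → Prop) j y,
      ‖(if Q j y then T.e g j y else 0)‖ ^ 2 ≤ T.ue g j y := by
    intro T g Q j y
    have := T.ue_nonneg g j y
    split_ifs
    · unfold TM.ue; nlinarith [sq_nonneg ‖T.u g j y‖]
    · simpa using this
  have hnz : ∀ {z : ℂ} {p : ℝ}, ‖z‖ ^ 2 ≤ p → z ≠ 0 → p ≠ 0 := fun h1 h2 h3 => by
    rw [h3] at h1; exact h2 (by simpa using le_antisymm h1 (sq_nonneg _))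
  have bφ : ∀ y, ‖φ y‖ ^ 2 ≤ 2 * S.ue f k y := fun y => by
    have := S.ue_e f k y; have := S.ue_nonneg f k y
    simp only [hφ]; split_ifs
    · assumption
    · simp; linarith
  have bψ : ∀ y, ‖ψ y‖ ^ 2 ≤ 2 * S'.ue g j y := fun y => by
    have := S'.ue_e g j y; have := S'.ue_nonneg g j y
    simp only [hψ]; split_ifs
    · assumption
    · simp; linarith
  have bbv : ∀ y, ‖bv y‖ ^ 2 ≤ S.ue f k y := fun y => uv S f P k y
  have bbv' : ∀ y, ‖bv' y‖ ^ 2 ≤ S'.ue g j y := fun y => uv S' g P' j y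
  have bε : ∀ y, ‖ε y‖ ^ 2 ≤ S.ue f k y := fun y => ev S f P k y
  have bε' : ∀ y, ‖ε' y‖ ^ 2 ≤ S'.ue g j y := fun y => ev S' g P' j y
  have bq2 : ∀ y, ‖q2 y‖ ^ 2 ≤ if s2 y then S.ue f k y else 0 := fun y => by
    simp only [hq2]; split_ifs
    · exact bbv y
    · simp
  have bq1 : ∀ y, ‖q1 y‖ ^ 2 ≤ if s1 y then S'.ue g j y else 0 := fun y => by
    simp only [hq1]; split_ifs
    · exact bbv' y
    · simp
  have bq2' : ∀ y, ‖q2' y‖ ^ 2 ≤ S.ue f k y := fun y => by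
    have := S.ue_nonneg f k y
    simp only [hq2']; split_ifs
    · simpa
    · exact bbv y
  have bq1' : ∀ y, ‖q1' y‖ ^ 2 ≤ S'.ue g j y := fun y => by
    have := S'.ue_nonneg g j y
    simp only [hq1']; split_ifs
    · simpa
    · exact bbv' y
  have nz2 : ∀ {z : ℂ} {p : ℝ}, ‖z‖ ^ 2 ≤ 2 * p → z ≠ 0 → p ≠ 0 := fun h1 h2 h3 => by
    apply hnz h1 h2; rw [h3, mul_zero]
  have split : Bw w K.k φ ψ = Bw w (KD.msk K.k (fun x y => ¬ nr x y)) φ ψ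
      + Bw w (KD.msk K.k nr) ε ψ + Bw w (KD.msk K.k nr) bv ε'
      + Bw w (KD.msk K.k (fun x y => nr x y ∧ ¬ J x y)) q2' q1'
      + Bw w (KD.msk K.k nr) q2 bv' + Bw w (KD.msk K.k nr) q2' q1
      + Bw w (KD.msk K.k J) bv bv' - Bw w (KD.msk K.k J) q2 bv'
      - Bw w (KD.msk K.k J) q2' q1 := by
    simp only [Bw, ← sum_add_distrib, ← sum_sub_distrib]
    refine sum_congr rfl fun x _ => sum_congr rfl fun y _ => ?_
    rw [eφ y, eψ x]
    have := hJn x y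
    simp only [KD.msk, hq1, hq1', hq2, hq2']
    by_cases h1 : J x y
    · simp only [h1, this h1, not_true, and_false, if_true, if_false]
      by_cases h2 : s2 y <;> by_cases h3 : s1 x <;> simp only [h2, h3, if_true, if_false] <;> ring
    · by_cases h4 : nr x y
      · simp only [h1, h4, not_true, not_false_iff, and_true, if_true, if_false]
        by_cases h2 : s2 y <;> by_cases h3 : s1 x <;> simp only [h2, h3, if_true, if_false] <;> ring
      · simp only [h1, h4, not_false_iff, and_true, if_true, if_false]; ring
  have anti0 : Bw w (KD.msk K.k J) bv bv' = 0 := by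
    have : Bw w (KD.msk K.k J) bv bv' = - Bw w (KD.msk K.k J) bv bv' := by
      conv_lhs => unfold Bw; rw [sum_comm]
      unfold Bw
      simp only [← sum_neg_distrib]
      refine sum_congr rfl fun x _ => sum_congr rfl fun y _ => ?_
      by_cases h1 : J x y
      · have h2 : J y x := ⟨h1.1.symm, h1.2.symm⟩
        have c1 : v x = v y := by
          simp only [hv, h.Pc k x y (S.hr _ _ _ h1.1), S.u_congr f h1.1]
        have c2 : v' x = v' y := by
          simp only [hv', h.Pc' j x y (S'.hr _ _ _ h1.2), S'.u_congr g h1.2]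
        simp only [KD.msk, h1, h2, if_true, hbv, hbv', c1, c2]
        rw [K.anti y x]; ring
      · have h2 : ¬ J y x := fun h3 => h1 ⟨h3.1.symm, h3.2.symm⟩
        simp [KD.msk, h1, h2]
    exact self_eq_neg.1 this
  rw [split, anti0]
  set a := ∑ y, w y * S.ue f k y with ha
  set a' := ∑ y, w y * S'.ue g j y with ha'
  have ha0 : 0 ≤ a := sum_nonneg fun y _ => mul_nonneg (hw y).le (S.ue_nonneg f k y)
  have ha0' : 0 ≤ a' := sum_nonneg fun y _ => mul_nonneg (hw y).le (S'.ue_nonneg g j y)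
  set σ2 := ∑ y, w y * (if s2 y then S.ue f k y else 0) with hσ2
  set σ1 := ∑ y, w y * (if s1 y then S'.ue g j y else 0) with hσ1
  have dbl : ∀ p : X → ℝ, ∑ y, w y * (2 * p y) = 2 * ∑ y, w y * p y := fun p => by
    rw [mul_sum]; exact sum_congr rfl fun y _ => by ring
  have nψ : nq w ψ ≤ 2 * a' := (nq_mono hw bψ).trans (dbl _).le
  have t1 := h.comp_far f ψ hik hki (fun y hy => tψ y (nz2 (bψ y) hy))
  rw [dbl] at t1
  set α0 := τ * K.ρ ^ 2 / K.A with hα0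
  have hα0p : 0 < α0 := pz
  have hα1 : α0 ≤ K.ρ ^ 2 / K.A := by
    rw [hα0]; gcongr; nlinarith [sq_nonneg K.ρ]
  have hα2 : α0 ≤ τ * K.ρ ^ 2 := div_le_self pz hA
  have low : ∀ x y z, z = x ∨ z = y → K.Ψ z ≤ K.s x y := by
    rintro x y z (rfl | rfl) <;> unfold KD.s
    · linarith [K.ds_nonneg z y, K.Ψpos y]
    · linarith [K.ds_nonneg x z, K.Ψpos x]
  have lowe : ∀ m z, m ≤ i + 1 → K.ℓ (m+1) ≤ K.A * K.Ψ z → α0 * K.ℓ i ≤ K.Ψ z := by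
    intro m z hm h1
    have := l2 m hm
    calc α0 * K.ℓ i ≤ K.ρ ^ 2 / K.A * K.ℓ i := by gcongr
      _ = (K.ρ ^ 2 * K.ℓ i) / K.A := by ring
      _ ≤ K.Ψ z := by rw [div_le_iff₀ lz]; linarith
  have t2 := K.nearS hw (i := i) hα0p (r := nr) (φ := ε) (ψ := ψ)
    (fun x y hr h1 _ => ⟨(lowe k y hki (he k y (by
      intro h0; apply h1; simp [hε, h0]))).trans (low x y y (Or.inr rfl)), near5 x y hr⟩)
    (fun y hy => tφ y (hnz (bε y) hy)) (fun y hy => tψ y (nz2 (bψ y) hy))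
  have t3 := K.nearS hw (i := i) hα0p (r := nr) (φ := bv) (ψ := ε')
    (fun x y hr _ h1 => ⟨(lowe j x hji (he' j x (by
      intro h0; apply h1; simp [hε', h0]))).trans (low x y x (Or.inl rfl)), near5 x y hr⟩)
    (fun y hy => tφ y (hnz (bbv y) hy)) (fun y hy => tψ y (hnz (bε' y) hy))
  have t4 := K.nearS hw (i := i) hα0p (r := fun x y => nr x y ∧ ¬ J x y) (φ := q2') (ψ := q1')
    (fun x y hr h1 h2 => by
      refine ⟨?_, near5 x y hr.1⟩
      have n2 : ¬ s2 y := fun h3 => h1 (by simp [hq2', h3])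
      have n1 : ¬ s1 x := fun h3 => h2 (by simp [hq1', h3])
      have hds : K.ds x y ≤ K.s x y := by unfold KD.s; linarith [K.Ψpos x, K.Ψpos y]
      refine le_trans ?_ hds
      have key : ∀ m, m ≤ i + 1 → τ * K.ℓ (m+1) ≤ K.ds x y → α0 * K.ℓ i ≤ K.ds x y := by
        intro m hm h5
        calc α0 * K.ℓ i ≤ τ * K.ρ ^ 2 * K.ℓ i := by gcongr
          _ = τ * (K.ρ ^ 2 * K.ℓ i) := by ring
          _ ≤ τ * K.ℓ (m+1) := by have := l2 m hm; gcongr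
          _ ≤ _ := h5
      by_cases h6 : S.lab (k+1) x = S.lab (k+1) y
      · have h7 : S'.lab (j+1) x ≠ S'.lab (j+1) y := fun h8 => hr.2 ⟨h6, h8⟩
        refine key j hji ?_
        by_contra h8
        exact n2 ⟨x, not_le.1 h8, h7⟩
      · refine key k hki ?_
        by_contra h8
        exact n1 ⟨y, by rw [K.ds_comm]; exact not_le.1 h8, fun h9 => h6 h9.symm⟩)
    (fun y hy => tφ y (hnz (bq2' y) hy)) (fun y hy => tψ y (hnz (bq1' y) hy))
  have hnrr : ∀ x y y', S.lab k y = S.lab k y' → nr x y → nr x y' := fun x y y' h1 h2 => by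
    simpa only [hnr, near, h1] using h2
  have t5 := KD.grp (S.lab k) hnrr hκ hw hN0 hl (fun φ ψ => hN φ ψ lam hl) q2 bv'
  have t6 := KD.grp (S.lab k) hnrr hκ hw hN0 (inv_pos.2 hl) (fun φ ψ => hN φ ψ lam⁻¹ (inv_pos.2 hl)) q2' q1
  have hJr : ∀ x y y', (S.lab (k+1) y, S'.lab (j+1) y) = (S.lab (k+1) y', S'.lab (j+1) y') → J x y → J x y' := by
    intro x y y' h1 h2
    rw [Prod.mk.injEq] at h1
    exact ⟨h2.1.trans h1.1, h2.2.trans h1.2⟩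
  have hJ1 : ∀ x, ((Finset.univ.image (fun y => (S.lab (k+1) y, S'.lab (j+1) y))).filter
      (fun l => ∃ y, (S.lab (k+1) y, S'.lab (j+1) y) = l ∧ J x y)).card ≤ 1 := by
    intro x
    rw [Finset.card_le_one]
    intro p hp q hq
    obtain ⟨-, y, h1, h2⟩ := mem_filter.1 hp
    obtain ⟨-, z, h3, h4⟩ := mem_filter.1 hq
    rw [← h1, ← h3, ← h2.1, ← h2.2, ← h4.1, ← h4.2]
  have t7 := KD.grp (fun y => (S.lab (k+1) y, S'.lab (j+1) y)) hJr (κ := 1) (fun x => by convert hJ1 x) hw hN0 hl (fun φ ψ => hN φ ψ lam hl) q2 bv'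
  have t8 := KD.grp (fun y => (S.lab (k+1) y, S'.lab (j+1) y)) hJr (κ := 1) (fun x => by convert hJ1 x) hw hN0 (inv_pos.2 hl)
    (fun φ ψ => hN φ ψ lam⁻¹ (inv_pos.2 hl)) q2' q1
  rw [inv_inv] at t6 t8
  have n2 : nq w q2 ≤ σ2 := nq_mono hw bq2
  have n1 : nq w q1 ≤ σ1 := nq_mono hw bq1
  have n2' : nq w q2' ≤ a := nq_mono hw bq2'
  have n1' : nq w q1' ≤ a' := nq_mono hw bq1'
  have nbv : nq w bv ≤ a := nq_mono hw bbv
  have nbv' : nq w bv' ≤ a' := nq_mono hw bbv'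
  have nε : nq w ε ≤ a := nq_mono hw bε
  have nε' : nq w ε' ≤ a' := nq_mono hw bε'
  have hκ' : (1:ℝ) ≤ κ := by exact_mod_cast hκ1
  have hσ20 : 0 ≤ σ2 := (S.nsq_nonneg q2).trans n2
  have hσ10 : 0 ≤ σ1 := (S.nsq_nonneg q1).trans n1
  have g1 : N * (lam⁻¹ * nq w q2 + lam * (κ * nq w bv')) ≤ N * (κ * (lam⁻¹ * σ2 + lam * a')) := by
    have i1 : lam⁻¹ * nq w q2 ≤ κ * (lam⁻¹ * σ2) := by
      calc _ ≤ lam⁻¹ * σ2 := by gcongr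
        _ ≤ _ := le_mul_of_one_le_left pz hκ'
    have i2 : lam * (κ * nq w bv') ≤ lam * (κ * a') := by gcongr
    refine mll ?_ hN0
    linarith
  have g2 : N * (lam * nq w q2' + lam⁻¹ * (κ * nq w q1)) ≤ N * (κ * (lam * a + lam⁻¹ * σ1)) := by
    have i1 : lam * nq w q2' ≤ κ * (lam * a) := by
      calc _ ≤ lam * a := by gcongr
        _ ≤ _ := le_mul_of_one_le_left pz hκ'
    have i2 : lam⁻¹ * (κ * nq w q1) ≤ lam⁻¹ * (κ * σ1) := by gcongr
    refine mll ?_ hN0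
    linarith
  have g3 : N * (lam⁻¹ * nq w q2 + lam * ((1:ℕ) * nq w bv')) ≤ N * (lam⁻¹ * nq w q2 + lam * (κ * nq w bv')) := by
    have := S.nsq_nonneg bv'
    gcongr
  have g4 : N * (lam * nq w q2' + lam⁻¹ * ((1:ℕ) * nq w q1)) ≤ N * (lam * nq w q2' + lam⁻¹ * (κ * nq w q1)) := by
    have := S.nsq_nonneg q1
    gcongr
  set c1 := K.C * (2 / K.ρ) ^ nα K * K.Ct with hc1
  set c2 := K.C * (α0⁻¹) ^ K.n * 6 ^ nα K * K.Ct with hc2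
  have hc10 : 0 < c1 := pz
  have hc20 : 0 < c2 := pz
  have T1 := t1.trans (mll (add_le_add_right nψ _) hc10.le)
  have T2 := t2.trans (mll (add_le_add nε nψ) hc20.le)
  have T3 := t3.trans (mll (add_le_add nbv nε') hc20.le)
  have T4 := t4.trans (mll (add_le_add n2' n1') hc20.le)
  have e : C4 K τ = 2 * c1 + 6 * c2 := rfl
  rw [e]
  exact comp_ar pz pz T1 T2 T3 T4 (t5.trans g1) (t6.trans g2) (t7.trans (g3.trans g1)) (t8.trans (g4.trans g2))
end GP
end
section
variable {X I : Type} [Fintype X] {w : X → ℝ} {b : X → ℂ} {M : ℕ} {δ : ℝ}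
namespace KD
lemma BB_add_l (k : X → X → ℂ) (φ φ' ψ : X → ℂ) : Bw w k (fun x => φ x + φ' x) ψ = Bw w k φ ψ + Bw w k φ' ψ := by
  simp only [Bw, ← sum_add_distrib]
  exact sum_congr rfl fun x _ => sum_congr rfl fun y _ => by ring
lemma BB_swap (K : KD w b) (φ ψ : X → ℂ) : Bw w K.k φ ψ = - Bw w K.k ψ φ := by
  conv_lhs => unfold Bw; rw [sum_comm]
  simp only [Bw, ← sum_neg_distrib]
  exact sum_congr rfl fun x _ => sum_congr rfl fun y _ => by rw [K.anti y x]; ring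
lemma BB_add_r (k : X → X → ℂ) (φ ψ ψ' : X → ℂ) : Bw w k φ (fun x => ψ x + ψ' x) = Bw w k φ ψ + Bw w k φ ψ' := by
  simp only [Bw, ← sum_add_distrib]
  exact sum_congr rfl fun x _ => sum_congr rfl fun y _ => by ring
lemma BB_sum_l (k : X → X → ℂ) {J : Type} (s : Finset J) (φ : J → X → ℂ) (ψ : X → ℂ) :
    Bw w k (fun x => ∑ j ∈ s, φ j x) ψ = ∑ j ∈ s, Bw w k (φ j) ψ := by
  induction s using induction_on with
  | empty => simp [Bw]
  | insert a s ha ih => simp only [sum_insert ha, BB_add_l, ih]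
lemma BB_sum_r (k : X → X → ℂ) {J : Type} (s : Finset J) (φ : X → ℂ) (ψ : J → X → ℂ) :
    Bw w k φ (fun x => ∑ j ∈ s, ψ j x) = ∑ j ∈ s, Bw w k φ (ψ j) := by
  induction s using induction_on with
  | empty => simp [Bw]
  | insert a s ha ih => simp only [sum_insert ha, BB_add_r, ih]
end KD
lemma sum_tri (M : ℕ) (c : ℕ → ℕ → ℂ) : ∑ k ∈ rg M, ∑ j ∈ rg M, c k j =
    ∑ k ∈ rg M, ∑ j ∈ rg (k-1), c k j + ∑ j ∈ rg M, ∑ k ∈ rg (j-1), c k j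
    + ∑ k ∈ rg M, ∑ j ∈ rg M, if k ≤ j + 1 ∧ j ≤ k + 1 then c k j else 0 := by
  have e : ∀ (g : ℕ → ℂ) k, k < M → ∑ j ∈ rg (k-1), g j = ∑ j ∈ rg M, if j + 1 < k then g j else 0 := by
    intro g k hk
    rw [← sum_filter]
    congr 1
    ext j; simp only [Finset.mem_range, mem_filter]; omega
  rw [sum_congr rfl fun k hk => e (fun j => c k j) k (Finset.mem_range.1 hk),
    sum_congr rfl fun k hk => e (fun j => c j k) k (Finset.mem_range.1 hk),
    sum_comm (f := fun x j => if j + 1 < x then c j x else 0)]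
  simp only [← sum_add_distrib]
  refine sum_congr rfl fun k _ => sum_congr rfl fun j _ => ?_
  by_cases h1 : j + 1 < k
  · simp [h1, show ¬ (k + 1 < j) by omega]
  · by_cases h2 : k + 1 < j
    · simp [h1, h2]
    · simp [h1, h2]
lemma sum_band (M : ℕ) (a : ℕ → ℝ) (ha : ∀ k, 0 ≤ a k) :
    ∑ k ∈ rg M, ∑ j ∈ rg M, (if k ≤ j + 1 ∧ j ≤ k + 1 then a k else 0) ≤ 3 * ∑ k ∈ rg M, a k := by
  rw [mul_sum]
  refine sum_le_sum fun k _ => ?_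
  rw [← sum_filter, sum_const, nsmul_eq_mul]
  have : ((rg M).filter (fun j => k ≤ j + 1 ∧ j ≤ k + 1)).card ≤ 3 := by
    calc _ ≤ (Finset.Icc (k-1) (k+1)).card := Finset.card_le_card fun j => by
          simp only [mem_filter, Finset.mem_Icc]; omega
      _ ≤ 3 := by simp; omega
  have h3 : (((rg M).filter (fun j => k ≤ j + 1 ∧ j ≤ k + 1)).card : ℝ) ≤ 3 := by exact_mod_cast this
  have := ha k
  gcongr
namespace GP
variable {K : KD w b} {S S' : TM w b M δ I} {P P' : ℕ → X → Prop}
def Cd (K : KD w b) (δ : ℝ) : ℝ := 19*δ⁻¹^4 + 200000*δ⁻¹^10*K.Λ^2 + 2*K.C*(2*K.A/K.ρ)^(K.n+K.α)*K.Ct*(19*δ⁻¹^4)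
def STR (K : KD w b) (S S' : TM w b M δ I) (τ : ℝ) (f g : X → ℂ) : ℝ :=
  ∑ k ∈ rg M, ∑ j ∈ rg M, if k ≤ j + 1 ∧ j ≤ k + 1 then
    (∑ y, w y * (if strip K S' τ (j+1) y then S.ue f k y else 0) +
          ∑ x, w x * (if strip K S τ (k+1) x then S'.ue g j x else 0)) else 0
def BAD (S : TM w b M δ I) (P : ℕ → X → Prop) (f : X → ℂ) : ℝ :=
  ∑ k ∈ rg M, ∑ x, w x * (if ¬ P k x then S.ue f k x else 0)
lemma good_good (h : GP K S S' P P') (f g : X → ℂ) (he : ∀ j x, S.e f j x ≠ 0 → K.ℓ (j+1) ≤ K.A * K.Ψ x)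
    (he' : ∀ j x, S'.e g j x ≠ 0 → K.ℓ (j+1) ≤ K.A * K.Ψ x)
    {τ : ℝ} (hτ : 0 < τ) (hτ1 : τ ≤ 1) {κ : ℕ} (hκ1 : 1 ≤ κ)
    (hκ : ∀ k x, ((Finset.univ.image (S.lab k)).filter (fun l => ∃ y, S.lab k y = l ∧ near K S k x y)).card ≤ κ)
    {N lam : ℝ} (hN0 : 0 ≤ N) (hl : 0 < lam)
    (hN : ∀ φ ψ, ∀ lam > 0, ‖Bw w K.k φ ψ‖ ≤ N * (lam⁻¹ * nq w φ + lam * nq w ψ)) :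
    ‖Bw w K.k (S.fg f P) (S'.fg g P')‖ ≤
      (2 * Cd K δ + 57 * δ⁻¹ ^ 4 * (C4 K τ + 2 * N * κ * lam)) * (nq w f + nq w g) + 2 * N * κ * lam⁻¹ * STR K S S' τ f g := by
  have hδ := S.hδ
  set φ : ℕ → X → ℂ := fun k y => if P k y then S.De f k y else 0 with hφ
  set ψ : ℕ → X → ℂ := fun j y => if P' j y then S'.De g j y else 0 with hψ
  set B := Bw w K.k with hB
  set t : X → ℂ := fun x => b x * S.ga f 0 x with ht
  set t' : X → ℂ := fun x => b x * S'.ga g 0 x with ht'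
  have d1 := h.deep f g he'
  have d2 := h.swap.deep g f he
  have tt : B t t' = 0 := by
    have : B t t' = - B t t' := by
      conv_lhs => rw [hB, K.BB_swap]
      congr 1
      simp only [hB, Bw]
      refine sum_congr rfl fun x _ => sum_congr rfl fun y _ => ?_
      simp only [ht, ht', S.ga_congr f (h.top x y), S'.ga_congr g (h.top' x y)]
      ring
    exact self_eq_neg.1 this
  have e : B (S.fg f P) (S'.fg g P') = (∑ k ∈ rg M, B (φ k) (fun x => t' x + ∑ j ∈ rg (k-1), ψ j x))
      - (∑ j ∈ rg M, B (ψ j) (fun x => t x + ∑ k ∈ rg (j-1), φ k x))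
      + ∑ k ∈ rg M, ∑ j ∈ rg M, if k ≤ j + 1 ∧ j ≤ k + 1 then B (φ k) (ψ j) else 0 := by
    have e1 : B (S.fg f P) (S'.fg g P') = B t t' + ∑ k ∈ rg M, B (φ k) t' + ∑ j ∈ rg M, B t (ψ j)
       + ∑ k ∈ rg M, ∑ j ∈ rg M, B (φ k) (ψ j) := by
      have : B (fun x => t x + ∑ k ∈ rg M, φ k x) (fun x => t' x + ∑ k ∈ rg M, ψ k x) = B t t' + ∑ k ∈ rg M, B (φ k) t' + ∑ j ∈ rg M, B t (ψ j)
       + ∑ k ∈ rg M, ∑ j ∈ rg M, B (φ k) (ψ j) := by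
        simp only [hB, KD.BB_add_l, KD.BB_add_r, KD.BB_sum_l, KD.BB_sum_r, sum_add_distrib]
        rw [sum_comm]; ring
      exact this
    rw [e1, tt, sum_tri]
    simp only [hB, KD.BB_add_r, KD.BB_sum_r, sum_add_distrib]
    simp only [K.BB_swap (ψ _) _, sum_neg_distrib]
    ring
  rw [e]
  have d3 : ‖∑ k ∈ rg M, ∑ j ∈ rg M, if k ≤ j + 1 ∧ j ≤ k + 1 then B (φ k) (ψ j) else 0‖ ≤
      57 * δ⁻¹ ^ 4 * (C4 K τ + 2 * N * κ * lam) * (nq w f + nq w g) + 2 * N * κ * lam⁻¹ * STR K S S' τ f g := by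
    set c := C4 K τ + 2 * N * κ * lam with hc
    have hc0 : 0 ≤ c := by
      have hn := K.hn; have hα := K.hα; have hC := K.hC; have hCt := K.hCt
      have hρ := K.hρ; have hA := K.hA
      rw [hc]; unfold C4; positivity
    set a : ℕ → ℝ := fun k => ∑ y, w y * S.ue f k y with ha
    set a' : ℕ → ℝ := fun k => ∑ y, w y * S'.ue g k y with ha'
    have h1 : ∀ k, 0 ≤ a k := fun k => sum_nonneg fun y _ => mul_nonneg (S.hw y).le (S.ue_nonneg f k y)
    have h1' : ∀ k, 0 ≤ a' k := fun k => sum_nonneg fun y _ => mul_nonneg (S.hw y).le (S'.ue_nonneg g k y)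
    have b1 := sum_band M a h1
    have b2 := sum_band M a' h1'
    have s1 := S.SQ f
    have s2 := S'.SQ g
    rw [sum_comm] at b2
    calc _ ≤ ∑ k ∈ rg M, ∑ j ∈ rg M, (c * ((if k ≤ j + 1 ∧ j ≤ k + 1 then a k else 0)
          + (if j ≤ k + 1 ∧ k ≤ j + 1 then a' j else 0)) + 2 * N * κ * lam⁻¹ * (if k ≤ j + 1 ∧ j ≤ k + 1 then
    (∑ y, w y * (if strip K S' τ (j+1) y then S.ue f k y else 0) +
          ∑ x, w x * (if strip K S τ (k+1) x then S'.ue g j x else 0)) else 0)) := by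
          refine (norm_sum_le _ _).trans (sum_le_sum fun k _ => (norm_sum_le _ _).trans (sum_le_sum fun j _ => ?_))
          by_cases hkj : k ≤ j + 1 ∧ j ≤ k + 1
          · simp only [hkj, and_self, if_true]
            exact h.comp_one f g he he' hkj.1 hkj.2 hτ hτ1 hκ1 (hκ k) hN0 hl hN
          · have : ¬ (j ≤ k + 1 ∧ k ≤ j + 1) := fun h => hkj ⟨h.2, h.1⟩
            simp only [hkj, this, if_false, norm_zero, mul_zero, add_zero]; rfl
      _ = c * (∑ k ∈ rg M, ∑ j ∈ rg M, (if k ≤ j + 1 ∧ j ≤ k + 1 then a k else 0) +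
            ∑ k ∈ rg M, ∑ j ∈ rg M, (if j ≤ k + 1 ∧ k ≤ j + 1 then a' j else 0)) + 2 * N * κ * lam⁻¹ * STR K S S' τ f g := by
          unfold STR
          simp only [sum_add_distrib, mul_add, mul_sum]
      _ ≤ c * (3 * (19 * δ⁻¹ ^ 4 * nq w f) + 3 * (19 * δ⁻¹ ^ 4 * nq w g)) + 2 * N * κ * lam⁻¹ * STR K S S' τ f g := by
          refine add_le_add_left (mll ?_ hc0) _
          linarith
      _ = _ := by ring
  refine (norm_add_le _ _).trans ((add_le_add ((norm_sub_le _ _).trans (add_le_add d1 d2)) d3).trans (le_of_eq ?_))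
  unfold Cd; ring
lemma assem (h : GP K S S' P P') (f g : X → ℂ) (he : ∀ j x, S.e f j x ≠ 0 → K.ℓ (j+1) ≤ K.A * K.Ψ x)
    (he' : ∀ j x, S'.e g j x ≠ 0 → K.ℓ (j+1) ≤ K.A * K.Ψ x)
    {τ : ℝ} (hτ : 0 < τ) (hτ1 : τ ≤ 1) {κ : ℕ} (hκ1 : 1 ≤ κ)
    (hκ : ∀ k x, ((Finset.univ.image (S.lab k)).filter (fun l => ∃ y, S.lab k y = l ∧ near K S k x y)).card ≤ κ)
    {N lam : ℝ} (hN0 : 0 ≤ N) (hl : 0 < lam)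
    (hN : ∀ φ ψ, ∀ lam > 0, ‖Bw w K.k φ ψ‖ ≤ N * (lam⁻¹ * nq w φ + lam * nq w ψ)) :
    ‖Bw w K.k f g‖ ≤
      (2 * Cd K δ + 57 * δ⁻¹ ^ 4 * C4 K τ + N * lam * (1 + 3042 * δ⁻¹ ^ 6 + 114 * δ⁻¹ ^ 4 * κ)) * (nq w f + nq w g)
      + N * lam⁻¹ * (2 * κ * STR K S S' τ f g + 80 * δ⁻¹ ^ 2 * (BAD S P f + BAD S' P' g)) := by
  have hδ := S.hδ
  have gg := h.good_good f g he he' hτ hτ1 hκ1 hκ hN0 hl hN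
  set fb : X → ℂ := fun x => ∑ k ∈ rg M, if ¬ P k x then S.De f k x else 0 with hfb
  set gb : X → ℂ := fun x => ∑ k ∈ rg M, if ¬ P' k x then S'.De g k x else 0 with hgb
  have sp : ∀ (T : TM w b M δ I) (Q : ℕ → X → Prop) f x, f x = (∑ k ∈ rg M, if ¬ Q k x then T.De f k x else 0) + T.fg f Q x := by
    intro T Q f x
    conv_lhs => rw [T.expand f x]
    unfold TM.fg
    rw [add_left_comm, ← sum_add_distrib]
    congr 1
    refine sum_congr rfl fun k _ => ?_
    by_cases hk : Q k x <;> simp [hk]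
  have e1 : f = fun x => fb x + S.fg f P x := funext fun x => sp S P f x
  have e2 := funext fun x => sp S' P' g x
  have e : Bw w K.k f g = Bw w K.k fb g + (Bw w K.k (S.fg f P) gb
      + Bw w K.k (S.fg f P) (S'.fg g P')) := by
    rw [← KD.BB_add_r, ← e2, ← KD.BB_add_l, ← e1]
  have q1 := S.dualSQ f (fun k x => ¬ P k x) (fun k x y hxy => not_congr (h.Pc k x y hxy))
  have q2 := S'.dualSQ g (fun k x => ¬ P' k x) (fun k x y hxy => not_congr (h.Pc' k x y hxy))
  have q3 := S.fg_nq f h.Pc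
  have r1 := hN fb g lam hl
  have r2 := hN (S.fg f P) gb lam⁻¹ (inv_pos.2 hl)
  rw [inv_inv] at r2
  have s1 : N * (lam⁻¹ * nq w fb + lam * nq w g) ≤ N * (lam⁻¹ * (80 * δ⁻¹ ^ 2 * BAD S P f) + lam * nq w g) := by
    have : nq w fb ≤ 80 * δ⁻¹ ^ 2 * BAD S P f := by unfold BAD; convert q1
    gcongr
  have s2 : N * (lam * nq w (S.fg f P) + lam⁻¹ * nq w gb) ≤ N * (lam * (3042 * δ⁻¹ ^ 6 * nq w f) + lam⁻¹ * (80 * δ⁻¹ ^ 2 * BAD S' P' g)) := by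
    have : nq w gb ≤ 80 * δ⁻¹ ^ 2 * BAD S' P' g := by unfold BAD; convert q2
    gcongr
  rw [e]
  refine (norm_add_le _ _).trans ((add_le_add (r1.trans s1) ((norm_add_le _ _).trans (add_le_add (r2.trans s2) gg))).trans ?_)
  have p1 : 0 ≤ N * lam * nq w f := by have := S.nsq_nonneg f; positivity
  have p2 : 0 ≤ N * lam * (3042 * δ⁻¹ ^ 6 * nq w g) := by have := S.nsq_nonneg g; positivity
  nlinarith
end GP
end
section
lemma count_per (Q c p R : ℕ) (hQ : 0 < Q) :
    ((rg (Q * c)).filter (fun m => (p + m) % Q < R ∨ Q ≤ (p + m) % Q + R)).card ≤ c * (2 * R) := by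
  set pr : ℕ → Prop := fun m => (p + m) % Q < R ∨ Q ≤ (p + m) % Q + R with hpr
  have base : Nat.count (fun r => r % Q < R ∨ Q ≤ r % Q + R) Q ≤ 2 * R := by
    rw [Nat.count_eq_card_filter_range]
    calc _ ≤ (rg R ∪ Finset.Ico (Q - R) Q).card := Finset.card_le_card fun r => by
          simp only [mem_filter, Finset.mem_range, Finset.mem_union, Finset.mem_Ico]
          rintro ⟨h1, h2⟩
          rw [mod_eq_of_lt h1] at h2
          omega
      _ ≤ _ := by
          refine (Finset.card_union_le _ _).trans ?_
          simp only [card_range, Nat.card_Ico]; omega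
  have one : ∀ n, ((Finset.Ico n (n + Q)).filter pr).card ≤ 2 * R := fun n => by
    have per2 : Function.Periodic (fun r => r % Q < R ∨ Q ≤ r % Q + R) Q := fun m => by simp
    have := Nat.filter_Ico_card_eq_of_periodic (p + n) Q (fun r => r % Q < R ∨ Q ≤ r % Q + R) per2
    rw [← this] at base
    refine le_trans ?_ base
    refine Finset.card_le_card_of_injOn (fun m => p + m) ?_ (fun a _ b _ h => by simpa using h)
    intro m hm
    simp only [Finset.coe_filter, Finset.mem_Ico, mem_ofPred_eq, hpr] at hm ⊢
    exact ⟨by omega, hm.2⟩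
  induction c with
  | zero => simp
  | succ c ih =>
    have : rg (Q * (c+1)) = rg (Q * c) ∪ Finset.Ico (Q * c) (Q * c + Q) := by grind
    rw [this, Finset.filter_union]
    refine (Finset.card_union_le _ _).trans ((add_le_add ih (le_trans (le_of_eq ?_) (one (Q * c)))).trans (by ring_nf; rfl))
    congr
variable {X : Type} {d : ℕ}
def glab (q N m : ℕ) (pos : X → Fin d → ℕ) (k : ℕ) (x : X) : Fin d → ℕ := fun i => (pos x i + m) / q ^ (N + 1 - k)
def gds (h : ℝ) (pos : X → Fin d → ℕ) (x y : X) : ℝ := h * dist (fun i => (pos x i : ℝ)) (fun i => (pos y i : ℝ))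
section
variable {q N m : ℕ} {pos : X → Fin d → ℕ} {h : ℝ}
lemma gds_coord (hh : 0 < h) {x y : X} {D : ℝ} (hD : gds h pos x y ≤ D) (i : Fin d) : |(pos x i : ℝ) - pos y i| ≤ D / h := by
  rw [le_div_iff₀ hh, mul_comm]
  refine le_trans (mll ?_ hh.le) hD
  exact dist_le_pi_dist (fun i => (pos x i : ℝ)) (fun i => (pos y i : ℝ)) i
lemma glab_succ (k : ℕ) (x y : X) (hxy : glab q N m pos (k+1) x = glab q N m pos (k+1) y) :
    glab q N m pos k x = glab q N m pos k y := by
  funext i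
  have h1 : (pos x i + m) / q ^ (N + 1 - (k+1)) = (pos y i + m) / q ^ (N + 1 - (k+1)) := congrFun hxy i
  show (pos x i + m) / q ^ (N + 1 - k) = (pos y i + m) / q ^ (N + 1 - k)
  by_cases hk : k ≤ N
  · have : q ^ (N + 1 - k) = q ^ (N + 1 - (k + 1)) * q := by rw [← pow_succ]; congr 1; omega
    rw [this, ← Nat.div_div_eq_div_mul, ← Nat.div_div_eq_div_mul, h1]
  · rw [show N + 1 - k = N + 1 - (k + 1) by omega]; exact h1
lemma glab_le {j k : ℕ} (hjk : j ≤ k) {x y : X} (hxy : glab q N m pos k x = glab q N m pos k y) :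
    glab q N m pos j x = glab q N m pos j y := by
  induction k, hjk using Nat.le_induction with
  | base => exact hxy
  | succ k _ ih => exact ih (glab_succ k x y hxy)
lemma glab_top (hq : 2 ≤ q) (hm : m < q ^ N) (hp : ∀ x i, pos x i < q ^ N) (x y : X) :
    glab q N m pos 0 x = glab q N m pos 0 y := by
  have : ∀ x i, (pos x i + m) / q ^ (N + 1 - 0) = 0 := fun x i => by
    apply Nat.div_eq_of_lt
    have := hp x i
    have : q ^ (N + 1 - 0) = q ^ N * q := pow_succ _ _
    nlinarith
  funext i; simp only [glab, this]
lemma glab_diam (hq : 2 ≤ q) (hh : 0 < h) (k : ℕ) (x y : X) (hxy : glab q N m pos k x = glab q N m pos k y) :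
    gds h pos x y ≤ h * q ^ (N + 1) * ((q:ℝ)⁻¹) ^ k := by
  have hq0 : (0:ℝ) < q := pz
  unfold gds
  rw [mul_assoc]
  refine mll ((dist_pi_le_iff pz).2 fun i => ?_) hh.le
  have h1 : (pos x i + m) / q ^ (N + 1 - k) = (pos y i + m) / q ^ (N + 1 - k) := congrFun hxy i
  by_cases hk : k ≤ N + 1
  · have e : (q:ℝ) ^ (N+1) * ((q:ℝ)⁻¹) ^ k = ((q ^ (N + 1 - k) : ℕ) : ℝ) := by
      push_cast
      rw [inv_pow, pow_sub₀ _ hq0.ne' hk]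
    rw [e]
    have hQ : 0 < q ^ (N + 1 - k) := pz
    generalize q ^ (N + 1 - k) = Q at *
    have a1 := div_add_mod (pos x i + m) Q
    have a2 := div_add_mod (pos y i + m) Q
    have b1 := mod_lt (pos x i + m) hQ
    have b2 := mod_lt (pos y i + m) hQ
    rw [h1] at a1
    rw [dist_eq, abs_le]
    have c1 : pos x i ≤ pos y i + Q := oz
    have c2 : pos y i ≤ pos x i + Q := oz
    have c1' : (pos x i : ℝ) ≤ pos y i + Q := by exact_mod_cast c1
    have c2' : (pos y i : ℝ) ≤ pos x i + Q := by exact_mod_cast c2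
    constructor <;> linarith
  · rw [show N + 1 - k = 0 by omega] at h1
    simp only [pow_zero] at h1
    have : pos x i = pos y i := oz
    rw [this, dist_self]; positivity
lemma nb_prob [Fintype X] (hq : 2 ≤ q) (hh : 0 < h) {D : ℝ} (hD : 0 ≤ D) {i : ℕ} (hi : 1 ≤ i) (hi2 : i ≤ N + 1) (x : X) :
    (((rg (q ^ N)).filter (fun m => ∃ y, gds h pos y x ≤ D ∧ glab q N m pos i y ≠ glab q N m pos i x)).card : ℝ)
      ≤ (q:ℝ) ^ N * (2 * d * D / (h * q ^ (N + 1) * ((q:ℝ)⁻¹) ^ i)) := by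
  have hq0 : (0:ℝ) < q := pz
  set Q := q ^ (N + 1 - i) with hQd
  have hQ : 0 < Q := pz
  set R := ⌊D / h⌋₊
  have hR1 : (R:ℝ) ≤ D / h := Nat.floor_le pz
  have hT : q ^ N = Q * q ^ (i - 1) := by rw [hQd, ← pow_add]; congr 1; omega
  have e : (q:ℝ) ^ (N+1) * ((q:ℝ)⁻¹) ^ i = Q := by
    rw [hQd]; push_cast
    rw [inv_pow, pow_sub₀ _ hq0.ne' hi2]
  have h1 : ((rg (q ^ N)).filter (fun m => ∃ y, gds h pos y x ≤ D ∧ glab q N m pos i y ≠ glab q N m pos i x)).card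
      ≤ d * (q ^ (i-1) * (2 * R)) := by
    calc _ ≤ (Finset.univ.biUnion (fun c : Fin d => (rg (Q * q ^ (i-1))).filter
          (fun m => (pos x c + m) % Q < R ∨ Q ≤ (pos x c + m) % Q + R))).card := by
          refine Finset.card_le_card fun m hm => ?_
          rw [mem_filter] at hm
          obtain ⟨hm, y, h1, h2⟩ := hm
          obtain ⟨c, hc⟩ := Function.ne_iff.1 h2
          have hc : (pos y c + m) / Q ≠ (pos x c + m) / Q := hc
          rw [Finset.mem_biUnion]
          refine ⟨c, Finset.mem_univ _, mem_filter.2 ⟨by rw [← hT]; exact hm, ?_⟩⟩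
          have h3 := gds_coord hh h1 c
          rw [abs_le] at h3
          have h4 : pos y c ≤ pos x c + R := by
            have : pos y c - pos x c ≤ R := Nat.le_floor (by
              by_cases h5 : pos x c ≤ pos y c
              · rw [Nat.cast_sub h5]; linarith
              · rw [Nat.sub_eq_zero_of_le oz]; simp; positivity)
            omega
          have h5 : pos x c ≤ pos y c + R := by
            have : pos x c - pos y c ≤ R := Nat.le_floor (by
              by_cases h5 : pos y c ≤ pos x c
              · rw [Nat.cast_sub h5]; linarith
              · rw [Nat.sub_eq_zero_of_le oz]; simp; positivity)
            omega
          have a1 := div_add_mod (pos x c + m) Q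
          have a2 := div_add_mod (pos y c + m) Q
          have b2 := mod_lt (pos y c + m) hQ
          rcases lt_or_gt_of_ne hc with h6 | h6
          · left
            have := Nat.mul_le_mul_left Q h6
            rw [mul_succ] at this
            omega
          · right
            have := Nat.mul_le_mul_left Q h6
            rw [mul_succ] at this
            omega
      _ ≤ ∑ c : Fin d, _ := Finset.card_biUnion_le
      _ ≤ ∑ c : Fin d, q ^ (i-1) * (2 * R) := sum_le_sum fun c _ => count_per Q _ _ R hQ
      _ = _ := zs
  calc _ ≤ ((d * (q ^ (i-1) * (2 * R)) : ℕ) : ℝ) := by exact_mod_cast h1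
    _ = (q:ℝ) ^ (i-1) * (2 * d * R) := by push_cast; ring
    _ ≤ (q:ℝ) ^ (i-1) * (2 * d * (D / h)) := by gcongr
    _ = _ := by
        have hT' : (q:ℝ) ^ N = Q * (q:ℝ) ^ (i-1) := by exact_mod_cast hT
        rw [mul_assoc h, e, hT']
        field_simp
end
end
section
variable {X : Type} [Fintype X] {w : X → ℝ} {b : X → ℂ} {δ : ℝ} {d : ℕ}
lemma modm {q N m : ℕ} (hm : m ∈ rg (q ^ N)) : m % q ^ N = m := mod_eq_of_lt (Finset.mem_range.1 hm)
structure CH (K : KD w b) (δ c : ℝ) (q N : ℕ) (h : ℝ) (pos : X → Fin d → ℕ) : Prop where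
  hq : 2 ≤ q
  hh : 0 < h
  hds : ∀ x y, K.ds x y = gds h pos x y
  eρ : K.ρ = (q:ℝ)⁻¹
  eL : K.L = h * q ^ (N+1)
  hp : ∀ x i, pos x i < q ^ N
  lip : ∀ x y, K.Ψ x ≤ K.Ψ y + K.ds x y
  hΨ : ∀ y, h ≤ K.Ψ y
  hw : ∀ x, 0 < w x
  hb : ∀ x, ‖b x‖ ≤ 1
  hδ : 0 < δ
  hδ1 : δ ≤ 1
  hc : 0 < c
  hu2 : K.u ≤ 1/2
  hAc : 4 * d ≤ c * K.A
  top : δ * ∑ x, w x ≤ ‖∑ x, w x * b x‖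
  big : ∃ y, K.A * K.Ψ y < K.L
  HP : ∀ x, ∃ z, K.ds x z ≤ K.Ψ x ∧ c * q ^ N ≤ (((rg (q ^ N)).filter
    (fun m => ∀ k ≤ N + 1, δ ≤ ‖av w (glab q N m pos k) b z‖)).card : ℝ)
namespace CH
variable {K : KD w b} {c : ℝ} {q N : ℕ} {h : ℝ} {pos : X → Fin d → ℕ} (H : CH K δ c q N h pos)
include H
lemma el (i : ℕ) : K.ℓ i = h * q ^ (N + 1) * ((q:ℝ)⁻¹) ^ i := by rw [KD.ℓ, H.eL, H.eρ]
lemma elM : K.ℓ (N+1) = h := by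
  have := H.hq
  rw [H.el, inv_pow]; field_simp
def S (m : ℕ) : TM w b (N+1) δ (Fin d → ℕ) where
  lab := glab q N (m % q ^ N) pos
  tr k x := ∀ j ≤ k, δ ≤ ‖av w (glab q N (m % q ^ N) pos j) b x‖ ∧
    ∃ y, glab q N (m % q ^ N) pos j y = glab q N (m % q ^ N) pos j x ∧ K.A * K.Ψ y < K.ℓ j
  hw := H.hw
  hr := glab_succ
  hb := H.hb
  hδ := H.hδ
  hδ1 := H.hδ1
  trc k x y hxy ht j hj := by
    have e := glab_le hj hxy
    obtain ⟨h1, z, h2, h3⟩ := ht j hj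
    exact ⟨by rw [← av_congr _ e]; exact h1, z, h2.trans e, h3⟩
  trm k x ht j hj := ht j oz
  tr0 x j hj := by
    obtain rfl : j = 0 := oz
    have hqN : 0 < q ^ N := by have := H.hq; positivity
    have tp := glab_top (pos := pos) H.hq (mod_lt m hqN) H.hp
    refine ⟨?_, ?_⟩
    · have hx : ∀ y, glab q N (m % q ^ N) pos 0 y = glab q N (m % q ^ N) pos 0 x := fun y => tp y x
      have hs : 0 < ∑ x, w x := sum_pos (fun y _ => H.hw y) ⟨x, Finset.mem_univ x⟩
      have := H.top
      simp only [av, cw, hx, Finset.filter_true, Complex.real_smul]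
      rw [norm_mul, norm_real, norm_inv, norm_of_nonneg hs.le, inv_mul_eq_div, le_div_iff₀ hs]
      exact this
    · obtain ⟨y, hy⟩ := H.big
      refine ⟨y, tp _ _, ?_⟩
      rw [KD.ℓ, pow_zero, mul_one]; exact hy
  trM x ht := by
    obtain ⟨-, y, -, h3⟩ := ht (N+1) le_rfl
    rw [H.elM] at h3
    have := H.hΨ y; have := K.hA; have := H.hh
    nlinarith
  acc k x ht := (ht k le_rfl).1
lemma nb {D : ℝ} (hD : 0 ≤ D) {i : ℕ} (hi : 1 ≤ i) (hi2 : i ≤ N + 1) (x : X) :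
    (((rg (q ^ N)).filter (fun m => ∃ y, K.ds y x ≤ D ∧ (H.S m).lab i y ≠ (H.S m).lab i x)).card : ℝ)
      ≤ (q:ℝ) ^ N * (2 * d * D / K.ℓ i) := by
  rw [H.el]
  refine le_trans (Nat.cast_le.2 (Finset.card_le_card fun m hm => ?_)) (nb_prob (pos := pos) H.hq H.hh hD hi hi2 x)
  rw [mem_filter] at hm ⊢
  refine ⟨hm.1, ?_⟩
  obtain ⟨y, h1, h2⟩ := hm.2
  rw [H.hds] at h1
  simp only [S, modm hm.1] at h2
  exact ⟨y, h1, h2⟩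
def keep (m : ℕ) (x : X) : Prop := ∀ j, (H.S m).tr j x → ¬ (H.S m).tr (j+1) x → K.ℓ (j+1) ≤ K.A * K.Ψ x
lemma keep_prob (x : X) : c / 2 * q ^ N ≤ (((rg (q ^ N)).filter (fun m => H.keep m x)).card : ℝ) := by
  obtain ⟨z, hz, hc⟩ := H.HP x
  have hA := K.hA; have hΨ := K.Ψpos x; have hh := H.hh
  have hT : (0:ℝ) < q ^ N := by have := H.hq; positivity
  obtain ⟨k, hk, hk1, hk2⟩ : ∃ k ≤ N + 1, (1 ≤ k → K.A * K.Ψ x < K.ℓ k) ∧ ∀ j ≤ N + 1, 1 ≤ j → K.A * K.Ψ x < K.ℓ j → j ≤ k := by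
    set s := (rg (N+2)).filter (fun k => 1 ≤ k ∧ K.A * K.Ψ x < K.ℓ k) with hs
    by_cases hne : s.Nonempty
    · obtain ⟨k, hk, hmax⟩ := s.exists_max_image id hne
      simp only [hs, mem_filter, Finset.mem_range] at hk hmax
      exact ⟨k, by omega, fun _ => hk.2.2, fun j h1 h2 h3 => hmax j ⟨by omega, h2, h3⟩⟩
    · refine ⟨0, by omega, fun h => by omega, fun j h1 h2 h3 => ?_⟩
      exact absurd ⟨j, mem_filter.2 ⟨Finset.mem_range.2 oz, h2, h3⟩⟩ hne
  set G := (rg (q ^ N)).filter (fun m => ∀ k ≤ N + 1, δ ≤ ‖av w (glab q N m pos k) b z‖) with hG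
  set F := (rg (q ^ N)).filter (fun m => (H.S m).lab k x ≠ (H.S m).lab k z) with hF
  have hsub : G ⊆ (rg (q ^ N)).filter (fun m => H.keep m x) ∪ F := by
    intro m hm
    rw [hG, mem_filter] at hm
    by_cases hmF : m ∈ F
    · exact Finset.mem_union_right _ hmF
    refine Finset.mem_union_left _ (mem_filter.2 ⟨hm.1, ?_⟩)
    have hsame : (H.S m).lab k x = (H.S m).lab k z := by grind
    intro j h1 h2
    by_contra h3
    rw [not_le] at h3
    apply h2
    intro i hi
    by_cases hij : i ≤ j
    · exact h1 i hij
    obtain rfl : i = j + 1 := oz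
    have hjN : j + 1 ≤ N + 1 := by
      by_contra h4
      exact (H.S m).trM x ((H.S m).tr_mono oz h1)
    have hjk := hk2 (j+1) hjN oz h3
    refine ⟨?_, x, rfl, h3⟩
    have e := glab_le hjk hsame
    rw [av_congr _ e, modm hm.1]
    exact hm.2 _ hjN
  have hFc : (F.card : ℝ) ≤ q ^ N * (c / 2) := by
    by_cases hk0 : 1 ≤ k
    · have h1 := hk1 hk0
      have hlk := K.ℓ_pos k
      calc (F.card : ℝ) ≤ (((rg (q ^ N)).filter (fun m => ∃ y, K.ds y x ≤ K.Ψ x ∧ (H.S m).lab k y ≠ (H.S m).lab k x)).card : ℝ) := by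
            norm_cast
            refine Finset.card_le_card fun m hm => ?_
            rw [hF, mem_filter] at hm
            exact mem_filter.2 ⟨hm.1, z, by rw [K.ds_comm]; exact hz, fun h => hm.2 h.symm⟩
        _ ≤ _ := H.nb hΨ.le hk0 hk x
        _ ≤ _ := by
            refine mll ?_ hT.le
            rw [div_le_iff₀ hlk]
            have := H.hAc; have := H.hc
            have h5 : 4 * (d:ℝ) * K.Ψ x ≤ c * K.A * K.Ψ x := by gcongr
            have h6 : c * (K.A * K.Ψ x) ≤ c * K.ℓ k := by gcongr
            linarith
    · obtain rfl : k = 0 := by omega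
      have : F = ∅ := by
        rw [hF, Finset.filter_eq_empty_iff]
        intro m hm h1
        exact h1 (glab_top H.hq (mod_lt m (by have := H.hq; positivity)) H.hp x z)
      rw [this]; have := H.hc; simp; positivity
  have h9 : (G.card : ℝ) ≤ ((rg (q ^ N)).filter (fun m => H.keep m x)).card + F.card := by
    exact_mod_cast (Finset.card_le_card hsub).trans (Finset.card_union_le _ _)
  linarith
def PP (m m' : ℕ) (k : ℕ) (x : X) : Prop := ∀ x', (H.S m).lab k x' = (H.S m).lab k x → ∀ i, 1 ≤ i → i < k →
  ∀ y, (H.S m').lab i y ≠ (H.S m').lab i x' → K.ℓ i * K.u ^ (k - i) ≤ K.ds x' y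
lemma gp (m m' : ℕ) : GP K (H.S m) (H.S m') (H.PP m m') (H.PP m' m) where
  Pc k x y hxy := by unfold PP; rw [hxy]
  Pc' k x y hxy := by unfold PP; rw [hxy]
  good k x hP i h1 h2 y hy := hP x rfl i h1 h2 y hy
  good' k x hP i h1 h2 y hy := hP x rfl i h1 h2 y hy
  trΨ k x ht := by
    obtain ⟨-, y, h2, h3⟩ := ht k le_rfl
    have h4 := glab_diam H.hq H.hh k y x h2
    rw [← H.el, ← H.hds, K.ds_comm] at h4
    have := H.lip x y; have := K.hA; have := K.Ψpos y
    nlinarith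
  trΨ' k x ht := by
    obtain ⟨-, y, h2, h3⟩ := ht k le_rfl
    have h4 := glab_diam (pos := pos) H.hq H.hh k y x h2
    rw [← H.el, ← H.hds, K.ds_comm] at h4
    have := H.lip x y; have := K.hA; have := K.Ψpos y
    nlinarith
  diam k x y hxy := by rw [H.hds, H.el]; exact glab_diam H.hq H.hh k x y hxy
  diam' k x y hxy := by rw [H.hds, H.el]; exact glab_diam H.hq H.hh k x y hxy
  top := glab_top H.hq (mod_lt m (by have := H.hq; positivity)) H.hp
  top' := glab_top H.hq (mod_lt m' (by have := H.hq; positivity)) H.hp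
lemma bad_prob (m k : ℕ) (hk : k ≤ N) (x : X) :
    (((rg (q ^ N)).filter (fun m' => ¬ H.PP m m' k x)).card : ℝ) ≤ q ^ N * (8 * d * K.u) := by
  have hu := K.hu; have hu2 := H.hu2; have hρ := K.hρ; have hA := K.hA
  set A : ℕ → Finset ℕ := fun i => (rg (q ^ N)).filter (fun m' => ∃ y, K.ds y x ≤ K.ℓ i * K.u ^ (k - i) + K.ℓ k ∧
    (H.S m').lab i y ≠ (H.S m').lab i x) with hAd
  have hsub : (rg (q ^ N)).filter (fun m' => ¬ H.PP m m' k x) ⊆ (Finset.Ico 1 k).biUnion A := by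
    intro m' hm
    rw [mem_filter] at hm
    obtain ⟨hm, hP⟩ := hm
    unfold PP at hP
    push Not at hP
    obtain ⟨x', h1, i, h2, h3, y, h4, h5⟩ := hP
    rw [Finset.mem_biUnion]
    refine ⟨i, Finset.mem_Ico.2 ⟨h2, h3⟩, mem_filter.2 ⟨hm, ?_⟩⟩
    have h6 := (H.gp m m').diam k x' x h1
    have hl := K.ℓ_pos i
    by_cases h7 : (H.S m').lab i x' = (H.S m').lab i x
    · refine ⟨y, ?_, by rw [← h7]; exact h4⟩
      have := K.ds_tri y x' x
      rw [K.ds_comm y x'] at this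
      linarith
    · refine ⟨x', ?_, h7⟩
      have : 0 ≤ K.ℓ i * K.u ^ (k - i) := pz
      linarith
  have h1 : ∀ i ∈ Finset.Ico 1 k, ((A i).card : ℝ) ≤ q ^ N * (4 * d * K.u ^ (k - i)) := by
    intro i hi
    rw [Finset.mem_Ico] at hi
    have hl := K.ℓ_pos i; have hlk := K.ℓ_pos k
    refine (H.nb pz hi.1 oz x).trans ?_
    have e : K.ℓ k = K.ρ ^ (k - i) * K.ℓ i := by rw [← K.ℓ_add]; congr 1; omega
    have h2 : K.ρ ^ (k - i) ≤ K.u ^ (k - i) := by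
      have := GP.pow_le K (m := k - i) oz
      nlinarith
    gcongr
    rw [e, div_le_iff₀ hl]
    have : 0 ≤ 2 * (d:ℝ) * K.ℓ i := pz
    nlinarith
  have h2 : ∑ i ∈ Finset.Ico 1 k, K.u ^ (k - i) ≤ 2 * K.u := by
    have : ∀ k : ℕ, ∑ i ∈ Finset.Ico 1 k, K.u ^ (k - i) ≤ 2 * K.u := by
      intro k
      induction k with
      | zero => simp; positivity
      | succ k ih =>
        rcases Nat.eq_zero_or_pos k with rfl | hk
        · simp; positivity
        rw [Finset.sum_Ico_succ_top hk]
        have : ∑ i ∈ Finset.Ico 1 k, K.u ^ (k + 1 - i) = K.u * ∑ i ∈ Finset.Ico 1 k, K.u ^ (k - i) := by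
          rw [mul_sum]
          refine sum_congr rfl fun i hi => ?_
          rw [Finset.mem_Ico] at hi
          rw [← pow_succ']; congr 1; omega
        rw [this]; simp; nlinarith
    exact this k
  calc _ ≤ (((Finset.Ico 1 k).biUnion A).card : ℝ) := by exact_mod_cast Finset.card_le_card hsub
    _ ≤ ∑ i ∈ Finset.Ico 1 k, ((A i).card : ℝ) := by exact_mod_cast Finset.card_biUnion_le
    _ ≤ ∑ i ∈ Finset.Ico 1 k, (q:ℝ) ^ N * (4 * d * K.u ^ (k - i)) := sum_le_sum h1
    _ = q ^ N * (4 * d) * ∑ i ∈ Finset.Ico 1 k, K.u ^ (k - i) := by rw [mul_sum]; simp only [mul_assoc]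
    _ ≤ q ^ N * (4 * d) * (2 * K.u) := by gcongr
    _ = _ := by ring
lemma strip_prob {τ : ℝ} (hτ : 0 < τ) {i : ℕ} (hi : 1 ≤ i) (hi2 : i ≤ N + 1) (x : X) :
    (((rg (q ^ N)).filter (fun m => GP.strip K (H.S m) τ i x)).card : ℝ) ≤ q ^ N * (2 * d * τ) := by
  have hl := K.ℓ_pos i
  have := H.nb (D := τ * K.ℓ i) pz hi hi2 x
  rw [show 2 * (d:ℝ) * (τ * K.ℓ i) / K.ℓ i = 2 * d * τ by field_simp] at this
  refine le_trans ?_ this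
  norm_cast
  refine Finset.card_le_card fun m hm => ?_
  rw [mem_filter] at hm ⊢
  obtain ⟨h1, y, h2, h3⟩ := hm
  exact ⟨h1, y, h2.le, h3⟩
lemma kap (m k : ℕ) (x : X) : ((Finset.univ.image ((H.S m).lab k)).filter
    (fun l => ∃ y, (H.S m).lab k y = l ∧ GP.near K (H.S m) k x y)).card ≤ 9 ^ d := by
  have hh := H.hh
  have hq0 : (0:ℝ) < q := by have := H.hq; positivity
  set Q := q ^ (N + 1 - k) with hQd
  have hQ : 0 < Q := by have := H.hq; positivity
  have hlQ : K.ℓ k ≤ h * Q := by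
    rw [H.el, mul_assoc]
    refine mll ?_ hh.le
    by_cases hk : k ≤ N + 1
    · rw [hQd]; push_cast
      rw [inv_pow, pow_sub₀ _ hq0.ne' hk]
    · rw [hQd, show N + 1 - k = 0 by omega, inv_pow, ← div_eq_mul_inv]
      rw [div_le_iff₀ pz]; simp
      exact pow_le_pow_right₀ (by exact_mod_cast (by have := H.hq; omega)) oz
  calc _ ≤ (Fintype.piFinset (fun i : Fin d => Finset.Icc ((H.S m).lab k x i - 4) ((H.S m).lab k x i + 4))).card := by
        refine Finset.card_le_card fun l hl => ?_
        obtain ⟨-, y, h1, y', h2, h3⟩ := mem_filter.1 hl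
        rw [Fintype.mem_piFinset]
        intro i
        rw [← h1, ← h2, Finset.mem_Icc]
        rw [H.hds] at h3
        have h4 := gds_coord hh h3.le i
        have h5 : 4 * K.ℓ k / h ≤ 4 * Q := by rw [div_le_iff₀ hh]; linarith
        have h6 := abs_le.1 (h4.trans h5)
        have h7 : pos x i ≤ pos y' i + 4 * Q := by
          have : (pos x i : ℝ) ≤ pos y' i + 4 * Q := lz
          exact_mod_cast this
        have h8 : pos y' i ≤ pos x i + 4 * Q := by
          have : (pos y' i : ℝ) ≤ pos x i + 4 * Q := lz
          exact_mod_cast this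
        have a1 : (pos x i + m % q ^ N) / Q ≤ (pos y' i + m % q ^ N) / Q + 4 := by
          rw [← Nat.add_mul_div_right _ _ hQ]; exact Nat.div_le_div_right oz
        have a2 : (pos y' i + m % q ^ N) / Q ≤ (pos x i + m % q ^ N) / Q + 4 := by
          rw [← Nat.add_mul_div_right _ _ hQ]; exact Nat.div_le_div_right oz
        exact ⟨Nat.sub_le_iff_le_add.2 a1, a2⟩
    _ ≤ _ := by
        rw [Fintype.card_piFinset]
        calc _ ≤ ∏ i : Fin d, 9 := Finset.prod_le_prod' fun i _ => by simp only [Nat.card_Icc]; omega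
          _ = _ := zs
end CH
end
section
variable {X : Type} [Fintype X] {w : X → ℝ} {b : X → ℂ} {δ : ℝ} {d : ℕ}
lemma BB_smul (k : X → X → ℂ) (a c : ℂ) (φ ψ : X → ℂ) :
    Bw w k (fun x => a * φ x) (fun x => c * ψ x) = a * c * Bw w k φ ψ := by
  simp only [Bw, mul_sum]
  exact sum_congr rfl fun x _ => sum_congr rfl fun y _ => by ring
lemma avg_ind (hw : ∀ x, 0 < w x) (s : Finset ℕ) (B : ℕ → X → Prop) {p : X → ℝ} (hp : ∀ x, 0 ≤ p x) {a : ℝ}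
    (hB : ∀ x, ((s.filter (fun m => B m x)).card : ℝ) ≤ a) :
    ∑ m ∈ s, ∑ x, w x * (if B m x then p x else 0) ≤ a * ∑ x, w x * p x := by
  rw [sum_comm, mul_sum]
  refine sum_le_sum fun x _ => ?_
  rw [← mul_sum, ← sum_filter, sum_const, nsmul_eq_mul]
  have := hp x; have := hw x
  calc _ ≤ w x * (a * p x) := by have := hB x; gcongr
    _ = _ := by ring
namespace GP
variable {I : Type} {M : ℕ}
def STa (K : KD w b) (S S' : TM w b M δ I) (τ : ℝ) (f : X → ℂ) : ℝ :=
  ∑ k ∈ rg M, ∑ j ∈ rg M, if k ≤ j + 1 ∧ j ≤ k + 1 then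
    ∑ y, w y * (if strip K S' τ (j+1) y then S.ue f k y else 0) else 0
lemma STR_eq (K : KD w b) (S S' : TM w b M δ I) (τ : ℝ) (f g : X → ℂ) :
    STR K S S' τ f g = STa K S S' τ f + STa K S' S τ g := by
  unfold STR STa
  rw [sum_comm (f := fun k j => if k ≤ j + 1 ∧ j ≤ k + 1 then
    ∑ y, w y * (if strip K S τ (j+1) y then S'.ue g k y else 0) else 0)]
  simp only [← sum_add_distrib]
  refine sum_congr rfl fun k _ => sum_congr rfl fun j _ => ?_
  by_cases h : k ≤ j + 1 ∧ j ≤ k + 1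
  · rw [if_pos h, if_pos h, if_pos ⟨h.2, h.1⟩]; simp only [sum_add_distrib]
  · rw [if_neg h, if_neg h, if_neg (fun h' => h ⟨h'.2, h'.1⟩), add_zero]
end GP
namespace CH
variable {K : KD w b} {c : ℝ} {q N : ℕ} {h : ℝ} {pos : X → Fin d → ℕ} (H : CH K δ c q N h pos)
include H
def v (x : X) : ℝ := (((rg (q ^ N)).filter (fun m => H.keep m x)).card : ℝ) / q ^ N
lemma v_ge (x : X) : c / 2 ≤ H.v x := by
  have hT : (0:ℝ) < q ^ N := by have := H.hq; positivity
  unfold v; rw [le_div_iff₀ hT]; exact H.keep_prob x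
def fm (f : X → ℂ) (m : ℕ) (x : X) : ℂ := if H.keep m x then f x / H.v x else 0
lemma fm_e (f : X → ℂ) (m j : ℕ) (x : X) (he : (H.S m).e (H.fm f m) j x ≠ 0) : K.ℓ (j+1) ≤ K.A * K.Ψ x := by
  unfold TM.e at he
  split_ifs at he with h1
  · unfold fm at he
    split_ifs at he with h2
    · exact h2 j h1.1 h1.2
    · exact absurd rfl he
  · exact absurd rfl he
lemma fm_nq (f : X → ℂ) (m : ℕ) : nq w (H.fm f m) ≤ 4 / c ^ 2 * nq w f := by
  unfold nq
  rw [mul_sum]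
  refine sum_le_sum fun x _ => ?_
  have hw := H.hw x; have hc := H.hc; have hv := H.v_ge x
  have hv0 : 0 < H.v x := lz
  have : ‖H.fm f m x‖ ^ 2 ≤ 4 / c ^ 2 * ‖f x‖ ^ 2 := by
    unfold fm; split_ifs
    · rw [norm_div, norm_real, norm_of_nonneg hv0.le, div_pow]
      rw [div_le_iff₀ pz]
      have h1 : 1 ≤ 4 / c ^ 2 * H.v x ^ 2 := by
        rw [div_mul_eq_mul_div, le_div_iff₀ pz]; nlinarith
      nlinarith
    · simp; positivity
  nlinarith
lemma fm_sum (f : X → ℂ) (x : X) : f x = ∑ m ∈ rg (q ^ N), ((q:ℂ) ^ N)⁻¹ * H.fm f m x := by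
  have hc := H.hc; have hv := H.v_ge x
  have hq := H.hq
  have hv0 : H.v x ≠ 0 := lz
  have hq0 : (q:ℂ) ^ N ≠ 0 := by
    have : (q:ℂ) ≠ 0 := by exact_mod_cast (by omega : q ≠ 0)
    positivity
  rw [← mul_sum]
  unfold fm
  rw [← sum_filter, sum_const, nsmul_eq_mul]
  have e : ((((rg (q ^ N)).filter (fun m => H.keep m x)).card : ℕ) : ℂ) = (H.v x : ℂ) * (q:ℂ) ^ N := by
    unfold v; push_cast; field_simp
  rw [e]
  have : (H.v x : ℂ) ≠ 0 := by exact_mod_cast hv0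
  field_simp
lemma sumSTa {τ : ℝ} (hτ : 0 < τ) (m : ℕ) (f : X → ℂ) :
    ∑ m' ∈ rg (q ^ N), GP.STa K (H.S m) (H.S m') τ f ≤ q ^ N * (2 * d * τ) * (3 * (19 * δ⁻¹ ^ 4 * nq w f)) := by
  unfold GP.STa
  have hue := (H.S m).ue_nonneg f
  have hb := sum_band (N+1) (fun k => ∑ y, w y * (H.S m).ue f k y) (fun k => sum_nonneg fun y _ =>
    mul_nonneg (H.hw y).le (hue k y))
  have hSQ := (H.S m).SQ f
  rw [sum_comm]
  calc _ ≤ ∑ k ∈ rg (N+1), ∑ j ∈ rg (N+1), q ^ N * (2 * d * τ) *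
        (if k ≤ j + 1 ∧ j ≤ k + 1 then ∑ y, w y * (H.S m).ue f k y else 0) := by
        refine sum_le_sum fun k _ => ?_
        rw [sum_comm]
        refine sum_le_sum fun j hj => ?_
        by_cases hkj : k ≤ j + 1 ∧ j ≤ k + 1
        · simp only [hkj]
          exact avg_ind H.hw _ _ (hue k) (fun x => H.strip_prob hτ oz (by have := Finset.mem_range.1 hj; omega) x)
        · simp [hkj]
    _ = q ^ N * (2 * d * τ) * _ := by simp only [← mul_sum]
    _ ≤ _ := mll (hb.trans lz) pz
lemma sumBAD (m : ℕ) (f : X → ℂ) :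
    ∑ m' ∈ rg (q ^ N), GP.BAD (H.S m) (H.PP m m') f ≤ q ^ N * (8 * d * K.u) * (19 * δ⁻¹ ^ 4 * nq w f) := by
  unfold GP.BAD
  have hu := K.hu
  rw [sum_comm]
  calc _ ≤ ∑ k ∈ rg (N+1), q ^ N * (8 * d * K.u) * ∑ y, w y * (H.S m).ue f k y :=
        sum_le_sum fun k hk => by
          have := avg_ind H.hw (rg (q ^ N)) (fun m' x => ¬ H.PP m m' k x) ((H.S m).ue_nonneg f k)
            (fun x => by convert H.bad_prob m k (by have := Finset.mem_range.1 hk; omega) x)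
          refine le_trans (le_of_eq ?_) this
          exact sum_congr rfl fun m' _ => sum_congr rfl fun x _ => by congr
    _ = q ^ N * (8 * d * K.u) * _ := by rw [← mul_sum]
    _ ≤ _ := mll ((H.S m).SQ f) pz
set_option maxHeartbeats 800000 in
lemma step {τ : ℝ} (hτ : 0 < τ) (hτ1 : τ ≤ 1) {R lam : ℝ} (hR : 0 ≤ R) (hl : 0 < lam)
    (hN : ∀ φ ψ, ∀ lam > 0, ‖Bw w K.k φ ψ‖ ≤ R * (lam⁻¹ * nq w φ + lam * nq w ψ)) (f g : X → ℂ) :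
    ‖Bw w K.k f g‖ ≤ 4 / c ^ 2 * (2 * GP.Cd K δ + 57 * δ⁻¹ ^ 4 * GP.C4 K τ +
      R * lam * (1 + 3042 * δ⁻¹ ^ 6 + 114 * δ⁻¹ ^ 4 * 9 ^ d)
      + R * lam⁻¹ * (19 * δ⁻¹ ^ 4) * (12 * 9 ^ d * d * τ + 640 * δ⁻¹ ^ 2 * d * K.u)) * (nq w f + nq w g) := by
  have hδ := H.hδ
  set T : ℝ := q ^ N with hTd
  have hT : 0 < T := by have := H.hq; rw [hTd]; positivity
  set s := rg (q ^ N) with hs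
  have hsc : (s.card : ℝ) = T := by rw [hs, card_range, hTd]; push_cast; rfl
  have e : Bw w K.k f g = ∑ m ∈ s, ∑ m' ∈ s, ((q:ℂ) ^ N)⁻¹ * ((q:ℂ) ^ N)⁻¹ * Bw w K.k (H.fm f m) (H.fm g m') := by
    conv_lhs => rw [show f = fun x => ∑ m ∈ s, ((q:ℂ) ^ N)⁻¹ * H.fm f m x from funext (H.fm_sum f),
      show g = fun x => ∑ m ∈ s, ((q:ℂ) ^ N)⁻¹ * H.fm g m x from funext (H.fm_sum g)]
    simp only [KD.BB_sum_l, KD.BB_sum_r, BB_smul]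
    rw [sum_comm]
  set c1 := 2 * GP.Cd K δ + 57 * δ⁻¹ ^ 4 * GP.C4 K τ + R * lam * (1 + 3042 * δ⁻¹ ^ 6 + 114 * δ⁻¹ ^ 4 * (9 ^ d : ℕ)) with hc1
  have hc10 : 0 ≤ c1 := by
    have hn := K.hn; have hα := K.hα; have hC := K.hC; have hCt := K.hCt
    have hρ := K.hρ; have hA := K.hA
    rw [hc1]; unfold GP.C4 GP.Cd; positivity
  set F := 4 / c ^ 2 * nq w f with hF
  set G := 4 / c ^ 2 * nq w g with hG
  have nf := H.fm_nq f
  have ng := H.fm_nq g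
  have hb : ∀ m m', ‖((q:ℂ) ^ N)⁻¹ * ((q:ℂ) ^ N)⁻¹ * Bw w K.k (H.fm f m) (H.fm g m')‖ ≤ T⁻¹ * T⁻¹ * (c1 * (F + G)
      + R * lam⁻¹ * (2 * 9 ^ d * (GP.STa K (H.S m) (H.S m') τ (H.fm f m) + GP.STa K (H.S m') (H.S m) τ (H.fm g m'))
        + 80 * δ⁻¹ ^ 2 * (GP.BAD (H.S m) (H.PP m m') (H.fm f m) + GP.BAD (H.S m') (H.PP m' m) (H.fm g m')))) := by
    intro m m'
    rw [norm_mul, norm_mul, norm_inv, norm_pow, Complex.norm_natCast]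
    refine mll ?_ pz
    refine ((H.gp m m').assem (H.fm f m) (H.fm g m') (H.fm_e f m) (H.fm_e g m') hτ hτ1 (κ := 9 ^ d)
      (Nat.one_le_pow _ _ nz) (fun k x => by convert H.kap m k x) hR hl hN).trans ?_
    rw [GP.STR_eq]
    push_cast
    refine add_le_add ?_ le_rfl
    have := mll (add_le_add (nf m) (ng m')) hc10
    rw [hc1] at this ⊢
    push_cast at this ⊢
    exact this
  have A1 : ∑ m ∈ s, ∑ m' ∈ s, GP.STa K (H.S m) (H.S m') τ (H.fm f m) ≤ T * (T * (2 * d * τ) * (3 * (19 * δ⁻¹ ^ 4 * F))) := by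
    calc _ ≤ ∑ m ∈ s, T * (2 * d * τ) * (3 * (19 * δ⁻¹ ^ 4 * F)) := sum_le_sum fun m _ =>
          (H.sumSTa hτ m _).trans (by have := nf m; gcongr)
      _ = _ := by rw [sum_const, nsmul_eq_mul, hsc]
  have A2 : ∑ m ∈ s, ∑ m' ∈ s, GP.STa K (H.S m') (H.S m) τ (H.fm g m') ≤ T * (T * (2 * d * τ) * (3 * (19 * δ⁻¹ ^ 4 * G))) := by
    rw [sum_comm]
    calc _ ≤ ∑ m ∈ s, T * (2 * d * τ) * (3 * (19 * δ⁻¹ ^ 4 * G)) := sum_le_sum fun m _ =>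
          (H.sumSTa hτ m _).trans (by have := ng m; gcongr)
      _ = _ := by rw [sum_const, nsmul_eq_mul, hsc]
  have hu := K.hu
  have B1 : ∑ m ∈ s, ∑ m' ∈ s, GP.BAD (H.S m) (H.PP m m') (H.fm f m) ≤ T * (T * (8 * d * K.u) * (19 * δ⁻¹ ^ 4 * F)) := by
    calc _ ≤ ∑ m ∈ s, T * (8 * d * K.u) * (19 * δ⁻¹ ^ 4 * F) := sum_le_sum fun m _ =>
          (H.sumBAD m _).trans (by have := nf m; gcongr)
      _ = _ := by rw [sum_const, nsmul_eq_mul, hsc]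
  have B2 : ∑ m ∈ s, ∑ m' ∈ s, GP.BAD (H.S m') (H.PP m' m) (H.fm g m') ≤ T * (T * (8 * d * K.u) * (19 * δ⁻¹ ^ 4 * G)) := by
    rw [sum_comm]
    calc _ ≤ ∑ m ∈ s, T * (8 * d * K.u) * (19 * δ⁻¹ ^ 4 * G) := sum_le_sum fun m _ =>
          (H.sumBAD m _).trans (by have := ng m; gcongr)
      _ = _ := by rw [sum_const, nsmul_eq_mul, hsc]
  rw [e]
  calc _ ≤ ∑ m ∈ s, ∑ m' ∈ s, T⁻¹ * T⁻¹ * (c1 * (F + G)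
      + R * lam⁻¹ * (2 * 9 ^ d * (GP.STa K (H.S m) (H.S m') τ (H.fm f m) + GP.STa K (H.S m') (H.S m) τ (H.fm g m'))
        + 80 * δ⁻¹ ^ 2 * (GP.BAD (H.S m) (H.PP m m') (H.fm f m) + GP.BAD (H.S m') (H.PP m' m) (H.fm g m')))) :=
        (norm_sum_le _ _).trans (sum_le_sum fun m _ => (norm_sum_le _ _).trans (sum_le_sum fun m' _ => hb m m'))
    _ = T⁻¹ * T⁻¹ * (T * (T * (c1 * (F + G))) + R * lam⁻¹ * (2 * 9 ^ d *
          (∑ m ∈ s, ∑ m' ∈ s, GP.STa K (H.S m) (H.S m') τ (H.fm f m) + ∑ m ∈ s, ∑ m' ∈ s, GP.STa K (H.S m') (H.S m) τ (H.fm g m'))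
          + 80 * δ⁻¹ ^ 2 * (∑ m ∈ s, ∑ m' ∈ s, GP.BAD (H.S m) (H.PP m m') (H.fm f m) + ∑ m ∈ s, ∑ m' ∈ s, GP.BAD (H.S m') (H.PP m' m) (H.fm g m')))) := by
        simp only [← mul_sum, sum_add_distrib, sum_const, nsmul_eq_mul, hsc]
        ring
    _ ≤ T⁻¹ * T⁻¹ * (T * (T * (c1 * (F + G))) + R * lam⁻¹ * (2 * 9 ^ d *
          (T * (T * (2 * d * τ) * (3 * (19 * δ⁻¹ ^ 4 * F))) + T * (T * (2 * d * τ) * (3 * (19 * δ⁻¹ ^ 4 * G))))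
          + 80 * δ⁻¹ ^ 2 * (T * (T * (8 * d * K.u) * (19 * δ⁻¹ ^ 4 * F)) + T * (T * (8 * d * K.u) * (19 * δ⁻¹ ^ 4 * G))))) := by
        gcongr
    _ = _ := by
        rw [hc1, hF, hG]; push_cast; field_simp; ring
end CH
end
section
lemma small_par (M : ℝ) (hM : 0 ≤ M) : ∃ τ : ℝ, 0 < τ ∧ τ ≤ 1/2 ∧ M * τ ≤ 1/8 :=
  ⟨1 / (8 * M + 2), by positivity, by rw [div_le_div_iff₀ pz pz]; linarith,
    by rw [mul_one_div, div_le_div_iff₀ pz pz]; linarith⟩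
lemma big_q {A u n α : ℝ} (hu : 0 < u) (hα : 0 < α) : ∃ q : ℕ, 2 ≤ q ∧ 4 * A * (q:ℝ)⁻¹ ≤ u ∧ ((q:ℝ)⁻¹) ^ α ≤ 1/2 * u ^ (n + α) := by
  have h1 : Tendsto (fun q : ℕ => 4 * A * (q:ℝ)⁻¹) atTop (nhds (4 * A * 0)) :=
    tendsto_inv_atTop_nhds_zero_nat.const_mul _
  have h2 :=
    (tendsto_inv_atTop_nhds_zero_nat).rpow_const (Or.inr hα.le)
  rw [mul_zero] at h1
  rw [Real.zero_rpow hα.ne'] at h2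
  have h3 : 0 < 1/2 * u ^ (n + α) := pz
  obtain ⟨q, ⟨ha, hb⟩, hc⟩ := (((h1.eventually (gt_mem_nhds hu)).and (h2.eventually (gt_mem_nhds h3))).and
    (eventually_ge_atTop 2)).exists
  exact ⟨q, hc, ha.le, hb.le⟩
lemma nq_smul {X : Type} [Fintype X] {w : X → ℝ} (a : ℂ) (f : X → ℂ) : nq w (fun x => a * f x) = ‖a‖ ^ 2 * nq w f := by
  simp only [nq, norm_mul, mul_sum]
  exact sum_congr rfl fun x _ => by ring
lemma BB_lam {X : Type} [Fintype X] {w : X → ℝ} (k : X → X → ℂ) {D : ℝ}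
    (h : ∀ f g, ‖Bw w k f g‖ ≤ D * (nq w f + nq w g)) (f g : X → ℂ) (lam : ℝ) (hl : 0 < lam) :
    ‖Bw w k f g‖ ≤ D * (lam⁻¹ * nq w f + lam * nq w g) := by
  have hs := Real.sqrt_pos.2 hl
  have hs2 := sq_sqrt hl.le
  have := h (fun x => ((√lam)⁻¹ : ℝ) * f x) (fun x => ((√lam : ℝ) : ℂ) * g x)
  rw [BB_smul, nq_smul, nq_smul, norm_real, norm_real, norm_of_nonneg pz,
    norm_of_nonneg pz, inv_pow, hs2, ← Complex.ofReal_mul, inv_mul_cancel₀ hs.ne', Complex.ofReal_one, one_mul] at this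
  exact this
lemma BB_crude {X : Type} [Fintype X] {w : X → ℝ} (hw : ∀ x, 0 < w x) (k : X → X → ℂ) :
    ∃ R, 0 ≤ R ∧ ∀ f g, ‖Bw w k f g‖ ≤ R * (nq w f + nq w g) := by
  refine ⟨∑ x, ∑ y, (w x + w y) * ‖k x y‖, sum_nonneg fun x _ => sum_nonneg fun y _ =>
    mul_nonneg (add_nonneg (hw x).le (hw y).le) (norm_nonneg _), fun f g => ?_⟩
  have hn : ∀ (φ : X → ℂ) x, w x * ‖φ x‖ ^ 2 ≤ nq w φ := fun φ x =>
    single_le_sum (f := fun x => w x * ‖φ x‖ ^ 2) (fun y _ => mul_nonneg (hw y).le pz) (Finset.mem_univ x)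
  unfold Bw
  simp only [sum_mul]
  refine (norm_sum_le _ _).trans (sum_le_sum fun x _ => (norm_sum_le _ _).trans (sum_le_sum fun y _ => ?_))
  have h1 := hn f y; have h2 := hn g x
  have wx := hw x; have wy := hw y
  rw [norm_mul, norm_mul, norm_mul, norm_mul, norm_real, norm_real, norm_of_nonneg wx.le, norm_of_nonneg wy.le]
  have h4 : ‖f y‖ * ‖g x‖ ≤ ‖f y‖ ^ 2 + ‖g x‖ ^ 2 := by nlinarith
  have f0 := le_trans pz h1
  have g0 := le_trans pz h2
  calc _ = ‖k x y‖ * (w x * w y * (‖f y‖ * ‖g x‖)) := by ring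
    _ ≤ ‖k x y‖ * (w x * w y * (‖f y‖ ^ 2 + ‖g x‖ ^ 2)) := by gcongr
    _ = ‖k x y‖ * (w x * (w y * ‖f y‖ ^ 2) + w y * (w x * ‖g x‖ ^ 2)) := by ring
    _ ≤ ‖k x y‖ * (w x * nq w f + w y * nq w g) := by gcongr
    _ ≤ ‖k x y‖ * ((w x + w y) * (nq w f + nq w g)) := by gcongr; nlinarith
    _ = _ := by ring
theorem core (d : ℕ) {n α C Ct Λ δ c : ℝ} (hn : 0 < n) (hα : 0 < α) (hC : 0 < C) (hCt : 0 < Ct) (hδ : 0 < δ) (hc : 0 < c) :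
    ∃ A u Cb : ℝ, ∃ q : ℕ, 1 ≤ A ∧ 4 * d ≤ c * A ∧ 0 < u ∧ u ≤ 1/2 ∧ 2 ≤ q ∧ 4 * A * (q:ℝ)⁻¹ ≤ u ∧
      ((q:ℝ)⁻¹) ^ α ≤ 1/2 * u ^ (n + α) ∧ 0 ≤ Cb ∧
      ∀ (X : Type) [Fintype X] (w : X → ℝ) (b : X → ℂ) (K : KD w b) (N : ℕ) (h : ℝ) (pos : X → Fin d → ℕ),
        K.n = n → K.α = α → K.C = C → K.Ct = Ct → K.Λ = Λ → K.A = A → K.u = u → CH K δ c q N h pos →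
        ∀ f g, ‖Bw w K.k f g‖ ≤ Cb * (nq w f + nq w g) := by
  set D1 : ℝ := 1 + 3042 * δ⁻¹ ^ 6 + 114 * δ⁻¹ ^ 4 * 9 ^ d with hD1
  have hD10 : 0 < D1 := pz
  set lam : ℝ := c ^ 2 / (16 * D1) with hlam
  have hl : 0 < lam := pz
  set E : ℝ := 4 / c ^ 2 * lam⁻¹ * (19 * δ⁻¹ ^ 4) with hE
  have hE0 : 0 < E := pz
  obtain ⟨τ, hτ, hτ1, hτE⟩ := small_par (E * (12 * 9 ^ d * d)) pz
  obtain ⟨u, hu, hu1, huE⟩ := small_par (E * (640 * δ⁻¹ ^ 2 * d)) pz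
  set A : ℝ := 1 + 4 * d / c with hA
  have hA1 : 1 ≤ A := by rw [hA]; have : 0 ≤ 4 * (d:ℝ) / c := pz
                         linarith
  obtain ⟨q, hq2, hq3, hq4⟩ := big_q (A := A) (n := n) hu hα
  set C6 : ℝ := 4 / c ^ 2 * (2 * (19*δ⁻¹^4 + 200000*δ⁻¹^10*Λ^2 + 2*C*(2*A/(q:ℝ)⁻¹)^(n+α)*Ct*(19*δ⁻¹^4))
    + 57 * δ⁻¹ ^ 4 * (2 * (C * (2 / (q:ℝ)⁻¹) ^ (n + α) * Ct) +
  6 * (C * ((τ * (q:ℝ)⁻¹ ^ 2 / A)⁻¹) ^ n * 6 ^ (n + α) * Ct))) with hC6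
  have hq0 : (0:ℝ) < q := pz
  have hC60 : 0 ≤ C6 := pz
  refine ⟨A, u, 2 * C6, q, hA1, ?_, hu, hu1, hq2, hq3, hq4, by positivity, ?_⟩
  · rw [hA]; have : c * (4 * d / c) = 4 * d := by field_simp
    nlinarith
  intro X _ w b K N h pos e1 e2 e3 e4 e5 e6 e7 H
  have key : ∀ R, 0 ≤ R → (∀ f g, ‖Bw w K.k f g‖ ≤ R * (nq w f + nq w g)) →
      ∀ f g, ‖Bw w K.k f g‖ ≤ (C6 + R / 2) * (nq w f + nq w g) := by
    intro R hR h1 f g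
    refine (H.step hτ lz hR hl (fun φ ψ lam hl => BB_lam K.k h1 φ ψ lam hl) f g).trans ?_
    have nf : 0 ≤ nq w f := sum_nonneg fun y _ => mul_nonneg (H.hw y).le pz
    have ng : 0 ≤ nq w g := sum_nonneg fun y _ => mul_nonneg (H.hw y).le pz
    refine mul_le_mul_of_nonneg_right ?_ lz
    rw [GP.Cd, GP.C4, e1, e2, e3, e4, e5, e6, e7, H.eρ, ← hD1]
    have x1 : 4 / c ^ 2 * (R * lam * D1) = R / 4 := by rw [hlam]; field_simp; ring
    have x2 : 4 / c ^ 2 * (R * lam⁻¹ * (19 * δ⁻¹ ^ 4) * (12 * 9 ^ d * d * τ + 640 * δ⁻¹ ^ 2 * d * u))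
      = R * (E * (12 * 9 ^ d * d) * τ + E * (640 * δ⁻¹ ^ 2 * d) * u) := by rw [hE]; ring
    have x3 : R * (E * (12 * 9 ^ d * d) * τ + E * (640 * δ⁻¹ ^ 2 * d) * u) ≤ R * (1/8 + 1/8) := by gcongr
    rw [mul_add, mul_add, x1, x2]
    linarith [hC6]
  obtain ⟨R0, hR0, hR⟩ := BB_crude H.hw K.k
  have it : ∀ j : ℕ, ∀ f g, ‖Bw w K.k f g‖ ≤ (2 * C6 + R0 * (1/2) ^ j) * (nq w f + nq w g) := by
    intro j
    induction j with
    | zero =>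
      intro f g
      have nf : 0 ≤ nq w f := sum_nonneg fun y _ => mul_nonneg (H.hw y).le pz
      have ng : 0 ≤ nq w g := sum_nonneg fun y _ => mul_nonneg (H.hw y).le pz
      refine (hR f g).trans (mul_le_mul_of_nonneg_right ?_ lz)
      simp; linarith
    | succ j ih =>
      intro f g
      refine (key _ pz ih f g).trans (le_of_eq ?_)
      rw [pow_succ]; ring
  intro f g
  have ht : Tendsto (fun j : ℕ => (2 * C6 + R0 * (1/2:ℝ) ^ j) * (nq w f + nq w g)) atTop
      (nhds ((2 * C6 + R0 * 0) * (nq w f + nq w g))) :=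
    (((_root_.tendsto_pow_atTop_nhds_zero_of_lt_one nz nz).const_mul R0).const_add _).mul_const _
  rw [mul_zero, add_zero] at ht
  exact ge_of_tendsto' ht fun j => it j f g
end
section
variable {Y : Type} [MetricSpace Y] [MeasurableSpace Y] [OpensMeasurableSpace Y] [SecondCountableTopology Y]
lemma vit {Z : Type} [MetricSpace Z] [MeasurableSpace Z] [OpensMeasurableSpace Z] [SecondCountableTopology Z] (S : Set Z)
    (r : Z → ℝ) (R : ℝ) (hr : ∀ x ∈ S, 0 < r x ∧ r x ≤ R) :
    ∃ u ⊆ S, u.Countable ∧ u.PairwiseDisjoint (fun x => closedBall x (r x)) ∧ S ⊆ ⋃ x ∈ u, closedBall x (5 * r x) := by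
  obtain ⟨u, hu, hd, hc⟩ := Vitali.exists_disjoint_subfamily_covering_enlargement_closedBall S id r R (fun a ha => (hr a ha).2) 5 nz
  refine ⟨u, hu, hd.countable_of_nonempty_interior fun x hx => ?_, hd, fun x hx => ?_⟩
  · exact ⟨x, ball_subset_interior_closedBall (mem_ball_self (hr x (hu hx)).1)⟩
  · obtain ⟨y, hy, h⟩ := hc x hx
    exact mem_biUnion hy (h (mem_closedBall_self (hr x hx).1.le))
lemma weak11 (μ ν : Measure Y) (L : ℝ≥0∞) (S : Set Y)
    (h : ∀ x ∈ S, ∃ r > 0, L * μ (closedBall x (5 * r)) ≤ ν (closedBall x r)) : L * μ S ≤ ν univ := by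
  choose! r hr0 hr using h
  have e : S = ⋃ k : ℕ, S ∩ {x | r x ≤ k} := by
    ext x; simp only [mem_iUnion]
    exact ⟨fun hx => (exists_nat_ge (r x)).imp fun k hk => ⟨hx, hk⟩, fun ⟨_, hx, _⟩ => hx⟩
  have hm : Monotone fun k : ℕ => S ∩ {x | r x ≤ k} := fun i j hij x hx => ⟨hx.1, show r x ≤ (j:ℝ) from le_trans hx.2 (Nat.cast_le.2 hij)⟩
  rw [e, hm.measure_iUnion, mul_iSup]
  refine iSup_le fun k => ?_
  obtain ⟨u, hu, hc, hd, hS⟩ := vit (S ∩ {x | r x ≤ k}) r k (fun x hx => ⟨hr0 x hx.1, hx.2⟩)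
  calc L * μ (S ∩ {x | r x ≤ k}) ≤ L * ∑' x : u, μ (closedBall x.1 (5 * r x.1)) := by
        gcongr; exact (measure_mono hS).trans (measure_biUnion_le μ hc _)
    _ = ∑' x : u, L * μ (closedBall x.1 (5 * r x.1)) := ENNReal.tsum_mul_left.symm
    _ ≤ ∑' x : u, ν (closedBall x.1 (r x.1)) := ENNReal.tsum_le_tsum fun x => hr x.1 (hu x.2).1
    _ = ν (⋃ x ∈ u, closedBall x (r x)) := (measure_biUnion hc hd (fun x _ => isClosed_closedBall.measurableSet)).symm
    _ ≤ _ := measure_mono (subset_univ _)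
lemma weakM (μ : Measure Y) (g : Y → ℝ≥0∞) (hg : Measurable g) (L : ℝ≥0∞) (hL : L ≠ ∞) (hf : ∀ (x : Y) r, μ (closedBall x r) ≠ ∞) (S : Set Y)
    (h : ∀ x ∈ S, ∃ r > 0, 2 * L * μ (closedBall x (5 * r)) < ∫⁻ y in closedBall x r, g y ∂μ) :
    L * μ S ≤ ∫⁻ y in {y | L < g y}, g y ∂μ := by
  have hm : MeasurableSet {y | L < g y} := measurableSet_lt measurable_const hg
  have := weak11 μ ((μ.restrict {y | L < g y}).withDensity g) L S (fun x hx => ?_)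
  · rwa [withDensity_apply _ MeasurableSet.univ, restrict_univ] at this
  obtain ⟨r, hr, h⟩ := h x hx
  refine ⟨r, hr, ?_⟩
  rw [withDensity_apply _ isClosed_closedBall.measurableSet, Measure.restrict_restrict isClosed_closedBall.measurableSet]
  have h2 : ∫⁻ y in closedBall x r, g y ∂μ ≤ ∫⁻ y in closedBall x r ∩ {y | L < g y}, g y ∂μ + L * μ (closedBall x (5 * r)) := by
    rw [← lintegral_inter_add_sdiff g (closedBall x r) hm]
    gcongr
    calc _ ≤ ∫⁻ y in closedBall x r \ {y | L < g y}, L ∂μ :=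
          setLIntegral_mono' (isClosed_closedBall.measurableSet.diff hm) fun y hy => not_lt.1 hy.2
      _ ≤ _ := by
          rw [setLIntegral_const]; gcongr
          exact sdiff_subset.trans (closedBall_subset_closedBall lz)
  have h3 := (h.trans_le h2).le
  rw [two_mul, add_mul] at h3
  exact (ENNReal.add_le_add_iff_right (mul_ne_top hL (hf _ _))).1 h3
lemma tailL {n α : ℝ} (hn : 0 < n) (hα : 0 < α) (ν : Measure Y) (x : Y) {Λ ℓ : ℝ} (hΛ : 0 ≤ Λ) (hℓ : 0 < ℓ)
    (h : ∀ r, ℓ ≤ r → ν (closedBall x r) ≤ oR (Λ * r ^ n)) :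
    ∫⁻ y, oR (ℓ ^ α / (ℓ + dist y x) ^ (n + α)) ∂ν ≤ oR (2 ^ (n + α) / (1 - 2 ^ (-α)) * Λ) := by
  have h21 : (2:ℝ) ^ (-α) < 1 := Real.rpow_lt_one_of_one_lt_of_neg nz lz
  set a : ℝ := ℓ ^ (-n) * 2 ^ (n + α) with ha
  have ha0 : 0 < a := pz
  set q : ℝ := 2 ^ (-(n + α)) with hq
  have hq0 : 0 < q := pz
  have p1 : ∀ y, oR (ℓ ^ α / (ℓ + dist y x) ^ (n + α)) ≤
      ∑' j : ℕ, (closedBall x (2 ^ j * ℓ)).indicator (fun _ => oR (a * q ^ j)) y := by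
    intro y
    have hex : ∃ j : ℕ, dist y x ≤ 2 ^ j * ℓ := by
      obtain ⟨j, hj⟩ := pow_unbounded_of_one_lt (dist y x / ℓ) (one_lt_two)
      exact ⟨j, ((div_lt_iff₀ hℓ).1 hj).le⟩
    refine le_trans ?_ (ENNReal.le_tsum (find hex))
    rw [indicator_of_mem (mem_closedBall.2 (find_spec hex))]
    apply ofReal_le_ofReal
    have hd := dist_nonneg (x := y) (y := x)
    have h3 : 2 ^ (find hex) * ℓ ≤ 2 * (ℓ + dist y x) := by
      rcases Nat.eq_zero_or_pos (find hex) with h0 | h0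
      · rw [h0]; simp; linarith
      · have := find_min hex (m := find hex - 1) oz
        push Not at this
        have e : (2:ℝ) ^ (find hex) = 2 * 2 ^ (find hex - 1) := by rw [← pow_succ']; congr 1; omega
        rw [e]; nlinarith
    rw [div_le_iff₀ pz]
    have h4 : (2 ^ (find hex) * ℓ) ^ (n + α) ≤ (2 * (ℓ + dist y x)) ^ (n + α) := Real.rpow_le_rpow pz h3 lz
    have e2 : a * q ^ (find hex) * ((2:ℝ) ^ (find hex) * ℓ) ^ (n + α) = ℓ ^ α * 2 ^ (n + α) := by
      have f1 : q ^ (find hex) * ((2:ℝ) ^ (find hex)) ^ (n + α) = 1 := by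
        rw [← Real.rpow_pow_comm nz, ← mul_pow, hq, ← Real.rpow_add nz]; simp
      have f2 : ℓ ^ (-n) * ℓ ^ (n + α) = ℓ ^ α := by rw [← Real.rpow_add hℓ]; ring_nf
      rw [ha, mul_rpow pz hℓ.le, ← f2]
      linear_combination (ℓ ^ (-n) * 2 ^ (n + α) * ℓ ^ (n + α)) * f1
    have e3 : (2 * (ℓ + dist y x)) ^ (n + α) = 2 ^ (n + α) * (ℓ + dist y x) ^ (n + α) := mul_rpow nz pz
    rw [e3] at h4
    have h5 := mll h4 (by positivity : 0 ≤ a * q ^ (find hex))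
    rw [e2] at h5
    have : (0:ℝ) < 2 ^ (n + α) := pz
    nlinarith
  calc _ ≤ ∫⁻ y, ∑' j : ℕ, (closedBall x (2 ^ j * ℓ)).indicator (fun _ => oR (a * q ^ j)) y ∂ν := lintegral_mono p1
    _ = ∑' j : ℕ, oR (a * q ^ j) * ν (closedBall x (2 ^ j * ℓ)) := by
        rw [lintegral_tsum fun j => (measurable_const.indicator isClosed_closedBall.measurableSet).aemeasurable]
        exact tsum_congr fun j => by rw [lintegral_indicator_const isClosed_closedBall.measurableSet]
    _ ≤ ∑' j : ℕ, oR (2 ^ (n + α) * Λ * (2 ^ (-α)) ^ j) := by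
        refine ENNReal.tsum_le_tsum fun j => ?_
        refine (mul_le_mul_right (h _ (le_mul_of_one_le_left hℓ.le (one_le_pow₀ nz))) _).trans ?_
        rw [← ofReal_mul pz]
        apply le_of_eq; congr 1
        have f1 : q ^ j * ((2:ℝ) ^ j) ^ n = (2 ^ (-α)) ^ j := by
          rw [← Real.rpow_pow_comm nz, ← mul_pow, hq, ← Real.rpow_add nz]; ring_nf
        have f2 : ℓ ^ (-n) * ℓ ^ n = 1 := by rw [← Real.rpow_add hℓ]; simp
        rw [ha, mul_rpow pz hℓ.le, ← f1]
        linear_combination (2 ^ (n + α) * Λ * (q ^ j * ((2:ℝ) ^ j) ^ n)) * f2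
    _ = _ := by
        rw [← ofReal_tsum_of_nonneg (fun j => by positivity) ((summable_geometric_of_lt_one pz h21).mul_left _),
          tsum_mul_left, tsum_geometric_of_lt_one pz h21]
        congr 1; ring
end
section
def ct (p t : ℝ) : ℝ := max 0 (min 1 (4 - 5 * (p / (t + p))))
lemma ct0 (p t : ℝ) : 0 ≤ ct p t := le_max_left _ _
lemma ct1 (p t : ℝ) : ct p t ≤ 1 := max_le zero_le_one (min_le_left _ _)
lemma ct_one {p t : ℝ} (hp : 0 < p) (ht : 2 * p ≤ 3 * t) : ct p t = 1 := by
  have : p / (t + p) ≤ 3 / 5 := by rw [div_le_div_iff₀ lz nz]; linarith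
  rw [ct, min_eq_left lz, max_eq_right zero_le_one]
lemma ct_zero {p t : ℝ} (hp : 0 < p) (h0 : 0 ≤ t) (ht : 4 * t ≤ p) : ct p t = 0 := by
  have : 4 / 5 ≤ p / (t + p) := by rw [div_le_div_iff₀ nz lz]; linarith
  rw [ct, max_eq_left]; exact (min_le_right _ _).trans lz
lemma ct_lip {p t p' t' r : ℝ} (hp : 0 < p) (hp' : 0 < p') (ht : 0 ≤ t) (ht' : 0 ≤ t') (h1 : |p - p'| ≤ 2 * r) (h2 : |t - t'| ≤ r) :
    |ct p t - ct p' t'| ≤ 25 * (r / (t + p)) := by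
  have a1 : |ct p t - ct p' t'| ≤ |(4 - 5 * (p / (t + p))) - (4 - 5 * (p' / (t' + p')))| := by
    unfold ct
    refine (abs_max_sub_max_le_max _ _ _ _).trans (max_le zs ?_)
    refine (abs_min_sub_min_le_max _ _ _ _).trans (max_le zs le_rfl)
  refine a1.trans ?_
  have e : (4 - 5 * (p / (t + p))) - (4 - 5 * (p' / (t' + p'))) = 5 * ((p' - p) / (t + p) + p' / (t' + p') * (((t - t') + (p - p')) / (t + p))) := by
    field_simp; ring
  rw [e, abs_mul, abs_of_pos (by norm_num : (0:ℝ) < 5)]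
  have s0 : 0 < t + p := lz
  have b1 : |(p' - p) / (t + p)| ≤ 2 * (r / (t + p)) := by
    rw [abs_div, abs_of_pos s0, abs_sub_comm, ← mul_div_assoc]; gcongr
  have b2 : |p' / (t' + p') * (((t - t') + (p - p')) / (t + p))| ≤ 1 * (3 * (r / (t + p))) := by
    rw [abs_mul]
    refine mul_le_mul ?_ ?_ (abs_nonneg _) zero_le_one
    · rw [abs_of_nonneg pz, div_le_one pz]; linarith
    · rw [abs_div, abs_of_pos s0, ← mul_div_assoc]; gcongr
      exact (abs_add_le _ _).trans lz
  have := abs_add_le ((p' - p) / (t + p)) (p' / (t' + p') * (((t - t') + (p - p')) / (t + p)))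
  linarith
structure SI {d : ℕ} (μ : Measure Eu d) (K : KT d) (n α C C0 : ℝ) : Prop where
  hn : 0 < n
  hnd : n ≤ d
  hα : 0 < α
  hα1 : α ≤ 1
  hC : 0 < C
  hC0 : 0 < C0
  gr : ∀ x r, 0 < r → μ (closedBall x r) ≤ oR (C0 * r ^ n)
  sz : ∀ x y, ‖K x y‖ ≤ C / dist x y ^ n
  sm : ∀ x y y', 2 * dist y y' ≤ dist x y → ‖K x y - K x y'‖ ≤ C * dist y y' ^ α / dist x y ^ (n + α)
  an : ∀ x y, K x y = - K y x
structure CK {E S : Type} [PseudoMetricSpace E] (K : E → E → ℂ) (n α C : ℝ) (ds : S → S → ℝ) (Ψ : S → ℝ) (ξ : S → E) (h : ℝ) : Prop where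
  hn : 0 < n
  hα : 0 < α
  hα1 : α ≤ 1
  hC : 0 < C
  sz : ∀ x y, ‖K x y‖ ≤ C / dist x y ^ n
  sm : ∀ x y y', 2 * dist y y' ≤ dist x y → ‖K x y - K x y'‖ ≤ C * dist y y' ^ α / dist x y ^ (n + α)
  d0 : ∀ x y, 0 ≤ ds x y
  ds_comm : ∀ x y, ds x y = ds y x
  tri : ∀ x y z, ds x z ≤ ds x y + ds y z
  hh : 0 ≤ h
  hΨ : ∀ x, 0 < Ψ x
  hhΨ : ∀ x, 64 * h ≤ Ψ x
  lip : ∀ x y, Ψ x ≤ Ψ y + ds x y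
  hξ : ∀ x y, |dist (ξ x) (ξ y) - ds x y| ≤ h
  dich : ∀ x y, x = y ∨ h ≤ ds x y
namespace CK
variable {E S : Type} [PseudoMetricSpace E] {K : E → E → ℂ} {n α C : ℝ} {ds : S → S → ℝ} {Ψ : S → ℝ} {ξ : S → E} {h : ℝ}
def kk (K : E → E → ℂ) (ds : S → S → ℝ) (Ψ : S → ℝ) (ξ : S → E) (x y : S) : ℂ := K (ξ x) (ξ y) * (ct (Ψ x + Ψ y) (ds x y) : ℂ)
lemma K1 (c : CK K n α C ds Ψ ξ h) (x y : S) : ‖kk K ds Ψ ξ x y‖ ≤ C * 128 * 12 ^ n / (ds x y + Ψ x + Ψ y) ^ n := by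
  have hC := c.hC
  have hx := c.hΨ x; have d0 := c.d0 x y
  have h1 := c.hhΨ x; have hd := abs_le.1 (c.hξ x y); have hn := c.hn; have hhy := c.hhΨ y
  set s := ds x y + Ψ x + Ψ y
  have s0 : 0 < s := lz
  by_cases hz : 4 * ds x y ≤ Ψ x + Ψ y
  · rw [kk, ct_zero lz d0 hz]; simp; positivity
  push Not at hz
  have hdd : s / 12 ≤ dist (ξ x) (ξ y) := lz
  have e : ‖kk K ds Ψ ξ x y‖ ≤ ‖K (ξ x) (ξ y)‖ := by
    rw [kk, norm_mul, norm_real, norm_eq_abs, abs_of_nonneg (ct0 _ _)]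
    exact mul_le_of_le_one_right (norm_nonneg _) (ct1 _ _)
  calc _ ≤ C / dist (ξ x) (ξ y) ^ n := e.trans (c.sz _ _)
    _ ≤ C / (s / 12) ^ n := by gcongr
    _ = C * 12 ^ n / s ^ n := by rw [div_rpow s0.le nz]; field_simp
    _ ≤ _ := by
        gcongr; nlinarith
lemma K2 (c : CK K n α C ds Ψ ξ h) (x y y' : S) (r : ℝ) (hr : 0 < r) (hy : ds y y' ≤ r) (h4 : 4 * r ≤ ds x y + Ψ x + Ψ y) :
    ‖kk K ds Ψ ξ x y - kk K ds Ψ ξ x y'‖ ≤ C * (10 ^ 6 * 24 ^ n) * r ^ α / (ds x y + Ψ x + Ψ y) ^ (n + α) := by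
  have hC := c.hC; have hn := c.hn; have hα := c.hα; have hα1 := c.hα1; have hh := c.hh
  have px := c.hΨ x; have py := c.hΨ y; have py' := c.hΨ y'
  have d0 := c.d0 x y; have d0' := c.d0 x y'
  have hx1 := c.hhΨ x; have hy1 := c.hhΨ y; have hy1' := c.hhΨ y'
  have l1 := c.lip y y'; have l2 := c.lip y' y; have t1 := c.tri x y y'; have t2 := c.tri x y' y
  rw [c.ds_comm y' y] at l2 t2
  set s := ds x y + Ψ x + Ψ y with hs
  have s0 : 0 < s := lz
  have rs0 : 0 < r / s := pz
  have split : r ^ α / s ^ (n + α) = (r / s) ^ α / s ^ n := by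
    rw [div_rpow hr.le s0.le, Real.rpow_add s0]; field_simp
  rw [mul_div_assoc, split, mul_div_assoc', div_eq_mul_inv]
  rcases c.dich y y' with rfl | hhy
  · simp; positivity
  have sn : (0:ℝ) < s ^ n := pz
  have f12 : (1:ℝ) ≤ 12 ^ n := Real.one_le_rpow nz hn.le
  have f24 : (12:ℝ) ^ n * 2 ^ n = 24 ^ n := by rw [← mul_rpow nz nz]; norm_num
  have f2 : (1:ℝ) ≤ 2 ^ n := Real.one_le_rpow nz hn.le
  have rsle : r / s ≤ 1 := by rw [div_le_one s0]; linarith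
  have rsα : r / s ≤ (r / s) ^ α := by
    calc r / s = (r / s) ^ (1:ℝ) := (Real.rpow_one _).symm
      _ ≤ _ := Real.rpow_le_rpow_of_exponent_ge rs0 rsle hα1
  have rsα0 : 0 < (r / s) ^ α := pz
  by_cases hsr : s ≤ 200 * r
  · have k1 := c.K1 x y; have k2 := c.K1 x y'
    have e2 : C * 128 * 12 ^ n / (ds x y' + Ψ x + Ψ y') ^ n ≤ C * 128 * 24 ^ n * (s ^ n)⁻¹ := by
      have : s / 2 ≤ ds x y' + Ψ x + Ψ y' := lz
      calc _ ≤ C * 128 * 12 ^ n / (s / 2) ^ n := by gcongr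
        _ = _ := by rw [div_rpow s0.le nz, ← f24]; field_simp
    have e1 : C * 128 * 12 ^ n / s ^ n ≤ C * 128 * 24 ^ n * (s ^ n)⁻¹ := by
      rw [div_eq_mul_inv, ← f24]; gcongr; nlinarith
    have e3 : 1 ≤ 200 * (r / s) := by rw [← mul_div_assoc, le_div_iff₀ s0]; linarith
    have e4 : C * 256 * 24 ^ n * (s ^ n)⁻¹ ≤ C * (10 ^ 6 * 24 ^ n) * (r / s) ^ α * (s ^ n)⁻¹ := by
      have : C * 256 * 24 ^ n * 1 ≤ C * 256 * 24 ^ n * (200 * (r / s) ^ α) := by gcongr; linarith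
      have p : 0 < C * 24 ^ n * (r / s) ^ α := pz
      refine mul_le_mul_of_nonneg_right ?_ pz; linarith
    refine (norm_sub_le _ _).trans ?_
    rw [← hs] at k1
    linarith
  push Not at hsr
  by_cases hz : ds x y < s / 6
  · have z1 : ct (Ψ x + Ψ y) (ds x y) = 0 := ct_zero lz d0 lz
    have z2 : ct (Ψ x + Ψ y') (ds x y') = 0 := ct_zero lz d0' lz
    rw [kk, kk, z1, z2]; simp; positivity
  push Not at hz
  have hd := abs_le.1 (c.hξ x y)
  have hd2 := abs_le.1 (c.hξ y y')
  have D1 : s / 12 ≤ dist (ξ x) (ξ y) := lz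
  have D2 : dist (ξ y) (ξ y') ≤ 2 * r := lz
  have b1 : ‖K (ξ x) (ξ y) - K (ξ x) (ξ y')‖ ≤ C * 24 * 12 ^ n * (r / s) ^ α * (s ^ n)⁻¹ := by
    refine (c.sm _ _ _ lz).trans ?_
    calc _ ≤ C * (2 * r) ^ α / (s / 12) ^ (n + α) := by gcongr
      _ = C * (2 ^ α * 12 ^ α) * 12 ^ n * (r / s) ^ α * (s ^ n)⁻¹ := by
        rw [mul_rpow nz hr.le, div_rpow s0.le nz, Real.rpow_add s0, Real.rpow_add nz, div_rpow hr.le s0.le]; field_simp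
      _ ≤ _ := by
        gcongr
        rw [← mul_rpow nz nz]
        calc (2 * 12 : ℝ) ^ α ≤ (2 * 12) ^ (1:ℝ) := Real.rpow_le_rpow_of_exponent_le nz hα1
          _ = 24 := nz
  have b2 : ‖K (ξ x) (ξ y)‖ ≤ C * 12 ^ n * (s ^ n)⁻¹ := by
    refine (c.sz _ _).trans ?_
    calc _ ≤ C / (s / 12) ^ n := by gcongr
      _ = _ := by rw [div_rpow s0.le nz]; field_simp
  have b3 : |ct (Ψ x + Ψ y) (ds x y) - ct (Ψ x + Ψ y') (ds x y')| ≤ 25 * (r / s) ^ α := by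
    have := ct_lip (p := Ψ x + Ψ y) (t := ds x y) (p' := Ψ x + Ψ y') (t' := ds x y') (r := r) lz lz d0 d0'
      (by rw [abs_le]; constructor <;> linarith) (by rw [abs_le]; constructor <;> linarith)
    rw [← add_assoc] at this
    linarith
  have e : kk K ds Ψ ξ x y - kk K ds Ψ ξ x y' = (K (ξ x) (ξ y) - K (ξ x) (ξ y')) * (ct (Ψ x + Ψ y') (ds x y') : ℂ)
      + K (ξ x) (ξ y) * ((ct (Ψ x + Ψ y) (ds x y) - ct (Ψ x + Ψ y') (ds x y') : ℝ) : ℂ) := by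
    rw [kk, kk]; push_cast; ring
  rw [e]
  refine (norm_add_le _ _).trans ?_
  rw [norm_mul, norm_mul, norm_real, norm_real, norm_eq_abs, norm_eq_abs, abs_of_nonneg (ct0 _ _)]
  have c1 : ‖K (ξ x) (ξ y) - K (ξ x) (ξ y')‖ * ct (Ψ x + Ψ y') (ds x y') ≤ C * 24 * 12 ^ n * (r / s) ^ α * (s ^ n)⁻¹ :=
    (mul_le_of_le_one_right (norm_nonneg _) (ct1 _ _)).trans b1
  have c2 := mul_le_mul b2 b3 (abs_nonneg _) pz
  have p : C * 12 ^ n * (r / s) ^ α * (s ^ n)⁻¹ * 1 ≤ C * 12 ^ n * (r / s) ^ α * (s ^ n)⁻¹ * 2 ^ n := by gcongr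
  rw [← f24]
  have p0 : 0 < C * 12 ^ n * (r / s) ^ α * (s ^ n)⁻¹ := pz
  linarith
end CK
end
section
def kr {d : ℕ} (K : KT d) (r : ℝ) (x y : Eu d) : ℂ := CK.kk K dist (fun _ => r) id x y
def Tr {d : ℕ} (μ : Measure Eu d) (K : KT d) (r : ℝ) (f : Eu d → ℂ) (x : Eu d) : ℂ :=
  ∫ y, kr K r x y * f y ∂μ
def Av {d : ℕ} (μ : Measure Eu d) (f : Eu d → ℂ) (x : Eu d) (m : ℝ) : Prop :=
  ∀ R > 0, ∫⁻ y in closedBall x R, ‖f y‖ₑ ∂μ ≤ oR m * μ (closedBall x (5 * R))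
def Dbl {d : ℕ} (μ : Measure Eu d) (x : Eu d) (R : ℝ) : Prop :=
  μ.real (closedBall x (100 * R)) < 2 * 100 ^ d * μ.real (closedBall x R)
structure BF {d : ℕ} (f : Eu d → ℂ) : Prop where
  me : Measurable f
  bd : ∃ M, ∀ y, ‖f y‖ ≤ M
  su : ∃ R, ∀ y, R < dist y 0 → f y = 0
variable {d : ℕ} {μ : Measure Eu d} {K : KT d} {n α C C0 : ℝ}
local notation "Sμ" => SI μ K n α C C0
local notation "E" => Eu d
lemma BF.ind {f : E → ℂ} (hf : BF f) {S : Set E} (hS : MeasurableSet S) : BF (S.indicator f) := by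
  obtain ⟨M, hM⟩ := hf.bd; obtain ⟨R, hR⟩ := hf.su
  refine ⟨hf.me.indicator hS, ⟨M, fun y => (norm_indicator_le_norm_self _ _).trans (hM y)⟩, ⟨R, fun y hy => ?_⟩⟩
  simp [ hR y hy]
lemma ind_le {f : E → ℂ} (S : Set E) (y : E) : ‖S.indicator f y‖ ≤ ‖f y‖ := norm_indicator_le_norm_self _ _
namespace SI
lemma ck (h : Sμ) {r : ℝ} (hr : 0 < r) : CK K n α C dist (fun _ : E => r) id 0 where
  hn := h.hn
  hα := h.hα
  hα1 := h.hα1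
  hC := h.hC
  sz := h.sz
  sm := h.sm
  d0 _ _ := dist_nonneg
  ds_comm := dist_comm
  tri := dist_triangle
  hh := le_rfl
  hΨ _ := hr
  hhΨ _ := by simpa using hr.le
  lip x y := by have := dist_nonneg (x := x) (y := y); linarith
  hξ x y := zs
  dich x y := Or.inr dist_nonneg
lemma fin (h : Sμ) (x : E) (r : ℝ) : μ (closedBall x r) ≠ ∞ :=
  ((measure_mono (closedBall_subset_closedBall (le_max_left r 1))).trans (h.gr x (max r 1) pz)).trans_lt ofReal_lt_top |>.ne
lemma grr (h : Sμ) (x : E) {r : ℝ} (hr : 0 < r) : μ.real (closedBall x r) ≤ C0 * r ^ n := by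
  have := h.hC0
  exact toReal_le_of_le_ofReal pz (h.gr x r hr)
lemma sfin (h : Sμ) : IsLocallyFiniteMeasure μ :=
  ⟨fun x => ⟨closedBall x 1, closedBall_mem_nhds x one_pos, (h.fin x 1).lt_top⟩⟩
lemma kr_one (K : E → E → ℂ) {r : ℝ} (hr : 0 < r) {x y : E} (hd : 4 * r ≤ 3 * dist x y) : kr K r x y = K x y := by
  rw [kr, CK.kk, ct_one lz lz]; simp
lemma kr_zero (K : E → E → ℂ) {r : ℝ} (hr : 0 < r) {x y : E} (hd : 2 * dist x y ≤ r) : kr K r x y = 0 := by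
  rw [kr, CK.kk, ct_zero lz dist_nonneg lz]; simp
lemma kr_le (K : E → E → ℂ) (r : ℝ) (x y : E) : ‖kr K r x y‖ ≤ ‖K x y‖ := by
  rw [kr, CK.kk, norm_mul, norm_real, norm_eq_abs, abs_of_nonneg (ct0 _ _)]
  exact mul_le_of_le_one_right (norm_nonneg _) (ct1 _ _)
lemma kr_an (h : Sμ) (r : ℝ) (x y : E) : kr K r x y = - kr K r y x := by
  rw [kr, CK.kk, kr, CK.kk, id, id, h.an, dist_comm]; ring
lemma kr_bd (h : Sμ) {r : ℝ} (hr : 0 < r) (x y : E) : ‖kr K r x y‖ ≤ C * 128 * 12 ^ n / (dist x y + r) ^ n := by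
  refine ((h.ck hr).K1 x y).trans ?_
  have hn := h.hn; have hC := h.hC
  gcongr; linarith
lemma kr_sm (h : Sμ) {r : ℝ} (hr : 0 < r) {x y y' : E} {ρ : ℝ} (hρ : 0 < ρ) (hy : dist y y' ≤ ρ) (h4 : 4 * ρ ≤ dist x y + 2 * r) :
    ‖kr K r x y - kr K r x y'‖ ≤ C * (10 ^ 6 * 24 ^ n) * ρ ^ α / (dist x y + 2 * r) ^ (n + α) := by
  have := (h.ck hr).K2 x y y' ρ hρ hy lz
  rwa [add_assoc, ← two_mul] at this
lemma kr_sm' (h : Sμ) {r : ℝ} (hr : 0 < r) {x y y' : E} {ρ : ℝ} (hρ : 0 < ρ) (hy : dist y y' ≤ ρ) (h4 : 4 * ρ ≤ dist x y + 2 * r) :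
    ‖kr K r y x - kr K r y' x‖ ≤ C * (10 ^ 6 * 24 ^ n) * ρ ^ α / (dist x y + 2 * r) ^ (n + α) := by
  rw [h.kr_an r y x, h.kr_an r y' x, neg_sub_neg, norm_sub_rev]; exact h.kr_sm hr hρ hy h4
lemma kr_hol (h : Sμ) {r : ℝ} (hr : 0 < r) (x y y' : E) (hd : 2 * dist y y' ≤ r) :
    ‖kr K r x y - kr K r x y'‖ ≤ C * (10 ^ 6 * 24 ^ n) / r ^ (n + α) * dist y y' ^ α := by
  have hn := h.hn; have hC := h.hC; have hα := h.hα
  rcases eq_or_ne y y' with rfl | hne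
  · simp; positivity
  have h0 := dist_pos.2 hne
  have hx := dist_nonneg (x := x) (y := y)
  refine (h.kr_sm hr h0 le_rfl lz).trans ?_
  rw [div_mul_eq_mul_div]; gcongr; linarith
lemma kr_cont (h : Sμ) {r : ℝ} (hr : 0 < r) : Continuous fun p : E × E => kr K r p.1 p.2 := by
  have hα := h.hα
  rw [continuous_iff_continuousAt]
  intro p
  set A := C * (10 ^ 6 * 24 ^ n) / r ^ (n + α)
  rw [ContinuousAt, tendsto_iff_norm_sub_tendsto_zero]
  have ht : Tendsto (fun q : E × E => A * dist p.2 q.2 ^ α + A * dist p.1 q.1 ^ α) (nhds p) (nhds 0) := by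
    have : Continuous (fun q : E × E => A * dist p.2 q.2 ^ α + A * dist p.1 q.1 ^ α) := by
      have c1 : Continuous fun q : E × E => dist p.2 q.2 ^ α := (continuous_const.dist continuous_snd).rpow_const fun _ => Or.inr hα.le
      have c2 : Continuous fun q : E × E => dist p.1 q.1 ^ α := (continuous_const.dist continuous_fst).rpow_const fun _ => Or.inr hα.le
      fun_prop
    have h2 := this.tendsto p
    simpa [Real.zero_rpow hα.ne'] using h2
  refine squeeze_zero' (Eventually.of_forall fun _ => norm_nonneg _) ?_ ht
  filter_upwards [ball_mem_nhds p (by positivity : 0 < r / 2)] with q hq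
  rw [mem_ball, dist_comm, Prod.dist_eq, max_lt_iff] at hq
  have e : kr K r q.1 q.2 - kr K r p.1 p.2 = (kr K r p.2 p.1 - kr K r p.2 q.1) - (kr K r q.1 p.2 - kr K r q.1 q.2) := by
    rw [h.kr_an r p.2 p.1, h.kr_an r p.2 q.1]; ring
  rw [e]
  refine (norm_sub_le _ _).trans ?_
  have := h.kr_hol hr p.2 p.1 q.1 lz
  have := h.kr_hol hr q.1 p.2 q.2 lz
  rw [add_comm]
  exact add_le_add ‹_› ‹_›
lemma kr_meas (h : Sμ) {r : ℝ} (hr : 0 < r) (x : E) : Measurable (kr K r x) :=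
  ((h.kr_cont hr).comp (by fun_prop : Continuous fun y : E => (x, y))).measurable
lemma int (h : Sμ) {f : E → ℂ} (hf : BF f) {g : E → ℂ} (hg : Measurable g) {M : ℝ} (hM : ∀ y, ‖g y‖ ≤ M) :
    Integrable (fun y => g y * f y) μ := by
  obtain ⟨M', hM'⟩ := hf.bd; obtain ⟨R, hR⟩ := hf.su
  have : IntegrableOn (fun y => g y * f y) (closedBall 0 R) μ := by
    refine Measure.integrableOn_of_bounded (M := M * M') (h.fin 0 R) (hg.mul hf.me).aestronglyMeasurable (Eventually.of_forall fun y => ?_)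
    rw [norm_mul]; exact mul_le_mul (hM y) (hM' y) (norm_nonneg _) ((norm_nonneg _).trans (hM y))
  rw [← integrableOn_univ]
  refine IntegrableOn.of_forall_sdiff_eq_zero this MeasurableSet.univ fun y hy => ?_
  rw [hR y (by simpa using hy.2), mul_zero]
lemma krb (h : Sμ) {r : ℝ} (hr : 0 < r) (x y : E) : ‖kr K r x y‖ ≤ C * 128 * 12 ^ n / r ^ n := by
  refine (h.kr_bd hr x y).trans ?_
  have hn := h.hn; have hC := h.hC; have := dist_nonneg (x := x) (y := y)
  gcongr; linarith
lemma int_kr (h : Sμ) {f : E → ℂ} (hf : BF f) {r : ℝ} (hr : 0 < r) (x : E) : Integrable (fun y => kr K r x y * f y) μ :=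
  h.int hf (h.kr_meas hr x) (h.krb hr x)
lemma Tr_add (h : Sμ) {f g : E → ℂ} (hf : BF f) (hg : BF g) {r : ℝ} (hr : 0 < r) (x : E) :
    Tr μ K r (fun y => f y + g y) x = Tr μ K r f x + Tr μ K r g x := by
  simp only [Tr, mul_add]; exact integral_add (h.int_kr hf hr x) (h.int_kr hg hr x)
lemma loc (h : Sμ) {f g : E → ℂ} {x : E} {m A R : ℝ} (hm : Av μ f x m) (hm0 : 0 ≤ m) (hA : 0 ≤ A) (hR : 0 < R)
    (h1 : ∀ y, dist y x ≤ R → ‖g y‖ ≤ A) (h2 : ∀ y, R < dist y x → g y = 0) :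
    ‖∫ y, g y * f y ∂μ‖ ≤ A * m * μ.real (closedBall x (5 * R)) := by
  have e : ‖∫ y, g y * f y ∂μ‖ₑ ≤ oR A * (oR m * μ (closedBall x (5 * R))) := by
    refine (enorm_integral_le_lintegral_enorm _).trans ?_
    calc _ ≤ ∫⁻ y, (closedBall x R).indicator (fun y => oR A * ‖f y‖ₑ) y ∂μ := by
          refine lintegral_mono fun y => ?_
          by_cases hy : dist y x ≤ R
          · rw [indicator_of_mem (mem_closedBall.2 hy), enorm_mul]; gcongr
            rw [← ofReal_norm]; exact ofReal_le_ofReal (h1 y hy)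
          · rw [h2 y (not_le.1 hy)]; simp
      _ ≤ _ := by
          rw [lintegral_indicator isClosed_closedBall.measurableSet, lintegral_const_mul' _ _ ofReal_ne_top]
          gcongr; exact hm R hR
  rw [← ofReal_toReal (h.fin x (5 * R)), ← ofReal_mul hm0, ← ofReal_mul hA, ← ofReal_norm] at e
  have := (ofReal_le_ofReal_iff pz).1 e
  rw [mul_assoc]; exact this
lemma tlf (h : Sμ) {f g : E → ℂ} (hf : Measurable f) {x : E} {m A ℓ : ℝ} (hm : Av μ f x m) (hm0 : 0 ≤ m) (hA : 0 ≤ A) (hℓ : 0 < ℓ)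
    (h1 : ∀ y, ‖g y‖ ≤ A * (ℓ ^ α / (ℓ + dist y x) ^ (n + α))) :
    ‖∫ y, g y * f y ∂μ‖ ≤ A * (2 ^ (n + α) / (1 - 2 ^ (-α)) * (m * (C0 * 5 ^ n))) := by
  have h21 : (2:ℝ) ^ (-α) < 1 := Real.rpow_lt_one_of_one_lt_of_neg nz (by linarith [h.hα])
  have hC0 := h.hC0
  have e : ‖∫ y, g y * f y ∂μ‖ₑ ≤ oR A * oR (2 ^ (n + α) / (1 - 2 ^ (-α)) * (m * (C0 * 5 ^ n))) := by
    refine (enorm_integral_le_lintegral_enorm _).trans ?_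
    calc _ ≤ ∫⁻ y, oR A * (‖f y‖ₑ * oR (ℓ ^ α / (ℓ + dist y x) ^ (n + α))) ∂μ := by
          refine lintegral_mono fun y => ?_
          rw [enorm_mul, mul_comm ‖f y‖ₑ, ← mul_assoc, ← ofReal_mul hA]; gcongr
          rw [← ofReal_norm]; exact ofReal_le_ofReal (h1 y)
      _ = oR A * ∫⁻ y, oR (ℓ ^ α / (ℓ + dist y x) ^ (n + α)) ∂(μ.withDensity fun y => ‖f y‖ₑ) := by
          rw [lintegral_const_mul' _ _ ofReal_ne_top, lintegral_withDensity_eq_lintegral_mul _ hf.enorm (by fun_prop)]; rfl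
      _ ≤ _ := by
          gcongr
          refine tailL h.hn h.hα _ x pz hℓ fun r hr => ?_
          rw [withDensity_apply _ isClosed_closedBall.measurableSet]
          have hr0 := hℓ.trans_le hr
          refine (hm r hr0).trans ?_
          rw [mul_assoc, ofReal_mul hm0]; gcongr
          refine (h.gr x _ pz).trans (le_of_eq ?_)
          rw [mul_rpow nz hr0.le, mul_assoc]
  rw [← ofReal_mul hA, ← ofReal_norm] at e
  exact (ofReal_le_ofReal_iff pz).1 e
lemma sz' (h : Sμ) {x y : E} {ρ : ℝ} (hρ : 0 < ρ) (hd : ρ ≤ dist x y) : ‖K x y‖ ≤ C / ρ ^ n := by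
  have := h.hC; have := h.hn
  refine (h.sz x y).trans ?_; gcongr
lemma step (h : Sμ) {f : E → ℂ} (hf : BF f) {x : E} {m r r' : ℝ} (hm : Av μ f x m) (hm0 : 0 ≤ m) (hr : 0 < r) (h1 : r ≤ r') (h2 : r' ≤ 100 * r) :
    ‖Tr μ K r f x - Tr μ K r' f x‖ ≤ 2 * C * 2 ^ n * m * (μ.real (closedBall x (10000 * r)) / r ^ n) := by
  have hC := h.hC
  rw [Tr, Tr, ← integral_sub (h.int_kr hf hr x) (h.int_kr hf (hr.trans_le h1) x)]
  simp_rw [← sub_mul]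
  have e := h.loc (g := fun y => kr K r x y - kr K r' x y) (A := 2 * C * 2 ^ n / r ^ n) (R := 134 * r) hm hm0 pz pz ?_ ?_
  · refine e.trans ?_
    rw [div_mul_eq_mul_div, div_mul_eq_mul_div, mul_div_assoc]
    have := measureReal_mono (closedBall_subset_closedBall (x := x) (by linarith : 5 * (134 * r) ≤ 10000 * r)) (h.fin _ _)
    gcongr
  · intro y _
    by_cases hy : 2 * dist x y ≤ r
    · rw [kr_zero K hr hy, kr_zero K (hr.trans_le h1) (hy.trans h1)]; simp; positivity
    · have := h.sz' (x := x) (y := y) (half_pos hr) lz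
      rw [div_rpow hr.le nz, div_div_eq_mul_div] at this
      refine (norm_sub_le _ _).trans ?_
      rw [show 2 * C * 2 ^ n / r ^ n = C * 2 ^ n / r ^ n + C * 2 ^ n / r ^ n by ring]
      exact add_le_add ((kr_le _ _ _ _).trans this) ((kr_le _ _ _ _).trans this)
  · intro y hy
    rw [dist_comm] at hy
    rw [kr_one K hr lz, kr_one K (hr.trans_le h1) lz, sub_self]
lemma chain (h : Sμ) {f : E → ℂ} (hf : BF f) {x : E} {m r : ℝ} (hm : Av μ f x m) (hm0 : 0 ≤ m) (hr : 0 < r) (J j : ℕ) (hj : j ≤ J)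
    (hJ : ∀ i, j ≤ i → i < J → ¬ Dbl μ x (100 ^ i * r)) :
    ‖Tr μ K (100 ^ j * r) f x - Tr μ K (100 ^ J * r) f x‖ ≤ 4 * (2 * C * 2 ^ n * C0 * 10000 ^ n) * m := by
  have hC := h.hC; have hC0 := h.hC0
  set c := 2 * C * 2 ^ n * 10000 ^ n * m with hc
  have c0 : 0 ≤ c := pz
  set a : ℕ → ℝ := fun i => μ.real (closedBall x (100 ^ i * r)) / (100 ^ i * r) ^ n with ha
  have a0 : ∀ i, 0 ≤ a i := fun i => by positivity
  have aC : ∀ i, a i ≤ C0 := fun i => by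
    rw [ha, div_le_iff₀ pz]; exact h.grr x pz
  have st : ∀ i, ‖Tr μ K (100 ^ i * r) f x - Tr μ K (100 ^ (i + 1) * r) f x‖ ≤ c * a (i + 2) := fun i => by
    have p : 0 < 100 ^ i * r := pz
    refine (h.step hf hm hm0 pz ?_ (by rw [pow_succ]; linarith)).trans (le_of_eq ?_)
    · rw [pow_succ]; linarith
    · rw [hc, ha]
      simp only
      rw [show (100:ℝ) ^ (i + 2) * r = 10000 * (100 ^ i * r) by ring, mul_rpow nz p.le]
      have : (0:ℝ) < 10000 ^ n := pz
      field_simp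
  have gr2 : ∀ i, j ≤ i → i < J → 2 * a i ≤ a (i + 1) := fun i h1 h2 => by
    have := hJ i h1 h2
    rw [Dbl, not_lt] at this
    have p : 0 < 100 ^ i * r := pz
    rw [ha]; simp only
    rw [show (100:ℝ) ^ (i + 1) * r = 100 * (100 ^ i * r) by ring, mul_rpow nz p.le]
    have p3 : (100:ℝ) ^ n ≤ 100 ^ d := by
      rw [← Real.rpow_natCast]; exact Real.rpow_le_rpow_of_exponent_le nz h.hnd
    rw [le_div_iff₀ pz]
    refine le_trans ?_ this
    have p4 : (0:ℝ) < (100 ^ i * r) ^ n := pz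
    rw [show 2 * (μ.real (closedBall x (100 ^ i * r)) / (100 ^ i * r) ^ n) * (100 ^ n * (100 ^ i * r) ^ n) = 2 * 100 ^ n * μ.real (closedBall x (100 ^ i * r)) by field_simp]
    gcongr
  have main : ∀ i l : ℕ, j ≤ l → l + i = J → ‖Tr μ K (100 ^ l * r) f x - Tr μ K (100 ^ J * r) f x‖ ≤ c * (if 2 ≤ i then 4 * C0 - a (l + 2) else 2 * C0) ∧
      (i ≤ 1 → ‖Tr μ K (100 ^ l * r) f x - Tr μ K (100 ^ J * r) f x‖ ≤ c * (i * C0)) := by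
    intro i
    induction i with
    | zero => intro l _ hl; obtain rfl : l = J := by omega
              simp; positivity
    | succ i ih =>
      intro l hjl hl
      obtain ⟨b1, b2⟩ := ih (l + 1) oz oz
      have t := norm_sub_le_norm_sub_add_norm_sub (Tr μ K (100 ^ l * r) f x) (Tr μ K (100 ^ (l + 1) * r) f x) (Tr μ K (100 ^ J * r) f x)
      have s := st l
      have q1 := mll (aC (l + 2)) c0
      have q2 := mul_nonneg c0 hC0.le
      rcases Nat.lt_or_ge i 1 with hi | hi
      · obtain rfl : i = 0 := by omega
        have b2 := b2 oz
        simp only [Nat.cast_zero, zero_mul, mul_zero] at b2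
        constructor
        · simp; linarith
        · intro _; simp; linarith
      · refine ⟨?_, by omega⟩
        rw [if_pos oz]
        rcases Nat.lt_or_ge i 2 with hi2 | hi2
        · obtain rfl : i = 1 := by omega
          have b2 := b2 le_rfl
          simp only [Nat.cast_one, one_mul] at b2
          linarith
        · rw [if_pos hi2] at b1
          have := mll (gr2 (l + 2) oz oz) c0
          rw [show l + 1 + 2 = l + 2 + 1 by ring] at b1
          linarith
  have := (main (J - j) j le_rfl oz).1
  refine this.trans ?_
  rw [show 4 * (2 * C * 2 ^ n * C0 * 10000 ^ n) * m = c * (4 * C0) by rw [hc]; ring]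
  gcongr
  split_ifs
  · linarith [a0 (j + 2)]
  · linarith
end SI
end
section
lemma acc_mass {X I : Type} [Fintype X] {w : X → ℝ} (hw : ∀ x, 0 < w x) {b : X → ℂ} (hb : ∀ x, ‖b x‖ ≤ 1) {δ : ℝ} (lab : ℕ → X → I) (M : ℕ)
    (hl : ∀ j k x y, j ≤ k → lab k x = lab k y → lab j x = lab j y) (top : 2 * δ * ∑ x, w x ≤ ‖∑ x, (w x : ℂ) * b x‖) (hδ : 0 < δ) :
    δ * ∑ x, w x ≤ ∑ x, w x * (if ∀ k ≤ M, δ ≤ ‖av w (lab k) b x‖ then 1 else 0) := by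
  set g : X → ℝ := fun x => if ∀ k ≤ M, δ ≤ ‖av w (lab k) b x‖ then 1 else 0 with hg
  set fi : ℕ → X → ℝ := fun k x => if ‖av w (lab k) b x‖ < δ ∧ ∀ j < k, δ ≤ ‖av w (lab j) b x‖ then 1 else 0 with hfi
  have one : ∀ x, g x + ∑ k ∈ rg (M + 1), fi k x = 1 := by
    intro x
    by_cases h : ∀ k ≤ M, δ ≤ ‖av w (lab k) b x‖
    · rw [hg]; simp only [if_pos h]
      rw [sum_eq_zero, add_zero]
      intro k hk
      exact if_neg fun h' => (h k (by simpa using hk)).not_gt h'.1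
    · rw [hg]; simp only [if_neg h]
      push Not at h
      have hex := h
      have hs := find_spec hex
      rw [sum_eq_single (find hex)]
      · rw [zero_add]
        exact if_pos ⟨hs.2, fun j hj => not_lt.1 fun h' => find_min hex hj ⟨by omega, h'⟩⟩
      · intro k hk hne
        refine if_neg fun h' => hne (le_antisymm ?_ ?_)
        · exact not_lt.1 fun h2 => (h'.2 _ h2).not_gt hs.2
        · exact Nat.find_min' hex ⟨by simpa using hk, h'.1⟩
      · intro hk; exact absurd (Finset.mem_range.2 oz) hk
  have fi0 : ∀ k x, 0 ≤ fi k x := fun k x => by rw [hfi]; positivity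
  have g0 : ∀ x, 0 ≤ g x := fun x => by rw [hg]; positivity
  have e1 : ∑ x, (w x : ℂ) * b x = ∑ x, (w x : ℂ) * (g x * b x) + ∑ k ∈ rg (M + 1), ∑ x, (w x : ℂ) * ((fi k x : ℂ) * b x) := by
    rw [sum_comm, ← sum_add_distrib]
    refine sum_congr rfl fun x _ => ?_
    rw [← mul_sum, ← sum_mul, ← mul_add, ← add_mul]
    have := one x
    rw [← ofReal_sum, ← Complex.ofReal_add, this]; simp
  have e2 : ∀ k, ‖∑ x, (w x : ℂ) * ((fi k x : ℂ) * b x)‖ ≤ ∑ x, w x * (fi k x * δ) := by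
    intro k
    rw [← sum_mul_avC hw]
    · refine (norm_sum_le _ _).trans (sum_le_sum fun x _ => ?_)
      rw [norm_mul, norm_mul, norm_real, norm_real, norm_of_nonneg (hw x).le, norm_of_nonneg (fi0 _ _)]
      refine mll ?_ (hw x).le
      rw [hfi]; simp only
      split_ifs with h
      · rw [one_mul, one_mul]; exact h.1.le
      · simp
    · intro x y hxy
      have : ∀ j ≤ k, av w (lab j) b x = av w (lab j) b y := fun j hj => av_congr b (hl j k x y hj hxy)
      have e : (‖av w (lab k) b x‖ < δ ∧ ∀ j < k, δ ≤ ‖av w (lab j) b x‖) ↔ (‖av w (lab k) b y‖ < δ ∧ ∀ j < k, δ ≤ ‖av w (lab j) b y‖) := by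
        rw [this k le_rfl]
        exact and_congr_right fun _ => forall₂_congr fun j hj => by rw [this j hj.le]
      rw [hfi]; simp only [e]
  have e3 : ‖∑ x, (w x : ℂ) * (g x * b x)‖ ≤ ∑ x, w x * g x := by
    refine (norm_sum_le _ _).trans (sum_le_sum fun x _ => ?_)
    rw [norm_mul, norm_mul, norm_real, norm_real, norm_of_nonneg (hw x).le, norm_of_nonneg (g0 _)]
    exact mll (mul_le_of_le_one_right (g0 x) (hb x)) (hw x).le
  have e4 : ∑ k ∈ rg (M + 1), ∑ x, w x * (fi k x * δ) ≤ δ * ∑ x, w x := by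
    rw [sum_comm, mul_sum]
    refine sum_le_sum fun x _ => ?_
    rw [← mul_sum, ← sum_mul]
    have h1 := one x
    have : ∑ k ∈ rg (M + 1), fi k x ≤ 1 := by linarith [g0 x]
    have := mll (mul_le_mul_of_nonneg_right this hδ.le) (hw x).le
    linarith
  have e5 : ‖∑ x, (w x : ℂ) * b x‖ ≤ ∑ x, w x * g x + δ * ∑ x, w x := by
    rw [e1]
    refine (norm_add_le _ _).trans (add_le_add e3 (((norm_sum_le _ _).trans (sum_le_sum fun k _ => e2 k)).trans e4))
  linarith
lemma hp_mass {d : ℕ} {X : Type} [Fintype X] {w : X → ℝ} (hw : ∀ x, 0 < w x) {b : X → ℂ} (hb : ∀ x, ‖b x‖ ≤ 1) {δ : ℝ} (hδ : 0 < δ) (q N : ℕ) (hq : 2 ≤ q)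
    (pos : X → Fin d → ℕ) (top : 2 * δ * ∑ x, w x ≤ ‖∑ x, (w x : ℂ) * b x‖) :
    δ / 2 * ∑ x, w x ≤ ∑ x, w x * (if δ / 2 * q ^ N ≤ (((rg (q ^ N)).filter
    (fun m => ∀ k ≤ N + 1, δ ≤ ‖av w (glab q N m pos k) b x‖)).card : ℝ) then 1 else 0) := by
  have a := fun m => acc_mass hw hb (fun k x => glab q N m pos k x) (N + 1) (fun j k x y hjk hxy => glab_le hjk hxy) top hδ
  have s := sum_le_sum fun m (_ : m ∈ rg (q ^ N)) => a m
  rw [sum_const, card_range, nsmul_eq_mul, sum_comm] at s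
  have q0 : (0:ℝ) < (q:ℝ) ^ N := pz
  have s2 : ∀ x, ∑ m ∈ rg (q ^ N), w x * (if ∀ k ≤ N + 1, δ ≤ ‖av w (fun x => glab q N m pos k x) b x‖ then (1:ℝ) else 0) ≤
      (q:ℝ) ^ N * (w x * (if δ / 2 * q ^ N ≤ (((rg (q ^ N)).filter (fun m => ∀ k ≤ N + 1, δ ≤ ‖av w (glab q N m pos k) b x‖)).card : ℝ) then 1 else 0))
      + (q:ℝ) ^ N * (δ / 2 * w x) := by
    intro x
    rw [← mul_sum, Finset.sum_boole]
    have hx := hw x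
    split_ifs with h
    · have : (((rg (q ^ N)).filter (fun m => ∀ k ≤ N + 1, δ ≤ ‖av w (fun x => glab q N m pos k x) b x‖)).card : ℝ) ≤ (q:ℝ) ^ N := by
        have := Finset.card_filter_le (rg (q ^ N)) (fun m => ∀ k ≤ N + 1, δ ≤ ‖av w (fun x => glab q N m pos k x) b x‖)
        rw [card_range] at this; exact_mod_cast this
      have := mll this hx.le
      have : 0 ≤ (q:ℝ) ^ N * (δ / 2 * w x) := pz
      linarith
    · push Not at h
      have := mll h.le hx.le
      linarith
  have s3 := s.trans (sum_le_sum fun x _ => s2 x)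
  rw [sum_add_distrib, ← mul_sum, ← mul_sum, ← mul_sum] at s3
  push_cast at s3
  rw [← mul_add] at s3
  have := le_of_mul_le_mul_left s3 q0
  linarith
end
section
variable {d : ℕ}
local notation "E" => Eu d
lemma grid (x0 : E) {S : ℝ} (hS : 0 < S) {M : ℕ} (hM : 2 ≤ M) : ∃ p : E → (Fin d → Fin M), Measurable p ∧
    ∀ y ∈ closedBall x0 S, ∀ z ∈ closedBall x0 S, |dist y z - 4 * S / M * dist (fun i => ((p y i : ℕ) : ℝ)) (fun i => ((p z i : ℕ) : ℝ))| ≤ 4 * S / M := by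
  have hM0 : (0:ℝ) < M := pz
  set h := 4 * S / M with hh
  have h0 : 0 < h := pz
  set p : E → (Fin d → Fin M) := fun y i => ⟨⌊(y i - x0 i + S) / h⌋₊ % M, mod_lt _ oz⟩ with hp
  refine ⟨p, ?_, ?_⟩
  · refine measurable_pi_iff.2 fun i => ?_
    have : Measurable (fun k : ℕ => (⟨k % M, mod_lt _ oz⟩ : Fin M)) := measurable_of_countable _
    exact this.comp (Nat.measurable_floor.comp (by fun_prop))
  have key : ∀ y ∈ closedBall x0 S, ∀ i, 0 ≤ (y i - x0 i + S) / h - ((p y i : ℕ) : ℝ) ∧ (y i - x0 i + S) / h - ((p y i : ℕ) : ℝ) ≤ 1 := by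
    intro y hy i
    have h1 : |y i - x0 i| ≤ S := by rw [← dist_eq]; exact (dist_le_pi_dist y x0 i).trans hy
    rw [abs_le] at h1
    have h2 : 0 ≤ (y i - x0 i + S) / h := by apply div_nonneg _ h0.le; linarith
    have h3 : (y i - x0 i + S) / h < M := by
      rw [div_lt_iff₀ h0, hh, mul_div_cancel₀ _ hM0.ne']; linarith
    have h4 := (Nat.floor_lt h2).2 h3
    have e : ((p y i : ℕ) : ℝ) = (⌊(y i - x0 i + S) / h⌋₊ : ℝ) := by rw [hp]; simp only; rw [mod_eq_of_lt h4]
    rw [e]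
    have := Nat.floor_le h2; have := Nat.lt_floor_add_one ((y i - x0 i + S) / h)
    constructor <;> linarith
  intro y hy z hz
  have co : ∀ i, |(y i - z i) - h * ((p y i : ℕ) - (p z i : ℕ) : ℝ)| ≤ h := by
    intro i
    have a := key y hy i; have b := key z hz i
    have e : (y i - z i) - h * ((p y i : ℕ) - (p z i : ℕ) : ℝ) = h * (((y i - x0 i + S) / h - ((p y i : ℕ) : ℝ)) - ((z i - x0 i + S) / h - ((p z i : ℕ) : ℝ))) := by
      field_simp; ring
    rw [e, abs_mul, abs_of_pos h0]
    exact mul_le_of_le_one_right h0.le (abs_le.2 ⟨by linarith, by linarith⟩)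
  rw [abs_le]
  constructor
  · have : dist (fun i => ((p y i : ℕ) : ℝ)) (fun i => ((p z i : ℕ) : ℝ)) ≤ (dist y z + h) / h := by
      refine (dist_pi_le_iff pz).2 fun i => ?_
      rw [le_div_iff₀ h0, dist_eq]
      have h1 := dist_le_pi_dist y z i
      rw [dist_eq] at h1
      have h2 := abs_sub_abs_le_abs_sub (h * ((p y i : ℕ) - (p z i : ℕ) : ℝ)) (y i - z i)
      rw [abs_mul, abs_of_pos h0] at h2
      have h3 := abs_sub_comm (h * ((p y i : ℕ) - (p z i : ℕ) : ℝ)) (y i - z i)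
      rw [h3] at h2
      have := co i
      linarith
    rw [le_div_iff₀ h0] at this; linarith
  · have : dist y z ≤ h * dist (fun i => ((p y i : ℕ) : ℝ)) (fun i => ((p z i : ℕ) : ℝ)) + h := by
      refine (dist_pi_le_iff pz).2 fun i => ?_
      have h1 := dist_le_pi_dist (fun i => ((p y i : ℕ) : ℝ)) (fun i => ((p z i : ℕ) : ℝ)) i
      simp only [dist_eq] at h1
      rw [dist_eq]
      have h2 := abs_sub_abs_le_abs_sub (y i - z i) (h * ((p y i : ℕ) - (p z i : ℕ) : ℝ))
      rw [abs_mul, abs_of_pos h0] at h2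
      have := co i
      have := mll h1 h0.le
      linarith
    linarith
variable {X ι : Type} [MeasurableSpace X] [Fintype ι] [MeasurableSpace ι] [MeasurableSingletonClass ι]
lemma cell_meas {p : X → ι} (hp : Measurable p) {Q : Set X} (hQ : MeasurableSet Q) (c : ι) : MeasurableSet (Q ∩ p ⁻¹' {c}) :=
  hQ.inter (hp (measurableSet_singleton c))
lemma cell_union (p : X → ι) (Q : Set X) : Q = ⋃ c, Q ∩ p ⁻¹' {c} := by ext; simp
lemma cell_disj (p : X → ι) (Q : Set X) : Pairwise (Function.onFun Disjoint fun c => Q ∩ p ⁻¹' {c}) := fun c c' hne =>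
  Set.disjoint_left.2 fun _ h1 h2 => hne (h1.2.symm.trans h2.2)
lemma cell_int {p : X → ι} (hp : Measurable p) {Q : Set X} (hQ : MeasurableSet Q) {μ : Measure X} {F : X → ℂ} (hF : IntegrableOn F Q μ) (a : ι → ℂ) :
    ∫ z in Q, a (p z) * F z ∂μ = ∑ c, a c * ∫ z in Q ∩ p ⁻¹' {c}, F z ∂μ := by
  have e : ∀ c, ∫ z in Q ∩ p ⁻¹' {c}, a (p z) * F z ∂μ = a c * ∫ z in Q ∩ p ⁻¹' {c}, F z ∂μ := fun c => by
    rw [← integral_const_mul]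
    exact setIntegral_congr_fun (cell_meas hp hQ c) fun z hz => by
      rw [show p z = c from hz.2]
  conv_lhs => rw [cell_union p Q]
  rw [integral_iUnion_fintype (cell_meas hp hQ) (cell_disj p Q)]
  · exact sum_congr rfl fun c _ => e c
  · intro c
    have h1 : IntegrableOn (fun z => a c * F z) (Q ∩ p ⁻¹' {c}) μ := Integrable.const_mul (hF.mono_set inter_subset_left) _
    exact h1.congr_fun (fun z hz => by simp only; rw [show p z = c from hz.2]) (cell_meas hp hQ c)
lemma cell_lint {p : X → ι} (hp : Measurable p) {Q : Set X} (hQ : MeasurableSet Q) {μ : Measure X} (F : X → ℝ≥0∞) :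
    ∫⁻ z in Q, F z ∂μ = ∑ c, ∫⁻ z in Q ∩ p ⁻¹' {c}, F z ∂μ := by
  conv_lhs => rw [cell_union p Q]
  rw [lintegral_iUnion (cell_meas hp hQ) (cell_disj p Q), tsum_fintype]
lemma cell_meas_sum {p : X → ι} (hp : Measurable p) {Q : Set X} (hQ : MeasurableSet Q) {μ : Measure X} :
    μ Q = ∑ c, μ (Q ∩ p ⁻¹' {c}) := by
  have := cell_lint hp hQ (μ := μ) (fun _ => 1)
  simpa using this
lemma sum_sub {V : ι → Prop} (f : ι → ℂ) (hf : ∀ c, ¬ V c → f c = 0) : ∑ c, f c = ∑ v : {c // V c}, f v.1 := by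
  rw [← sum_subtype (Finset.univ.filter V) zs, sum_filter]
  exact sum_congr rfl fun c _ => by by_cases h : V c <;> simp [h, hf]
lemma sum_subR {V : ι → Prop} (f : ι → ℝ≥0∞) (hf : ∀ c, ¬ V c → f c = 0) : ∑ c, f c = ∑ v : {c // V c}, f v.1 := by
  rw [← sum_subtype (Finset.univ.filter V) zs, sum_filter]
  exact sum_congr rfl fun c _ => by by_cases h : V c <;> simp [h, hf]
end
section
lemma cellL2 {X ι : Type} [MeasurableSpace X] [Fintype ι] [MeasurableSpace ι] [MeasurableSingletonClass ι] {p : X → ι} (hp : Measurable p) {Q : Set X} (hQ : MeasurableSet Q) {μ : Measure X} (hμ : μ Q ≠ ∞)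
    {V : ι → Prop} {w : {c // V c} → ℝ} (hw : ∀ v, 0 < w v) (hμw : ∀ v, μ.real (Q ∩ p ⁻¹' {v.1}) ≤ w v) (h0 : ∀ c, ¬ V c → μ (Q ∩ p ⁻¹' {c}) = 0)
    (kc : ι → ι → ℂ) {D : ℝ} (hD : 0 < D) (hB : ∀ f g, ‖Bw w (fun x y => kc x.1 y.1) f g‖ ≤ D * (nq w f + nq w g))
    {F : X → ℂ} (hF : IntegrableOn F Q μ) (hF2 : IntegrableOn (fun x => ‖F x‖ ^ 2) Q μ) :
    ∫⁻ y in Q, ‖∫ z in Q, kc (p y) (p z) * F z ∂μ‖ₑ ^ 2 ∂μ ≤ oR (4 * D ^ 2) * ∫⁻ y in Q, ‖F y‖ₑ ^ 2 ∂μ := by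
  set t : ι → ℂ := fun c => ∑ c', kc c c' * ∫ z in Q ∩ p ⁻¹' {c'}, F z ∂μ
  set m : ι → ℝ := fun c => μ.real (Q ∩ p ⁻¹' {c})
  have hfin : ∀ c, μ (Q ∩ p ⁻¹' {c}) ≠ ∞ := fun c => measure_ne_top_of_subset inter_subset_left hμ
  have ht : ∀ v, t v = ∑ y : {c // V c}, kc v y.1 * ∫ z in Q ∩ p ⁻¹' {y.1}, F z ∂μ := fun v =>
    sum_sub (fun c' => kc v c' * ∫ z in Q ∩ p ⁻¹' {c'}, F z ∂μ) fun c hc => by rw [Measure.restrict_eq_zero.2 (h0 c hc)]; simp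
  have e1 : ∫⁻ y in Q, ‖∫ z in Q, kc (p y) (p z) * F z ∂μ‖ₑ ^ 2 ∂μ = oR (∑ v : {c // V c}, m v.1 * ‖t v.1‖ ^ 2) := by
    rw [cell_lint hp hQ, ofReal_sum_of_nonneg (fun v _ => by positivity), ← sum_subR (V := V) (fun c => oR (m c * ‖t c‖ ^ 2))]
    · refine sum_congr rfl fun c _ => ?_
      rw [setLIntegral_congr_fun (g := fun _ => ‖t c‖ₑ ^ 2) (cell_meas hp hQ c) fun y hy => ?_]
      · rw [setLIntegral_const, ofReal_mul measureReal_nonneg, ofReal_pow (norm_nonneg _), ofReal_norm, ofReal_measureReal (hfin c), mul_comm]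
      · simp only; rw [show p y = c from hy.2, cell_int hp hQ hF (kc c)]
    · intro c hc; simp [m, measureReal_def, h0 c hc]
  have e2 : ∫⁻ y in Q, ‖F y‖ₑ ^ 2 ∂μ = oR (∫ y in Q, ‖F y‖ ^ 2 ∂μ) := by
    rw [ofReal_integral_eq_lintegral_ofReal hF2 (.of_forall fun _ => by positivity)]
    simp_rw [ofReal_pow (norm_nonneg _), ofReal_norm]
  rw [e1, e2, ← ofReal_mul pz]
  apply ofReal_le_ofReal
  set T := ∑ v : {c // V c}, m v.1 * ‖t v.1‖ ^ 2
  have hΦ : ∑ v : {c // V c}, ∫ z in Q ∩ p ⁻¹' {v.1}, ‖F z‖ ^ 2 ∂μ ≤ ∫ y in Q, ‖F y‖ ^ 2 ∂μ := by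
    conv_rhs => rw [cell_union p Q]
    rw [integral_iUnion_fintype (cell_meas hp hQ) (cell_disj p Q) fun c => hF2.mono_set inter_subset_left,
      ← sum_subtype (Finset.univ.filter V) zs (f := fun c => ∫ z in Q ∩ p ⁻¹' {c}, ‖F z‖ ^ 2 ∂μ)]
    exact sum_le_sum_of_subset_of_nonneg (Finset.filter_subset _ _) fun _ _ _ => by positivity
  set φ : {c // V c} → ℂ := fun v => (∫ z in Q ∩ p ⁻¹' {v.1}, F z ∂μ) / (w v : ℂ)
  set ψ : {c // V c} → ℂ := fun v => (starRingEnd ℂ) (t v) * (m v / w v : ℝ)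
  have wn : ∀ v, (w v : ℂ) ≠ 0 := fun v => by exact_mod_cast (hw v).ne'
  have hBB : Bw w (fun x y => kc x.1 y.1) φ ψ = (T : ℂ) := by
    simp only [Bw, T, ofReal_sum]
    refine sum_congr rfl fun v _ => ?_
    have : ∀ y, (w v : ℂ) * w y * (kc v.1 y.1 * φ y * ψ v) = (w v * ψ v) * (kc v.1 y.1 * ∫ z in Q ∩ p ⁻¹' {y.1}, F z ∂μ) := fun y => by
      simp only [φ]; field_simp [wn y]
    simp_rw [this]
    rw [← mul_sum, ← ht]
    simp only [ψ]
    push_cast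
    rw [← Complex.mul_conj']
    field_simp [wn v]
  have nφ : nq w φ ≤ ∫ y in Q, ‖F y‖ ^ 2 ∂μ := by
    refine le_trans (sum_le_sum fun v _ => ?_) hΦ
    set A := Q ∩ p ⁻¹' {v.1}
    set c := ‖∫ z in A, F z ∂μ‖ / w v
    have e : w v * ‖φ v‖ ^ 2 = 2 * c * ‖∫ z in A, F z ∂μ‖ - c ^ 2 * w v := by
      simp only [φ, c, norm_div, norm_real, norm_of_nonneg (hw v).le]; field_simp [(hw v).ne']; ring
    have hc0 : 0 ≤ c := div_nonneg (norm_nonneg _) (hw v).le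
    have iF : IntegrableOn (fun z => ‖F z‖) A μ := (hF.mono_set inter_subset_left).norm
    have := integral_mono (μ := μ.restrict A) (f := fun z => 2 * c * ‖F z‖ - c ^ 2) ((iF.const_mul _).sub (integrableOn_const (hfin _))) (hF2.mono_set inter_subset_left)
      (fun z => by simp only; nlinarith [sq_nonneg (‖F z‖ - c)])
    rw [integral_sub (iF.const_mul _) (integrableOn_const (hfin _)), integral_const_mul] at this
    simp only [integral_const, smul_eq_mul, measureReal_restrict_apply MeasurableSet.univ, univ_inter] at this
    rw [e]
    have h1 := mll (norm_integral_le_integral_norm (μ := μ.restrict A) F) (show 0 ≤ 2 * c by positivity)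
    have h2 := mll (hμw v) (sq_nonneg c)
    have e3 : μ.real (Q ∩ p ⁻¹' {v.1}) = μ.real A := rfl
    nlinarith
  have nψ : nq w ψ ≤ T := by
    refine sum_le_sum fun v _ => ?_
    have m0 : 0 ≤ m v.1 := measureReal_nonneg
    simp only [ψ, norm_mul, RCLike.norm_conj, norm_real, norm_of_nonneg (div_nonneg m0 (hw v).le)]
    have : w v * (‖t v‖ * (m v / w v)) ^ 2 = m v.1 * ‖t v‖ ^ 2 * (m v / w v) := by field_simp [(hw v).ne']
    rw [this]
    exact mul_le_of_le_one_right pz ((div_le_one (hw v)).2 (hμw v))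
  have T0 : 0 ≤ T := sum_nonneg fun v _ => by positivity
  have := BB_lam (w := w) _ hB φ ψ (2 * D)⁻¹ pz
  rw [hBB, norm_real, norm_of_nonneg T0, inv_inv] at this
  have h1 : D * (2 * D * nq w φ + (2 * D)⁻¹ * nq w ψ) ≤ 2 * D ^ 2 * (∫ y in Q, ‖F y‖ ^ 2 ∂μ) + T / 2 := by
    have e : D * (2 * D * nq w φ + (2 * D)⁻¹ * nq w ψ) = 2 * D ^ 2 * nq w φ + nq w ψ / 2 := by field_simp
    rw [e]
    have := mll nφ (show 0 ≤ 2 * D ^ 2 by positivity)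
    linarith
  linarith
variable {d : ℕ} {μ : Measure Eu d} {K : KT d} {n α C C0 : ℝ}
local notation "Sμ" => SI μ K n α C C0
local notation "E" => Eu d
lemma SI.far (h : Sμ) {x z y' z' : E} {r : ℝ} (hr : 0 < r) (h1 : dist x y' ≤ 2 * r) (h2 : dist z z' ≤ 2 * r) (h3 : 20 * r ≤ dist x z) :
    ‖K y' z' - K x z‖ ≤ 4 * C * 2 ^ (n + α) * r ^ α / dist x z ^ (n + α) := by
  have hn := h.hn; have hα := h.hα; have hC := h.hC; have hα1 := h.hα1
  have D0 : 0 < dist x z := lz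
  have t1 := dist_triangle x y' z
  have a1 := h.sm y' z z' lz
  have a2 := h.sm z x y' (by rw [dist_comm z x]; linarith)
  rw [dist_comm z x] at a2
  have e2 : (2:ℝ) ^ α ≤ 2 := by simpa using Real.rpow_le_rpow_of_exponent_le nz hα1
  have p0 : 1 ≤ (2:ℝ) ^ (n + α) := Real.one_le_rpow nz lz
  have g : ∀ s, 0 ≤ s → s ≤ 2 * r → s ^ α ≤ 2 * r ^ α := fun s s0 hs => by
    refine (Real.rpow_le_rpow s0 hs hα.le).trans ?_
    rw [mul_rpow nz hr.le]; gcongr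
  have q0 : 0 < dist x z ^ (n + α) := pz
  have q1 : dist x z ^ (n + α) ≤ 2 ^ (n + α) * dist y' z ^ (n + α) := by
    rw [← mul_rpow nz dist_nonneg]; exact Real.rpow_le_rpow D0.le lz lz
  have y0 : 0 < dist y' z ^ (n + α) := Real.rpow_pos_of_pos lz _
  have b1 : ‖K y' z - K y' z'‖ ≤ 2 * C * 2 ^ (n + α) * r ^ α / dist x z ^ (n + α) := by
    refine a1.trans ?_
    rw [div_le_div_iff₀ y0 q0]
    calc _ ≤ C * (2 * r ^ α) * (2 ^ (n + α) * dist y' z ^ (n + α)) := by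
          gcongr
          exact g _ dist_nonneg h2
      _ = _ := by ring
  have b2 : ‖K z x - K z y'‖ ≤ 2 * C * 2 ^ (n + α) * r ^ α / dist x z ^ (n + α) := by
    refine a2.trans (div_le_div_of_nonneg_right ?_ q0.le)
    calc _ ≤ C * (2 * r ^ α) * 1 := by rw [mul_one]; gcongr; exact g _ dist_nonneg h1
      _ ≤ C * (2 * r ^ α) * 2 ^ (n + α) := by gcongr
      _ = _ := by ring
  rw [h.an z x, h.an z y'] at b2
  have e : K y' z' - K x z = -(K y' z - K y' z') + (-K x z - -K y' z) := by ring
  rw [e]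
  refine (norm_add_le _ _).trans ?_
  rw [norm_neg]
  refine (add_le_add b1 b2).trans (le_of_eq ?_)
  ring
end
section
structure TD {d : ℕ} (μ : Measure Eu d) (K : KT d) (n Λ δ D1 : ℝ) (e : Eu d → Eu d → ℝ) (x0 : Eu d) (S : ℝ)
    (b : Eu d → ℂ) (σ : Measure Eu d) (H : Set Eu d) : Prop where
  hS : 0 < S
  bi : Integrable b μ
  bm : Measurable b
  b0 : ∀ x ∉ closedBall x0 S, b x = 0
  e1 : ∀ x y, dist x y ≤ e x y
  e2 : ∀ x y, e x y ≤ D1 * dist x y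
  em : ∀ x r, MeasurableSet {y | r < e x y}
  s1 : μ.restrict (closedBall x0 S) ≤ σ
  s2 : μ.withDensity (fun y => ‖b y‖ₑ) ≤ σ
  s3 : σ (closedBall x0 S)ᶜ = 0
  sf : IsFiniteMeasure σ
  s0 : σ univ ≠ 0
  top : 2 * δ * σ.real univ ≤ ‖∫ y, b y ∂μ‖
  hH : σ.real H ≤ δ / 4 * σ.real univ
  T : ∀ x ∈ closedBall x0 S, x ∉ H → ∀ r > 0, ‖∫ y in {y | r < e x y}, K x y * b y ∂μ‖ ≤ Λ
  g : ∀ x ∈ closedBall x0 S, x ∉ H → ∀ r > 0, σ (closedBall x r) ≤ oR (Λ * r ^ n)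
lemma cell_P {X ι : Type} [MeasurableSpace X] [Fintype ι] [MeasurableSpace ι] [MeasurableSingletonClass ι] {p : X → ι} (hp : Measurable p) {Q : Set X} (hQ : MeasurableSet Q) (μ : Measure X) (P : ι → Prop) :
    μ (Q ∩ p ⁻¹' {c | P c}) = ∑ c, if P c then μ (Q ∩ p ⁻¹' {c}) else 0 := by
  rw [cell_meas_sum hp (hQ.inter (hp (Set.toFinite _).measurableSet))]
  refine sum_congr rfl fun c _ => ?_
  split_ifs with h
  · congr 1; ext y; simp only [mem_inter_iff]; constructor
    · tauto
    · rintro ⟨a, rfl⟩; tauto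
  · convert measure_empty (μ := μ); ext y; simp only [ mem_empty_iff_false, iff_false]
    rintro ⟨⟨-, a⟩, rfl⟩; exact h a
variable {d : ℕ}
local notation "E" => Eu d
set_option maxHeartbeats 1600000 in
theorem disc (d : ℕ) {n α C Λ δ D1 : ℝ} (hn : 0 < n) (hα : 0 < α) (hC : 0 < C) (hΛ : 0 < Λ) (hδ : 0 < δ) (hδ1 : δ ≤ 1) (hD1 : 1 ≤ D1) : ∃ D : ℝ, 0 < D ∧
    ∀ {μ : Measure Eu d} {K : KT d} {C0 : ℝ} (h : SI μ K n α C C0) {e x0 S b σ H} (t : TD μ K n Λ δ D1 e x0 S b σ H) {ε : ℝ} (hε : 0 < ε) (hεS : ε ≤ S),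
    ∃ (M : ℕ) (p : Eu d → (Fin d → Fin M)) (kc : (Fin d → Fin M) → (Fin d → Fin M) → ℂ) (Q0 G : Set Eu d), Measurable p ∧ MeasurableSet G ∧ G ⊆ Q0 ∧ Q0 ⊆ closedBall x0 S ∧
      μ (closedBall x0 S \ Q0) = 0 ∧ δ / 4 * σ.real univ ≤ σ.real G ∧
      (∀ F : Eu d → ℂ, IntegrableOn F (closedBall x0 S) μ → IntegrableOn (fun x => ‖F x‖ ^ 2) (closedBall x0 S) μ →
        ∫⁻ y in closedBall x0 S, ‖∫ z in closedBall x0 S, kc (p y) (p z) * F z ∂μ‖ₑ ^ 2 ∂μ ≤ oR D * ∫⁻ y in closedBall x0 S, ‖F y‖ₑ ^ 2 ∂μ) ∧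
      ∀ x ∈ G, ∀ y ∈ Q0, ∀ z ∈ Q0, ∀ r, ε ≤ r → dist x y ≤ r → 20 * r ≤ dist x z → ‖kc (p y) (p z) - K x z‖ ≤ 4 * C * 2 ^ (n + α) * r ^ α / dist x z ^ (n + α) := by
  have h21 : 0 < 1 - (2:ℝ) ^ (-α) := by have := Real.rpow_lt_one_of_one_lt_of_neg (x := 2) (z := -α) nz lz; linarith
  set tl := 2 ^ (n + α) / (1 - (2:ℝ) ^ (-α)) with htl
  have htl0 : 0 < tl := pz
  set C' := C * (10 ^ 6 * (24:ℝ) ^ n) with hC'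
  have hC'0 : 0 < C' := pz
  set C2 := 4 * C * 2 ^ (n + α) * 2 ^ (n + α) + C' * 2 ^ n * (1 + 20 * D1) ^ (n + α) with hC2
  have hC20 : 0 < C2 := pz
  obtain ⟨A, u, Cb, q, hA, hAc, hu, hu2, hq, hqu, hqκ, hCb, core⟩ := core d (n := n) (α := α) (C := C') (Ct := 4 ^ (n + α) * (tl * Λ)) (Λ := Λ + C2 * (tl * Λ)) (δ := δ) (c := δ / 2) hn hα hC'0 pz hδ pz
  refine ⟨4 * (Cb + 1) ^ 2, by positivity, ?_⟩
  intro μ K C0 h e x0 S b σ H t ε hε hεS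
  have hS := t.hS
  have := t.sf
  have := h.sfin
  have q0 : (0:ℝ) < q := by have : 0 < q := by omega
                            exact_mod_cast this
  set Q := closedBall x0 S with hQd
  have hQ : MeasurableSet Q := isClosed_closedBall.measurableSet
  obtain ⟨N, hN⟩ := pow_unbounded_of_one_lt (256 * S / ε) (show (1:ℝ) < q by exact_mod_cast (by omega : 1 < q))
  have hM : 2 ≤ q ^ N := by
    have : (2:ℝ) < q ^ N := lt_of_le_of_lt (by rw [le_div_iff₀ hε]; linarith) hN
    exact_mod_cast this.le
  obtain ⟨p, hp, hgr⟩ := grid x0 hS hM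
  set hh := 4 * S / ((q ^ N : ℕ) : ℝ) with hhd
  have hh0 : 0 < hh := pz
  have hhε : 64 * hh ≤ ε := by
    rw [div_lt_iff₀ hε] at hN
    rw [hhd, ← mul_div_assoc, div_le_iff₀ pz]; push_cast; linarith
  obtain ⟨V, hV⟩ : ∃ V : (Fin d → Fin (q ^ N)) → Prop, ∀ c, V c ↔ σ (Q ∩ p ⁻¹' {c}) ≠ 0 := ⟨_, fun _ => Iff.rfl⟩
  have hVn : ∀ c, ¬ V c → σ (Q ∩ p ⁻¹' {c}) = 0 := fun c hc => not_not.1 fun h => hc ((hV c).2 h)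
  set cell : {c // V c} → Set Eu d := fun v => Q ∩ p ⁻¹' {v.1} with hcell
  have cm : ∀ v, MeasurableSet (cell v) := fun v => cell_meas hp hQ v.1
  set w : {c // V c} → ℝ := fun v => σ.real (cell v)
  have hw : ∀ v, 0 < w v := fun v => toReal_pos ((hV _).1 v.2) (measure_ne_top _ _)
  have wσ : ∀ v, oR (w v) = σ (cell v) := fun v => ofReal_measureReal (measure_ne_top _ _)
  set bX : {c // V c} → ℂ := fun v => (∫ z in cell v, b z ∂μ) / (w v : ℂ)
  have wn : ∀ v, (w v : ℂ) ≠ 0 := fun v => by exact_mod_cast (hw v).ne'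
  have hbX : ∀ v, ‖bX v‖ ≤ 1 := fun v => by
    simp only [bX, norm_div, norm_real, norm_of_nonneg (hw v).le]
    rw [div_le_one (hw v), ← ofReal_le_ofReal_iff (hw v).le, wσ, ofReal_norm]
    refine (enorm_integral_le_lintegral_enorm _).trans ?_
    rw [← withDensity_apply _ (cm v)]
    exact t.s2 _
  set pos : {c // V c} → Fin d → ℕ := fun v i => (v.1 i : ℕ) with hpos
  set ds := gds hh pos with hds
  have key : ∀ u v, ∀ y ∈ cell u, ∀ z ∈ cell v, |dist y z - ds u v| ≤ hh := by
    intro u v y hy z hz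
    have := hgr y hy.1 z hz.1
    rwa [show p y = u.1 from hy.2, show p z = v.1 from hz.2] at this
  have d0 : ∀ u v, 0 ≤ ds u v := fun u v => by simp only [hds, gds]; positivity
  have dcomm : ∀ u v, ds u v = ds v u := fun u v => by simp only [hds, gds, dist_comm]
  have dtri : ∀ u v v', ds u v' ≤ ds u v + ds v v' := fun u v v' => by
    simp only [hds, gds, ← mul_add]; exact mll (dist_triangle _ _ _) hh0.le
  have dself : ∀ u, ds u u = 0 := fun u => by simp [hds, gds]
  have hξe : ∀ v, ∃ a ∈ cell v, σ (cell v \ H) ≠ 0 → a ∉ H := by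
    intro v
    by_cases hv : σ (cell v \ H) = 0
    · obtain ⟨a, ha⟩ := nonempty_of_measure_ne_zero ((hV _).1 v.2); exact ⟨a, ha, fun h => absurd hv h⟩
    · obtain ⟨a, ha⟩ := nonempty_of_measure_ne_zero hv; exact ⟨a, ha.1, fun _ => ha.2⟩
  choose ξ hξ hξH using hξe
  set hpc : {c // V c} → Prop := fun v => δ / 2 * q ^ N ≤ (((rg (q ^ N)).filter (fun m => ∀ k ≤ N + 1, δ ≤ ‖av w (glab q N m pos k) bX v‖)).card : ℝ) with hhpc
  set good : {c // V c} → Prop := fun v => hpc v ∧ σ (cell v \ H) ≠ 0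
  set P : (Fin d → Fin (q ^ N)) → Prop := fun c => ∃ hv : V c, good ⟨c, hv⟩
  have subV : ∀ (ν : Measure Eu d) [IsFiniteMeasure ν] (R : (Fin d → Fin (q ^ N)) → Prop) (hR : ∀ c, ¬ V c → R c → ν (Q ∩ p ⁻¹' {c}) = 0), ν.real (Q ∩ p ⁻¹' {c | R c}) = ∑ v : {c // V c}, if R v.1 then ν.real (cell v) else 0 := by
    intro ν _ R hR
    rw [measureReal_def, cell_P hp hQ, sum_subR (V := V), toReal_sum]
    · refine sum_congr rfl fun v _ => ?_
      split_ifs <;> simp [measureReal_def, cell]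
    · intro v _; split_ifs <;> simp
    · intro c hc; split_ifs with hr
      · exact hR c hc hr
      · rfl
  have wsum : ∑ v, w v = σ.real univ := by
    have := subV σ (fun _ => True) (fun c hc _ => hVn c hc)
    simp only [Set.ofPred_true, preimage_univ, inter_univ, if_true] at this
    rw [← this]
    exact (measureReal_congr (ae_eq_univ.2 t.s3))
  have bsum : ∑ v, (w v : ℂ) * bX v = ∫ y, b y ∂μ := by
    have e1 : ∀ v, (w v : ℂ) * bX v = 1 * ∫ z in cell v, b z ∂μ := fun v => by simp only [bX]; field_simp [wn v]
    rw [sum_congr rfl fun v _ => e1 v]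
    simp only [hcell]
    rw [← sum_sub (V := V) (fun c => 1 * ∫ z in Q ∩ p ⁻¹' {c}, b z ∂μ), ← cell_int hp hQ t.bi.integrableOn (fun _ => 1)]
    · simp only [one_mul]; exact setIntegral_eq_integral_of_forall_compl_eq_zero fun x hx => t.b0 x hx
    · intro c hc
      rw [Measure.restrict_eq_zero.2]; · simp
      have := t.s1 (Q ∩ p ⁻¹' {c}); rw [hVn c hc, Measure.restrict_apply (cell_meas hp hQ c)] at this
      rw [← nonpos_iff_eq_zero]; refine le_trans (measure_mono (show Q ∩ p ⁻¹' {c} ⊆ Q ∩ p ⁻¹' {c} ∩ Q from fun y hy => ⟨hy, hy.1⟩)) this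
  have mass : δ / 4 * σ.real univ ≤ σ.real (Q ∩ p ⁻¹' {c | P c}) := by
    have m1 := hp_mass hw hbX hδ q N hq pos (by rw [wsum, bsum]; exact t.top)
    have m2 := subV σ P (fun c hc hP => absurd hP.1 hc)
    have m3 := subV (σ.restrict H) (fun _ => True) (fun c hc _ => by
      rw [← nonpos_iff_eq_zero]; exact (Measure.restrict_apply_le _ _).trans (hVn c hc).le)
    have m4 : (σ.restrict H).real (Q ∩ p ⁻¹' {c | True}) ≤ σ.real H := by
      have := measureReal_mono (μ := σ.restrict H) (subset_univ (Q ∩ p ⁻¹' {c | True}))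
      simpa [measureReal_def] using this
    have m5 : ∑ v, w v * (if hpc v then 1 else 0) ≤ σ.real (Q ∩ p ⁻¹' {c | P c}) + (σ.restrict H).real (Q ∩ p ⁻¹' {c | True}) := by
      rw [m2, m3, ← sum_add_distrib]
      refine sum_le_sum fun v _ => ?_
      by_cases h1 : hpc v
      · by_cases h2 : σ (cell v \ H) = 0
        · have : w v = (σ.restrict H).real (cell v) := by
            simp only [w, measureReal_def]
            rw [Measure.restrict_apply (cm v)]
            have := measure_le_inter_add_sdiff σ (cell v) H
            rw [h2, add_zero] at this
            rw [le_antisymm this (measure_mono inter_subset_left)]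
          simp only [h1, if_true, mul_one, ← this]
          exact le_add_of_nonneg_left (by split_ifs <;> positivity)
        · have hP : P v.1 := ⟨v.2, h1, h2⟩
          simp only [h1, hP, if_true, mul_one]
          have : 0 ≤ (σ.restrict H).real (cell v) := measureReal_nonneg
          simp only [w]; linarith
      · simp only [h1, if_false, mul_zero]
        split_ifs <;> positivity
    have := t.hH
    rw [wsum] at m1
    linarith
  have σ0 : 0 < σ.real univ := toReal_pos t.s0 (measure_ne_top _ _)
  have gne : (Finset.univ.filter good).Nonempty := by
    have : σ (Q ∩ p ⁻¹' {c | P c}) ≠ 0 := fun h0 => by rw [measureReal_def σ (_ ∩ _), h0] at mass; exact absurd mass (not_le.2 (by rw [toReal_zero]; positivity))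
    obtain ⟨y, hy⟩ := nonempty_of_measure_ne_zero this
    obtain ⟨hv, hg⟩ := hy.2
    exact ⟨_, by simpa using hg⟩
  have nre : ∀ v, ∃ g, good g ∧ ∀ g', good g' → ds v g ≤ ds v g' := fun v => by
    obtain ⟨g, hg, hg'⟩ := Finset.exists_min_image _ (fun g => ds v g) gne
    exact ⟨g, by simpa using hg, fun g' h' => hg' g' (by simpa using h')⟩
  choose nr nrg nrm using nre
  set Ψ : {c // V c} → ℝ := fun v => ε + ds v (nr v) with hΨd
  have Ψε : ∀ v, ε ≤ Ψ v := fun v => by simp only [hΨd]; linarith [d0 v (nr v)]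
  have lip : ∀ u v, Ψ u ≤ Ψ v + ds u v := fun u v => by
    have h1 := nrm u _ (nrg v); have h2 := dtri u v (nr v); simp only [hΨd]; linarith
  have Ψg : ∀ g, good g → Ψ g = ε := fun g hg => by
    have := nrm g g hg; rw [dself] at this; have := d0 g (nr g); simp only [hΨd]; linarith
  have ck : CK K n α C ds Ψ ξ hh := ⟨hn, hα, h.hα1, hC, h.sz, h.sm, d0, dcomm, dtri, hh0.le, fun v => hε.trans_le (Ψε v), fun v => hhε.trans (Ψε v), lip, fun u v => key u v _ (hξ u) _ (hξ v), by
    intro u v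
    by_cases huv : u = v
    · exact Or.inl huv
    refine Or.inr ?_
    obtain ⟨i, hi⟩ : ∃ i, u.1 i ≠ v.1 i := by by_contra hc; push Not at hc; exact huv (Subtype.ext (funext hc))
    have h1 : (1:ℝ) ≤ dist (fun i => (pos u i : ℝ)) (fun i => (pos v i : ℝ)) := by
      refine le_trans ?_ (dist_le_pi_dist _ _ i)
      rw [Nat.dist_cast_real]
      have : (u.1 i : ℕ) ≠ (v.1 i : ℕ) := fun h => hi (Fin.ext h)
      rw [Nat.dist_eq]; exact_mod_cast Int.one_le_abs (by simpa [sub_ne_zero] using this)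
    exact le_mul_of_one_le_right hh0.le h1⟩
  set kk := CK.kk K ds Ψ ξ with hkk
  set kc : (Fin d → Fin (q ^ N)) → (Fin d → Fin (q ^ N)) → ℂ := fun c c' => if hv : V c ∧ V c' then kk ⟨c, hv.1⟩ ⟨c', hv.2⟩ else 0 with hkc
  have kck : ∀ u v : {c // V c}, kc u.1 v.1 = kk u v := fun u v => by simp [hkc, u.2, v.2]
  have two : ∀ g v v', good g → ∀ x ∈ cell g, ∀ y ∈ cell v, ∀ z ∈ cell v', ∀ r, ε ≤ r → dist x y ≤ r → 20 * r ≤ dist x z → ‖kk v v' - K x z‖ ≤ 4 * C * 2 ^ (n + α) * r ^ α / dist x z ^ (n + α) := by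
    intro g v v' hg x hx y hy z hz r hr hxy hxz
    have k1 := abs_le.1 (key v g y hy x hx); have k2 := abs_le.1 (key v v' y hy z hz)
    have k3 := abs_le.1 (key v v _ (hξ v) y hy); have k4 := abs_le.1 (key v' v' _ (hξ v') z hz)
    rw [dself] at k3 k4
    have l1 := lip v g; have l2 := lip v' v; rw [Ψg g hg] at l1
    have t1 := dist_triangle x y z; have t2 := dist_triangle x y (ξ v)
    rw [dist_comm y x] at k1; rw [dist_comm (ξ v) y] at k3; rw [dist_comm (ξ v') z] at k4; rw [dcomm v' v] at l2
    have : kk v v' = K (ξ v) (ξ v') := by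
      simp only [hkk, CK.kk]; rw [ct_one (by have := Ψε v; have := Ψε v'; linarith) lz]; simp
    rw [this]
    exact h.far lz lz lz hxz
  have aQ : ∀ v, ξ (nr v) ∈ Q ∧ ξ (nr v) ∉ H := fun v => ⟨(hξ _).1, hξH _ (nrg v).2⟩
  have tailσ : ∀ v ℓ, 0 < ℓ → ∫⁻ y, oR (ℓ ^ α / (ℓ + dist y (ξ (nr v))) ^ (n + α)) ∂σ ≤ oR (tl * Λ) := fun v ℓ hℓ =>
    tailL hn hα σ _ hΛ.le hℓ fun r hr => t.g _ (aQ v).1 (aQ v).2 r (hℓ.trans_le hr)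
  have tail : ∀ ℓ z, 0 < ℓ → Ψ z ≤ 2 * ℓ → ∑ x, w x * (ℓ ^ α / (ℓ + ds x z) ^ (n + α)) ≤ 4 ^ (n + α) * (tl * Λ) := by
    intro ℓ z hℓ hz
    rw [← ofReal_le_ofReal_iff pz, ofReal_sum_of_nonneg (fun v _ => by have := d0 v z; have := hw v; positivity), ofReal_mul pz]
    refine le_trans ?_ (mul_le_mul_right (tailσ z ℓ hℓ) _)
    rw [← lintegral_const_mul _ (by fun_prop)]
    refine le_trans ?_ (setLIntegral_le_lintegral Q _)
    rw [cell_lint hp hQ]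
    have : ∀ v : {c // V c}, oR (w v * (ℓ ^ α / (ℓ + ds v z) ^ (n + α))) ≤ ∫⁻ y in cell v, oR (4 ^ (n + α)) * oR (ℓ ^ α / (ℓ + dist y (ξ (nr z))) ^ (n + α)) ∂σ := by
      intro v
      rw [ofReal_mul (hw v).le, wσ, mul_comm, ← setLIntegral_const]
      refine setLIntegral_mono (by fun_prop) fun y hy => ?_
      rw [← ofReal_mul pz]
      apply ofReal_le_ofReal
      have k1 := abs_le.1 (key v (nr z) y hy _ (hξ _)); have := dtri v z (nr z); have := d0 v z
      have := dist_nonneg (x := y) (y := ξ (nr z))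
      have hb : ℓ + dist y (ξ (nr z)) ≤ 4 * (ℓ + ds v z) := by simp only [hΨd] at hz; linarith
      have hb2 := Real.rpow_le_rpow pz hb (show 0 ≤ n + α by positivity)
      rw [mul_rpow nz pz] at hb2
      rw [mul_div_assoc', div_le_div_iff₀ pz pz]
      have := mll hb2 (Real.rpow_nonneg hℓ.le α)
      linarith
    refine (sum_le_sum fun v _ => this v).trans ?_
    rw [← sum_subtype (Finset.univ.filter V) zs (f := fun c => ∫⁻ y in Q ∩ p ⁻¹' {c}, oR (4 ^ (n + α)) * oR (ℓ ^ α / (ℓ + dist y (ξ (nr z))) ^ (n + α)) ∂σ)]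
    exact Finset.sum_le_sum_of_subset (Finset.filter_subset _ _)
  have hV0 : ∀ c, ¬ V c → μ (Q ∩ p ⁻¹' {c}) = 0 := fun c hc => by
    have := t.s1 (Q ∩ p ⁻¹' {c}); rw [hVn c hc, Measure.restrict_apply (cell_meas hp hQ c)] at this
    rw [← nonpos_iff_eq_zero]; exact le_trans (measure_mono (show Q ∩ p ⁻¹' {c} ⊆ Q ∩ p ⁻¹' {c} ∩ Q from fun y hy => ⟨hy, hy.1⟩)) this
  have nullQ : μ (Q \ (Q ∩ p ⁻¹' {c | V c})) = 0 := by
    have : Q \ (Q ∩ p ⁻¹' {c | V c}) = Q ∩ p ⁻¹' {c | ¬ V c} := by ext; simp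
    rw [this, cell_P hp hQ]
    exact sum_eq_zero fun c _ => by by_cases hc : V c <;> simp [hc, hV0]
  have K1' : ∀ x y, ‖kk x y‖ ≤ C' / (ds x y + Ψ x + Ψ y) ^ n := fun x y => by
    refine (ck.K1 x y).trans (div_le_div_of_nonneg_right ?_ (Real.rpow_nonneg (by have := d0 x y; have := Ψε x; have := Ψε y; linarith) _))
    rw [hC', mul_assoc]
    gcongr <;> norm_num
  have Tb : ∀ v, ‖∑ y, (w y : ℂ) * (kk v y * bX y)‖ ≤ Λ + C2 * (tl * Λ) := by
    intro v
    set a := ξ (nr v)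
    set ρ := Ψ v
    have ρ0 : 0 < ρ := hε.trans_le (Ψε v)
    set r := 2 * ρ with hr
    have s1 : ∑ y, (w y : ℂ) * (kk v y * bX y) = ∫ z, kc v (p z) * b z ∂μ := by
      have e1 : ∀ y, (w y : ℂ) * (kk v y * bX y) = kc v y.1 * ∫ z in Q ∩ p ⁻¹' {y.1}, b z ∂μ := fun y => by rw [kck]; simp only [bX]; field_simp [wn y]; rfl
      rw [sum_congr rfl fun v _ => e1 v]
      rw [← sum_sub (V := V) (fun c => kc v c * ∫ z in Q ∩ p ⁻¹' {c}, b z ∂μ), ← cell_int hp hQ t.bi.integrableOn]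
      · exact setIntegral_eq_integral_of_forall_compl_eq_zero fun x hx => by rw [t.b0 x hx, mul_zero]
      · intro c hc; simp [hkc, hc]
    set Z := {y | 20 * D1 * r < e a y}
    have hZm : MeasurableSet Z := t.em _ _
    have Zfar : ∀ z ∈ Z, 20 * r ≤ dist a z := fun z hz => by
      have h1 := t.e2 a z; have h2 : 20 * D1 * r < e a z := hz
      have : D1 * (20 * r) < D1 * dist a z := lz
      exact (lt_of_mul_lt_mul_left this lz).le
    have s2 : ∫ z in Z, K a z * b z ∂μ = ∫ z, Z.indicator (kr K r a) z * b z ∂μ := by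
      rw [← integral_indicator hZm]
      congr 1; ext z
      by_cases hz : z ∈ Z
      · simp only [indicator_of_mem hz]; rw [SI.kr_one K pz (by have := Zfar z hz; linarith)]
      · simp [indicator_of_notMem hz]
    have i1 : Integrable (fun z => kc v (p z) * b z) μ := t.bi.bdd_mul (c := ∑ c, ‖kc v c‖) ((measurable_of_countable (kc v)).comp hp).aestronglyMeasurable
      (.of_forall fun z => single_le_sum (f := fun c => ‖kc v c‖) (fun c _ => norm_nonneg _) (Finset.mem_univ (p z)))
    have i2 : Integrable (fun z => Z.indicator (kr K r a) z * b z) μ := t.bi.bdd_mul (c := C * 128 * 12 ^ n / r ^ n) ((h.kr_meas pz a).indicator hZm).aestronglyMeasurable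
      (.of_forall fun z => (norm_indicator_le_norm_self _ _).trans (h.krb pz a z))
    have s3 : ‖∫ z, (kc v (p z) * b z - Z.indicator (kr K r a) z * b z) ∂μ‖ ≤ C2 * (tl * Λ) := by
      rw [← ofReal_le_ofReal_iff pz, ofReal_norm, ofReal_mul pz]
      refine (enorm_integral_le_lintegral_enorm _).trans (le_trans ?_ (mul_le_mul_right (tailσ v r pz) _))
      rw [← lintegral_const_mul _ (by fun_prop)]
      refine le_trans ?_ (lintegral_mono' t.s2 le_rfl)
      rw [lintegral_withDensity_eq_lintegral_mul _ (by have := t.bm; fun_prop) (by fun_prop)]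
      refine lintegral_mono_ae ?_
      have : ∀ᵐ z ∂μ, z ∉ Q \ (Q ∩ p ⁻¹' {c | V c}) := measure_eq_zero_iff_ae_notMem.1 nullQ
      filter_upwards [this] with z hz
      rw [← sub_mul, enorm_mul, mul_comm, Pi.mul_apply]
      by_cases hzQ : z ∈ Q
      swap
      · simp [t.b0 z hzQ]
      gcongr
      have hzV : V (p z) := by by_contra hc; exact hz ⟨hzQ, fun h => hc h.2⟩
      rw [← ofReal_mul pz, ← ofReal_norm]
      apply ofReal_le_ofReal
      have hr0 : 0 < r := pz
      have hρε := Ψε v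
      by_cases hzZ : z ∈ Z
      · rw [indicator_of_mem hzZ, SI.kr_one K hr0 (by have := Zfar z hzZ; linarith)]
        have zf := Zfar z hzZ
        have h2 := two (nr v) v ⟨p z, hzV⟩ (nrg v) a (hξ _) (ξ v) (hξ v) z ⟨hzQ, rfl⟩ r lz (by
          have := abs_le.1 (key (nr v) v a (hξ _) _ (hξ v))
          rw [dcomm] at this
          have e0 : ρ = ε + ds v (nr v) := rfl
          linarith) zf
        rw [kck v ⟨p z, hzV⟩]
        refine h2.trans ?_
        have D0 : 0 < dist a z := lz
        have e1 : (r + dist z a) ^ (n + α) ≤ 2 ^ (n + α) * dist a z ^ (n + α) := by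
          rw [← mul_rpow nz D0.le, dist_comm z a]
          exact Real.rpow_le_rpow pz lz pz
        rw [mul_div_assoc', div_le_div_iff₀ pz pz]
        calc _ ≤ 4 * C * 2 ^ (n + α) * r ^ α * (2 ^ (n + α) * dist a z ^ (n + α)) := by gcongr
          _ = (4 * C * 2 ^ (n + α) * 2 ^ (n + α)) * r ^ α * dist a z ^ (n + α) := by ring
          _ ≤ _ := by
            gcongr
            rw [hC2]; linarith [show 0 < C' * 2 ^ n * (1 + 20 * D1) ^ (n + α) by positivity]
      · rw [indicator_of_notMem hzZ, sub_zero, kck v ⟨p z, hzV⟩]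
        have hD : dist z a ≤ 20 * D1 * r := by rw [dist_comm]; exact (t.e1 a z).trans (not_lt.1 hzZ)
        have e1 : (r + dist z a) ^ (n + α) ≤ (1 + 20 * D1) ^ (n + α) * (r ^ n * r ^ α) := by
          rw [← Real.rpow_add hr0, ← mul_rpow pz hr0.le]
          exact Real.rpow_le_rpow pz lz pz
        have e2 : ‖kk v ⟨p z, hzV⟩‖ ≤ C' * 2 ^ n / r ^ n := by
          refine (K1' _ _).trans ?_
          rw [hr, mul_rpow nz ρ0.le, div_le_div_iff₀ (Real.rpow_pos_of_pos (by have := d0 v ⟨p z, hzV⟩; have := Ψε ⟨p z, hzV⟩; linarith) _) pz]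
          have : ρ ^ n ≤ (ds v ⟨p z, hzV⟩ + Ψ v + Ψ ⟨p z, hzV⟩) ^ n := Real.rpow_le_rpow ρ0.le (by have := d0 v ⟨p z, hzV⟩; have := Ψε ⟨p z, hzV⟩; have e0 : ρ = Ψ v := rfl; linarith) hn.le
          calc _ = C' * 2 ^ n * ρ ^ n := by ring
            _ ≤ _ := by gcongr
        refine e2.trans ?_
        rw [mul_div_assoc', div_le_div_iff₀ pz pz]
        calc _ ≤ C' * 2 ^ n * ((1 + 20 * D1) ^ (n + α) * (r ^ n * r ^ α)) := by gcongr
          _ = (C' * 2 ^ n * (1 + 20 * D1) ^ (n + α)) * r ^ α * r ^ n := by ring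
          _ ≤ _ := by
            gcongr
            rw [hC2]; linarith [show 0 < 4 * C * 2 ^ (n + α) * 2 ^ (n + α) by positivity]
    rw [s1]
    rw [integral_sub i1 i2, ← s2] at s3
    have s4 := t.T a (aQ v).1 (aQ v).2 (20 * D1 * r) pz
    have := norm_add_le (∫ z, kc v (p z) * b z ∂μ - ∫ z in Z, K a z * b z ∂μ) (∫ z in Z, K a z * b z ∂μ)
    rw [sub_add_cancel] at this
    linarith
  have qA : 8 * A ≤ q := by
    have := hqu.trans hu2
    rw [← div_eq_mul_inv, div_le_iff₀ q0] at this; linarith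
  have hL : hh * q ^ (N + 1) = 4 * S * q := by rw [hhd]; push_cast; field_simp; try ring
  let KK : KD w bX := ⟨ds, Ψ, kk, n, α, C', 4 ^ (n + α) * (tl * Λ), Λ + C2 * (tl * Λ), hh * q ^ (N + 1), (q:ℝ)⁻¹, u, A, d0, dcomm, dtri, fun v => hε.trans_le (Ψε v),
    fun x y => by simp only [hkk, CK.kk]; rw [h.an, add_comm (Ψ x), dcomm x y]; ring, hn, hα, hC'0, by positivity, by positivity, by positivity, by positivity,
    inv_lt_one_of_one_lt₀ (by exact_mod_cast (by omega : 1 < q)), hu, by linarith, hA, hqu, hqκ, K1', fun x y y' r h1 h2 h3 => ck.K2 x y y' r h1 h2 h3, tail, Tb⟩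
  have ch : CH KK δ (δ / 2) q N hh pos := ⟨hq, hh0, fun _ _ => rfl, rfl, rfl, fun v i => (v.1 i).2, lip, fun v => by have := Ψε v; show hh ≤ Ψ v; linarith, hw, hbX, hδ, hδ1, by positivity, hu2, hAc,
    by rw [bsum, wsum]; have := t.top; have := mul_pos hδ σ0; linarith, by
      obtain ⟨g, hg⟩ := gne
      refine ⟨g, ?_⟩
      show A * Ψ g < hh * q ^ (N + 1)
      rw [Ψg g (by simpa using hg), hL]; have := mll qA hS.le; have := mll hεS (zero_le_one.trans hA); have := mul_pos hS (zero_lt_one.trans_le hA); linarith, fun v => ⟨nr v, by show ds v (nr v) ≤ ε + ds v (nr v); linarith, (nrg v).1⟩⟩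
  have fin := core _ w bX KK N hh pos rfl rfl rfl rfl rfl rfl rfl ch
  refine ⟨q ^ N, p, kc, Q ∩ p ⁻¹' {c | V c}, Q ∩ p ⁻¹' {c | P c}, hp, hQ.inter (hp (Set.toFinite _).measurableSet), fun y hy => ⟨hy.1, hy.2.1⟩, inter_subset_left, nullQ, mass, ?_, ?_⟩
  · intro F hF hF2
    refine cellL2 hp hQ (h.fin x0 S) hw (fun v => ?_) hV0 kc pz (fun f g => ?_) hF hF2
    · have := t.s1 (cell v)
      rw [Measure.restrict_apply (cm v)] at this
      refine toReal_mono (measure_ne_top _ _) (le_trans (measure_mono fun y hy => ?_) this)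
      exact ⟨hy, hy.1⟩
    · have e : (fun x y : {c // V c} => kc x.1 y.1) = kk := by ext x y; exact kck x y
      rw [e]
      have n0 : ∀ f : {c // V c} → ℂ, 0 ≤ nq w f := fun f => sum_nonneg fun v _ => mul_nonneg (hw v).le (sq_nonneg _)
      exact (fin f g).trans (mul_le_mul_of_nonneg_right lz (add_nonneg (n0 f) (n0 g)))
  · intro x hx y hy z hz r h1 h2 h3
    have := two ⟨p x, hx.2.1⟩ ⟨p y, hy.2⟩ ⟨p z, hz.2⟩ hx.2.2 x ⟨hx.1, rfl⟩ y ⟨hy.1, rfl⟩ z ⟨hz.1, rfl⟩ r h1 h2 h3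
    rwa [← kck] at this
end
section
structure TF {d : ℕ} (μ : Measure Eu d) (K : KT d) (e : Eu d → Eu d → ℝ) (q B1 B2 s : ℝ) (x0 : Eu d) (S : ℝ) (b : Eu d → ℂ) : Prop where
  bm : Measurable b
  b0 : ∀ x ∉ closedBall x0 S, b x = 0
  it : ∫ y, b y ∂μ = (μ.real (closedBall x0 S) : ℂ)
  lq : ∫⁻ y, ‖b y‖ₑ ^ q ∂μ ≤ oR B1 * μ (closedBall x0 S)
  wk : ∀ lam > 0, oR (lam ^ s) * μ {x | x ∈ closedBall x0 S ∧ ∃ r > 0, lam < ‖∫ y in {y | r < e x y}, K x y * b y ∂μ‖} ≤ oR B2 * μ (closedBall x0 S)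
structure EE {d : ℕ} (e : Eu d → Eu d → ℝ) (D1 : ℝ) : Prop where
  e1 : ∀ x y, dist x y ≤ e x y
  e2 : ∀ x y, e x y ≤ D1 * dist x y
  em : ∀ x r, MeasurableSet {y | r < e x y}
lemma exP {s B η : ℝ} (hs : 0 < s) (hη : 0 < η) : ∀ᶠ L : ℝ in atTop, L ^ (-s) * B ≤ η := by
  have := (tendsto_rpow_neg_atTop hs).mul_const B
  rw [zero_mul] at this
  exact (this.eventually (gt_mem_nhds hη)).mono fun _ h => le_of_lt h
lemma young {κ q t : ℝ} (hκ : 0 < κ) (hq : 1 < q) (ht : 0 ≤ t) : t ≤ κ + κ ^ (1 - q) * t ^ q := by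
  rcases le_total t κ with h | h
  · have : 0 ≤ κ ^ (1 - q) * t ^ q := pz
    linarith
  · have t0 := hκ.trans_le h
    have e : t = t ^ (1 - q) * t ^ q := by rw [← Real.rpow_add t0]; simp
    have : t ^ (1 - q) ≤ κ ^ (1 - q) := Real.rpow_le_rpow_of_nonpos hκ h lz
    calc t = t ^ (1 - q) * t ^ q := e
      _ ≤ κ ^ (1 - q) * t ^ q := by gcongr
      _ ≤ _ := lz
theorem mkTD (d : ℕ) {n α C C0 q B1 B2 s D1 : ℝ} (hn : 0 < n) (hC0 : 0 < C0) (hq : 1 < q) (hB1 : 0 < B1) (hB2 : 0 < B2) (hs : 0 < s) : ∃ δ Λ η : ℝ, 0 < δ ∧ δ ≤ 1 ∧ 0 < Λ ∧ 0 < η ∧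
    ∀ {μ : Measure Eu d} {K : KT d} (h : SI μ K n α C C0) {e} (he : EE e D1) {x0 S b} (t : TF μ K e q B1 B2 s x0 S b) (hS : 0 < S) (h0 : μ (closedBall x0 S) ≠ 0),
    ∃ σ H, TD μ K n Λ δ D1 e x0 S b σ H ∧ ∀ G, MeasurableSet G → G ⊆ closedBall x0 S → δ / 4 * σ.real univ ≤ σ.real G → η * μ.real (closedBall x0 S) ≤ μ.real G := by
  set δ := 1 / (2 * (2 + B1)) with hδ
  have δ0 : 0 < δ := pz
  have δe : 2 * δ * (2 + B1) = 1 := by rw [hδ]; field_simp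
  obtain ⟨κ, hκ, κ1⟩ := ((exP (s := q - 1) (B := B1) (η := δ / 8) lz pz).and (eventually_ge_atTop 1)).exists
  rw [neg_sub] at hκ
  set η := δ / (8 * (1 + κ)) with hη
  have η0 : 0 < η := pz
  have ηe : (1 + κ) * η = δ / 8 := by rw [hη]; field_simp
  obtain ⟨Λ, hΛ, hΛ', Λ1⟩ := ((exP (s := s) (B := B2) (η := η / 2) hs pz).and ((exP (s := 1) (B := (2 + B1) * (C0 * 5 ^ n)) (η := η / 2) nz pz).and (eventually_ge_atTop 1))).exists
  have Λ0 : 0 < Λ := lz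
  refine ⟨δ, Λ, η, δ0, by nlinarith, Λ0, η0, ?_⟩
  intro μ K h e he x0 S b t hS h0
  have := h.sfin
  set Q := closedBall x0 S
  have hQ : MeasurableSet Q := isClosed_closedBall.measurableSet
  have mf : μ Q ≠ ∞ := h.fin x0 S
  have m0 : 0 < μ.real Q := toReal_pos h0 mf
  have me := t.bm.enorm
  set σ := μ.restrict Q + μ.withDensity (fun y => ‖b y‖ₑ) with hσ
  have wd : ∀ A, MeasurableSet A → ∀ k, 1 ≤ k → μ.withDensity (fun y => ‖b y‖ₑ) A ≤ oR k * μ (A ∩ Q) + oR (k ^ (1 - q) * B1) * μ Q := by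
    intro A hA k hk
    rw [withDensity_apply _ hA]
    have p1 : ∀ y, ‖b y‖ₑ ≤ Q.indicator (fun _ => oR k) y + oR (k ^ (1 - q)) * ‖b y‖ₑ ^ q := fun y => by
      by_cases hy : y ∈ Q
      · rw [indicator_of_mem hy, ← ofReal_norm, ofReal_rpow_of_nonneg (norm_nonneg _) lz, ← ofReal_mul pz, ← ofReal_add pz pz]
        exact ofReal_le_ofReal (young lz hq (norm_nonneg _))
      · simp [t.b0 y hy]
    refine (lintegral_mono p1).trans ?_
    rw [lintegral_add_left (measurable_const.indicator hQ), lintegral_indicator hQ, Measure.restrict_restrict hQ, setLIntegral_const, inter_comm Q, ofReal_mul pz, mul_assoc]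
    refine add_le_add_right ((setLIntegral_le_lintegral _ _).trans ?_) _
    rw [lintegral_const_mul _ (me.pow_const q)]
    exact mul_le_mul_right t.lq _
  have σA : ∀ A, MeasurableSet A → ∀ k, 1 ≤ k → σ A ≤ oR ((1 + k) * μ.real (A ∩ Q) + k ^ (1 - q) * B1 * μ.real Q) := by
    intro A hA k hk
    rw [hσ, Measure.add_apply, Measure.restrict_apply hA, ofReal_add pz pz, ofReal_mul pz, ofReal_mul pz (q := μ.real Q),
      ofReal_measureReal (measure_ne_top_of_subset inter_subset_right mf), ofReal_measureReal mf, ofReal_add zero_le_one lz, add_mul, ofReal_one, one_mul, add_assoc]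
    exact add_le_add_right (wd A hA k hk) _
  have sf : IsFiniteMeasure σ := ⟨(σA _ MeasurableSet.univ 1 le_rfl).trans_lt ofReal_lt_top⟩
  have σu : σ.real univ ≤ (2 + B1) * μ.real Q := by
    have := toReal_mono ofReal_ne_top (σA _ MeasurableSet.univ 1 le_rfl)
    rw [toReal_ofReal pz, Real.one_rpow, univ_inter] at this
    simp only [measureReal_def] at *; linarith
  have s1 : μ.restrict Q ≤ σ := Measure.le_add_right le_rfl
  have σl : μ.real Q ≤ σ.real univ := by
    have := toReal_mono (measure_ne_top _ _) (s1 univ)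
    rwa [restrict_apply_univ] at this
  set H1 := {x | x ∈ Q ∧ ∃ r > 0, Λ < ‖∫ y in {y | r < e x y}, K x y * b y ∂μ‖}
  set H2 := {x | x ∈ Q ∧ ∃ r > 0, oR (Λ * r ^ n) < σ (closedBall x r)}
  have b1 : μ.real H1 ≤ η / 2 * μ.real Q := by
    have := t.wk Λ Λ0
    rw [← ofReal_measureReal mf, ← ofReal_measureReal (measure_ne_top_of_subset (fun x hx => hx.1) mf), ← ofReal_mul pz, ← ofReal_mul pz, ofReal_le_ofReal_iff pz] at this
    have h2 := mll this (show 0 ≤ Λ ^ (-s) by positivity)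
    rw [← mul_assoc, ← Real.rpow_add Λ0] at h2
    simp only [neg_add_cancel, Real.rpow_zero, one_mul] at h2
    refine h2.trans ?_
    rw [← mul_assoc]; gcongr
  have b2 : μ.real H2 ≤ η / 2 * μ.real Q := by
    set L := Λ / (C0 * 5 ^ n) with hL
    have := weak11 μ σ (oR L) H2 (fun x hx => by
      obtain ⟨r, hr, hx⟩ := hx.2
      refine ⟨r, hr, le_trans (mul_le_mul_right (h.gr x (5 * r) pz) _) (le_trans (le_of_eq ?_) hx.le)⟩
      rw [← ofReal_mul pz, mul_rpow nz hr.le, hL]; congr 1; field_simp)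
    rw [← ofReal_measureReal (measure_ne_top_of_subset (fun x hx => hx.1) mf), ← ofReal_mul pz] at this
    have h2 := toReal_mono (measure_ne_top _ _) this
    rw [toReal_ofReal pz, ← measureReal_def] at h2
    have h3 := mll (h2.trans σu) (show 0 ≤ L⁻¹ by positivity)
    rw [inv_mul_cancel_left₀ pz] at h3
    refine h3.trans ?_
    rw [← mul_assoc]
    gcongr
    refine le_trans (le_of_eq ?_) hΛ'
    rw [Real.rpow_neg_one, hL]; field_simp
  set H := toMeasurable μ (H1 ∪ H2)
  have bH : μ.real (H ∩ Q) ≤ η * μ.real Q := by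
    have : μ.real H = μ.real (H1 ∪ H2) := by simp only [measureReal_def, H, measure_toMeasurable]
    have f0 : μ (H1 ∪ H2) ≠ ∞ := measure_ne_top_of_subset (union_subset (fun x hx => hx.1) (fun x hx => hx.1)) mf
    have h1 : μ.real (H ∩ Q) ≤ μ.real H := measureReal_mono inter_subset_left (by rwa [measure_toMeasurable])
    have := measureReal_union_le (μ := μ) H1 H2
    linarith
  have subH : ∀ x, x ∉ H → x ∉ H1 ∧ x ∉ H2 := fun x hx => ⟨fun h => hx (subset_toMeasurable μ _ (Or.inl h)), fun h => hx (subset_toMeasurable μ _ (Or.inr h))⟩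
  refine ⟨σ, H, ⟨hS, ⟨t.bm.aestronglyMeasurable, ?_⟩, t.bm, t.b0, he.e1, he.e2, he.em, s1, Measure.le_add_left le_rfl, ?_, sf, ?_, ?_, ?_, ?_, ?_⟩, ?_⟩
  · have := wd _ MeasurableSet.univ 1 le_rfl
    rw [withDensity_apply _ MeasurableSet.univ, restrict_univ, univ_inter] at this
    exact this.trans_lt (add_lt_top.2 ⟨mul_lt_top ofReal_lt_top mf.lt_top, mul_lt_top ofReal_lt_top mf.lt_top⟩)
  · rw [hσ, Measure.add_apply, Measure.restrict_apply hQ.compl, compl_inter_self, measure_empty, zero_add, withDensity_apply _ hQ.compl]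
    rw [setLIntegral_congr_fun (g := fun _ => 0) hQ.compl fun y hy => by simp [t.b0 y hy]]; simp
  · intro h0
    have : σ.real univ = 0 := by rw [measureReal_def, h0]; rfl
    linarith
  · rw [t.it, norm_real, norm_of_nonneg m0.le]
    calc 2 * δ * σ.real univ ≤ 2 * δ * ((2 + B1) * μ.real Q) := by gcongr
      _ = 2 * δ * (2 + B1) * μ.real Q := by ring
      _ ≤ _ := by rw [δe, one_mul]
  · have := toReal_mono ofReal_ne_top (σA H (measurableSet_toMeasurable _ _) κ κ1)
    rw [toReal_ofReal pz] at this
    refine this.trans ?_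
    have h1 := mll bH (show 0 ≤ 1 + κ by positivity)
    rw [← mul_assoc, ηe] at h1
    have h2 := mul_le_mul_of_nonneg_right hκ m0.le
    have h3 := mll σl δ0.le
    linarith
  · intro x hx hxH r hr
    by_contra hc
    exact (subH x hxH).1 ⟨hx, r, hr, not_le.1 hc⟩
  · intro x hx hxH r hr
    by_contra hc
    exact (subH x hxH).2 ⟨hx, r, hr, not_le.1 hc⟩
  · intro G hG hGQ hm
    have := toReal_mono ofReal_ne_top (σA G hG κ κ1)
    rw [toReal_ofReal pz, inter_eq_left.2 hGQ] at this
    have h2 := mul_le_mul_of_nonneg_right hκ m0.le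
    have h3 := mll σl δ0.le
    have h4 : (1 + κ) * (η * μ.real Q) ≤ (1 + κ) * μ.real G := by
      rw [← mul_assoc, ηe]
      have e : (σ G).toReal = σ.real G := rfl
      linarith
    exact le_of_mul_le_mul_left h4 pz
end
section
def A2 {d : ℕ} (μ : Measure Eu d) (g : Eu d → ℝ≥0∞) (x : Eu d) (m : ℝ) : Prop :=
  ∀ R > 0, ∫⁻ y in closedBall x R, g y ∂μ ≤ oR (m ^ 2) * μ (closedBall x (5 * R))
structure BP {d : ℕ} (μ : Measure Eu d) (K : KT d) (n α C D ε : ℝ) (x0 : Eu d) (S : ℝ) (kk : KT d) (Q0 G : Set Eu d) : Prop where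
  km : ∀ y, Measurable (kk y)
  kb : ∃ M, ∀ y z, ‖kk y z‖ ≤ M
  kp : ∀ F : Eu d → ℂ, Measurable fun y => ∫ z, kk y z * F z ∂μ
  gq : G ⊆ Q0
  q0 : Q0 ⊆ closedBall x0 S
  qn : μ (closedBall x0 S \ Q0) = 0
  l2 : ∀ F : Eu d → ℂ, BF F → (∀ y ∉ closedBall x0 S, F y = 0) → ∫⁻ y in closedBall x0 S, ‖∫ z, kk y z * F z ∂μ‖ₑ ^ 2 ∂μ ≤ oR D * ∫⁻ y, ‖F y‖ₑ ^ 2 ∂μ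
  cl : ∀ x ∈ G, ∀ y ∈ Q0, ∀ z ∈ Q0, ∀ r, ε ≤ r → dist x y ≤ r → 20 * r ≤ dist x z → ‖kk y z - K x z‖ ≤ 4 * C * 2 ^ (n + α) * r ^ α / dist x z ^ (n + α)
variable {d : ℕ} {μ : Measure Eu d} {K : KT d} {n α C C0 : ℝ}
local notation "Sμ" => SI μ K n α C C0
local notation "E" => Eu d
lemma A2.av {f : E → ℂ} {g : E → ℝ≥0∞} {x : E} {m : ℝ} (hm : 0 < m) (h : A2 μ g x m) (hg : ∀ y, ‖f y‖ₑ ^ 2 ≤ g y) : Av μ f x m := fun R hR => by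
  have p : ∀ y, ‖f y‖ₑ ≤ oR (m / 2) + oR (1 / (2 * m)) * g y := fun y => by
    refine le_trans ?_ (add_le_add_right (mul_le_mul_right (hg y) _) _)
    rw [← ofReal_norm, ← ofReal_pow (norm_nonneg _), ← ofReal_mul pz, ← ofReal_add pz pz]
    apply ofReal_le_ofReal
    have : m / 2 + 1 / (2 * m) * ‖f y‖ ^ 2 = ‖f y‖ + (‖f y‖ - m) ^ 2 / (2 * m) := by field_simp; ring
    rw [this]; have : 0 ≤ (‖f y‖ - m) ^ 2 / (2 * m) := pz
    linarith
  refine (lintegral_mono p).trans ?_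
  rw [lintegral_add_left measurable_const, lintegral_const_mul' _ _ ofReal_ne_top, setLIntegral_const]
  refine (add_le_add (mul_le_mul_right (measure_mono (closedBall_subset_closedBall (by linarith : R ≤ 5 * R))) _) (mul_le_mul_right (h R hR) _)).trans (le_of_eq ?_)
  rw [← mul_assoc, ← add_mul, ← ofReal_mul pz, ← ofReal_add pz pz]
  congr 2; field_simp; ring
namespace SI
lemma sub_rp (h : Sμ) {a R c : ℝ} (hR : 0 < R) (hc : 0 ≤ c) (ha : 0 < a) (x : E) {m : ℝ} (hm : 0 ≤ m) : c / R ^ n * m * μ.real (closedBall x (a * R)) ≤ c * C0 * a ^ n * m := by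
  have := h.grr x (mul_pos ha hR)
  rw [mul_rpow ha.le hR.le] at this
  calc _ ≤ c / R ^ n * m * (C0 * (a ^ n * R ^ n)) := by gcongr
    _ = _ := by field_simp
lemma cot (h : Sμ) {D ε τ S : ℝ} {x0 : E} {kk Q0 G} (hD : 0 < D) (hε : 0 < ε) (hτ : 0 < τ) (t : BP μ K n α C D ε x0 S kk Q0 G) {f : E → ℂ} (hf : BF f)
    (f0 : ∀ y ∉ closedBall x0 S, f y = 0) {x : E} (hx : x ∈ G) (hxS : closedBall x (τ * S) ⊆ closedBall x0 S) {m : ℝ} (hm : 0 < m)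
    (hA : A2 μ (fun y => ‖f y‖ₑ ^ 2 + (closedBall x0 S).indicator (fun y => ‖∫ z, kk y z * f z ∂μ‖ₑ ^ 2) y) x m) {r : ℝ} (hr : ε ≤ r) :
    ‖Tr μ K r f x‖ ≤ (4 * (2 * C * 2 ^ n * C0 * 10000 ^ n) + C * 128 * 12 ^ n * C0 * (1000 / τ) ^ n + C * 128 * 12 ^ n * C0 * 100 ^ n +
      4 * C * 2 ^ (n + α) * 2 ^ (n + α) * (2 ^ (n + α) / (1 - 2 ^ (-α)) * (C0 * 5 ^ n)) + (2 + 2 * D) * (2 * 100 ^ d)) * m := by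
  have hn := h.hn; have hα := h.hα; have hC := h.hC; have hC0 := h.hC0
  have h21 : 0 < 1 - (2:ℝ) ^ (-α) := by have := Real.rpow_lt_one_of_one_lt_of_neg (x := 2) (z := -α) nz lz; linarith
  have r0 := hε.trans_le hr
  have av : Av μ f x m := hA.av hm fun y => le_self_add
  have hQ := t.q0 (t.gq hx)
  have S0 : 0 ≤ S := dist_nonneg.trans (mem_closedBall.1 hQ)
  have hex : ∃ j : ℕ, Dbl μ x (100 ^ j * r) ∨ τ * S < 100 * (100 ^ j * r) := by
    obtain ⟨j, hj⟩ := pow_unbounded_of_one_lt (τ * S / r) (by norm_num : (1:ℝ) < 100)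
    refine ⟨j, Or.inr ?_⟩
    have := (div_lt_iff₀ r0).1 hj
    have : 0 < (100:ℝ) ^ j * r := pz
    linarith
  have ch := h.chain hf av hm.le r0 (find hex) 0 oz fun i _ hi hd => find_min hex hi (Or.inl hd)
  set R := 100 ^ (find hex) * r with hR
  have rR : r ≤ R := le_mul_of_one_le_left r0.le (one_le_pow₀ nz)
  have R0 : 0 < R := pz
  rw [pow_zero, one_mul] at ch
  have t1 := norm_sub_norm_le (Tr μ K r f x) (Tr μ K R f x)
  set c1 := 4 * (2 * C * 2 ^ n * C0 * 10000 ^ n)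
  set c2 := C * 128 * 12 ^ n * C0 * (1000 / τ) ^ n with hc2
  set c3 := C * 128 * 12 ^ n * C0 * 100 ^ n with hc3
  set c4 := 4 * C * 2 ^ (n + α) * 2 ^ (n + α) * (2 ^ (n + α) / (1 - 2 ^ (-α)) * (C0 * 5 ^ n)) with hc4
  set c5 := (2 + 2 * D) * (2 * 100 ^ d) with hc5
  have p2 : 0 ≤ c2 * m := pz
  have p3 : 0 ≤ c3 * m := pz
  have p4 : 0 ≤ c4 * m := pz
  have p5 : 0 ≤ c5 * m := pz
  have kb := h.krb R0 x
  have k0 : 0 ≤ C * 128 * 12 ^ n / R ^ n := pz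
  suffices g : ‖Tr μ K R f x‖ ≤ c2 * m ∨ ‖Tr μ K R f x‖ ≤ (c3 + c4 + c5) * m by rcases g with g | g <;> linarith
  by_cases hS : τ * S < 100 * R
  · left
    have e : Tr μ K R f x = ∫ y, (closedBall x (200 / τ * R)).indicator (kr K R x) y * f y ∂μ := by
      refine integral_congr_ae (Eventually.of_forall fun y => ?_)
      by_cases hy : y ∈ closedBall x0 S
      · have : y ∈ closedBall x (200 / τ * R) := by
          rw [mem_closedBall] at *
          have := dist_triangle_right y x x0
          have : τ * S / τ < 100 * R / τ := by gcongr
          rw [mul_div_cancel_left₀ _ hτ.ne'] at this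
          rw [show 200 / τ * R = 2 * (100 * R / τ) by ring]; linarith
        simp [this]
      · simp [f0 y hy]
    rw [e]
    refine (h.loc av hm.le k0 (by positivity : 0 < 200 / τ * R) (fun y _ => (ind_le _ y).trans (kb y)) fun y hy => indicator_of_notMem (by simpa using hy) _).trans ?_
    rw [show 5 * (200 / τ * R) = 1000 / τ * R by ring]
    exact h.sub_rp R0 pz pz x hm.le
  right
  have hD' : Dbl μ x R := (find_spec hex).resolve_right hS
  set B := closedBall x (20 * R) with hB
  have hBm : MeasurableSet B := isClosed_closedBall.measurableSet
  have f1 := hf.ind hBm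
  have BQ : closedBall x R ⊆ closedBall x0 S := (closedBall_subset_closedBall lz).trans hxS
  obtain ⟨M, hM⟩ := t.kb
  have ik : ∀ y {F : E → ℂ}, BF F → Integrable (fun z => kk y z * F z) μ := fun y F hF => h.int hF (t.km y) (hM y)
  have f2 := hf.ind hBm.compl
  have key : ∀ y ∈ Q0, dist x y ≤ R → ‖Tr μ K R f x‖ ≤ (c3 + c4) * m + ‖∫ z, kk y z * f z ∂μ‖ + ‖∫ z, kk y z * B.indicator f z ∂μ‖ := fun y hy hd => by
    have e1 : Tr μ K R f x = Tr μ K R (B.indicator f) x + Tr μ K R (Bᶜ.indicator f) x := by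
      rw [← h.Tr_add f1 f2 R0]; congr 1; ext z; exact (indicator_self_add_compl_apply B f z).symm
    have e2 : ∫ z, kk y z * f z ∂μ = ∫ z, kk y z * B.indicator f z ∂μ + ∫ z, kk y z * Bᶜ.indicator f z ∂μ := by
      rw [← integral_add (ik y f1) (ik y f2)]; congr 1; ext z; rw [← mul_add, indicator_self_add_compl_apply B f z]
    have b1 : ‖Tr μ K R (B.indicator f) x‖ ≤ c3 * m := by
      have : Tr μ K R (B.indicator f) x = ∫ z, B.indicator (kr K R x) z * f z ∂μ := by
        rw [Tr]; congr 1; ext z; by_cases hz : z ∈ B <;> simp [hz]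
      rw [this]
      refine (h.loc av hm.le k0 (by positivity : 0 < 20 * R) (fun y _ => (ind_le _ y).trans (kb y)) fun y hy => indicator_of_notMem (by simpa [hB] using hy) _).trans ?_
      rw [show 5 * (20 * R) = 100 * R by ring]
      exact h.sub_rp R0 pz pz x hm.le
    have b2 : ‖∫ z, kk y z * Bᶜ.indicator f z ∂μ - Tr μ K R (Bᶜ.indicator f) x‖ ≤ c4 * m := by
      rw [Tr, ← integral_sub (ik y f2) (h.int_kr f2 R0 x)]
      have : ∫ z, (kk y z * Bᶜ.indicator f z - kr K R x z * Bᶜ.indicator f z) ∂μ = ∫ z, (if z ∈ Q0 ∧ z ∉ B then kk y z - K x z else 0) * f z ∂μ := by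
        refine integral_congr_ae ?_
        filter_upwards [(measure_eq_zero_iff_ae_notMem.1 t.qn)] with z hz
        by_cases hzB : z ∈ B
        · simp [hzB]
        by_cases hz0 : z ∈ Q0
        · simp only [hz0, hzB, mem_compl_iff, not_false_eq_true, indicator_of_mem, and_self, if_true]
          rw [mem_closedBall, dist_comm, not_le] at hzB
          rw [kr_one K R0 lz]; ring
        · have : f z = 0 := f0 z fun hq => hz ⟨hq, hz0⟩
          simp [indicator, this]
      rw [this]
      refine (h.tlf (A := 4 * C * 2 ^ (n + α) * 2 ^ (n + α)) hf.me av hm.le pz R0 fun z => ?_).trans (le_of_eq (by rw [hc4]; ring))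
      split_ifs with hz
      · have hz2 := hz.2
        rw [mem_closedBall, dist_comm, not_le] at hz2
        refine (t.cl x hx y hy z hz.1 R (hr.trans rR) hd hz2.le).trans ?_
        rw [dist_comm z x, mul_assoc _ ((2:ℝ) ^ (n + α)) (_ / _), mul_div_assoc]
        gcongr
        rw [mul_div_assoc', div_le_div_iff₀ (by have := R0.trans (by linarith : R < dist x z); positivity) pz, mul_comm (_ * _), ← mul_assoc, mul_comm]
        gcongr
        rw [← mul_rpow pz nz]; gcongr; linarith
      · rw [norm_zero]; positivity
    have := norm_add_le (Tr μ K R (B.indicator f) x) (Tr μ K R (Bᶜ.indicator f) x)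
    have := norm_sub_norm_le (Tr μ K R (Bᶜ.indicator f) x) (∫ z, kk y z * Bᶜ.indicator f z ∂μ)
    have := norm_sub_le (∫ z, kk y z * f z ∂μ) (∫ z, kk y z * B.indicator f z ∂μ)
    rw [e2, add_sub_cancel_left, ← e2] at this
    rw [norm_sub_rev] at b2
    rw [e1]; linarith
  by_contra hcon
  push Not at hcon
  set N := c5 * m
  have l1 : ∫⁻ y in closedBall x R, oR (N ^ 2) ∂μ ≤ ∫⁻ y in closedBall x R, (2 * ‖∫ z, kk y z * f z ∂μ‖ₑ ^ 2 + 2 * ‖∫ z, kk y z * B.indicator f z ∂μ‖ₑ ^ 2) ∂μ := by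
    refine lintegral_mono_ae ?_
    filter_upwards [ae_restrict_of_ae (measure_eq_zero_iff_ae_notMem.1 t.qn), ae_restrict_mem isClosed_closedBall.measurableSet] with y hy hyR
    have y0 : y ∈ Q0 := by by_contra hc; exact hy ⟨BQ hyR, hc⟩
    have k := key y y0 (by rwa [dist_comm])
    set a := ‖∫ z, kk y z * f z ∂μ‖ with ha
    set b := ‖∫ z, kk y z * B.indicator f z ∂μ‖ with hb
    rw [← ofReal_norm, ← ofReal_norm, ← ha, ← hb, ← ofReal_pow (norm_nonneg _), ← ofReal_pow (norm_nonneg _), ← mul_add, ← ofReal_add pz pz,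
      ← ofReal_ofNat, ← ofReal_mul nz]
    apply ofReal_le_ofReal
    have k2 : N ≤ a + b := lz
    have := pow_le_pow_left₀ p5 k2 2
    linarith [sq_nonneg (a - b), sq_nonneg (a + b), this, show (a - b) ^ 2 = a ^ 2 - 2 * (a * b) + b ^ 2 by ring, show (a + b) ^ 2 = a ^ 2 + 2 * (a * b) + b ^ 2 by ring]
  have l2 : ∫⁻ y in closedBall x R, ‖∫ z, kk y z * f z ∂μ‖ₑ ^ 2 ∂μ ≤ oR (m ^ 2) * μ (closedBall x (100 * R)) := by
    refine le_trans ?_ ((hA R R0).trans (mul_le_mul_right (measure_mono (closedBall_subset_closedBall lz)) _))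
    refine setLIntegral_mono' isClosed_closedBall.measurableSet fun y hy => ?_
    rw [indicator_of_mem (BQ hy)]; exact le_add_self
  have l3 : ∫⁻ y in closedBall x R, ‖∫ z, kk y z * B.indicator f z ∂μ‖ₑ ^ 2 ∂μ ≤ oR D * (oR (m ^ 2) * μ (closedBall x (100 * R))) := by
    refine (lintegral_mono_set BQ).trans ((t.l2 _ f1 fun y hy => by simp [indicator, f0 y hy]).trans ?_)
    gcongr
    have := hA (20 * R) pz
    rw [show 5 * (20 * R) = 100 * R by ring] at this
    refine le_trans ?_ this
    rw [← lintegral_indicator hBm]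
    refine lintegral_mono fun y => ?_
    by_cases hy : y ∈ B <;> simp [hy]
  have me : Measurable fun y => ‖∫ z, kk y z * B.indicator f z ∂μ‖ₑ ^ 2 := (t.kp _).enorm.pow_const 2
  rw [lintegral_add_right _ (me.const_mul _), lintegral_const_mul' _ _ nz, lintegral_const_mul' _ _ nz, setLIntegral_const] at l1
  have l4 := l1.trans (add_le_add (mul_le_mul_right l2 _) (mul_le_mul_right l3 _))
  rw [Dbl] at hD'
  rw [show closedBall x (100 * R) = closedBall x (100 * R) from rfl, ← ofReal_toReal (h.fin x R), ← ofReal_toReal (h.fin x (100 * R)), ← measureReal_def, ← measureReal_def, ← ofReal_ofNat] at l4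
  rw [← ofReal_mul pz, ← ofReal_mul pz, ← ofReal_mul hD.le, ← ofReal_mul nz, ← ofReal_mul nz, ← ofReal_add pz pz, ofReal_le_ofReal_iff pz] at l4
  have q1 : c5 * m ^ 2 * μ.real (closedBall x R) ≤ N ^ 2 * μ.real (closedBall x R) := by
    have : 1 ≤ c5 := by have : (1:ℝ) ≤ 100 ^ d := one_le_pow₀ nz
                        nlinarith
    rw [show N ^ 2 = c5 * (c5 * m ^ 2) by ring]; gcongr
    exact le_mul_of_one_le_left pz this
  have q2 := mul_lt_mul_of_pos_left hD' (by positivity : 0 < (2 + 2 * D) * m ^ 2)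
  linarith
end SI
end
section
variable {d : ℕ} {μ : Measure Eu d} {K : KT d} {n α C C0 : ℝ}
local notation "Sμ" => SI μ K n α C C0
local notation "E" => Eu d
def TST (μ : Measure E) (K : E → E → ℂ) (e : E → E → ℝ) (q B1 B2 s : ℝ) : Prop :=
  ∀ x0 S, 0 < S → μ (closedBall x0 (5 * S)) ≤ oR (2 * 100 ^ d) * μ (closedBall x0 S) →
    (∀ l > 0, μ {x ∈ closedBall x0 (5 * S) | |dist x x0 - S| ≤ l * (2 * S)} ≤ oR (160 * 100 ^ d * l) * μ (closedBall x0 (5 * S))) →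
    μ (closedBall x0 S) ≠ 0 → ∃ b, TF μ K e q B1 B2 s x0 S b
namespace SI
lemma sb (h : Sμ) {x : E} {R : ℝ} (hR : 0 < R) (hD : Dbl μ x R) : ∃ S, R ≤ S ∧ S ≤ 2 * R ∧ μ (closedBall x (5 * S)) ≤ oR (2 * 100 ^ d) * μ (closedBall x S) ∧
    (∀ l > 0, μ {y ∈ closedBall x (5 * S) | |dist y x - S| ≤ l * (2 * S)} ≤ oR (160 * 100 ^ d * l) * μ (closedBall x (5 * S))) ∧ μ (closedBall x S) ≠ 0 := by
  have hD' : μ (closedBall x (100 * R)) ≤ oR (2 * 100 ^ d) * μ (closedBall x R) := by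
    rw [← ofReal_toReal (h.fin x R), ← ofReal_toReal (h.fin x (100 * R)), ← ofReal_mul pz]
    exact ofReal_le_ofReal hD.le
  have m0 : 0 < μ.real (closedBall x R) := by
    have := measureReal_nonneg.trans_lt hD
    exact pos_of_mul_pos_right this pz
  set M := μ.real (closedBall x R)
  have eM : μ (closedBall x R) = oR M := (ofReal_toReal (h.fin x R)).symm
  set ν := (μ.restrict (closedBall x (10 * R))).map fun y => dist y x with hν
  have dm : Measurable fun y : E => dist y x := by fun_prop
  by_contra! hc
  have w := weak11 volume ν (oR (4 * 100 ^ d * M / R)) (Icc R (2 * R)) fun S hS => by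
    have S0 := hR.trans_le hS.1
    have mo := measure_mono (μ := μ) (closedBall_subset_closedBall (x := x) hS.1)
    have h5 : closedBall x (5 * S) ⊆ closedBall x (10 * R) := closedBall_subset_closedBall (by linarith [hS.2])
    have c := fun hh => hc S hS.1 hS.2 (((measure_mono h5).trans (measure_mono (closedBall_subset_closedBall lz))).trans (hD'.trans (mul_le_mul_right mo _))) hh
    by_cases hh : ∀ l > 0, μ {y ∈ closedBall x (5 * S) | |dist y x - S| ≤ l * (2 * S)} ≤ oR (160 * 100 ^ d * l) * μ (closedBall x (5 * S))
    · have c := c hh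
      rw [c, eM] at mo
      exact absurd (ofReal_eq_zero.1 (le_antisymm mo bot_le)) (not_le.2 m0)
    push Not at hh
    obtain ⟨l, l0, hl⟩ := hh
    refine ⟨l * (2 * S), by positivity, ?_⟩
    rw [hν, Measure.map_apply dm isClosed_closedBall.measurableSet, Measure.restrict_apply (dm isClosed_closedBall.measurableSet), Real.volume_closedBall, ← ofReal_mul pz]
    refine le_trans ?_ (hl.le.trans (measure_mono fun y hy => ⟨by simpa [dist_eq] using hy.2, h5 hy.1⟩))
    refine le_trans ?_ (mul_le_mul_right (mo.trans (measure_mono (closedBall_subset_closedBall lz))) _)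
    rw [eM, ← ofReal_mul pz]
    apply ofReal_le_ofReal
    rw [div_mul_eq_mul_div, div_le_iff₀ hR]
    have : 80 * 100 ^ d * M * l * S ≤ 80 * 100 ^ d * M * l * (2 * R) := by gcongr; exact hS.2
    linarith
  rw [Real.volume_Icc, hν, Measure.map_apply dm MeasurableSet.univ, preimage_univ, restrict_apply_univ, ← ofReal_mul pz] at w
  have w := w.trans ((measure_mono (closedBall_subset_closedBall lz)).trans hD')
  rw [eM, ← ofReal_mul pz, ofReal_le_ofReal_iff pz, show 4 * 100 ^ d * M / R * (2 * R - R) = 4 * 100 ^ d * M by field_simp; ring] at w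
  have : 0 < 100 ^ d * M := pz
  linarith
lemma kdif (h : Sμ) {r : ℝ} (hr : 0 < r) {x x' : E} (hx : dist x x' ≤ 8 * r) (z : E) :
    ‖kr K r x z - kr K r x' z‖ ≤ (C * (10 ^ 6 * 24 ^ n) * 8 ^ α + 2 * (C * 128 * 12 ^ n) * 31 ^ (n + α)) * (r ^ α / (r + dist z x) ^ (n + α)) := by
  have hn := h.hn; have hα := h.hα; have hC := h.hC
  rw [add_mul]
  by_cases h4 : 4 * (8 * r) ≤ dist z x + 2 * r
  · refine le_add_of_le_of_nonneg ((h.kr_sm' hr pz hx h4).trans ?_) pz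
    rw [mul_rpow nz hr.le, ← mul_assoc, mul_div_assoc, add_comm r]
    gcongr; linarith
  · refine le_add_of_nonneg_of_le pz ?_
    refine (norm_sub_le _ _).trans ((add_le_add (h.krb hr x z) (h.krb hr x' z)).trans ?_)
    rw [← two_mul, ← mul_div_assoc, mul_assoc _ ((31:ℝ) ^ _), div_eq_mul_one_div]
    refine mll ?_ pz
    rw [mul_div_assoc', div_le_div_iff₀ pz pz, one_mul, mul_assoc, ← Real.rpow_add hr, add_comm α, ← mul_rpow nz hr.le]
    gcongr; linarith
lemma Tdif (h : Sμ) {f : E → ℂ} (hf : BF f) {r m : ℝ} (hr : 0 < r) {x x' : E} (hx : dist x x' ≤ 8 * r) (av : Av μ f x m) (hm : 0 ≤ m) :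
    ‖Tr μ K r f x - Tr μ K r f x'‖ ≤ (C * (10 ^ 6 * 24 ^ n) * 8 ^ α + 2 * (C * 128 * 12 ^ n) * 31 ^ (n + α)) * (2 ^ (n + α) / (1 - 2 ^ (-α)) * (m * (C0 * 5 ^ n))) := by
  have hC := h.hC
  rw [Tr, Tr, ← integral_sub (h.int_kr hf hr x) (h.int_kr hf hr x')]
  simp_rw [← sub_mul]
  exact h.tlf hf.me av hm pz hr (h.kdif hr hx)
lemma sel (h : Sμ) {f : E → ℂ} (hf : BF f) {x : E} {m ε ρ L r0 : ℝ} (av : Av μ f x m) (hm : 0 ≤ m) (hε : 0 < ε) (hr0 : ε ≤ r0)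
    (far : ∀ r ≥ ε, ρ ≤ 2 * r → ‖Tr μ K r f x‖ ≤ L) (bad : L + 4 * (2 * C * 2 ^ n * C0 * 10000 ^ n) * m < ‖Tr μ K r0 f x‖) :
    ∃ R ≥ ε, Dbl μ x R ∧ 2 * R < ρ ∧ ∀ r ≥ 2 * R, ‖Tr μ K r f x‖ ≤ L + 4 * (2 * C * 2 ^ n * C0 * 10000 ^ n) * m := by
  have hC := h.hC; have hC0 := h.hC0
  set c := 4 * (2 * C * 2 ^ n * C0 * 10000 ^ n) * m
  have c0 : 0 ≤ c := pz
  set Z := {r | ε ≤ r ∧ L + c < ‖Tr μ K r f x‖}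
  have zr : ∀ r ∈ Z, 2 * r < ρ := fun r hr => by
    by_contra hh; push Not at hh
    linarith [far r hr.1 hh, hr.2]
  have bZ : BddAbove Z := ⟨ρ / 2, fun r hr => by linarith [zr r hr]⟩
  have r0Z : r0 ∈ Z := ⟨hr0, bad⟩
  have sp := (hε.trans_le hr0).trans_le (le_csSup bZ r0Z)
  obtain ⟨r, hr, hr2⟩ := exists_lt_of_lt_csSup ⟨r0, r0Z⟩ (half_lt_self sp)
  have rp := hε.trans_le hr.1
  have gd : ∀ r' ≥ 2 * r, ‖Tr μ K r' f x‖ ≤ L + c := fun r' h' => by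
    by_contra! hh
    linarith [le_csSup bZ (show r' ∈ Z from ⟨by linarith [hr.1], hh⟩)]
  by_cases hj : ∃ j : ℕ, Dbl μ x (100 ^ j * r) ∧ 2 * (100 ^ j * r) < ρ
  · obtain ⟨j, hj, hj2⟩ := hj
    have : r ≤ 100 ^ j * r := le_mul_of_one_le_left rp.le (one_le_pow₀ nz)
    exact ⟨_, hr.1.trans this, hj, hj2, fun r' h' => gd r' lz⟩
  push Not at hj
  have hex : ∃ j : ℕ, ρ ≤ 2 * (100 ^ j * r) := by
    obtain ⟨j, hj⟩ := pow_unbounded_of_one_lt (ρ / r) (by norm_num : (1:ℝ) < 100)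
    have := (div_lt_iff₀ rp).1 hj
    have : 0 < (100:ℝ) ^ j * r := pz
    exact ⟨j, by linarith⟩
  have ch := h.chain hf av hm rp (find hex) 0 oz fun i _ hi hd => find_min hex hi (hj i hd)
  have le : r ≤ 100 ^ (find hex) * r := le_mul_of_one_le_left rp.le (one_le_pow₀ nz)
  have fa := far _ (hr.1.trans le) (find_spec hex)
  rw [pow_zero, one_mul] at ch
  have := norm_sub_norm_le (Tr μ K r f x) (Tr μ K (100 ^ (find hex) * r) f x)
  linarith [hr.2]
end SI
lemma bpx (d : ℕ) {n α C C0 q B1 B2 s D1 : ℝ} (hn : 0 < n) (hα : 0 < α) (hC : 0 < C) (hC0 : 0 < C0) (hq : 1 < q) (hB1 : 0 < B1) (hB2 : 0 < B2) (hs : 0 < s) (hD1 : 1 ≤ D1) : ∃ D η : ℝ, 0 < D ∧ 0 < η ∧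
    ∀ {μ : Measure Eu d} {K : KT d} (h : SI μ K n α C C0) {e} (he : EE e D1) {x0 S b} (t : TF μ K e q B1 B2 s x0 S b) (hS : 0 < S) (h0 : μ (closedBall x0 S) ≠ 0)
    {ε : ℝ} (hε : 0 < ε) (hεS : ε ≤ S), ∃ kk Q0 G, BP μ K n α C D ε x0 S kk Q0 G ∧ oR η * μ (closedBall x0 S) ≤ μ G := by
  obtain ⟨δ, Λ, η, hδ, hδ1, hΛ, hη, H⟩ := mkTD d hn hC0 hq hB1 hB2 hs
  obtain ⟨D, hD, HD⟩ := disc d hn hα hC hΛ hδ hδ1 hD1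
  refine ⟨D, η, hD, hη, fun {μ K} h {e} he {x0 S b} t hS h0 {ε} hε hεS => ?_⟩
  obtain ⟨σ, H', td, hG⟩ := H h he t hS h0
  obtain ⟨M, p, kc, Q0, G, pm, gm, gq, q0, qn, sg, l2, cl⟩ := HD h td hε hεS
  refine ⟨fun y z => kc (p y) (p z), Q0, G, ⟨fun y => (measurable_of_countable (kc (p y))).comp pm, ?_, fun F => (measurable_of_countable fun i => ∫ z, kc i (p z) * F z ∂μ).comp pm, gq, q0, qn, fun F hF F0 => ?_, cl⟩, ?_⟩
  · obtain ⟨A, hA⟩ := (Set.finite_range fun i : (Fin d → Fin M) × (Fin d → Fin M) => ‖kc i.1 i.2‖).bddAbove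
    exact ⟨A, fun y z => hA ⟨(p y, p z), rfl⟩⟩
  · have i1 : Integrable F μ := by simpa using h.int hF (g := fun _ => 1) measurable_const (M := 1) zs
    have i2 : Integrable (fun x => ‖F x‖ ^ 2) μ := by
      obtain ⟨A, hA⟩ := hF.bd
      have := (h.int hF hF.me hA).norm
      simpa [ ← sq] using this
    have := l2 F i1.integrableOn i2.integrableOn
    have e : ∀ y, ∫ z in closedBall x0 S, kc (p y) (p z) * F z ∂μ = ∫ z, kc (p y) (p z) * F z ∂μ := fun y => setIntegral_eq_integral_of_forall_compl_eq_zero fun z hz => by rw [F0 z hz, mul_zero]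
    simp_rw [e] at this
    exact this.trans (mul_le_mul_right (setLIntegral_le_lintegral _ _) _)
  · have g := hG G gm (gq.trans q0) sg
    have fG := measure_ne_top_of_subset (gq.trans q0) (h.fin x0 S)
    rw [← ofReal_toReal (h.fin x0 S), ← ofReal_toReal fG, ← ofReal_mul hη.le]
    exact ofReal_le_ofReal g
end
section
lemma BL (d : ℕ) {n α C C0 q B1 B2 s D1 : ℝ} (hn : 0 < n) (hα : 0 < α) (hC : 0 < C) (hC0 : 0 < C0) (hq : 1 < q) (hB1 : 0 < B1) (hB2 : 0 < B2) (hs : 0 < s) (hD1 : 1 ≤ D1) :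
    ∃ c κ A : ℝ, 0 < c ∧ 0 < κ ∧ 0 < A ∧ ∀ {μ : Measure Eu d} {K : KT d} (h : SI μ K n α C C0) {e} (he : EE e D1) (ts : TST μ K e q B1 B2 s)
    {ε : ℝ} (hε : 0 < ε) {f} (hf : BF f) {x R} (hR : ε ≤ R) (hD : Dbl μ x R) {L m : ℝ} (hm : 0 < m) (hA : A2 μ (fun y => ‖f y‖ₑ ^ 2) x (κ * m)) (far : ∀ r ≥ 2 * R, ‖Tr μ K r f x‖ ≤ L),
    ∃ S > 0, S ≤ 2 * R ∧ oR c * μ (closedBall x (5 * S)) ≤ μ (closedBall x S ∩ {y | ∀ r ≥ ε, ‖Tr μ K r f y‖ ≤ L + A * m}) := by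
  obtain ⟨D, η, hD, hη, bp⟩ := bpx d hn hα hC hC0 hq hB1 hB2 hs hD1
  have h21 : 0 < 1 - (2:ℝ) ^ (-α) := by have := Real.rpow_lt_one_of_one_lt_of_neg (x := 2) (z := -α) nz lz; linarith
  set b : ℝ := 2 * 100 ^ d with hb
  set t : ℝ := 160 * 100 ^ d with ht
  have b0 : 0 < b := pz
  have t0 : 0 < t := pz
  obtain ⟨τ, hτ, hτη⟩ : ∃ τ : ℝ, 0 < τ ∧ t * (τ / 2) * b = η / 4 := ⟨η / (2 * t * b), by positivity, by field_simp; ring⟩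
  obtain ⟨κ, hκ, hκη⟩ : ∃ κ : ℝ, 0 < κ ∧ (1 + D) * (κ ^ 2 * b) = η / 4 := ⟨√(η / (4 * (1 + D) * b)), by positivity, by rw [sq_sqrt pz]; field_simp⟩
  set cc := 4 * (2 * C * 2 ^ n * C0 * 10000 ^ n) + C * 128 * 12 ^ n * C0 * (1000 / τ) ^ n + C * 128 * 12 ^ n * C0 * 100 ^ n +
      4 * C * 2 ^ (n + α) * 2 ^ (n + α) * (2 ^ (n + α) / (1 - 2 ^ (-α)) * (C0 * 5 ^ n)) + (2 + 2 * D) * (2 * 100 ^ d) with hcc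
  set cT := (C * (10 ^ 6 * 24 ^ n) * 8 ^ α + 2 * (C * 128 * 12 ^ n) * 31 ^ (n + α)) * (2 ^ (n + α) / (1 - 2 ^ (-α)) * (C0 * 5 ^ n)) with hcT
  set c3 := 2 * C / τ ^ n * C0 * 20 ^ n with hc3
  refine ⟨η / (2 * b), κ, 2 * cc + (cT + c3) * κ, by positivity, hκ, by positivity, fun {μ K} h {e} he ts {ε} hε {f} hf {x R} hR hD' {L m} hm hA far => ?_⟩
  obtain ⟨S, hS, hS2, db, sbd, ne⟩ := h.sb (hε.trans_le hR) hD'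
  have S0 : 0 < S := lz
  obtain ⟨bb, tf⟩ := ts x S S0 db sbd ne
  obtain ⟨kk, Q0, G, p, hG⟩ := bp h he tf S0 ne hε (hR.trans hS)
  refine ⟨S, S0, hS2, ?_⟩
  set Q := closedBall x S with hQ
  have mQ : MeasurableSet Q := isClosed_closedBall.measurableSet
  have km : 0 < κ * m := pz
  have av : Av μ f x (κ * m) := hA.av km fun y => le_rfl
  have fQ := hf.ind mQ
  have f0 : ∀ y ∉ Q, Q.indicator f y = 0 := fun y hy => indicator_of_notMem hy _
  set g := fun y => ‖Q.indicator f y‖ₑ ^ 2 + Q.indicator (fun y => ‖∫ z, kk y z * Q.indicator f z ∂μ‖ₑ ^ 2) y with hg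
  set N := {y | ¬ A2 μ g y m} with hN
  have Td : ∀ y ∈ Q, ∀ r ≥ 2 * S, ‖Tr μ K r f y‖ ≤ L + cT * (κ * m) := fun y hy r hr => by
    have := h.Tdif hf (r := r) lz (x := x) (x' := y) (by rw [mem_closedBall, dist_comm] at hy; linarith) av km.le
    have fa := far r lz
    rw [norm_sub_rev] at this
    have := norm_sub_norm_le (Tr μ K r f y) (Tr μ K r f x)
    rw [show cT * (κ * m) = (C * (10 ^ 6 * 24 ^ n) * 8 ^ α + 2 * (C * 128 * 12 ^ n) * 31 ^ (n + α)) * (2 ^ (n + α) / (1 - 2 ^ (-α)) * (κ * m * (C0 * 5 ^ n))) by rw [hcT]; ring]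
    linarith
  have good : G \ (N ∪ {y ∈ closedBall x (5 * S) | |dist y x - S| ≤ τ / 2 * (2 * S)}) ⊆ Q ∩ {y | ∀ r ≥ ε, ‖Tr μ K r f y‖ ≤ L + (2 * cc + (cT + c3) * κ) * m} := fun y hy => by
    have yQ := p.q0 (p.gq hy.1)
    refine ⟨yQ, fun r hr => ?_⟩
    have dy : dist y x ≤ S := yQ
    have dy2 : dist y x ≤ S - τ * S := by
      by_contra! hc
      exact hy.2 (Or.inr ⟨mem_closedBall.2 lz, by rw [abs_le]; constructor <;> linarith⟩)
    have yA : A2 μ g y m := by_contra fun hc => hy.2 (Or.inl hc)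
    have sub : closedBall y (τ * S) ⊆ Q := closedBall_subset_closedBall' lz
    have ct : ∀ r ≥ ε, ‖Tr μ K r (Q.indicator f) y‖ ≤ cc * m := fun r hr => h.cot hD hε hτ p fQ f0 hy.1 sub hm yA hr
    have q3 : 0 ≤ c3 * κ * m := pz
    have q4 : 0 ≤ cc * m := pz
    rcases le_or_gt (2 * S) r with h2 | h2
    · linarith [Td y yQ r h2]
    have r0 := hε.trans_le hr
    have S2 : 0 < 2 * S := pz
    have fc := hf.ind mQ.compl
    have sp : ∀ r > 0, Tr μ K r f y = Tr μ K r (Q.indicator f) y + Tr μ K r (Qᶜ.indicator f) y := fun r r0 => by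
      rw [← h.Tr_add fQ fc r0]; congr 1; ext z; exact (indicator_self_add_compl_apply Q f z).symm
    have df : ‖Tr μ K r (Qᶜ.indicator f) y - Tr μ K (2 * S) (Qᶜ.indicator f) y‖ ≤ c3 * (κ * m) := by
      rw [Tr, Tr, ← integral_sub (h.int_kr fc r0 y) (h.int_kr fc S2 y)]
      have : ∀ z, kr K r y z * Qᶜ.indicator f z - kr K (2 * S) y z * Qᶜ.indicator f z = Qᶜ.indicator (fun z => kr K r y z - kr K (2 * S) y z) z * f z := fun z => by
        by_cases hz : z ∈ Q <;> simp [hz, sub_mul]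
      simp_rw [this]
      refine (h.loc (A := 2 * C / τ ^ n / S ^ n) av km.le pz (by positivity : 0 < 4 * S) (fun z _ => ?_) fun z hz => ?_).trans ?_
      · by_cases hz : z ∈ Q
        · simp only [mem_compl_iff, hz, not_true_eq_false, not_false_eq_true, indicator_of_notMem, norm_zero]; positivity
        · have : τ * S ≤ dist y z := by by_contra! hc; exact hz (sub (by rw [mem_closedBall, dist_comm]; exact hc.le))
          have := h.sz' pz this
          rw [indicator_of_mem hz, div_div, ← mul_rpow hτ.le S0.le, mul_div_assoc, two_mul (C / _)]
          exact (norm_sub_le _ _).trans (add_le_add ((SI.kr_le _ _ _ _).trans this) ((SI.kr_le _ _ _ _).trans this))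
      · have : 3 * S ≤ dist y z := by have := dist_triangle z y x; rw [dist_comm z y] at this; linarith
        rw [indicator_of_mem (by rw [mem_compl_iff, mem_closedBall]; linarith), SI.kr_one K r0 lz, SI.kr_one K S2 lz, sub_self]
      · rw [show 5 * (4 * S) = 20 * S by ring]
        exact h.sub_rp S0 pz pz x km.le
    have t1 := norm_add_le (Tr μ K r (Q.indicator f) y) (Tr μ K r (Qᶜ.indicator f) y)
    rw [← sp r r0] at t1
    have t2 := norm_sub_norm_le (Tr μ K r (Qᶜ.indicator f) y) (Tr μ K (2 * S) (Qᶜ.indicator f) y)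
    have t3 := norm_sub_le (Tr μ K (2 * S) f y) (Tr μ K (2 * S) (Q.indicator f) y)
    rw [sp _ S2, add_sub_cancel_left, ← sp _ S2] at t3
    linarith [ct r hr, ct (2 * S) lz, Td y yQ _ le_rfl]
  have e1 : oR (m ^ 2) * μ N ≤ oR (m ^ 2) * (oR (η / 4) * μ Q) := by
    have gm : Measurable g := (fQ.me.enorm.pow_const 2).add (((p.kp _).enorm.pow_const 2).indicator mQ)
    refine (weak11 μ (μ.withDensity g) (oR (m ^ 2)) N fun y hy => ?_).trans ?_
    · simp only [hN, mem_ofPred_eq, A2] at hy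
      push Not at hy
      obtain ⟨r, r0, hr⟩ := hy
      exact ⟨r, r0, by rw [withDensity_apply _ isClosed_closedBall.measurableSet]; exact hr.le⟩
    · rw [withDensity_apply _ MeasurableSet.univ, restrict_univ, hg, lintegral_add_left (fQ.me.enorm.pow_const 2), lintegral_indicator mQ]
      have i1 : ∫⁻ y, ‖Q.indicator f y‖ₑ ^ 2 ∂μ ≤ oR ((κ * m) ^ 2) * (oR b * μ Q) := by
        refine le_trans ?_ ((hA S S0).trans (mul_le_mul_right db _))
        rw [← lintegral_indicator mQ]
        refine lintegral_mono fun y => ?_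
        by_cases hy : y ∈ Q <;> simp [hy]
      refine (add_le_add i1 ((p.l2 _ fQ f0).trans (mul_le_mul_right i1 _))).trans (le_of_eq ?_)
      rw [← one_add_mul, ← ofReal_one, ← ofReal_add zero_le_one hD.le, ← mul_assoc, ← mul_assoc, ← mul_assoc, ← ofReal_mul pz, ← ofReal_mul pz, ← ofReal_mul pz]
      congr 2; rw [← hκη]; ring
  rw [ENNReal.mul_le_mul_iff_right (by simpa using hm.ne') ofReal_ne_top] at e1
  have e2 := (sbd (τ / 2) pz).trans (mul_le_mul_right db _)
  rw [← mul_assoc (oR _), ← ofReal_mul pz, ← ht, ← hb, hτη] at e2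
  have e3 := hG.trans ((measure_mono (t := Q ∩ {y | ∀ r ≥ ε, ‖Tr μ K r f y‖ ≤ L + (2 * cc + (cT + c3) * κ) * m} ∪ (N ∪ {y ∈ closedBall x (5 * S) | |dist y x - S| ≤ τ / 2 * (2 * S)})) fun y hy => by
    by_cases hy2 : y ∈ N ∪ {y ∈ closedBall x (5 * S) | |dist y x - S| ≤ τ / 2 * (2 * S)}
    · exact Or.inr hy2
    · exact Or.inl (good ⟨hy, hy2⟩)).trans ((measure_union_le _ _).trans (add_le_add_right ((measure_union_le _ _).trans (add_le_add e1 e2)) _)))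
  rw [← add_mul, ← ofReal_add pz pz, show η = η / 2 + (η / 4 + η / 4) by ring, ofReal_add pz pz, add_mul,
    show (η / 2 + (η / 4 + η / 4)) / 4 + (η / 2 + (η / 4 + η / 4)) / 4 = η / 4 + η / 4 by ring, ENNReal.add_le_add_iff_right (mul_ne_top ofReal_ne_top (h.fin _ _))] at e3
  refine le_trans ?_ e3
  refine (mul_le_mul_right db _).trans (le_of_eq ?_)
  rw [← mul_assoc, ← ofReal_mul pz]
  congr 2; field_simp; exact hb.symm
end
section
def Om {d : ℕ} (μ : Measure Eu d) (K : KT d) (ε : ℝ) (f : Eu d → ℂ) (l : ℝ) : Set Eu d := {y | ∃ r ≥ ε, l < ‖Tr μ K r f y‖}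
lemma SI.dec {d : ℕ} {μ : Measure Eu d} {K : KT d} {n α C C0 : ℝ} (h : SI μ K n α C C0) {ε : ℝ} (hε : 0 < ε) {f} (hf : BF f) :
    ∃ A > 0, ∀ r ≥ ε, ∀ y, ‖Tr μ K r f y‖ ≤ A / (1 + dist y 0) ^ n := by
  obtain ⟨R, hR⟩ := hf.su
  have fi : Integrable f μ := by simpa using h.int hf measurable_const (g := fun _ => 1) (M := 1) zs
  have hn := h.hn; have hC := h.hC
  set P := (1 + |R|) / ε + 1
  have P0 : 0 < P := pz
  refine ⟨C * 128 * 12 ^ n * P ^ n * (∫ y, ‖f y‖ ∂μ + 1), by positivity, fun r hr y => ?_⟩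
  have : ‖Tr μ K r f y‖ ≤ C * 128 * 12 ^ n * P ^ n / (1 + dist y 0) ^ n * ∫ y, ‖f y‖ ∂μ := by
    rw [← integral_const_mul]
    refine norm_integral_le_of_norm_le (fi.norm.const_mul _) (ae_of_all _ fun z => ?_)
    rw [norm_mul]
    by_cases hz : R < dist z 0
    · simp [hR z hz]
    gcongr
    push Not at hz
    refine (h.kr_bd (hε.trans_le hr) y z).trans ?_
    have r0 := hε.trans_le hr
    rw [div_le_div_iff₀ pz pz, mul_assoc _ (P ^ n), ← mul_rpow P0.le pz]
    gcongr
    have : 1 + |R| = (1 + |R|) / ε * ε := by field_simp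
    have t := dist_triangle y z 0
    have q : 0 ≤ (1 + |R|) / ε * dist y z := pz
    have := le_abs_self R
    have : P * (dist y z + ε) ≤ P * (dist y z + r) := by gcongr
    linarith
  refine this.trans ?_
  rw [div_mul_eq_mul_div]
  gcongr; linarith
lemma SI.omc {d : ℕ} {μ : Measure Eu d} {K : KT d} {n α C C0 : ℝ} (h : SI μ K n α C C0) {ε : ℝ} (hε : 0 < ε) {f} (hf : BF f) {l : ℝ} (hl : 0 < l) :
    (Om μ K ε f l)ᶜ.Nonempty := by
  obtain ⟨A, hA, H⟩ := h.dec hε hf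
  have hn := h.hn
  have := Fin.pos_iff_nonempty.1 (by have := h.hnd; exact_mod_cast hn.trans_le this)
  refine ⟨fun _ => (A / l) ^ (1 / n), fun ⟨r, hr, h2⟩ => h2.not_ge ((H r hr _).trans ?_)⟩
  rw [dist_zero_right, pi_norm_const, norm_of_nonneg pz, div_le_comm₀ pz hl]
  calc A / l = ((A / l) ^ (1 / n)) ^ n := by rw [← Real.rpow_mul pz, one_div_mul_cancel hn.ne', Real.rpow_one]
    _ ≤ _ := by gcongr; linarith
lemma glm (d : ℕ) {n α C C0 q B1 B2 s D1 : ℝ} (hn : 0 < n) (hα : 0 < α) (hC : 0 < C) (hC0 : 0 < C0) (hq : 1 < q) (hB1 : 0 < B1) (hB2 : 0 < B2) (hs : 0 < s) (hD1 : 1 ≤ D1) :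
    ∃ c > 0, ∀ η > 0, ∃ γ > 0, ∀ {μ : Measure Eu d} {K : KT d} (h : SI μ K n α C C0) {e} (he : EE e D1) (ts : TST μ K e q B1 B2 s)
    {ε : ℝ} (hε : 0 < ε) {f} (hf : BF f) {l : ℝ} (hl : 0 < l),
    oR c * μ (Om μ K ε f ((1 + η) * l) ∩ {x | A2 μ (fun y => ‖f y‖ₑ ^ 2) x (γ * l)}) ≤ μ (Om μ K ε f l \ Om μ K ε f ((1 + η) * l)) := by
  obtain ⟨c, κ, A, hc, hκ, hA, bl⟩ := BL d hn hα hC hC0 hq hB1 hB2 hs hD1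
  have h21 : 0 < 1 - (2:ℝ) ^ (-α) := by have := Real.rpow_lt_one_of_one_lt_of_neg (x := 2) (z := -α) nz lz; linarith
  set cT := (C * (10 ^ 6 * 24 ^ n) * 8 ^ α + 2 * (C * 128 * 12 ^ n) * 31 ^ (n + α)) * (2 ^ (n + α) / (1 - 2 ^ (-α)) * (C0 * 5 ^ n)) with hcT
  set c1 := 4 * (2 * C * 2 ^ n * C0 * 10000 ^ n) with hc1
  have c10 : 0 < c1 := pz
  have cT0 : 0 < cT := pz
  refine ⟨c, hc, fun η hη => ⟨κ * (η / (A + (cT + c1) * κ)), by positivity, fun {μ K} h {e} he ts {ε} hε {f} hf {l} hl => ?_⟩⟩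
  obtain ⟨m, hm⟩ : ∃ m, m = η / (A + (cT + c1) * κ) * l := ⟨_, rfl⟩
  have m0 : 0 < m := by rw [hm]; positivity
  have me : A * m + (cT + c1) * κ * m = η * l := by rw [hm]; field_simp
  have km : 0 < κ * m := pz
  rw [mul_assoc κ, ← hm]
  rw [← restrict_apply_univ (_ \ _)]
  refine weak11 μ _ _ _ fun x ⟨⟨r0, hr0, hx⟩, xA⟩ => ?_
  have av := A2.av km xA fun y => le_rfl
  have Am : 0 < A * m := pz
  have ne := h.omc hε hf hl
  obtain ⟨R, hR, hD, h2, fr⟩ := h.sel hf (ρ := infDist x (Om μ K ε f l)ᶜ) (L := l + cT * (κ * m)) av km.le hε hr0 (fun r hr hρ => by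
    obtain ⟨x', hx', hd⟩ := (infDist_lt_iff (r := 3 * r) ne).1 lz
    have h1 : ‖Tr μ K r f x'‖ ≤ l := by by_contra! hh; exact hx' ⟨r, hr, hh⟩
    have h3 := h.Tdif hf (r := r) lz lz av km.le
    have h4 := norm_sub_norm_le (Tr μ K r f x) (Tr μ K r f x')
    linarith) (by rw [← hc1]; linarith)
  obtain ⟨S, S0, hS, hb⟩ := bl h he ts hε hf hR hD m0 xA fr
  refine ⟨S, S0, hb.trans ?_⟩
  rw [Measure.restrict_apply isClosed_closedBall.measurableSet]
  refine measure_mono fun y hy => ⟨hy.1, ?_, fun ⟨r, hr, hh⟩ => ?_⟩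
  · by_contra hc
    have := infDist_le_dist_of_mem (x := x) (s := (Om μ K ε f l)ᶜ) hc
    have h5 := mem_closedBall'.1 hy.1
    linarith
  · have := hy.2 r hr
    rw [← hc1] at this; linarith
end
section
lemma scl (F : ℝ → ℝ≥0∞) {a : ℝ} (ha : 0 < a) : ∫⁻ t in Ioi 0, F t = oR a * ∫⁻ t in Ioi 0, F (a * t) := by
  have := lintegral_image_eq_lintegral_abs_deriv_mul (measurableSet_Ioi (a := (0:ℝ))) (fun x _ => (by simpa using (hasDerivAt_id x).const_mul a : HasDerivAt _ _ _).hasDerivWithinAt) (fun x _ y _ h => mul_left_cancel₀ ha.ne' h) F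
  rw [image_mul_left_Ioi ha, mul_zero] at this
  rw [this, abs_of_pos ha, lintegral_const_mul' _ _ ofReal_ne_top]
lemma SI.Tc {d : ℕ} {μ : Measure Eu d} {K : KT d} {n α C C0 : ℝ} (h : SI μ K n α C C0) {r : ℝ} (hr : 0 < r) {f} (hf : BF f) : Continuous (Tr μ K r f) := by
  have fi : Integrable f μ := by simpa using h.int hf measurable_const (g := fun _ => 1) (M := 1) zs
  refine continuous_of_dominated (fun y => (h.int_kr hf hr y).aestronglyMeasurable) (fun y => ae_of_all _ fun z => ?_) (fi.norm.const_mul (C * 128 * 12 ^ n / r ^ n)) (ae_of_all _ fun z => ?_)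
  · rw [norm_mul]; gcongr; exact h.krb hr y z
  · have := (h.kr_cont hr).comp (f := fun y : Eu d => (y, z)) (by fun_prop)
    exact this.mul continuous_const
lemma L4 (d : ℕ) {n α C C0 q B1 B2 s D1 : ℝ} (hn : 0 < n) (hα : 0 < α) (hC : 0 < C) (hC0 : 0 < C0) (hq : 1 < q) (hB1 : 0 < B1) (hB2 : 0 < B2) (hs : 0 < s) (hD1 : 1 ≤ D1) :
    ∃ A > 0, ∀ {μ : Measure Eu d} {K : KT d} (h : SI μ K n α C C0) {e} (he : EE e D1) (ts : TST μ K e q B1 B2 s)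
    {ε : ℝ} (hε : 0 < ε) {f} (hf : BF f), ∫⁻ y, oR (‖Tr μ K ε f y‖ ^ (4:ℝ)) ∂μ ≤ oR A * ∫⁻ y, oR (‖f y‖ ^ (4:ℝ)) ∂μ := by
  obtain ⟨c, hc, gl⟩ := glm d hn hα hC hC0 hq hB1 hB2 hs hD1
  obtain ⟨a, ha1, ha⟩ : ∃ a : ℝ, 1 < a ∧ a ^ (4:ℝ) = (1 + c) / (1 + c / 2) :=
    ⟨((1 + c) / (1 + c / 2)) ^ (1 / 4 : ℝ), Real.one_lt_rpow ((one_lt_div pz).2 lz) nz, by rw [← Real.rpow_mul pz]; norm_num⟩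
  have a0 : 0 < a := lz
  obtain ⟨γ, hγ, gl⟩ := gl (a - 1) lz
  rw [add_sub_cancel] at gl
  refine ⟨16 / γ ^ 4, by positivity, fun {μ K} h {e} he ts {ε} hε {f} hf => ?_⟩
  obtain ⟨A, hA, dec⟩ := h.dec hε hf
  set g := fun y => ‖f y‖ₑ ^ 2 with hg
  have gm : Measurable g := hf.me.enorm.pow_const 2
  set F := fun l => μ (Om μ K ε f l) with hF
  have Fm : Measurable F := Antitone.measurable fun l l' hl => measure_mono fun y ⟨r, hr, hh⟩ => ⟨r, hr, hl.trans_lt hh⟩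
  set W : ℝ → ℝ≥0∞ := fun l => oR (l ^ (4 - 1 : ℝ)) with hW
  have Wm : Measurable W := by fun_prop
  set I := ∫⁻ l in Ioi 0, F l * W l with hI
  set J := ∫⁻ y, oR (‖f y‖ ^ (4:ℝ)) ∂μ with hJ
  set ν := μ.withDensity g with hν
  set u := fun y => √2 / γ * ‖f y‖ with hu
  have um : Measurable u := hf.me.norm.const_mul _
  set V := fun l => ν {y | l < u y} with hV
  have If : I ≠ ∞ := by
    have i1 : oR 4 * I ≤ ∫⁻ y, oR ((A / (1 + dist y 0) ^ n) ^ (4:ℝ)) ∂μ := by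
      rw [lintegral_rpow_eq_lintegral_meas_lt_mul μ (ae_of_all _ fun y => by positivity) (by fun_prop) nz]
      refine mul_le_mul_right (lintegral_mono fun l => mul_le_mul_left (measure_mono ?_) _) _
      rintro y ⟨r, hr, hh⟩
      exact hh.trans_le (dec r hr y)
    have i2 := tailL (α := 3 * n) hn pz μ 0 hC0.le one_pos fun r hr => h.gr 0 r lz
    have i3 : ∫⁻ y, oR ((A / (1 + dist y 0) ^ n) ^ (4:ℝ)) ∂μ = oR (A ^ (4:ℝ)) * ∫⁻ y, oR (1 ^ (3 * n) / (1 + dist y 0) ^ (n + 3 * n)) ∂μ := by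
      rw [← lintegral_const_mul' _ _ ofReal_ne_top]
      congr 1; ext y
      rw [← ofReal_mul pz, div_rpow hA.le pz, ← Real.rpow_mul pz, Real.one_rpow, mul_one_div, show n + 3 * n = n * 4 by ring]
    rw [i3] at i1
    have := (i1.trans (mul_le_mul_right i2 _)).trans_lt (mul_lt_top ofReal_lt_top ofReal_lt_top)
    exact fun hh => by simp [hh] at this
  have op : ∀ l, MeasurableSet (Om μ K ε f l) := fun l => by
    have : Om μ K ε f l = ⋃ r : Ici ε, {y | l < ‖Tr μ K r f y‖} := by ext y; simp [Om]
    rw [this]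
    exact (isOpen_iUnion fun r => isOpen_lt continuous_const (h.Tc (hε.trans_le r.2) hf).norm).measurableSet
  have key : ∀ l ∈ Ioi (0:ℝ), oR (1 + c) * (F (a * l) * W l) ≤ F l * W l + oR (c * (2 / γ ^ 2)) * (V l * oR (l ^ (2 - 1 : ℝ))) := fun l hl => by
    have l0 : 0 < l := hl
    set N := {x | ¬ A2 μ g x (γ * l)} with hN
    have n1 : oR ((γ * l) ^ 2 / 2) * μ N ≤ V l := by
      refine (weakM μ g gm _ ofReal_ne_top h.fin N fun x hx => ?_).trans ?_
      · simp only [hN, mem_ofPred_eq, A2] at hx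
        push Not at hx
        obtain ⟨r, r0, hr⟩ := hx
        refine ⟨r, r0, ?_⟩
        rwa [show (2:ℝ≥0∞) = oR 2 by simp, ← ofReal_mul zero_le_two, mul_div_cancel₀ _ two_ne_zero]
      · simp only [hV]; rw [hν, withDensity_apply _ (measurableSet_lt measurable_const um)]
        refine lintegral_mono_set fun y hy => ?_
        simp only [mem_ofPred_eq, hg, ← ofReal_norm, ← ofReal_pow (norm_nonneg _)] at hy
        have hy := (ofReal_lt_ofReal_iff_of_nonneg pz).1 hy
        show l < u y
        refine lt_of_pow_lt_pow_left₀ 2 pz ?_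
        rw [hu, mul_pow, div_pow, sq_sqrt zero_le_two, div_mul_eq_mul_div, lt_div_iff₀ pz]
        rw [mul_pow] at hy; linarith
    have n2 : μ N * W l ≤ oR (2 / γ ^ 2) * (V l * oR (l ^ (2 - 1 : ℝ))) := by
      have : W l = oR (2 / γ ^ 2) * oR (l ^ (2 - 1 : ℝ)) * oR ((γ * l) ^ 2 / 2) := by
        rw [hW, ← ofReal_mul pz, ← ofReal_mul pz]
        norm_num
        congr 1; field_simp
      rw [this, mul_comm (μ N), mul_assoc, mul_assoc, mul_comm (V l)]
      gcongr
    have n3 : oR (1 + c) * F (a * l) ≤ F l + oR c * μ N := by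
      have g1 := gl h he ts hε hf l0
      have g2 : F (a * l) ≤ μ (Om μ K ε f (a * l) ∩ {x | A2 μ g x (γ * l)}) + μ N := (measure_mono fun y hy => by
        by_cases hh : A2 μ g y (γ * l)
        exacts [Or.inl ⟨hy, hh⟩, Or.inr hh]).trans (measure_union_le _ _)
      have g3 : μ (Om μ K ε f l \ Om μ K ε f (a * l)) + F (a * l) ≤ F l := by
        refine (add_le_add_right (measure_mono ?_) _).trans (measure_sdiff_add_inter (Om μ K ε f l) (op (a * l))).le
        exact fun y ⟨r, hr, hh⟩ => ⟨⟨r, hr, lt_trans (lt_mul_of_one_lt_left l0 ha1) hh⟩, r, hr, hh⟩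
      rw [ofReal_add zero_le_one hc.le, ofReal_one, add_mul, one_mul, add_comm]
      refine le_trans (add_le_add_left (mul_le_mul_right g2 _) _) ?_
      rw [mul_add, add_right_comm]
      exact add_le_add_left ((add_le_add_left g1 _).trans g3) _
    calc _ = oR (1 + c) * F (a * l) * W l := (mul_assoc _ _ _).symm
      _ ≤ (F l + oR c * μ N) * W l := by gcongr
      _ = F l * W l + oR c * (μ N * W l) := by ring
      _ ≤ _ := by
        rw [ofReal_mul hc.le, mul_assoc]
        gcongr
  have k2 := setLIntegral_mono' (μ := volume) measurableSet_Ioi key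
  rw [lintegral_const_mul' _ _ ofReal_ne_top, lintegral_add_left (f := fun l => F l * W l) (Fm.mul Wm), lintegral_const_mul' _ _ ofReal_ne_top, ← hI] at k2
  have k3 : ∫⁻ l in Ioi 0, F (a * l) * W l = oR (1 / a ^ (4:ℝ)) * I := by
    rw [hI, scl (fun l => F l * W l) a0, ← mul_assoc, ← ofReal_mul pz, ← lintegral_const_mul' _ _ ofReal_ne_top]
    refine setLIntegral_congr_fun measurableSet_Ioi fun l hl => ?_
    have l0 : 0 < l := hl
    simp only [hW]
    rw [mul_left_comm, ← ofReal_mul pz, mul_rpow a0.le l0.le, Real.rpow_sub_one a0.ne']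
    congr 2; field_simp
  have k4 : ∫⁻ l in Ioi 0, V l * oR (l ^ (2 - 1 : ℝ)) = oR (1 / γ ^ 2) * J := by
    have := lintegral_rpow_eq_lintegral_meas_lt_mul ν (f := u) (ae_of_all _ fun y => by positivity) um.aemeasurable (p := 2) nz
    have e : ∫⁻ y, oR (u y ^ (2:ℝ)) ∂ν = oR (2 / γ ^ 2) * J := by
      rw [hν, lintegral_withDensity_eq_lintegral_mul _ gm (by fun_prop), hJ, ← lintegral_const_mul' _ _ ofReal_ne_top]
      congr 1; ext y
      simp only [hg, hu, Pi.mul_apply]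
      rw [← ofReal_norm, ← ofReal_pow (norm_nonneg _), ← ofReal_mul pz, ← ofReal_mul pz, Real.rpow_two, mul_pow, div_pow, sq_sqrt zero_le_two,
        show (4:ℝ) = (4:ℕ) by norm_num, Real.rpow_natCast]
      congr 1; ring
    rw [e] at this
    calc _ = oR (1 / 2) * (oR 2 * ∫⁻ l in Ioi 0, V l * oR (l ^ (2 - 1 : ℝ))) := by
          rw [← mul_assoc, ← ofReal_mul pz]; norm_num
      _ = _ := by rw [← this, ← mul_assoc, ← ofReal_mul pz]; congr 2; field_simp
  rw [k3, k4, ← mul_assoc, ← mul_assoc, ← ofReal_mul pz, ← ofReal_mul pz, ha, show (1 + c) * (1 / ((1 + c) / (1 + c / 2))) = 1 + c / 2 by field_simp,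
    ofReal_add zero_le_one pz, ofReal_one, add_mul, one_mul, ENNReal.add_le_add_iff_left If] at k2
  rw [lintegral_rpow_eq_lintegral_meas_lt_mul μ (ae_of_all _ fun y => norm_nonneg _) (h.Tc hε hf).norm.measurable.aemeasurable nz]
  calc _ ≤ oR 4 * I := by
        exact mul_le_mul_right (lintegral_mono fun l => mul_le_mul_left (measure_mono (t := Om μ K ε f l) fun y hh => ⟨ε, le_rfl, hh⟩) _) _
    _ = oR (8 / c) * (oR (c / 2) * I) := by
        rw [← mul_assoc, ← ofReal_mul pz]; congr 2; field_simp; norm_num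
    _ ≤ _ := by
        refine (mul_le_mul_right k2 _).trans (le_of_eq ?_)
        rw [← mul_assoc, ← ofReal_mul pz]; congr 2; field_simp; norm_num
end
section
lemma lcx {v : ℕ → ℝ} {M A : ℝ} (hA : 0 < A) (h0 : ∀ m, 0 ≤ v m) (h1 : ∀ m, v (m + 1) ^ 2 ≤ v m * v (m + 2)) (h2 : ∀ m, v m ^ 2 ≤ M * A ^ m) : v 1 ≤ √A * v 0 := by
  by_contra! hc
  have v1 := lt_of_le_of_lt (mul_nonneg (Real.sqrt_nonneg _) (h0 0)) hc
  have v0 := (h0 0).lt_of_ne fun e => by have := h1 0; rw [← e, zero_mul, zero_add] at this; exact this.not_gt pz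
  set ρ := v 1 / v 0 with hρ
  have ρ0 : 0 < ρ := pz
  have k : ∀ m, 0 < v m ∧ ρ * v m ≤ v (m + 1) := fun m => by
    induction m with
    | zero => exact ⟨v0, by rw [hρ, div_mul_cancel₀ _ v0.ne']⟩
    | succ m ih =>
      have p := lt_of_lt_of_le (mul_pos ρ0 ih.1) ih.2
      refine ⟨p, le_of_mul_le_mul_left ?_ ih.1⟩
      refine le_trans ?_ (h1 m)
      rw [sq, mul_left_comm, ← mul_assoc]
      gcongr; exact ih.2
  have k2 : ∀ m, ρ ^ m * v 0 ≤ v m := fun m => by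
    induction m with
    | zero => simp
    | succ m ih => refine le_trans ?_ (k m).2; rw [pow_succ', mul_assoc]; gcongr
  have hb : 1 < ρ ^ 2 / A := by
    rw [one_lt_div hA, ← sq_sqrt hA.le]
    gcongr; rwa [hρ, lt_div_iff₀ v0]
  obtain ⟨m, hm⟩ := pow_unbounded_of_one_lt (M / v 0 ^ 2) hb
  have := (pow_le_pow_left₀ pz (k2 m) 2).trans (h2 m)
  rw [div_lt_iff₀ pz, div_pow, div_mul_eq_mul_div, lt_div_iff₀ pz, ← pow_mul, mul_comm 2, pow_mul, ← mul_pow] at hm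
  exact hm.not_ge this
lemma csq {X : Type*} [MeasurableSpace X] (μ : Measure X) {F G : X → ℝ≥0∞} (hF : AEMeasurable F μ) (hG : AEMeasurable G μ) : (∫⁻ x, F x * G x ∂μ) ^ 2 ≤ (∫⁻ x, F x ^ 2 ∂μ) * ∫⁻ x, G x ^ 2 ∂μ := by
  have := pow_le_pow_left' (lintegral_mul_le_Lp_mul_Lq μ Real.HolderConjugate.two_two hF hG) 2
  rw [mul_pow, ← rpow_mul_natCast, ← rpow_mul_natCast] at this
  simpa using this
variable {d : ℕ} {μ : Measure Eu d} {K : KT d} {n α C C0 : ℝ}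
local notation "Sμ" => SI μ K n α C C0
local notation "E" => Eu d
lemma SI.asy (h : Sμ) {r : ℝ} (hr : 0 < r) {f g : E → ℂ} (hf : BF f) (hg : BF g) : ∫ x, Tr μ K r f x * g x ∂μ = - ∫ x, f x * Tr μ K r g x ∂μ := by
  have := h.sfin
  have fi {f : E → ℂ} (hf : BF f) : Integrable f μ := by simpa using h.int hf measurable_const (g := fun _ => 1) (M := 1) zs
  have : Integrable (Function.uncurry fun x y => kr K r x y * (g x * f y)) (μ.prod μ) :=
    ((fi hg).mul_prod (fi hf)).bdd_mul (h.kr_cont hr).measurable.aestronglyMeasurable (ae_of_all _ fun p => h.krb hr p.1 p.2)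
  have sw := integral_integral_swap this
  rw [← integral_neg]
  convert sw using 2
  · ext x
    rw [Tr, ← integral_mul_const]; congr 1; ext y; ring
  · ext x
    rw [Tr, ← mul_neg, ← integral_neg, ← integral_const_mul]; congr 1; ext y; rw [h.kr_an]; ring
def SS (μ : Measure E) (K : E → E → ℂ) (r R : ℝ) (f : E → ℂ) : E → ℂ := (closedBall 0 R).indicator fun x => (starRingEnd ℂ) (Tr μ K r f x)
lemma SI.SB (h : Sμ) {r R : ℝ} (hr : 0 < r) {f : E → ℂ} (hf : BF f) : BF (SS μ K r R f) := by
  refine ⟨((h.Tc hr hf).star.measurable).indicator isClosed_closedBall.measurableSet, ?_, R, fun y hy => indicator_of_notMem (by simpa using hy) _⟩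
  obtain ⟨A, hA, H⟩ := h.dec hr hf
  have hn := h.hn
  refine ⟨A, fun y => (norm_indicator_le_norm_self _ _).trans ?_⟩
  rw [RCLike.norm_conj]
  exact (H r le_rfl y).trans (div_le_self hA.le (Real.one_le_rpow (by linarith [dist_nonneg (x := y) (y := 0)]) hn.le))
lemma SI.S2 (h : Sμ) {r R : ℝ} (hr : 0 < r) {f : E → ℂ} (hf : BF f) (h0 : ∀ y ∉ closedBall 0 R, f y = 0) :
    (∫⁻ x, ‖SS μ K r R f x‖ₑ ^ 2 ∂μ) ^ 2 ≤ (∫⁻ x, ‖f x‖ₑ ^ 2 ∂μ) * ∫⁻ x, ‖SS μ K r R (SS μ K r R f) x‖ₑ ^ 2 ∂μ := by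
  set g := SS μ K r R f with hg
  have gB : BF g := h.SB hr hf
  have a := h.asy hr hf gB
  have : ∀ x, Tr μ K r f x * g x = ((‖g x‖ ^ 2 : ℝ) : ℂ) := fun x => by
    by_cases hx : x ∈ closedBall 0 R
    · rw [hg, SS, indicator_of_mem hx, Complex.mul_conj, RCLike.norm_conj, normSq_eq_norm_sq]
    · rw [hg, SS, indicator_of_notMem hx]; simp
  simp_rw [this] at a
  obtain ⟨M, hM⟩ := gB.bd
  rw [integral_complex_ofReal] at a
  have e : oR (∫ x, ‖g x‖ ^ 2 ∂μ) = ∫⁻ x, ‖g x‖ₑ ^ 2 ∂μ := by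
    rw [ofReal_integral_eq_lintegral_ofReal _ (ae_of_all _ fun x => by positivity)]
    · simp_rw [← ofReal_norm, ofReal_pow (norm_nonneg _)]
    · simpa [sq] using (h.int gB gB.me hM).norm
  rw [← e]
  refine le_trans (pow_le_pow_left' ?_ 2) (csq μ hf.me.enorm.aemeasurable (h.SB hr gB).me.enorm.aemeasurable)
  refine (ofReal_le_ofReal (le_abs_self _)).trans ?_
  rw [← norm_eq_abs, ← norm_real, a, norm_neg, ofReal_norm]
  refine (enorm_integral_le_lintegral_enorm _).trans (lintegral_mono fun x => ?_)
  rw [enorm_mul]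
  by_cases hx : x ∈ closedBall 0 R
  · rw [SS, indicator_of_mem hx, ← ofReal_norm (starRingEnd ℂ _), RCLike.norm_conj, ofReal_norm]
  · simp [h0 x hx]
lemma SI.Sf (h : Sμ) {r R A : ℝ} (hA : 0 < A) (hr : 0 < r) (H : ∀ f : E → ℂ, BF f → ∫⁻ y, oR (‖Tr μ K r f y‖ ^ (4:ℝ)) ∂μ ≤ oR A * ∫⁻ y, oR (‖f y‖ ^ (4:ℝ)) ∂μ) {f : E → ℂ} (hf : BF f) (h0 : ∀ y ∉ closedBall 0 R, f y = 0) :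
    ∫⁻ x in closedBall 0 R, ‖Tr μ K r f x‖ₑ ^ 2 ∂μ ≤ oR √A * ∫⁻ x, ‖f x‖ₑ ^ 2 ∂μ := by
  set B := closedBall (0 : E) R
  have mB : MeasurableSet B := isClosed_closedBall.measurableSet
  set F : ℕ → E → ℂ := fun m => (SS μ K r R)^[m] f with hF
  have Fs : ∀ m, F (m + 1) = SS μ K r R (F m) := fun m => Function.iterate_succ_apply' _ _ _
  have Fb : ∀ m, BF (F m) ∧ ∀ y ∉ B, F m y = 0 := fun m => by
    induction m with
    | zero => exact ⟨hf, h0⟩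
    | succ m ih => rw [Fs]; exact ⟨h.SB hr ih.1, fun y hy => indicator_of_notMem hy _⟩
  set V : ℕ → ℝ≥0∞ := fun m => ∫⁻ x, ‖F m x‖ₑ ^ 2 ∂μ with hV
  have W : ∀ m, ∫⁻ y, oR (‖F m y‖ ^ (4:ℝ)) ∂μ ≤ oR (A ^ m) * ∫⁻ y, oR (‖f y‖ ^ (4:ℝ)) ∂μ := fun m => by
    induction m with
    | zero => simp [hF]
    | succ m ih =>
      rw [Fs, pow_succ', ofReal_mul hA.le, mul_assoc]
      refine (lintegral_mono fun y => ofReal_le_ofReal ?_).trans ((H _ (Fb m).1).trans (mul_le_mul_right ih _))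
      gcongr
      exact (norm_indicator_le_norm_self _ _).trans (RCLike.norm_conj _).le
  have Wf : ∫⁻ y, oR (‖f y‖ ^ (4:ℝ)) ∂μ ≠ ∞ := by
    obtain ⟨M, hM⟩ := hf.bd
    have : ∫⁻ y, oR (‖f y‖ ^ (4:ℝ)) ∂μ ≤ ∫⁻ y, B.indicator (fun _ => oR (M ^ (4:ℝ))) y ∂μ := lintegral_mono fun y => by
      by_cases hy : y ∈ B
      · rw [indicator_of_mem hy]; exact ofReal_le_ofReal (by gcongr; exact hM y)
      · simp [h0 y hy]
    rw [lintegral_indicator_const mB] at this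
    exact (this.trans_lt (mul_lt_top ofReal_lt_top (h.fin 0 R).lt_top)).ne
  have V2 : ∀ m, V m ^ 2 ≤ oR (A ^ m) * (∫⁻ y, oR (‖f y‖ ^ (4:ℝ)) ∂μ) * μ B := fun m => by
    have := csq μ ((Fb m).1.me.enorm.pow_const 2).aemeasurable (measurable_one.indicator mB).aemeasurable
    refine le_trans (le_of_eq ?_) (this.trans (mul_le_mul' (le_trans (le_of_eq ?_) (W m)) (le_of_eq ?_)))
    · refine congrArg (· ^ 2) (lintegral_congr fun x => ?_)
      by_cases hx : x ∈ B <;> simp [hx, (Fb m).2]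
    · congr 1; ext x
      rw [← ofReal_norm, ← pow_mul, show (4:ℝ) = ((2 * 2 : ℕ) : ℝ) by norm_num, Real.rpow_natCast, ofReal_pow (norm_nonneg _)]
    · rw [← lintegral_indicator_one mB]; congr 1; ext x
      by_cases hx : x ∈ B <;> simp [hx]
  have Vf : ∀ m, V m ≠ ∞ := fun m hh => by
    have := (V2 m).trans_lt (mul_lt_top (mul_lt_top ofReal_lt_top Wf.lt_top) (h.fin 0 R).lt_top)
    simp [hh] at this
  have v := lcx (v := fun m => (V m).toReal) (M := (∫⁻ y, oR (‖f y‖ ^ (4:ℝ)) ∂μ).toReal * μ.real B) hA (fun m => toReal_nonneg) (fun m => ?_) fun m => ?_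
  · change _ ≤ _ * V 0
    rw [← ofReal_toReal (Vf 0), ← ofReal_mul (Real.sqrt_nonneg _)]
    refine le_trans (le_of_eq ?_) ((ofReal_toReal (Vf 1)).symm.le.trans (ofReal_le_ofReal v))
    rw [hV, ← lintegral_indicator mB]
    refine lintegral_congr fun x => ?_
    rw [Fs]
    by_cases hx : x ∈ B
    · rw [SS, indicator_of_mem hx, indicator_of_mem hx, ← ofReal_norm (starRingEnd ℂ _), RCLike.norm_conj, ofReal_norm]; rfl
    · rw [SS, indicator_of_notMem hx, indicator_of_notMem hx]; simp
  · rw [← toReal_pow, ← toReal_mul]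
    refine toReal_mono (mul_ne_top (Vf _) (Vf _)) ?_
    have := h.S2 hr (Fb m).1 (Fb m).2
    rwa [← Fs, ← Fs] at this
  · refine (toReal_pow _ _).symm.le.trans ((toReal_mono (mul_ne_top (mul_ne_top ofReal_ne_top Wf) (h.fin 0 R)) (V2 m)).trans (le_of_eq ?_))
    rw [toReal_mul, toReal_mul, toReal_ofReal pz, Measure.real]; ring
end
section
variable {d : ℕ} {μ : Measure Eu d} {K : KT d} {n α C C0 : ℝ}
local notation "Sμ" => SI μ K n α C C0
local notation "E" => Eu d
lemma SI.ik (h : Sμ) {r : ℝ} (hr : 0 < r) {f : E → ℂ} (hf : Measurable f) (h2 : ∫⁻ y, ‖f y‖ₑ ^ 2 ∂μ ≠ ∞) (x : E) : Integrable (fun y => kr K r x y * f y) μ := by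
  refine ⟨((h.kr_meas hr x).mul hf).aestronglyMeasurable, ?_⟩
  have hn := h.hn
  have i2 := tailL hn hn μ x h.hC0.le hr fun t ht => h.gr x t (hr.trans_le ht)
  have i3 : ∫⁻ y, ‖kr K r x y‖ₑ ^ 2 ∂μ ≤ oR ((C * 128 * 12 ^ n) ^ 2 / r ^ n) * ∫⁻ y, oR (r ^ n / (r + dist y x) ^ (n + n)) ∂μ := by
    rw [← lintegral_const_mul' _ _ ofReal_ne_top]
    refine lintegral_mono fun y => ?_
    rw [← ofReal_norm, ← ofReal_pow (norm_nonneg _), ← ofReal_mul pz]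
    refine ofReal_le_ofReal ((pow_le_pow_left₀ (norm_nonneg _) (h.kr_bd hr x y) 2).trans (le_of_eq ?_))
    rw [Real.rpow_add pz, dist_comm x y, add_comm (dist y x)]; field_simp
  have c := csq μ (h.kr_meas hr x).enorm.aemeasurable hf.enorm.aemeasurable
  have := c.trans_lt (mul_lt_top (i3.trans_lt (mul_lt_top ofReal_lt_top (i2.trans_lt ofReal_lt_top))) h2.lt_top)
  simp_rw [← enorm_mul] at this
  exact (pow_lt_top_iff.1 this).resolve_right two_ne_zero
lemma SI.Ta (h : Sμ) {r : ℝ} (hr : 0 < r) {A : ℝ≥0∞} (H : ∀ R, ∀ f : E → ℂ, BF f → (∀ y ∉ closedBall 0 R, f y = 0) → ∫⁻ x in closedBall 0 R, ‖Tr μ K r f x‖ₑ ^ 2 ∂μ ≤ A * ∫⁻ x, ‖f x‖ₑ ^ 2 ∂μ)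
    {f : E → ℂ} (hf : Measurable f) (h2 : ∫⁻ y, ‖f y‖ₑ ^ 2 ∂μ ≠ ∞) : ∫⁻ x, ‖Tr μ K r f x‖ₑ ^ 2 ∂μ ≤ A * ∫⁻ x, ‖f x‖ₑ ^ 2 ∂μ := by
  set Q : ℕ → Set E := fun k => closedBall 0 k ∩ {y | ‖f y‖ ≤ k}
  have Qm : ∀ k, MeasurableSet (Q k) := fun k => isClosed_closedBall.measurableSet.inter (measurableSet_le hf.norm measurable_const)
  have ev : ∀ y, ∀ᶠ k : ℕ in atTop, y ∈ Q k := fun y => by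
    filter_upwards [eventually_ge_atTop ⌈max (dist y 0) ‖f y‖⌉₊] with k hk
    have := max_le_iff.1 (Nat.ceil_le.1 hk)
    exact ⟨this.1, this.2⟩
  have fB : ∀ k, BF ((Q k).indicator f) := fun k => ⟨hf.indicator (Qm k), ⟨k, fun y => by
    by_cases hy : y ∈ Q k
    · rw [indicator_of_mem hy]; exact hy.2
    · simp [hy]⟩, k, fun y hy => indicator_of_notMem (fun hh => hy.not_ge hh.1) _⟩
  set G : ℕ → E → ℝ≥0∞ := fun k => (closedBall 0 k).indicator fun x => ‖Tr μ K r ((Q k).indicator f) x‖ₑ ^ 2 with hG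
  have Gm : ∀ k, Measurable (G k) := fun k => ((h.Tc hr (fB k)).measurable.enorm.pow_const 2).indicator isClosed_closedBall.measurableSet
  have lim : ∀ x, ‖Tr μ K r f x‖ₑ ^ 2 = Filter.liminf (fun k => G k x) atTop := fun x => by
    have t : Tendsto (fun k => Tr μ K r ((Q k).indicator f) x) atTop (nhds (Tr μ K r f x)) := by
      refine tendsto_integral_of_dominated_convergence (fun y => ‖kr K r x y * f y‖) (fun k => (h.int_kr (fB k) hr x).aestronglyMeasurable) (h.ik hr hf h2 x).norm (fun k => ae_of_all _ fun y => ?_) (ae_of_all _ fun y => ?_)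
      · rw [norm_mul, norm_mul]; gcongr; exact ind_le _ _
      · exact tendsto_const_nhds.congr' ((ev y).mono fun k hk => by simp only [indicator_of_mem hk])
    refine (Tendsto.liminf_eq (((ENNReal.continuous_pow 2).tendsto _).comp ((continuous_enorm.tendsto _).comp t) |>.congr' ((ev x).mono fun k hk => ?_))).symm
    simp only [hG, Function.comp]
    rw [indicator_of_mem hk.1]
  simp_rw [lim]
  refine (lintegral_liminf_le Gm).trans (Filter.liminf_le_of_frequently_le' (Filter.Frequently.of_forall fun k => ?_))
  rw [lintegral_indicator isClosed_closedBall.measurableSet]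
  refine (H k _ (fB k) fun y hy => indicator_of_notMem (fun hh => hy hh.1) _).trans (mul_le_mul_right (lintegral_mono fun y => ?_) _)
  exact pow_le_pow_left' (enorm_le_iff_norm_le.2 (ind_le _ _)) 2
lemma L2E (d : ℕ) {n α C C0 q B1 B2 s D1 : ℝ} (hn : 0 < n) (hα : 0 < α) (hC : 0 < C) (hC0 : 0 < C0) (hq : 1 < q) (hB1 : 0 < B1) (hB2 : 0 < B2) (hs : 0 < s) (hD1 : 1 ≤ D1) :
    ∃ A > 0, ∀ {μ : Measure Eu d} {K : KT d} (h : SI μ K n α C C0) {e} (he : EE e D1) (ts : TST μ K e q B1 B2 s)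
    {ε : ℝ} (hε : 0 < ε) {f : Eu d → ℂ} (hf : Measurable f), ∫⁻ x, ‖∫ y in {y | ε < e x y}, K x y * f y ∂μ‖ₑ ^ 2 ∂μ ≤ oR A * ∫⁻ y, ‖f y‖ₑ ^ 2 ∂μ := by
  obtain ⟨A, hA, l4⟩ := L4 d hn hα hC hC0 hq hB1 hB2 hs hD1
  refine ⟨2 * √A + 2 * (C * 128 * 12 ^ n * C0 * (2 * D1) ^ n) ^ 2, by positivity, fun {μ K} h {e} he ts {ε} hε {f} hf => ?_⟩
  by_cases h2 : ∫⁻ y, ‖f y‖ₑ ^ 2 ∂μ = ∞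
  · rw [h2, mul_top (by simp; positivity)]; exact le_top
  have := h.sfin
  obtain ⟨r, hr⟩ : ∃ r, r = ε / (2 * D1) := ⟨_, rfl⟩
  have r0 : 0 < r := by rw [hr]; positivity
  have T := h.Ta r0 (fun R f hf h0 => h.Sf hA r0 (fun f hf => l4 h he ts r0 hf) hf h0) hf h2
  set a := oR (C * 128 * 12 ^ n / r ^ n) with ha
  set b := oR (C0 * ε ^ n) with hb
  have pt : ∀ x, ‖∫ y in {y | ε < e x y}, K x y * f y ∂μ‖ₑ ^ 2 ≤ 2 * ‖Tr μ K r f x‖ₑ ^ 2 + 2 * (a ^ 2 * b) * ∫⁻ y, (closedBall x ε).indicator (fun y => ‖f y‖ₑ ^ 2) y ∂μ := fun x => by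
    have mS := he.em x ε
    have e1 : ∫ y in {y | ε < e x y}, K x y * f y ∂μ = Tr μ K r f x - ∫ y in {y | ε < e x y}ᶜ, kr K r x y * f y ∂μ := by
      rw [eq_sub_iff_add_eq, Tr, ← integral_add_compl mS (h.ik r0 hf h2 x)]
      congr 1
      refine setIntegral_congr_fun mS fun y hy => ?_
      have h3 := he.e2 x y
      have h4 : ε < e x y := hy
      have : 2 * r ≤ dist x y := by rw [hr, ← mul_div_assoc, div_le_iff₀ pz]; linarith
      rw [SI.kr_one K r0 lz]
    have e2 : ‖∫ y in {y | ε < e x y}ᶜ, kr K r x y * f y ∂μ‖ₑ ≤ a * ∫⁻ y in closedBall x ε, 1 * ‖f y‖ₑ ∂μ := by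
      rw [← lintegral_const_mul' _ _ ofReal_ne_top]
      refine (enorm_integral_le_lintegral_enorm _).trans ((lintegral_mono_set fun y hy => ?_).trans (lintegral_mono fun y => ?_))
      · have := he.e1 x y
        simp only [mem_compl_iff, mem_ofPred_eq, not_lt] at hy
        rw [mem_closedBall']; linarith
      · rw [enorm_mul, one_mul, ← ofReal_norm (kr K r x y)]
        gcongr; exact h.krb r0 x y
    have e3 := csq (μ.restrict (closedBall x ε)) (F := fun _ => 1) aemeasurable_const hf.enorm.aemeasurable
    simp only [one_pow, lintegral_const, one_mul, restrict_apply_univ] at e3 e2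
    rw [lintegral_indicator isClosed_closedBall.measurableSet, mul_assoc, ← mul_add, e1]
    have e4 : ‖∫ y in {y | ε < e x y}ᶜ, kr K r x y * f y ∂μ‖ₑ ^ 2 ≤ a ^ 2 * b * ∫⁻ y in closedBall x ε, ‖f y‖ₑ ^ 2 ∂μ := by
      refine (pow_le_pow_left' e2 2).trans ?_
      rw [mul_pow, mul_assoc]
      exact mul_le_mul_right (e3.trans (mul_le_mul_left (h.gr x ε hε) _)) _
    refine le_trans ?_ (mul_le_mul_right (add_le_add_right e4 _) _)
    refine (pow_le_pow_left' enorm_sub_le 2).trans ?_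
    have := rpow_add_le_mul_rpow_add_rpow ‖Tr μ K r f x‖ₑ ‖∫ y in {y | ε < e x y}ᶜ, kr K r x y * f y ∂μ‖ₑ one_le_two
    norm_num at this; exact this
  refine (lintegral_mono pt).trans ?_
  have Im : Measurable fun p : Eu d × Eu d => (closedBall p.1 ε).indicator (fun y => ‖f y‖ₑ ^ 2) p.2 := by
    have : MeasurableSet {p : Eu d × Eu d | dist p.2 p.1 ≤ ε} := (isClosed_le (by fun_prop) continuous_const).measurableSet
    exact ((hf.enorm.pow_const 2).comp measurable_snd).indicator this
  have bt : ∫⁻ x, ∫⁻ y, (closedBall x ε).indicator (fun y => ‖f y‖ₑ ^ 2) y ∂μ ∂μ ≤ b * ∫⁻ y, ‖f y‖ₑ ^ 2 ∂μ := by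
    rw [lintegral_lintegral_swap Im.aemeasurable, ← lintegral_const_mul' _ _ ofReal_ne_top]
    refine lintegral_mono fun y => ?_
    have : ∀ x, (closedBall x ε).indicator (fun y => ‖f y‖ₑ ^ 2) y = (closedBall y ε).indicator (fun _ => ‖f y‖ₑ ^ 2) x := fun x => by
      simp only [indicator, mem_closedBall, dist_comm]
    simp_rw [this]
    rw [lintegral_indicator_const isClosed_closedBall.measurableSet, mul_comm]
    exact mul_le_mul_left (h.gr y ε hε) _
  have ab : a * b = oR (C * 128 * 12 ^ n * C0 * (2 * D1) ^ n) := by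
    rw [ha, hb, ← ofReal_mul pz, show ε = 2 * D1 * r by rw [hr]; field_simp, mul_rpow pz r0.le]
    congr 1; field_simp
  rw [lintegral_add_right _ (Im.lintegral_prod_right'.const_mul _), lintegral_const_mul' _ _ zs, lintegral_const_mul _ Im.lintegral_prod_right']
  refine (add_le_add (mul_le_mul_right T _) (mul_le_mul_right bt _)).trans (le_of_eq ?_)
  rw [ofReal_add pz pz, ofReal_mul zero_le_two, ofReal_mul zero_le_two, ofReal_pow pz, ← ab, ofReal_ofNat]
  ring
end
section
variable {d : ℕ} {n α C C0 : ℝ}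
lemma SI.L2F {μ : Measure Eu d} {K : KT d} (h : SI μ K n α C C0) {D1 A ε : ℝ} (hD1 : 1 ≤ D1) {e} (he : EE e D1) (ec : ∀ x, Continuous (e x)) (hε : 0 < ε)
    (H : ∀ {f : Eu d → ℂ}, Measurable f → ∫⁻ x, ‖∫ y in {y | ε < e x y}, K x y * f y ∂μ‖ₑ ^ 2 ∂μ ≤ oR A * ∫⁻ y, ‖f y‖ₑ ^ 2 ∂μ) (f : Eu d → ℂ) :
    ∫⁻ x, ‖∫ y in {y | ε < e x y}, K x y * f y ∂μ‖ₑ ^ 2 ∂μ ≤ oR A * ∫⁻ y, ‖f y‖ₑ ^ 2 ∂μ := by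
  obtain ⟨r, hr⟩ : ∃ r, r = ε / (2 * D1) := ⟨_, rfl⟩
  have r0 : 0 < r := by rw [hr]; positivity
  have kk : ∀ x y, ε < e x y → kr K r x y = K x y := fun x y hy => by
    have h3 := he.e2 x y
    have : 2 * r ≤ dist x y := by rw [hr, ← mul_div_assoc, div_le_iff₀ pz]; linarith
    exact SI.kr_one K r0 lz
  have mS := fun x => he.em x ε
  set W := fun x => {y | ε < e x y} ∩ {y | kr K r x y ≠ 0}
  have Wo : ∀ x, IsOpen (W x) := fun x => (isOpen_lt continuous_const (ec x)).inter (isOpen_ne_fun ((h.kr_cont r0).comp (f := fun y : Eu d => (x, y)) (by fun_prop)) continuous_const)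
  set X := {x | ∫ y in {y | ε < e x y}, K x y * f y ∂μ ≠ 0}
  obtain ⟨T, TX, Tc, TU⟩ := TopologicalSpace.isOpen_biUnion_countable X W fun x _ => Wo x
  set V := ⋃ x ∈ X, W x
  have Vm : MeasurableSet V := (isOpen_biUnion fun x _ => Wo x).measurableSet
  have fV : AEMeasurable f (μ.restrict V) := by
    have := Tc.to_subtype
    rw [← TU, biUnion_eq_iUnion, aemeasurable_iUnion_iff]
    intro ⟨x, hx⟩
    have i := (not_imp_comm.1 integral_undef (TX hx)).aemeasurable.mono_measure (Measure.restrict_mono_set μ (inter_subset_left : W x ⊆ _))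
    refine ((h.kr_meas r0 x).inv.aemeasurable.mul i).congr ((ae_restrict_mem (Wo x).measurableSet).mono fun y hy => ?_)
    simp only [Pi.mul_apply, Pi.inv_apply]
    rw [← kk x y hy.1, inv_mul_cancel_left₀ hy.2]
  set g := V.indicator (fV.mk f) with hg
  have gm : Measurable g := fV.measurable_mk.indicator Vm
  have ae := (ae_restrict_iff' Vm).1 fV.ae_eq_mk
  refine (lintegral_mono fun x => pow_le_pow_left' (?_ : _ ≤ ‖∫ y in {y | ε < e x y}, K x y * g y ∂μ‖ₑ) 2).trans ((H gm).trans (mul_le_mul_right (lintegral_mono_ae (ae.mono fun y hy => ?_)) _))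
  · by_cases hx : x ∈ X
    · refine le_of_eq (congr_arg _ (setIntegral_congr_ae (mS x) (ae.mono fun y hy hS => ?_)))
      by_cases hk : kr K r x y = 0
      · rw [← kk x y hS, hk, zero_mul, zero_mul]
      have hyV : y ∈ V := mem_biUnion hx ⟨hS, hk⟩
      rw [hg, indicator_of_mem hyV, hy hyV]
    · rw [not_not.1 hx]; simp
  · by_cases hyV : y ∈ V
    · rw [hg, indicator_of_mem hyV, hy hyV]
    · simp [hg, hyV]
lemma eD (d : ℕ) : ∃ D1 : ℝ, 1 ≤ D1 ∧ EE (d := d) (fun x y => dist (WithLp.toLp 2 x) (WithLp.toLp 2 y)) D1 := by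
  refine ⟨max 1 ((Fintype.card (Fin d) : NNReal) ^ (1 / (2:ℝ≥0∞)).toReal : NNReal), le_max_left _ _, fun x y => ?_, fun x y => ?_, fun x r => ?_⟩
  · have := (PiLp.lipschitzWith_ofLp 2 fun _ : Fin d => ℝ).dist_le_mul (WithLp.toLp 2 x) (WithLp.toLp 2 y)
    simpa using this
  · refine ((PiLp.lipschitzWith_toLp 2 fun _ : Fin d => ℝ).dist_le_mul x y).trans ?_
    gcongr; exact le_max_right _ _
  · exact (isOpen_lt continuous_const (by fun_prop)).measurableSet
lemma mkSI {C₀ D1 : ℝ} (hn : 0 < n) (hnd : n ≤ d) (hα : 0 < α) (hα1 : α ≤ 1) (hC : 0 < C) (hC0 : 0 < C₀) (hD : 1 ≤ D1) (he : EE (d := d) (fun x y => dist (WithLp.toLp 2 x) (WithLp.toLp 2 y)) D1)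
    {μ : Measure (Pt d)} (hμ : HasDegree μ n C₀) {K : Pt d → Pt d → ℂ} (hK : IsCZKernel K n C α) (an : ∀ x y, K x y = - K y x) :
    SI (μ.map (MeasurableEquiv.toLp 2 Eu d).symm) (fun x y => K (.toLp 2 x) (.toLp 2 y)) n α (C * (1 + 2 ^ n) * (2 * D1) ^ α) (C₀ * (2 * D1) ^ n) := by
  have k1 : (1:ℝ) ≤ 1 + 2 ^ n := by simp; positivity
  have k2 : (1:ℝ) ≤ (2 * D1) ^ α := Real.one_le_rpow lz hα.le
  have sz : ∀ x y : Eu d, ‖K (.toLp 2 x) (.toLp 2 y)‖ ≤ C / dist x y ^ n := fun x y => by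
    rcases eq_or_ne x y with rfl | hxy
    · have := self_eq_neg.1 (an (.toLp 2 x) (.toLp 2 x))
      rw [this, norm_zero]; positivity
    · have := dist_pos.2 hxy
      refine (hK.size _ _ (by simpa using hxy)).trans ?_
      gcongr; exact he.e1 x y
  refine ⟨hn, hnd, hα, hα1, by positivity, by positivity, fun x r hr => ?_, fun x y => (sz x y).trans ?_, fun x y y' hh => ?_, fun x y => an _ _⟩
  · rw [MeasurableEquiv.map_apply, mul_assoc, ← mul_rpow pz hr.le]
    refine (measure_mono fun z hz => ?_).trans (hμ (.toLp 2 x) _ pz)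
    have h1 := he.e2 (WithLp.ofLp z) x
    have h2 : dist (WithLp.ofLp z) x ≤ r := hz
    simp only [WithLp.toLp_ofLp] at h1
    rw [mem_ball]; nlinarith
  · gcongr; rw [mul_assoc]; exact le_mul_of_one_le_right hC.le (one_le_mul_of_one_le_of_one_le k1 k2)
  · rcases eq_or_ne x y with rfl | hxy
    · rw [dist_self] at hh
      have := dist_le_zero.1 lz
      simp [this]; positivity
    have d0 := dist_pos.2 hxy
    by_cases h2 : 2 * dist (WithLp.toLp 2 y) (WithLp.toLp 2 y') ≤ dist (WithLp.toLp 2 x) (WithLp.toLp 2 y)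
    · refine (hK.smooth_snd _ _ _ (by simpa using hxy) h2).trans ?_
      have h3 := he.e2 y y'
      calc _ ≤ C * (D1 * dist y y') ^ α / dist x y ^ (n + α) := by gcongr; exact he.e1 x y
        _ ≤ C * 1 * (2 * D1) ^ α * dist y y' ^ α / dist x y ^ (n + α) := by
          rw [mul_rpow pz dist_nonneg, mul_one, mul_assoc C]; gcongr; linarith
        _ ≤ _ := by gcongr
    · have h3 := he.e2 y y'
      have h4 := he.e1 x y
      have h5 : dist x y / 2 ≤ dist x y' := by have := dist_triangle x y' y; rw [dist_comm y' y] at this; linarith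
      calc _ ≤ C / dist x y ^ n + C / (dist x y / 2) ^ n := (norm_sub_le _ _).trans (add_le_add (sz x y) ((sz x y').trans (by gcongr)))
        _ = C * (1 + 2 ^ n) * dist x y ^ α / dist x y ^ (n + α) := by
          rw [div_rpow d0.le zero_le_two, Real.rpow_add d0]; field_simp
        _ ≤ C * (1 + 2 ^ n) * (2 * D1 * dist y y') ^ α / dist x y ^ (n + α) := by gcongr; linarith
        _ = _ := by rw [mul_rpow pz dist_nonneg]; ring
lemma mkT (μ : Measure (Pt d)) (K : Pt d → Pt d → ℂ) (ε : ℝ) (f : Pt d → ℂ) (x : Eu d) :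
    ∫ y in {y | ε < dist (WithLp.toLp 2 x) (WithLp.toLp 2 y)}, K (.toLp 2 x) (.toLp 2 y) * f (.toLp 2 y) ∂(μ.map (MeasurableEquiv.toLp 2 Eu d).symm) = truncT μ K ε f (.toLp 2 x) := by
  rw [(MeasurableEquiv.toLp 2 Eu d).symm.measurableEmbedding.setIntegral_map]; rfl
lemma cbs (x : Eu d) {S a : ℝ} (hS : 0 < S) (ha : a = 2 * S) : (⟨.toLp 2 x, a⟩ : Cube d).toSet = (MeasurableEquiv.toLp 2 Eu d).symm ⁻¹' closedBall x S := by
  ext z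
  simp only [Cube.toSet, mem_preimage, mem_closedBall, dist_pi_le_iff hS.le, dist_eq, ha]
  simp
lemma mkTST {q B₁ B₂ s b t : ℝ} (hd : 0 < d) (hq : 1 < q) {μ : Measure (Pt d)} (fin : ∀ x S, μ.map (MeasurableEquiv.toLp 2 Eu d).symm (closedBall x S) ≠ ∞) {K : Pt d → Pt d → ℂ} {D1 : ℝ} (hD : 1 ≤ D1) (he : EE (d := d) (fun x y => dist (WithLp.toLp 2 x) (WithLp.toLp 2 y)) D1)
    (hb : 2 * 100 ^ d ≤ b) (ht : 160 * 100 ^ d ≤ t)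
    (H : ∀ Q : Cube d, 0 < Q.side → IsDoubling μ 5 b Q → SmallBoundary μ t Q →
          ∃ bQ : Pt d → ℂ, IsAdmissible μ Q q B₁ bQ ∧
            ∀ lam : ℝ, 0 < lam → oR (lam ^ s) * μ {x | x ∈ Q.toSet ∧ oR lam < maxT μ K 0 bQ x} ≤ oR B₂ * μ Q.toSet) :
    TST (μ.map (MeasurableEquiv.toLp 2 Eu d).symm) (fun x y => K (.toLp 2 x) (.toLp 2 y)) (fun x y => dist (WithLp.toLp 2 x) (WithLp.toLp 2 y)) q B₁ B₂ s := by
  intro x S hS h5 hsb h0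
  have e1 := cbs x hS rfl
  have e5 : (Cube.scale 5 (⟨.toLp 2 x, 2 * S⟩ : Cube d)).toSet = _ := cbs x (S := 5 * S) pz (by ring)
  have f0 := fin x S
  rw [MeasurableEquiv.map_apply, ← e1] at h0 f0
  rw [MeasurableEquiv.map_apply, MeasurableEquiv.map_apply, ← e1, ← e5] at h5
  obtain ⟨bQ, ⟨b0, bi, bq⟩, wk⟩ := H ⟨.toLp 2 x, 2 * S⟩ (by simpa) (h5.trans (by gcongr)) fun l hl => by
    have := hsb l hl
    rw [MeasurableEquiv.map_apply, MeasurableEquiv.map_apply, ← e5] at this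
    refine (measure_mono fun z hz => ?_).trans (this.trans (by gcongr))
    refine ⟨by have := hz.1; rw [e5] at this; exact this, le_trans ?_ hz.2⟩
    have cf : Continuous fun z : Pt d => dist (WithLp.ofLp z) x := by fun_prop
    have fs : ∀ z ∈ frontier (⟨.toLp 2 x, 2 * S⟩ : Cube d).toSet, dist (WithLp.ofLp z) x = S := fun z hz => by
      rw [e1] at hz
      exact frontier_le_subset_eq cf continuous_const hz
    refine (le_infDist (nonempty_frontier_iff.2 ⟨⟨.toLp 2 x, by rw [e1]; simp [hS.le]⟩, fun hu => ?_⟩)).2 fun w hw => ?_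
    · have : WithLp.toLp 2 (fun i => x i + (S + 1)) ∈ (⟨.toLp 2 x, 2 * S⟩ : Cube d).toSet := hu ▸ mem_univ _
      have := this ⟨0, hd⟩
      simp at this
      linarith [le_abs_self (S + 1)]
    · have h1 := fs w hw
      have h2 := he.e1 (WithLp.ofLp z) (WithLp.ofLp w)
      simp only [WithLp.toLp_ofLp] at h2
      refine le_trans ?_ h2
      rw [← h1]; exact abs_dist_sub_le _ _ _
  set Q : Cube d := ⟨.toLp 2 x, 2 * S⟩ with hQ
  have Qm : MeasurableSet Q.toSet := by rw [e1]; exact (MeasurableEquiv.measurable _) isClosed_closedBall.measurableSet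
  have ba := (not_imp_comm.1 integral_undef (by rw [bi]; simpa using toReal_ne_zero.2 ⟨h0, f0⟩)).aemeasurable
  set g := Q.toSet.indicator (ba.mk bQ) with hg
  have gm : Measurable g := ba.measurable_mk.indicator Qm
  have ae : ∀ᵐ y ∂μ, g y = bQ y := ((ae_restrict_iff' Qm).1 ba.ae_eq_mk).mono fun y hy => by
    by_cases hh : y ∈ Q.toSet
    · rw [hg, indicator_of_mem hh, hy hh]
    · rw [hg, indicator_of_notMem hh, b0 y hh]
  refine ⟨fun y => g (.toLp 2 y), gm.comp (MeasurableEquiv.toLp 2 Eu d).measurable, fun y hy => ?_, ?_, ?_, fun l hl => ?_⟩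
  · refine indicator_of_notMem (fun hh => hy ?_) _
    rw [e1] at hh; exact hh
  · rw [measureReal_def, MeasurableEquiv.map_apply, ← e1, ← bi, setIntegral_eq_integral_of_forall_compl_eq_zero b0, (MeasurableEquiv.toLp 2 Eu d).symm.measurableEmbedding.integral_map]
    exact integral_congr_ae ae
  · rw [MeasurableEquiv.map_apply, ← e1, (MeasurableEquiv.toLp 2 Eu d).symm.measurableEmbedding.lintegral_map]
    refine le_trans (le_of_eq ?_) bq
    rw [← lintegral_indicator Qm]
    refine lintegral_congr_ae (ae.mono fun y hy => ?_)
    simp only [MeasurableEquiv.toLp_symm_apply, WithLp.toLp_ofLp, hy]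
    by_cases hh : y ∈ Q.toSet
    · rw [indicator_of_mem hh]; rfl
    · rw [indicator_of_notMem hh, b0 y hh]; simp; linarith
  · rw [MeasurableEquiv.map_apply, MeasurableEquiv.map_apply, ← e1]
    refine le_trans (mul_le_mul_right (measure_mono fun z hz => ?_) _) (wk l hl)
    obtain ⟨z1, r, r0, hr⟩ := hz
    refine ⟨by rw [e1]; exact z1, ?_⟩
    rw [mkT] at hr
    have : truncT μ K r g z = truncT μ K r bQ z := integral_congr_ae (ae_restrict_of_ae (ae.mono fun y hy => by simp only [hy]))
    refine lt_of_lt_of_le ?_ (le_iSup₂ r r0)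
    rw [← this, ← enorm_eq_nnnorm, ← ofReal_norm]
    exact (ofReal_lt_ofReal_iff (hl.trans hr)).2 hr
end
theorem local_Tb_weak_type_maximal_testing (d : ℕ) :
    ∃ b₀ t₀ : ℝ, 0 < b₀ ∧ 0 < t₀ ∧
      ∀ b t : ℝ, b₀ ≤ b → t₀ ≤ t →
      ∀ n C₀ C α q B₁ B₂ s : ℝ, 0 < n → n ≤ d → 0 < C₀ → 0 < C → 0 < α → α ≤ 1 →
        1 < q → 0 < B₁ → 0 < B₂ → 0 < s →
      ∃ Cb : ℝ≥0∞, Cb < ∞ ∧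
        ∀ μ : Measure (Pt d), HasDegree μ n C₀ →
        ∀ K : Pt d → Pt d → ℂ, IsCZKernel K n C α → (∀ x y, K x y = - K y x) →
        (∀ Q : Cube d, 0 < Q.side → IsDoubling μ 5 b Q → SmallBoundary μ t Q →
          ∃ bQ : Pt d → ℂ, IsAdmissible μ Q q B₁ bQ ∧
            ∀ lam : ℝ, 0 < lam →
              ENNReal.ofReal (lam ^ s) *
                  μ {x | x ∈ Q.toSet ∧ ENNReal.ofReal lam < maxT μ K 0 bQ x}
                ≤ ENNReal.ofReal B₂ * μ Q.toSet) →
        ∀ ε : ℝ, 0 < ε → ∀ f : Pt d → ℂ,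
          eLpNorm (truncT μ K ε f) 2 μ ≤ Cb * eLpNorm f 2 μ := by
  refine ⟨2 * 100 ^ d, 160 * 100 ^ d, by positivity, by positivity, fun b t hb ht n C₀ C α q B₁ B₂ s hn hnd hC0 hC hα hα1 hq hB1 hB2 hs => ?_⟩
  obtain ⟨D1, hD, he⟩ := eD d
  obtain ⟨A, A0, hA⟩ := L2E d hn hα (C := C * (1 + 2 ^ n) * (2 * D1) ^ α) (C0 := C₀ * (2 * D1) ^ n) pz pz hq hB1 hB2 hs hD
  refine ⟨oR A ^ (1 / 2 : ℝ), rpow_lt_top_of_nonneg nz ofReal_ne_top, fun μ hμ K hK an H ε hε f => ?_⟩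
  have si := mkSI hn hnd hα hα1 hC hC0 hD he hμ hK an
  have ts := mkTST (Nat.cast_pos.1 (hn.trans_le hnd)) hq (fun x S => si.fin x S) hD he hb ht H
  have F := si.L2F hD he (fun x => by fun_prop) hε (fun hf => hA si he ts hε hf) fun y => f (.toLp 2 y)
  simp_rw [mkT] at F
  rw [(MeasurableEquiv.toLp 2 Eu d).symm.measurableEmbedding.lintegral_map, (MeasurableEquiv.toLp 2 Eu d).symm.measurableEmbedding.lintegral_map] at F
  rw [eLpNorm_eq_lintegral_rpow_enorm_toReal zs zs, eLpNorm_eq_lintegral_rpow_enorm_toReal zs zs]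
  simp only [toReal_ofNat, rpow_ofNat]
  rw [← mul_rpow_of_nonneg _ _ nz]
  exact rpow_le_rpow F nz
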